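/- Let η(t) = t² e^{−t²/2}, η₁ = 2·1_{[1/2,1]}, η₂ = η₁ ∗_M η₁, and η_* = η₂ ∗_M η. Let x ∈ ℝ⁺, δ ∈ ℝ, and let χ be a primitive Dirichlet character mod q, q ≥ 1. Assume all nontrivial zeros ρ of L(s,χ) with |Im(ρ)| ≤ T₀ lie on the critical line, where T₀ ≥ max(4π²|δ|, 100). Then ∑_{n=1}^∞ Λ(n) χ(n) e(δn/x) η_*(n/x) equals η̂_*(−δ)x + O*(err)·x if q = 1, and O*(err)·x if q > 1, where err = T₀ log(qT₀/2π)·(3.5 e^{−0.1598 T₀} + 0.0019 e^{−0.1065 T₀²/(πδ)²}) + (1.675 √T₀ log(qT₀) + 6.936 √T₀ + 1.954 log q + 51.047) x^{−1/2} + (6 + 22|δ|) x^{−1} + (log q + 6)(3 + 17|δ|) x^{−3/2}. -/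

import Mathlib

open MeasureTheory Set

/-- `e(t) = e^{2πit}`. -/
noncomputable def e2pi (t : ℝ) : ℂ := Complex.exp (2 * Real.pi * Complex.I * t)

/-- Mellin (multiplicative) convolution `(f ∗_M g)(x) = ∫₀^∞ f(x/w) g(w) dw/w`. -/
noncomputable def mellinConv (f g : ℝ → ℝ) (x : ℝ) : ℝ :=
  ∫ w in Set.Ioi (0:ℝ), f (x / w) * g w / w

/-- `η₁ = 2 · 1_{[1/2,1]}`. -/
noncomputable def eta1 (t : ℝ) : ℝ := if t ∈ Set.Icc (1/2 : ℝ) 1 then 2 else 0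

/-- `η₂ = η₁ ∗_M η₁`. -/
noncomputable def eta2 (t : ℝ) : ℝ := mellinConv eta1 eta1 t

/-- `η_* = η₂ ∗_M η`, with `η(t) = t² e^{-t²/2}`. -/
noncomputable def etaStar (t : ℝ) : ℝ :=
  mellinConv eta2 (fun u => u^2 * Real.exp (-u^2 / 2)) t

set_option linter.all false

local notation "byp" => (by positivity)
local notation "byn" => (by norm_num)
local notation "byl" => (by linarith)
local notation "IQ" => Ioc (1/4:ℝ) 1

section Hadamard
open Filter Topology Metric

lemma hd_eq {s ρ : ℂ} (hρ : ρ ≠ 0) (h : 1 - s / ρ = 0) : s = ρ := by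
  have := (sub_eq_zero.1 h).symm
  rwa [div_eq_one_iff_eq hρ] at this

lemma hd_order_ne_top {f : ℂ → ℂ} (hf : Differentiable ℂ f) (h0 : f 0 ≠ 0) (z : ℂ) :
    analyticOrderAt f z ≠ ⊤ := by
  intro h
  rw [analyticOrderAt_eq_top] at h
  have := AnalyticOnNhd.eq_of_eventuallyEq (f := f) (g := fun _ => 0) (z₀ := z)
    (fun w _ => hf.analyticAt w) (fun w _ => analyticAt_const) h
  exact h0 (congrFun this 0)

lemma hd_factor_one {g : ℂ → ℂ} (hg : Differentiable ℂ g) {ρ : ℂ} (hρ : ρ ≠ 0)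
    (ht : analyticOrderAt g ρ ≠ ⊤) :
    ∃ k : ℂ → ℂ, Differentiable ℂ k ∧ k ρ ≠ 0 ∧
      ∀ s, g s = (1 - s / ρ) ^ (analyticOrderNatAt g ρ) * k s := by
  set n := analyticOrderNatAt g ρ with hn
  obtain ⟨l, hl, hl0, hle⟩ := ((hg.analyticAt ρ).analyticOrderNatAt_eq_iff ht).1 hn.symm
  have key : ∀ s, s ≠ ρ → (1 - s / ρ) ≠ 0 := by
    intro s hs h
    exact hs (hd_eq hρ h)
  let k : ℂ → ℂ := fun s => if s = ρ then (-ρ) ^ n * l ρ else g s / (1 - s / ρ) ^ n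
  have hk1 : ∀ᶠ s in 𝓝 ρ, k s = (-ρ) ^ n * l s := by
    filter_upwards [hle] with s hs
    by_cases h : s = ρ
    · simp [k, h]
    · simp only [k, h, if_false]
      rw [div_eq_iff (pow_ne_zero _ (key s h)), hs, smul_eq_mul]
      have : s - ρ = -ρ * (1 - s / ρ) := by field_simp; ring
      rw [this, mul_pow]; ring
  refine ⟨k, fun s => ?_, ?_, fun s => ?_⟩
  · by_cases h : s = ρ
    · subst h
      exact ((hl.differentiableAt).const_mul _).congr_of_eventuallyEq hk1
    · have : k =ᶠ[𝓝 s] fun s => g s / (1 - s / ρ) ^ n := by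
        filter_upwards [isOpen_ne.mem_nhds h] with w hw
        simp only [k, if_neg hw]
      refine DifferentiableAt.congr_of_eventuallyEq ?_ this
      exact (hg s).div (by fun_prop) (pow_ne_zero _ (key s h))
  · simp [k, hρ, hl0]
  · by_cases h : s = ρ
    · subst h
      have := hle.self_of_nhds
      rw [this]
      by_cases h0 : n = 0
      · simp [h0, k]
      · simp [h0, hρ]
    · simp only [k, if_neg h]
      rw [mul_div_cancel₀ _ (pow_ne_zero _ (key s h))]

lemma hd_factor {f : ℂ → ℂ} (hf : Differentiable ℂ f) (h0 : f 0 ≠ 0) (Z : Finset ℂ)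
    (hZ : ∀ ρ ∈ Z, ρ ≠ 0) :
    ∃ g : ℂ → ℂ, Differentiable ℂ g ∧ (∀ ρ ∈ Z, g ρ ≠ 0) ∧
      ∀ s, f s = (∏ ρ ∈ Z, (1 - s / ρ) ^ (analyticOrderNatAt f ρ)) * g s := by
  classical
  induction Z using Finset.induction_on with
  | empty => exact ⟨f, hf, by simp, by simp⟩
  | insert ρ Z hρZ ih =>
    obtain ⟨g, hg, hgZ, hfg⟩ := ih (fun r hr => hZ r (Finset.mem_insert_of_mem hr))
    have hρ : ρ ≠ 0 := hZ ρ (Finset.mem_insert_self _ _)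
    set P : ℂ → ℂ := fun s => ∏ r ∈ Z, (1 - s / r) ^ (analyticOrderNatAt f r) with hP
    have hPd : Differentiable ℂ P := by fun_prop
    have hPρ : P ρ ≠ 0 := by
      rw [hP]
      refine Finset.prod_ne_zero_iff.2 fun r hr => pow_ne_zero _ ?_
      intro h
      have hr0 : r ≠ 0 := hZ r (Finset.mem_insert_of_mem hr)
      apply hρZ
      rw [hd_eq hr0 h]; exact hr
    have hmul : analyticOrderAt f ρ = analyticOrderAt g ρ := by
      have : f = P * g := by ext s; exact hfg s
      rw [this, analyticOrderAt_mul (hPd.analyticAt ρ) (hg.analyticAt ρ),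
        (hPd.analyticAt ρ).analyticOrderAt_eq_zero.2 hPρ, zero_add]
    have hmul' : analyticOrderNatAt f ρ = analyticOrderNatAt g ρ := by
      simp [analyticOrderNatAt, hmul]
    obtain ⟨k, hk, hkρ, hgk⟩ := hd_factor_one hg hρ (hmul ▸ hd_order_ne_top hf h0 ρ)
    refine ⟨k, hk, fun r hr => ?_, fun s => ?_⟩
    · rcases Finset.mem_insert.1 hr with rfl | hr
      · exact hkρ
      · intro h
        exact hgZ r hr (by rw [hgk, h, mul_zero])
    · rw [Finset.prod_insert hρZ, hfg s, hgk s, hmul']; ring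

/-- log-derivative of the factorization -/
lemma hd_logDeriv {f g : ℂ → ℂ} (hg : Differentiable ℂ g) (Z : Finset ℂ)
    (hZ : ∀ ρ ∈ Z, ρ ≠ 0) (m : ℂ → ℕ)
    (hfg : ∀ s, f s = (∏ ρ ∈ Z, (1 - s / ρ) ^ (m ρ)) * g s) {s : ℂ} (hs : f s ≠ 0)
    (hsZ : ∀ ρ ∈ Z, s ≠ ρ) :
    logDeriv f s = ∑ ρ ∈ Z, (m ρ : ℂ) / (s - ρ) + logDeriv g s := by
  have h1 : f = fun s => (∏ ρ ∈ Z, (1 - s / ρ) ^ (m ρ)) * g s := funext hfg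
  have h2 := hs
  rw [hfg s] at h2
  have key : ∀ ρ ∈ Z, (1 - s / ρ) ≠ 0 := by
    intro ρ hρ h
    exact hsZ ρ hρ (hd_eq (hZ ρ hρ) h)
  rw [h1, logDeriv_mul s (left_ne_zero_of_mul h2) (right_ne_zero_of_mul h2) (by fun_prop) (hg s)]
  congr 1
  have h3 := logDeriv_prod (s := Z) (f := fun ρ s => (1 - s / ρ) ^ (m ρ)) (x := s)
    (fun ρ hρ => pow_ne_zero _ (key ρ hρ)) (fun ρ hρ => by fun_prop)
  rw [h3]
  refine Finset.sum_congr rfl fun ρ hρ => ?_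
  rw [logDeriv_fun_pow (by fun_prop), logDeriv_apply]
  have hd : deriv (fun s => 1 - s / ρ) s = -1 / ρ := by
    simp [deriv_const_sub, deriv_div_const, neg_div]
  rw [hd]
  have a := hZ ρ hρ
  have b := key ρ hρ
  have c : s - ρ ≠ 0 := sub_ne_zero.2 (hsZ ρ hρ)
  have : 1 - s / ρ = - (s - ρ) / ρ := by field_simp; ring
  rw [this]
  field_simp

/-- growth -/
lemma hd_bound {f : ℂ → ℂ} {C : ℝ}
    (hgr : ∀ k : ℕ, ∀ s : ℂ, ‖s‖ ≤ 6 * 4 ^ k → ‖f s‖ ≤ Real.exp (C * 8 ^ k)) (k : ℕ)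
    (Z : Finset ℂ) (hZ : ∀ ρ ∈ Z, ρ ≠ 0 ∧ ‖ρ‖ ≤ 2 * 4 ^ k) (m : ℂ → ℕ)
    {g : ℂ → ℂ} (hg : Differentiable ℂ g)
    (hfg : ∀ s, f s = (∏ ρ ∈ Z, (1 - s / ρ) ^ (m ρ)) * g s) {s : ℂ} (hs : ‖s‖ ≤ 6 * 4 ^ k) :
    2 ^ (∑ ρ ∈ Z, m ρ) * ‖g s‖ ≤ Real.exp (C * 8 ^ k) := by
  have h4 : (0:ℝ) < 4 ^ k := by positivity
  have := Complex.norm_le_of_forall_mem_frontier_norm_le (f := g) (U := ball (0:ℂ) (6 * 4 ^ k))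
    (C := Real.exp (C * 8 ^ k) / 2 ^ (∑ ρ ∈ Z, m ρ)) isBounded_ball hg.diffContOnCl ?_ (z := s) ?_
  · rwa [le_div_iff₀ byp, mul_comm] at this
  · intro z hz
    rw [frontier_ball _ byp, mem_sphere_zero_iff_norm] at hz
    rw [le_div_iff₀ byp]
    refine le_trans ?_ (hgr k z hz.le)
    rw [hfg z, norm_mul, mul_comm, norm_prod, ← Finset.prod_pow_eq_pow_sum]
    refine mul_le_mul_of_nonneg_right ?_ (norm_nonneg _)
    refine Finset.prod_le_prod (fun _ _ => by positivity) fun ρ hρ => ?_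
    rw [norm_pow]
    refine pow_le_pow_left₀ byn ?_ _
    obtain ⟨hρ0, hρ2⟩ := hZ ρ hρ
    have h1 : (0:ℝ) < ‖ρ‖ := norm_pos_iff.2 hρ0
    have h2 : 3 ≤ ‖z / ρ‖ := by
      rw [norm_div, hz, le_div_iff₀ h1]; linarith
    have := norm_sub_norm_le (z / ρ) 1
    rw [norm_one, norm_sub_rev] at this
    linarith
  · rw [closure_ball _ byp]; simpa using hs

lemma hd_count {f : ℂ → ℂ} (hf : Differentiable ℂ f) (h0 : f 0 ≠ 0) {C : ℝ}
    (hgr : ∀ k : ℕ, ∀ s : ℂ, ‖s‖ ≤ 6 * 4 ^ k → ‖f s‖ ≤ Real.exp (C * 8 ^ k)) :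
    ∃ D : ℝ, 0 < D ∧ ∀ (k : ℕ) (Z : Finset ℂ), (∀ ρ ∈ Z, ‖ρ‖ ≤ 2 * 4 ^ k) →
      ∑ ρ ∈ Z, (analyticOrderNatAt f ρ : ℝ) ≤ D * 8 ^ k := by
  classical
  refine ⟨2 * (|C| + |Real.log ‖f 0‖|) + 1, by positivity, fun k Z hZ => ?_⟩
  have hm0 : analyticOrderNatAt f 0 = 0 := by
    by_contra h
    exact h0 (apply_eq_zero_of_analyticOrderNatAt_ne_zero h)
  have hsum : ∑ ρ ∈ Z, (analyticOrderNatAt f ρ : ℝ) = ∑ ρ ∈ Z.erase 0, (analyticOrderNatAt f ρ : ℝ) := by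
    symm
    exact Finset.sum_erase _ (by simp [hm0])
  rw [hsum]
  have hZ' : ∀ ρ ∈ Z.erase 0, ρ ≠ 0 ∧ ‖ρ‖ ≤ 2 * 4 ^ k := fun ρ hρ =>
    ⟨Finset.ne_of_mem_erase hρ, hZ ρ (Finset.mem_of_mem_erase hρ)⟩
  obtain ⟨g, hg, -, hfg⟩ := hd_factor hf h0 (Z.erase 0) (fun ρ hρ => (hZ' ρ hρ).1)
  have hb := hd_bound hgr k (Z.erase 0) hZ' _ hg hfg (s := 0) (by simp)
  have hg0 : g 0 = f 0 := by rw [hfg 0]; simp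
  rw [hg0] at hb
  set n := ∑ ρ ∈ Z.erase 0, analyticOrderNatAt f ρ
  have hn : (∑ ρ ∈ Z.erase 0, (analyticOrderNatAt f ρ : ℝ)) = n := by simp [n]
  rw [hn]
  have hf0 : 0 < ‖f 0‖ := norm_pos_iff.2 h0
  have hl := Real.log_le_log byp hb
  rw [Real.log_exp, Real.log_mul byp hf0.ne', Real.log_pow] at hl
  have h2 : (1:ℝ)/2 ≤ Real.log 2 := by have := Real.log_two_gt_d9; linarith
  have h8 : (1:ℝ) ≤ 8 ^ k := one_le_pow₀ byn
  have hn0 : (0:ℝ) ≤ n := by positivity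
  have e1 : C * 8 ^ k ≤ |C| * 8 ^ k := by gcongr; exact le_abs_self C
  have e2 : -Real.log ‖f 0‖ ≤ |Real.log ‖f 0‖| * 8 ^ k := by
    nlinarith [neg_abs_le (Real.log ‖f 0‖), abs_nonneg (Real.log ‖f 0‖)]
  nlinarith

lemma hd_summable {f : ℂ → ℂ} (hf : Differentiable ℂ f) (h0 : f 0 ≠ 0) {C : ℝ}
    (hgr : ∀ k : ℕ, ∀ s : ℂ, ‖s‖ ≤ 6 * 4 ^ k → ‖f s‖ ≤ Real.exp (C * 8 ^ k)) :
    Summable fun ρ : ℂ => (analyticOrderNatAt f ρ : ℝ) / (1 + ‖ρ‖) ^ 2 := by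
  classical
  obtain ⟨D, hD, hc⟩ := hd_count hf h0 hgr
  refine summable_of_sum_le (c := 32 * D) (fun ρ => by positivity) fun Z => ?_
  -- choose K
  obtain ⟨K, hK⟩ : ∃ K : ℕ, ∀ ρ ∈ Z, 1 + ‖ρ‖ ≤ 4 ^ K := by
    induction Z using Finset.induction_on with
    | empty => exact ⟨0, by simp⟩
    | insert a Z ha ih =>
      obtain ⟨K, hK⟩ := ih
      obtain ⟨L, hL⟩ := pow_unbounded_of_one_lt (1 + ‖a‖) (by norm_num : (1:ℝ) < 4)
      refine ⟨max K L, fun ρ hρ => ?_⟩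
      rcases Finset.mem_insert.1 hρ with rfl | h
      · exact hL.le.trans (pow_le_pow_right₀ byn (le_max_right _ _))
      · exact (hK ρ h).trans (pow_le_pow_right₀ byn (le_max_left _ _))
  have h1 : ∀ ρ ∈ Z, (analyticOrderNatAt f ρ : ℝ) / (1 + ‖ρ‖) ^ 2 ≤
      ∑ k ∈ Finset.range (K+1), if ‖ρ‖ ≤ 2 * 4 ^ k then (analyticOrderNatAt f ρ : ℝ) * 16 / 16 ^ k else 0 := by
    intro ρ hρ
    have hex : ∃ k : ℕ, 1 + ‖ρ‖ ≤ 4 ^ k := ⟨K, hK ρ hρ⟩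
    set k := Nat.find hex
    have hk := Nat.find_spec hex
    have hkK : k ≤ K := Nat.find_min' hex (hK ρ hρ)
    have h4 : (4:ℝ) ^ k ≤ 4 * (1 + ‖ρ‖) := by
      rcases Nat.eq_zero_or_pos k with h | h
      · rw [h]; have := norm_nonneg ρ; simp; linarith
      · have := Nat.find_min hex (Nat.sub_lt h one_pos)
        push Not at this
        have e : (4:ℝ) ^ k = 4 * 4 ^ (k - 1) := by
          rw [← pow_succ']; congr 1; omega
        rw [e]; linarith
    refine le_trans ?_ (Finset.single_le_sum (f := fun k => if ‖ρ‖ ≤ 2 * 4 ^ k then (analyticOrderNatAt f ρ : ℝ) * 16 / 16 ^ k else 0) (fun i _ => ?_) (Finset.mem_range.2 (Nat.lt_succ_of_le hkK)))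
    · have h5 : ‖ρ‖ ≤ 2 * 4 ^ k := by
        have : (0:ℝ) < 4 ^ k := by positivity
        linarith
      simp only [h5, if_true]
      rw [div_le_div_iff₀ byp byp]
      have : (16:ℝ) ^ k = (4 ^ k) ^ 2 := by rw [← pow_mul, mul_comm, pow_mul]; norm_num
      rw [this, mul_assoc]
      refine mul_le_mul_of_nonneg_left ?_ byp
      calc ((4:ℝ)^k)^2 ≤ (4 * (1 + ‖ρ‖))^2 := by gcongr
        _ = _ := by ring
    · split_ifs <;> positivity
  refine (Finset.sum_le_sum h1).trans ?_
  rw [Finset.sum_comm]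
  have h2 : ∀ k ∈ Finset.range (K+1), (∑ ρ ∈ Z, if ‖ρ‖ ≤ 2 * 4 ^ k then (analyticOrderNatAt f ρ : ℝ) * 16 / 16 ^ k else 0) ≤ 16 * D * (1/2) ^ k := by
    intro k _
    rw [← Finset.sum_filter]
    have := hc k (Z.filter fun ρ => ‖ρ‖ ≤ 2 * 4 ^ k) (fun ρ hρ => (Finset.mem_filter.1 hρ).2)
    rw [← Finset.sum_div, ← Finset.sum_mul, div_le_iff₀ byp]
    have e : 16 * D * (1/2) ^ k * 16 ^ k = D * 8 ^ k * 16 := by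
      rw [mul_assoc, ← mul_pow]; norm_num; ring
    rw [e]; gcongr
  refine (Finset.sum_le_sum h2).trans ?_
  rw [← Finset.mul_sum]
  have : ∑ i ∈ Finset.range (K+1), ((1:ℝ)/2)^i ≤ 2 := by
    have := sum_geometric_two_le (K+1); simpa using this
  nlinarith

lemma hd_deriv_bound {g : ℂ → ℂ} (hg : Differentiable ℂ g) {R M : ℝ} (hR : 0 < R) (hM : 0 < M)
    (hg0 : ∀ s, ‖s‖ < 2 * R → g s ≠ 0) (hgM : ∀ s, ‖s‖ < 2 * R → ‖g s‖ ≤ ‖g 0‖ * Real.exp M)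
    {s : ℂ} (hs : ‖s‖ ≤ R / 4) :
    ‖logDeriv g s - logDeriv g 0‖ ≤ 16 * M / R ^ 2 * ‖s‖ := by
  have hR2 : 0 < 2 * R := by linarith
  have h00 : (0:ℂ) ∈ ball (0:ℂ) (2 * R) := by simp; linarith
  have hgz : g 0 ≠ 0 := hg0 0 (by simpa using hR2)
  have hld : DifferentiableOn ℂ (logDeriv g) (ball 0 (2 * R)) := by
    intro z hz
    have hz' := hg0 z (by simpa using hz)
    have : DifferentiableAt ℂ (deriv g) z := (hg.deriv) z
    exact (this.div (hg z) hz').differentiableWithinAt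
  obtain ⟨h, hh0, hh⟩ := hld.isExactOn_ball.with_val_at 0 0
  have hexp : ∀ z ∈ ball (0:ℂ) (2 * R), g z = g 0 * Complex.exp (h z) := by
    intro z hz
    have hc : ∀ w ∈ ball (0:ℂ) (2 * R), HasDerivWithinAt (fun z => g z * Complex.exp (- h z)) 0 (ball 0 (2*R)) w := by
      intro w hw
      have := ((hg w).hasDerivAt.mul ((hh w hw).neg.cexp))
      refine HasDerivAt.hasDerivWithinAt ?_
      have hz' := hg0 w (by simpa using hw)
      have e : deriv g w * Complex.exp ((-h) w) + g w * (Complex.exp ((-h) w) * -logDeriv g w) = 0 := by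
        rw [logDeriv_apply]; field_simp; ring
      rw [e] at this
      exact this
    have := (convex_ball (0:ℂ) (2*R)).norm_image_sub_le_of_norm_hasDerivWithin_le (C := 0) hc (by simp) h00 hz
    simp only [zero_mul] at this
    have := sub_eq_zero.1 (norm_le_zero_iff.1 this)
    simp only [hh0, neg_zero, Complex.exp_zero, mul_one] at this
    rw [← this, mul_assoc, ← Complex.exp_add]; simp
  have hhd : DifferentiableOn ℂ h (ball 0 (2*R)) := fun z hz => (hh z hz).differentiableAt.differentiableWithinAt
  have hmaps : MapsTo h (ball 0 (2*R)) {z | z.re ≤ M} := by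
    intro z hz
    have h1 := hgM z (by simpa using hz)
    rw [hexp z hz, norm_mul, Complex.norm_exp] at h1
    have h2 := le_of_mul_le_mul_left h1 (norm_pos_iff.2 hgz)
    exact Real.exp_le_exp.1 h2
  have hbd : ∀ z : ℂ, ‖z‖ ≤ R → ‖h z‖ ≤ 2 * M := by
    intro z hz
    have := Complex.borelCaratheodory_zero hM hhd hmaps hR2 (by simp; linarith : z ∈ ball 0 (2*R)) hh0
    refine this.trans ?_
    rw [div_le_iff₀ byl]
    nlinarith
  have hd1 : ∀ z : ℂ, ‖z‖ ≤ R / 2 → ‖logDeriv g z‖ ≤ 4 * M / R := by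
    intro z hz
    have hsub : closedBall z (R/2) ⊆ ball 0 (2*R) := by
      intro w hw
      simp only [mem_closedBall, dist_eq_norm, mem_ball, sub_zero] at hw ⊢
      have := norm_le_norm_add_norm_sub z w
      rw [norm_sub_rev] at this
      linarith
    have h1 := Complex.norm_deriv_le_of_forall_mem_sphere_norm_le (f := h) (c := z) (R := R/2) (C := 2*M)
      byl ((hhd.mono hsub).diffContOnCl_ball subset_rfl) (by
        intro w hw
        apply hbd
        rw [mem_sphere, dist_eq_norm] at hw
        have := norm_le_norm_add_norm_sub z w
        rw [norm_sub_rev] at this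
        linarith)
    rw [(hh z (by simp; linarith)).deriv] at h1
    refine h1.trans (le_of_eq ?_)
    field_simp; norm_num
  have hd2 : ∀ z ∈ closedBall (0:ℂ) (R / 4), ‖deriv (logDeriv g) z‖ ≤ 16 * M / R ^ 2 := by
    intro z hz
    rw [mem_closedBall_zero_iff] at hz
    have hsub : closedBall z (R/4) ⊆ ball 0 (2*R) := by
      intro w hw
      simp only [mem_closedBall, dist_eq_norm, mem_ball, sub_zero] at hw ⊢
      have := norm_le_norm_add_norm_sub z w
      rw [norm_sub_rev] at this
      linarith
    have h1 := Complex.norm_deriv_le_of_forall_mem_sphere_norm_le (f := logDeriv g) (c := z) (R := R/4) (C := 4*M/R)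
      byl ((hld.mono hsub).diffContOnCl_ball subset_rfl) (by
        intro w hw
        apply hd1
        rw [mem_sphere, dist_eq_norm] at hw
        have := norm_le_norm_add_norm_sub z w
        rw [norm_sub_rev] at this
        linarith)
    refine h1.trans (le_of_eq ?_)
    field_simp; norm_num
  have := (convex_closedBall (0:ℂ) (R/4)).norm_image_sub_le_of_norm_deriv_le (f := logDeriv g) (fun z hz => ?_) hd2
    (mem_closedBall_self byl) (mem_closedBall_zero_iff.2 hs)
  · simpa using this
  · refine hld.differentiableAt (isOpen_ball.mem_nhds ?_)
    rw [mem_closedBall_zero_iff] at hz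
    simp; linarith

lemma hd_term_bound {s ρ : ℂ} (hsρ : s ≠ ρ) {c : ℝ} (hc0 : 0 < c) (hc : c * (1 + ‖ρ‖) ≤ ‖s - ρ‖)
   (hc' : c * (1 + ‖ρ‖) ≤ ‖ρ‖) :
    ‖1 / (s - ρ) + 1 / ρ‖ ≤ ‖s‖ / c ^ 2 / (1 + ‖ρ‖) ^ 2 := by
  have h1 : (0:ℝ) < 1 + ‖ρ‖ := by positivity
  have hρ : ρ ≠ 0 := by
    rintro rfl; simp at hc'; linarith
  have h3 : s - ρ ≠ 0 := sub_ne_zero.2 hsρ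
  have : 1 / (s - ρ) + 1 / ρ = s / ((s - ρ) * ρ) := by field_simp; ring
  rw [this, norm_div, norm_mul, div_div]
  refine div_le_div_of_nonneg_left (norm_nonneg _) byp ?_
  calc c ^ 2 * (1 + ‖ρ‖) ^ 2 = (c * (1 + ‖ρ‖)) * (c * (1 + ‖ρ‖)) := by ring
    _ ≤ _ := mul_le_mul hc hc' byp (norm_nonneg _)

/-- For an entire function the nonzero points have a uniform gap from the zeros -/
lemma hd_gap {f : ℂ → ℂ} (hf : Differentiable ℂ f) {s : ℂ} (hs : f s ≠ 0) :
    ∃ c : ℝ, 0 < c ∧ ∀ ρ, f ρ = 0 → c * (1 + ‖ρ‖) ≤ ‖s - ρ‖ := by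
  have : ∀ᶠ z in 𝓝 s, f z ≠ 0 := hf.continuous.continuousAt.eventually_ne hs
  obtain ⟨ε, hε, hb⟩ := Metric.eventually_nhds_iff.1 this
  refine ⟨ε / (1 + ‖s‖ + ε), by positivity, fun ρ hρ => ?_⟩
  have h1 : ε ≤ ‖s - ρ‖ := by
    by_contra h
    push Not at h
    exact hb (y := ρ) (by rw [dist_eq_norm, norm_sub_rev]; exact h) hρ
  have h2 : ‖ρ‖ ≤ ‖s‖ + ‖s - ρ‖ := norm_le_norm_add_norm_sub s ρ
  have : 0 ≤ ‖s‖ := norm_nonneg s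
  rw [div_mul_eq_mul_div, div_le_iff₀ byp]
  nlinarith

theorem hadamard {f : ℂ → ℂ} (hf : Differentiable ℂ f) (h0 : f 0 ≠ 0) {C : ℝ}
    (hgr : ∀ k : ℕ, ∀ s : ℂ, ‖s‖ ≤ 6 * 4 ^ k → ‖f s‖ ≤ Real.exp (C * 8 ^ k))
    {s : ℂ} (hs : f s ≠ 0) :
    HasSum (fun ρ : ℂ => (analyticOrderNatAt f ρ : ℂ) * (1 / (s - ρ) + 1 / ρ))
      (logDeriv f s - logDeriv f 0) := by
  classical
  have hsum := hd_summable hf h0 hgr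
  obtain ⟨D, hD, hcount⟩ := hd_count hf h0 hgr
  set m := fun ρ => analyticOrderNatAt f ρ with hm
  have hm0 : ∀ ρ, m ρ ≠ 0 → f ρ = 0 := fun ρ h => apply_eq_zero_of_analyticOrderNatAt_ne_zero h
  have hm1 : ∀ ρ, f ρ = 0 → m ρ ≠ 0 := by
    intro ρ h h'
    have := Nat.cast_analyticOrderNatAt (hd_order_ne_top hf h0 ρ)
    rw [show analyticOrderNatAt f ρ = 0 from h'] at this
    exact (hf.analyticAt ρ).analyticOrderAt_eq_zero.1 this.symm h
  obtain ⟨c1, hc1, hg1⟩ := hd_gap hf hs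
  obtain ⟨c2, hc2, hg2⟩ := hd_gap hf h0
  set c := min c1 c2
  have hc : 0 < c := lt_min hc1 hc2
  set T : ℂ → ℂ := fun ρ => (m ρ : ℂ) * (1 / (s - ρ) + 1 / ρ) with hT
  have hTb : ∀ ρ, ‖T ρ‖ ≤ ‖s‖ / c ^ 2 * ((m ρ : ℝ) / (1 + ‖ρ‖) ^ 2) := by
    intro ρ
    by_cases h : m ρ = 0
    · simp [hT, h]
    · have hz := hm0 ρ h
      have hsρ : s ≠ ρ := by rintro rfl; exact hs hz
      have := hd_term_bound hsρ hc
        ((mul_le_mul_of_nonneg_right (min_le_left _ _) byp).trans (hg1 ρ hz))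
        ((mul_le_mul_of_nonneg_right (min_le_right _ _) byp).trans (by simpa using hg2 ρ hz))
      simp only [hT, norm_mul, Complex.norm_natCast]
      calc (m ρ : ℝ) * ‖1 / (s - ρ) + 1 / ρ‖ ≤ m ρ * (‖s‖ / c ^ 2 / (1 + ‖ρ‖) ^ 2) := by gcongr
        _ = _ := by ring
  have hTs : Summable T := (hsum.mul_left (‖s‖ / c ^ 2)).of_norm_bounded hTb
  -- the zero set in the ball
  have hfin : ∀ k : ℕ, {ρ | f ρ = 0 ∧ ‖ρ‖ ≤ 2 * 4 ^ k}.Finite := by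
    intro k
    by_contra hinf
    obtain ⟨Z, hZ, hZc⟩ := Set.Infinite.exists_subset_card_eq hinf (⌈D * 8 ^ k⌉₊ + 1)
    have h1 := hcount k Z (fun ρ hρ => (hZ hρ).2)
    have h2 : (Z.card : ℝ) ≤ ∑ ρ ∈ Z, (m ρ : ℝ) := by
      rw [Finset.card_eq_sum_ones, Nat.cast_sum]
      refine Finset.sum_le_sum fun ρ hρ => ?_
      exact_mod_cast Nat.one_le_iff_ne_zero.2 (hm1 ρ (hZ hρ).1)
    rw [hZc] at h2
    push_cast at h2
    have := Nat.le_ceil (D * 8 ^ k)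
    linarith
  set Z : ℕ → Finset ℂ := fun k => (hfin k).toFinset with hZdef
  have hZmem : ∀ k ρ, ρ ∈ Z k ↔ f ρ = 0 ∧ ‖ρ‖ ≤ 2 * 4 ^ k := by simp [hZdef]
  have hlim1 : Tendsto (fun k : ℕ => ∑ ρ ∈ Z k, T ρ) atTop (𝓝 (∑' ρ, T ρ)) := by
    have e : ∀ k, ∑ ρ ∈ Z k, T ρ = ∑' ρ, if ρ ∈ Z k then T ρ else 0 := by
      intro k
      rw [tsum_eq_sum (s := Z k)]
      · exact Finset.sum_congr rfl (fun ρ h => by simp [h])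
      · intro ρ h; simp [h]
    simp_rw [e]
    refine tendsto_tsum_of_dominated_convergence (hTs.norm) (fun ρ => ?_) (Eventually.of_forall fun k ρ => ?_)
    · by_cases h : f ρ = 0
      · obtain ⟨K, hK⟩ := pow_unbounded_of_one_lt ‖ρ‖ (by norm_num : (1:ℝ) < 4)
        refine tendsto_const_nhds.congr' ?_
        filter_upwards [eventually_ge_atTop K] with k hk
        have : ρ ∈ Z k := (hZmem k ρ).2 ⟨h, by
          have : (4:ℝ) ^ K ≤ 4 ^ k := pow_le_pow_right₀ byn hk
          have : (0:ℝ) < 4 ^ k := by positivity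
          linarith⟩
        simp [this]
      · have : T ρ = 0 := by
          have : m ρ = 0 := by by_contra h'; exact h (hm0 ρ h')
          simp [hT, this]
        simp [this]
    · split_ifs <;> simp
  have hlim2 : Tendsto (fun k : ℕ => ∑ ρ ∈ Z k, T ρ) atTop (𝓝 (logDeriv f s - logDeriv f 0)) := by
    set B := |C| + |Real.log ‖f 0‖| + 1
    have hB : ∀ᶠ k : ℕ in atTop, ‖∑ ρ ∈ Z k, T ρ - (logDeriv f s - logDeriv f 0)‖ ≤ 16 * B * ‖s‖ * (1/2) ^ k := by
      obtain ⟨K, hK⟩ := pow_unbounded_of_one_lt (4 * ‖s‖) (by norm_num : (1:ℝ) < 4)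
      filter_upwards [eventually_ge_atTop K] with k hk
      have h4k : 4 * ‖s‖ ≤ 4 ^ k := hK.le.trans (pow_le_pow_right₀ byn hk)
      have hZ0 : ∀ ρ ∈ Z k, ρ ≠ 0 ∧ ‖ρ‖ ≤ 2 * 4 ^ k := fun ρ hρ =>
        ⟨by rintro rfl; exact h0 ((hZmem k 0).1 hρ).1, ((hZmem k ρ).1 hρ).2⟩
      obtain ⟨g, hg, hgZ, hfg⟩ := hd_factor hf h0 (Z k) (fun ρ hρ => (hZ0 ρ hρ).1)
      have hg00 : g 0 = f 0 := by rw [hfg 0]; simp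
      have hgne : ∀ z, ‖z‖ < 2 * 4 ^ k → g z ≠ 0 := by
        intro z hz h
        have hfz : f z = 0 := by rw [hfg, h, mul_zero]
        exact hgZ z ((hZmem k z).2 ⟨hfz, hz.le⟩) h
      have hM : 0 < B * 8 ^ k := by positivity
      have hf0 : 0 < ‖f 0‖ := norm_pos_iff.2 h0
      have hgb : ∀ z, ‖z‖ < 2 * 4 ^ k → ‖g z‖ ≤ ‖g 0‖ * Real.exp (B * 8 ^ k) := by
        intro z hz
        have h6 : ‖z‖ ≤ 6 * 4 ^ k := by have : (0:ℝ) < 4 ^ k := by positivity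
                                        linarith
        have h7 := hd_bound hgr k (Z k) hZ0 _ hg hfg h6
        have h8 : ‖g z‖ ≤ 2 ^ (∑ ρ ∈ Z k, analyticOrderNatAt f ρ) * ‖g z‖ :=
          le_mul_of_one_le_left (norm_nonneg _) (one_le_pow₀ byn)
        refine (h8.trans h7).trans ?_
        rw [hg00]
        rw [show ‖f 0‖ * Real.exp (B * 8 ^ k) = Real.exp (Real.log ‖f 0‖) * Real.exp (B * 8 ^ k) by rw [Real.exp_log hf0],
          ← Real.exp_add, Real.exp_le_exp]
        have h8 : (1:ℝ) ≤ 8 ^ k := one_le_pow₀ byn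
        have e1 : C * 8 ^ k ≤ |C| * 8 ^ k := by gcongr; exact le_abs_self C
        have e2 : -Real.log ‖f 0‖ ≤ |Real.log ‖f 0‖| * 8 ^ k := by
          nlinarith [neg_abs_le (Real.log ‖f 0‖), abs_nonneg (Real.log ‖f 0‖)]
        have : B * 8 ^ k = |C| * 8 ^ k + |Real.log ‖f 0‖| * 8 ^ k + 8 ^ k := by simp only [B]; ring
        linarith
      have hder := hd_deriv_bound hg (R := 4 ^ k) byp hM hgne hgb (s := s) byl
      have l1 := hd_logDeriv hg (Z k) (fun ρ hρ => (hZ0 ρ hρ).1) _ hfg hs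
        (by rintro ρ hρ rfl; exact hs ((hZmem k _).1 hρ).1)
      have l2 := hd_logDeriv hg (Z k) (fun ρ hρ => (hZ0 ρ hρ).1) _ hfg h0
        (by rintro ρ hρ rfl; exact h0 ((hZmem k _).1 hρ).1)
      have : ∑ ρ ∈ Z k, T ρ - (logDeriv f s - logDeriv f 0) = -(logDeriv g s - logDeriv g 0) := by
        rw [l1, l2]
        have : ∑ ρ ∈ Z k, T ρ = ∑ ρ ∈ Z k, (m ρ : ℂ) / (s - ρ) - ∑ ρ ∈ Z k, (m ρ : ℂ) / (0 - ρ) := by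
          rw [← Finset.sum_sub_distrib]
          refine Finset.sum_congr rfl fun ρ _ => ?_
          simp only [hT, zero_sub, div_neg]; ring
        rw [this]; ring
      rw [this, norm_neg]
      refine hder.trans (le_of_eq ?_)
      have e : ((4:ℝ)^k)^2 = 8 ^ k * 2 ^ k := by rw [← pow_mul, mul_comm k 2, pow_mul, ← mul_pow]; norm_num
      rw [e, one_div, inv_pow]; field_simp
    rw [tendsto_iff_norm_sub_tendsto_zero]
    refine squeeze_zero' (Eventually.of_forall fun _ => norm_nonneg _) hB ?_
    have := (tendsto_pow_atTop_nhds_zero_of_lt_one (by norm_num : (0:ℝ) ≤ 1/2) byn).const_mul (16 * B * ‖s‖)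
    simpa using this
  rw [tendsto_nhds_unique hlim2 hlim1]
  exact hTs.hasSum

end Hadamard

section XiSec
open Complex DirichletCharacter HurwitzZeta

lemma mellin_strip {f : ℝ → ℂ} (hf : ∀ s, MellinConvergent f s) (a b : ℝ) :
    ∃ M : ℝ, 0 ≤ M ∧ ∀ s : ℂ, a ≤ s.re → s.re ≤ b → ‖mellin f s‖ ≤ M := by
  have hn : ∀ (s : ℂ) (t : ℝ), t ∈ Ioi (0:ℝ) → ‖(t:ℂ) ^ (s - 1) • f t‖ = t ^ (s.re - 1) * ‖f t‖ := by
    intro s t ht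
    rw [norm_smul, norm_cpow_eq_rpow_re_of_pos ht]; simp
  have hi : ∀ c : ℝ, IntegrableOn (fun t : ℝ => t ^ (c - 1) * ‖f t‖) (Ioi 0) := by
    intro c
    have := (hf (c:ℂ)).norm
    refine IntegrableOn.congr_fun this (fun t ht => ?_) measurableSet_Ioi
    simpa using hn (c:ℂ) t ht
  refine ⟨∫ t in Ioi (0:ℝ), (t ^ (a - 1) * ‖f t‖ + t ^ (b - 1) * ‖f t‖), ?_, fun s ha hb => ?_⟩
  · refine setIntegral_nonneg measurableSet_Ioi fun t ht => ?_
    have : (0:ℝ) < t := ht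
    positivity
  · unfold mellin
    refine (norm_integral_le_integral_norm _).trans ?_
    refine setIntegral_mono_on (hf s).norm ((hi a).add (hi b)) measurableSet_Ioi fun t ht => ?_
    have ht0 : (0:ℝ) < t := ht
    rw [hn s t ht, ← add_mul]
    refine mul_le_mul_of_nonneg_right ?_ (norm_nonneg _)
    rcases le_total t 1 with h | h
    · have := Real.rpow_le_rpow_of_exponent_ge ht0 h (by linarith : a - 1 ≤ s.re - 1)
      have : 0 ≤ t ^ (b - 1) := by positivity
      linarith
    · have := Real.rpow_le_rpow_of_exponent_le h (by linarith : s.re - 1 ≤ b - 1)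
      have : 0 ≤ t ^ (a - 1) := by positivity
      linarith

lemma even_strip (a : UnitAddCircle) :
    ∃ M : ℝ, 0 ≤ M ∧ ∀ s : ℂ, -1 ≤ s.re → s.re ≤ 2 → ‖completedHurwitzZetaEven₀ a s‖ ≤ M := by
  obtain ⟨M, hM, h⟩ := mellin_strip (f := (hurwitzEvenFEPair a).f_modif) (fun s =>
    ((hurwitzEvenFEPair a).isStrongFEPair_toStrongFEPair.hasMellin s).1) (-1) 2
  refine ⟨M, hM, fun s h1 h2 => ?_⟩
  have := h (s/2) (by simp; linarith) (by simp; linarith)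
  have e : completedHurwitzZetaEven₀ a s = mellin (hurwitzEvenFEPair a).f_modif (s/2) / 2 := rfl
  rw [e, norm_div]
  simp only [Complex.norm_ofNat]
  linarith [norm_nonneg (mellin (hurwitzEvenFEPair a).f_modif (s/2))]

lemma odd_strip (a : UnitAddCircle) :
    ∃ M : ℝ, 0 ≤ M ∧ ∀ s : ℂ, -1 ≤ s.re → s.re ≤ 2 → ‖completedHurwitzZetaOdd a s‖ ≤ M := by
  obtain ⟨M, hM, h⟩ := mellin_strip (f := (hurwitzOddFEPair a).f) (fun s =>
    ((isStrong_hurwitzOddFEPair a).hasMellin s).1) (-1) 2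
  refine ⟨M, hM, fun s h1 h2 => ?_⟩
  have := h ((s+1)/2) (by simp; linarith) (by simp; linarith)
  have e : completedHurwitzZetaOdd a s = mellin (hurwitzOddFEPair a).f ((s+1)/2) / 2 := by
    rw [((isStrong_hurwitzOddFEPair a).hasMellin ((s+1)/2)).2]; rfl
  rw [e, norm_div]
  simp only [Complex.norm_ofNat]
  linarith [norm_nonneg (mellin (hurwitzOddFEPair a).f ((s+1)/2))]

variable {q : ℕ} [NeZero q]

lemma one_le_q (q : ℕ) [NeZero q] : (1:ℝ) ≤ q := by
  exact_mod_cast Nat.one_le_iff_ne_zero.2 (NeZero.ne q)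

lemma norm_q_cpow (q : ℕ) [NeZero q] (s : ℂ) : ‖(q:ℂ) ^ s‖ = (q:ℝ) ^ s.re :=
  Complex.norm_natCast_cpow_of_pos (NeZero.pos q) s

lemma prim_ne_one {χ : DirichletCharacter ℂ q} (hχ : χ.IsPrimitive) (hq : q ≠ 1) : χ ≠ 1 := by
  rintro rfl
  rw [isPrimitive_def, conductor_one] at hχ
  exact hq hχ.symm

lemma completedL_strip (χ : DirichletCharacter ℂ q) (hq : q ≠ 1) (hχ : χ ≠ 1) :
    ∃ M : ℝ, 0 ≤ M ∧ ∀ s : ℂ, -1 ≤ s.re → s.re ≤ 2 → ‖completedLFunction χ s‖ ≤ M := by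
  choose A hA0 hA using even_strip
  choose B hB0 hB using odd_strip
  refine ⟨q * ∑ j : ZMod q, A (ZMod.toAddCircle j) + q * ∑ j : ZMod q, B (ZMod.toAddCircle j), ?_, fun s h1 h2 => ?_⟩
  · have := fun j : ZMod q => hA0 (ZMod.toAddCircle j)
    exact add_nonneg (mul_nonneg byp (Finset.sum_nonneg fun j _ => hA0 _))
      (mul_nonneg byp (Finset.sum_nonneg fun j _ => hB0 _))
  · have e : completedLFunction χ s = ZMod.completedLFunction₀ χ s := by
      rw [completedLFunction, ZMod.completedLFunction_eq, χ.map_zero' hq, MulChar.sum_eq_zero_of_ne_one hχ]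
      simp
    rw [e, ZMod.completedLFunction₀]
    have hq1 : ‖(q:ℂ) ^ (-s)‖ ≤ q := by
      rw [norm_q_cpow]
      calc (q:ℝ) ^ (-s).re ≤ (q:ℝ) ^ (1:ℝ) := Real.rpow_le_rpow_of_exponent_le (one_le_q q) (by simp; linarith)
        _ = q := Real.rpow_one _
    refine (norm_add_le _ _).trans (add_le_add ?_ ?_)
    · rw [norm_mul]
      refine mul_le_mul hq1 ((norm_sum_le _ _).trans (Finset.sum_le_sum fun j _ => ?_)) (norm_nonneg _) byp
      rw [norm_mul]
      exact (mul_le_of_le_one_left (norm_nonneg _) (χ.norm_le_one j)).trans (hA _ s h1 h2)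
    · rw [norm_mul]
      refine mul_le_mul hq1 ((norm_sum_le _ _).trans (Finset.sum_le_sum fun j _ => ?_)) (norm_nonneg _) byp
      rw [norm_mul]
      exact (mul_le_of_le_one_left (norm_nonneg _) (χ.norm_le_one j)).trans (hB _ s h1 h2)

/-- the completed entire function -/
noncomputable def xiF (χ : DirichletCharacter ℂ q) (s : ℂ) : ℂ :=
  if q = 1 then s * (s - 1) * completedRiemannZeta₀ s + 1
  else (q:ℂ) ^ (s / 2) * completedLFunction χ s

noncomputable def polF (q : ℕ) (s : ℂ) : ℂ := if q = 1 then s * (s - 1) else 1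

lemma polF_ne {q : ℕ} {s : ℂ} (h0 : s ≠ 0) (h1 : s ≠ 1) : polF q s ≠ 0 := by
  unfold polF; split_ifs
  · exact mul_ne_zero h0 (sub_ne_zero.2 h1)
  · exact one_ne_zero

lemma xiF_eq (χ : DirichletCharacter ℂ q) {s : ℂ} (h0 : s ≠ 0) (h1 : s ≠ 1) :
    xiF χ s = polF q s * (q:ℂ) ^ (s / 2) * completedLFunction χ s := by
  unfold xiF polF
  split_ifs with hq
  · subst hq
    rw [completedLFunction_modOne_eq, completedRiemannZeta_eq]
    have : 1 - s ≠ 0 := sub_ne_zero.2 h1.symm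
    simp only [Nat.cast_one, one_cpow]
    field_simp
    ring
  · simp

lemma xiF_diff (χ : DirichletCharacter ℂ q) (h : q ≠ 1 → χ ≠ 1) : Differentiable ℂ (xiF χ) := by
  unfold xiF
  by_cases hq : q = 1
  · simp only [hq, if_true]
    have := differentiable_completedZeta₀
    fun_prop
  · simp only [hq, if_false]
    have := differentiable_completedLFunction (h hq)
    have hq0 : (q:ℂ) ≠ 0 := by exact_mod_cast NeZero.ne q
    refine Differentiable.mul ?_ this
    exact fun s => DifferentiableAt.const_cpow (by fun_prop) (Or.inl hq0)

noncomputable def kap (χ : DirichletCharacter ℂ q) : ℝ := by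
  classical exact if χ.Even then 0 else 1

lemma kap_cases (χ : DirichletCharacter ℂ q) : kap χ = 0 ∨ kap χ = 1 := by
  classical
  unfold kap; split_ifs <;> simp

lemma kap_nonneg (χ : DirichletCharacter ℂ q) : 0 ≤ kap χ := by
  rcases kap_cases χ with h | h <;> simp [h]

lemma kap_le (χ : DirichletCharacter ℂ q) : kap χ ≤ 1 := by
  rcases kap_cases χ with h | h <;> simp [h]

lemma gammaFactor_kap (χ : DirichletCharacter ℂ q) (s : ℂ) : gammaFactor χ s = Gammaℝ (s + kap χ) := by
  classical
  unfold kap gammaFactor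
  split_ifs <;> simp

lemma kap_inv (χ : DirichletCharacter ℂ q) : kap χ⁻¹ = kap χ := by
  classical
  unfold kap
  have : χ⁻¹.Even ↔ χ.Even := by
    unfold DirichletCharacter.Even
    rw [← MulChar.star_apply' χ (-1)]
    constructor
    · intro h; have := congrArg star h; simpa using this
    · intro h; rw [h]; simp
  simp [this]

lemma kap_one (χ : DirichletCharacter ℂ q) (hq : q = 1) : kap χ = 0 := by
  classical
  subst hq
  unfold kap
  rw [if_pos]
  exact map_one χ

lemma xiF_eq_L (χ : DirichletCharacter ℂ q) {s : ℂ} (h1 : s ≠ 1) (hs : 0 < s.re) :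
    xiF χ s = polF q s * (q:ℂ) ^ (s / 2) * (Gammaℝ (s + kap χ) * LFunction χ s) := by
  have h0 : s ≠ 0 := by rintro rfl; simp at hs
  rw [xiF_eq χ h0 h1, LFunction_eq_completed_div_gammaFactor χ s (Or.inl h0), gammaFactor_kap,
    mul_div_cancel₀]
  apply Gammaℝ_ne_zero_of_re_pos
  simp; linarith [kap_nonneg χ]

lemma xiF_ne_zero_right (χ : DirichletCharacter ℂ q) (h : q ≠ 1 → χ ≠ 1) {s : ℂ} (hs : 1 ≤ s.re) : xiF χ s ≠ 0 := by
  by_cases h1 : s = 1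
  · subst h1
    by_cases hq : q = 1
    · simp [xiF, hq]
    · have hL := LFunction_ne_zero_of_one_le_re χ (s := 1) (Or.inl (h hq)) (by simp)
      rw [LFunction_eq_completed_div_gammaFactor χ 1 (Or.inl one_ne_zero)] at hL
      have := (div_ne_zero_iff.1 hL).1
      simp only [xiF, hq, if_false]
      refine mul_ne_zero ?_ this
      simp [NeZero.ne q]
  · have h0 : s ≠ 0 := by rintro rfl; simp at hs; linarith
    rw [xiF_eq_L χ h1 byl]
    refine mul_ne_zero (mul_ne_zero (polF_ne h0 h1) ?_) (mul_ne_zero ?_ ?_)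
    · simp [NeZero.ne q]
    · apply Gammaℝ_ne_zero_of_re_pos; simp; linarith [kap_nonneg χ]
    · exact LFunction_ne_zero_of_one_le_re χ (Or.inr h1) hs

lemma xiF_fe {χ : DirichletCharacter ℂ q} (hχ : χ.IsPrimitive) (s : ℂ) :
    xiF χ (1 - s) = rootNumber χ * xiF χ⁻¹ s := by
  unfold xiF
  split_ifs with hq
  · subst hq
    rw [rootNumber_modOne, completedRiemannZeta₀_one_sub]; ring
  · rw [IsPrimitive.completedLFunction_one_sub hχ]
    have hq0 : (q:ℂ) ≠ 0 := by exact_mod_cast NeZero.ne q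
    have : (q:ℂ) ^ (s/2) = (q:ℂ) ^ ((1 - s)/2) * (q:ℂ) ^ (s - 1/2) := by
      rw [← cpow_add _ _ hq0]; congr 1; ring
    rw [this]; ring

lemma inv_ne {χ : DirichletCharacter ℂ q} (h : χ ≠ 1) : χ⁻¹ ≠ 1 := inv_ne_one.2 h

lemma root_ne {χ : DirichletCharacter ℂ q} (hχ : χ.IsPrimitive) : rootNumber χ ≠ 0 := by
  intro h
  have := xiF_fe hχ (-1)
  rw [h, zero_mul] at this
  exact xiF_ne_zero_right χ (prim_ne_one hχ) byn this

lemma xiF_zero_ne {χ : DirichletCharacter ℂ q} (hχ : χ.IsPrimitive) {s : ℂ} (hs : s.re ≤ 0) : xiF χ s ≠ 0 := by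
  have := xiF_fe hχ (1 - s)
  rw [sub_sub_cancel] at this
  rw [this]
  exact mul_ne_zero (root_ne hχ) (xiF_ne_zero_right χ⁻¹ (fun h => inv_ne (prim_ne_one hχ h)) (by simp; linarith))

lemma xiF_zeros {χ : DirichletCharacter ℂ q} (hχ : χ.IsPrimitive) {ρ : ℂ} (h : xiF χ ρ = 0) :
    0 < ρ.re ∧ ρ.re < 1 ∧ LFunction χ ρ = 0 := by
  have h0 : 0 < ρ.re := by
    by_contra hc; exact xiF_zero_ne hχ (not_lt.1 hc) h
  have h1 : ρ.re < 1 := by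
    by_contra hc; exact xiF_ne_zero_right χ (prim_ne_one hχ) (not_lt.1 hc) h
  refine ⟨h0, h1, ?_⟩
  have hρ1 : ρ ≠ 1 := by rintro rfl; simp at h1
  have hρ0 : ρ ≠ 0 := by rintro rfl; simp at h0
  rw [xiF_eq_L χ hρ1 h0] at h
  have a1 : Gammaℝ (ρ + kap χ) ≠ 0 := by apply Gammaℝ_ne_zero_of_re_pos; simp; linarith [kap_nonneg χ]
  have a2 : (q:ℂ) ^ (ρ/2) ≠ 0 := by simp [NeZero.ne q]
  have a3 := polF_ne (q := q) hρ0 hρ1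
  simpa [a1, a2, a3] using h

/-! growth -/
lemma gamma_growth (k : ℕ) {y : ℝ} (h1 : 1 ≤ y) (hy : y ≤ 4 * 4 ^ k) : Real.Gamma y ≤ Real.exp (36 * 8 ^ k) := by
  set n := ⌈y⌉₊ with hn
  have hyn : y ≤ n := Nat.le_ceil y
  have hn1 : (n:ℝ) ≤ 5 * 4 ^ k := by
    have := (Nat.ceil_lt_add_one (by linarith : 0 ≤ y)).le
    have h4 : (1:ℝ) ≤ 4 ^ k := one_le_pow₀ byn
    linarith
  have hG : Real.Gamma y ≤ n.factorial := by
    have h2 : Real.Gamma (y + 1) = y * Real.Gamma y := Real.Gamma_add_one byl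
    have hp : 0 < Real.Gamma y := Real.Gamma_pos_of_pos byl
    have h3 : Real.Gamma (y+1) ≤ Real.Gamma (n + 1) :=
      Real.Gamma_strictMonoOn_Ici.monotoneOn (by simp; linarith) (by simp; linarith) byl
    rw [Real.Gamma_nat_eq_factorial] at h3
    nlinarith
  have hnpos : (0:ℝ) < n := by linarith
  have hf : (n.factorial : ℝ) ≤ (n:ℝ) ^ n := by exact_mod_cast Nat.factorial_le_pow n
  refine (hG.trans hf).trans ?_
  rw [← Real.exp_log (pow_pos hnpos n), Real.exp_le_exp, Real.log_pow]
  have hs : Real.log n ≤ 2 * Real.sqrt n := by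
    have := Real.log_le_sub_one_of_pos (Real.sqrt_pos.2 hnpos)
    rw [Real.log_sqrt hnpos.le] at this
    linarith
  have hs2 : Real.sqrt n ≤ 3 * 2 ^ k := by
    rw [Real.sqrt_le_left byp]
    have : (3 * (2:ℝ)^k)^2 = 9 * 4 ^ k := by rw [mul_pow, ← pow_mul, mul_comm k 2, pow_mul]; norm_num
    rw [this]; nlinarith [pow_pos (by norm_num : (0:ℝ) < 4) k]
  have e : (8:ℝ)^k = 4 ^ k * 2 ^ k := by rw [← mul_pow]; norm_num
  have p4 : (0:ℝ) < 4 ^ k := by positivity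
  have p2 : (0:ℝ) < 2 ^ k := by positivity
  calc (n:ℝ) * Real.log n ≤ (5 * 4 ^ k) * (2 * (3 * 2 ^ k)) := by
        refine mul_le_mul hn1 byl (Real.log_nonneg byl) byp
    _ ≤ _ := by rw [e]; nlinarith [mul_pos p4 p2]

lemma norm_Gamma_le' {s : ℂ} (hs : 0 < s.re) : ‖Complex.Gamma s‖ ≤ Real.Gamma s.re := by
  rw [Complex.Gamma_eq_integral hs, Real.Gamma_eq_integral hs, Complex.GammaIntegral]
  refine (norm_integral_le_integral_norm _).trans (le_of_eq ?_)
  refine setIntegral_congr_fun measurableSet_Ioi fun t ht => ?_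
  have : (0:ℝ) < t := ht
  simp only [norm_mul, norm_cpow_eq_rpow_re_of_pos this, Complex.norm_real, Real.norm_eq_abs, Real.abs_exp]
  simp

lemma L_bound2 : ∃ K : ℝ, 0 ≤ K ∧ ∀ (χ : DirichletCharacter ℂ q) (s : ℂ), 2 ≤ s.re → ‖LFunction χ s‖ ≤ K := by
  have hsum : Summable fun n : ℕ => 1 / (n:ℝ) ^ (2:ℝ) := Real.summable_one_div_nat_rpow.2 byn
  refine ⟨∑' n : ℕ, 1 / (n:ℝ) ^ (2:ℝ), tsum_nonneg fun n => by positivity, fun χ s hs => ?_⟩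
  rw [LFunction_eq_LSeries χ byl]
  refine tsum_of_norm_bounded hsum.hasSum fun n => ?_
  rw [LSeries.norm_term_eq]
  split_ifs with h
  · simp [h]
  · have hn : (1:ℝ) ≤ n := by exact_mod_cast Nat.one_le_iff_ne_zero.2 h
    refine div_le_div₀ byn (χ.norm_le_one _) byp ?_
    exact Real.rpow_le_rpow_of_exponent_le hn hs

lemma xiF_growth_right (χ : DirichletCharacter ℂ q) (h : q ≠ 1 → χ ≠ 1) :
    ∃ C : ℝ, 0 ≤ C ∧ ∀ (k : ℕ) (s : ℂ), ‖s‖ ≤ 7 * 4 ^ k → -1 ≤ s.re → ‖xiF χ s‖ ≤ Real.exp (C * 8 ^ k) := by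
  obtain ⟨M, hM0, hM⟩ : ∃ M : ℝ, 0 ≤ M ∧ ∀ s : ℂ, -1 ≤ s.re → s.re ≤ 2 → ‖xiF χ s‖ ≤ M * (1 + ‖s‖) ^ 2 + 1 := by
    by_cases hq : q = 1
    · obtain ⟨M, hM0, hM⟩ := even_strip 0
      refine ⟨M, hM0, fun s h1 h2 => ?_⟩
      simp only [xiF, hq, if_true]
      refine (norm_add_le _ _).trans (add_le_add ?_ (by simp))
      rw [norm_mul, norm_mul, mul_comm]
      refine mul_le_mul (hM s h1 h2) ?_ byp hM0
      have : ‖s - 1‖ ≤ ‖s‖ + 1 := by simpa using norm_sub_le s 1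
      nlinarith [norm_nonneg s]
    · obtain ⟨M, hM0, hM⟩ := completedL_strip χ hq (h hq)
      refine ⟨q * M, by positivity, fun s h1 h2 => ?_⟩
      simp only [xiF, hq, if_false]
      rw [norm_mul, norm_q_cpow]
      have h3 : (q:ℝ) ^ (s/2).re ≤ q := by
        calc (q:ℝ) ^ (s/2).re ≤ (q:ℝ) ^ (1:ℝ) := Real.rpow_le_rpow_of_exponent_le (one_le_q q) (by simp; linarith)
        _ = q := Real.rpow_one _
      have h4 : (q:ℝ) ^ (s/2).re * ‖completedLFunction χ s‖ ≤ q * M :=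
        mul_le_mul h3 (hM s h1 h2) (norm_nonneg _) byp
      have h5 : 1 ≤ (1 + ‖s‖)^2 := one_le_pow₀ (by linarith [norm_nonneg s])
      nlinarith [mul_nonneg (Nat.cast_nonneg q : (0:ℝ) ≤ q) hM0]
  obtain ⟨K, hK0, hK⟩ := L_bound2 (q := q)
  have hlogq : 0 ≤ Real.log q := Real.log_nonneg (one_le_q q)
  have hpoly : ∀ (k : ℕ) (s : ℂ), ‖s‖ ≤ 7 * 4 ^ k → (1 + ‖s‖)^2 ≤ Real.exp (64 * 8 ^ k) := by
    intro k s hs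
    have h4 : (1:ℝ) ≤ 4 ^ k := one_le_pow₀ byn
    have h48 : (4:ℝ) ^ k ≤ 8 ^ k := pow_le_pow_left₀ byn byn k
    have h1 : 1 + ‖s‖ ≤ Real.exp (8 * 8 ^ k) := by
      refine le_trans ?_ (Real.add_one_le_exp _); nlinarith
    calc (1 + ‖s‖)^2 ≤ (Real.exp (8 * 8 ^ k))^2 := by gcongr
      _ = Real.exp (16 * 8 ^ k) := by rw [← Real.exp_nat_mul]; congr 1; push_cast; ring
      _ ≤ _ := Real.exp_le_exp.2 (by nlinarith)
  refine ⟨64 + 36 + (M + 1) + K + 4 * Real.log q, by positivity, fun k s hs hre => ?_⟩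
  have h4 : (1:ℝ) ≤ 4 ^ k := one_le_pow₀ byn
  have h8 : (1:ℝ) ≤ 8 ^ k := one_le_pow₀ byn
  have h48 : (4:ℝ) ^ k ≤ 8 ^ k := pow_le_pow_left₀ byn byn k
  rcases le_total s.re 2 with h2 | h2
  · refine (hM s hre h2).trans ?_
    have hp := hpoly k s hs
    have h5 : 1 ≤ (1 + ‖s‖)^2 := one_le_pow₀ (by linarith [norm_nonneg s])
    have h6 : M * (1 + ‖s‖)^2 + 1 ≤ (M + 1) * (1 + ‖s‖)^2 := by nlinarith
    have h7 : M + 1 ≤ Real.exp (M + 1) := by linarith [Real.add_one_le_exp (M+1)]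
    refine h6.trans ((mul_le_mul h7 hp byp byp).trans ?_)
    rw [← Real.exp_add, Real.exp_le_exp]
    nlinarith [mul_nonneg hM0 (by linarith : (0:ℝ) ≤ 8^k - 1), mul_nonneg hK0 (by linarith : (0:ℝ) ≤ 8^k), mul_nonneg hlogq (by linarith : (0:ℝ) ≤ 8^k)]
  · have hs1 : s ≠ 1 := by rintro rfl; norm_num at h2
    have hre7 : s.re ≤ 7 * 4 ^ k := (Complex.re_le_norm s).trans hs
    rw [xiF_eq_L χ hs1 byl]
    have n1 : ‖polF q s‖ ≤ Real.exp (64 * 8 ^ k) := by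
      refine le_trans ?_ (hpoly k s hs)
      unfold polF; split_ifs
      · rw [norm_mul]
        have : ‖s - 1‖ ≤ ‖s‖ + 1 := by simpa using norm_sub_le s 1
        nlinarith [norm_nonneg s]
      · rw [norm_one]; exact one_le_pow₀ (by linarith [norm_nonneg s])
    have n2 : ‖(q:ℂ) ^ (s/2)‖ ≤ Real.exp (4 * Real.log q * 8 ^ k) := by
      rw [norm_q_cpow, Real.rpow_def_of_pos (by linarith [one_le_q q]), Real.exp_le_exp]
      have : (s/2).re ≤ 4 * 8 ^ k := by simp; linarith
      nlinarith
    have n3 : ‖Gammaℝ (s + kap χ)‖ ≤ Real.exp (36 * 8 ^ k) := by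
      rw [Gammaℝ_def, norm_mul]
      have hp : ‖(Real.pi:ℂ) ^ (-(s + kap χ)/2)‖ ≤ 1 := by
        rw [norm_cpow_eq_rpow_re_of_pos Real.pi_pos]
        refine Real.rpow_le_one_of_one_le_of_nonpos (by linarith [Real.pi_gt_three]) ?_
        simp; linarith [kap_nonneg χ]
      have hr : ((s + kap χ)/2).re = (s.re + kap χ)/2 := by simp
      have hg := norm_Gamma_le' (s := (s + kap χ)/2) (by rw [hr]; linarith [kap_nonneg χ])
      have hg2 : Real.Gamma ((s + kap χ)/2).re ≤ Real.exp (36 * 8 ^ k) :=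
        gamma_growth k (by rw [hr]; linarith [kap_nonneg χ]) (by rw [hr]; linarith [kap_le χ])
      calc _ ≤ 1 * Real.exp (36 * 8 ^ k) := mul_le_mul hp (hg.trans hg2) (norm_nonneg _) byn
        _ = _ := one_mul _
    have n4 : ‖LFunction χ s‖ ≤ Real.exp (K * 8 ^ k) := by
      refine (hK χ s h2).trans ?_
      have := Real.add_one_le_exp (K * 8 ^ k)
      nlinarith
    rw [norm_mul, norm_mul, norm_mul]
    calc _ ≤ (Real.exp (64 * 8 ^ k) * Real.exp (4 * Real.log q * 8 ^ k)) * (Real.exp (36 * 8 ^ k) * Real.exp (K * 8 ^ k)) := by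
          gcongr
      _ ≤ _ := by
        rw [← Real.exp_add, ← Real.exp_add, ← Real.exp_add, Real.exp_le_exp]
        nlinarith

lemma xiF_growth {χ : DirichletCharacter ℂ q} (hχ : χ.IsPrimitive) :
    ∃ C : ℝ, ∀ k : ℕ, ∀ s : ℂ, ‖s‖ ≤ 6 * 4 ^ k → ‖xiF χ s‖ ≤ Real.exp (C * 8 ^ k) := by
  obtain ⟨C1, h1, H1⟩ := xiF_growth_right χ (prim_ne_one hχ)
  obtain ⟨C2, h2, H2⟩ := xiF_growth_right χ⁻¹ (fun h => inv_ne (prim_ne_one hχ h))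
  refine ⟨C1 + C2 + ‖rootNumber χ‖, fun k s hs => ?_⟩
  have h4 : (1:ℝ) ≤ 4 ^ k := one_le_pow₀ byn
  have h8 : (1:ℝ) ≤ 8 ^ k := one_le_pow₀ byn
  have hr := norm_nonneg (rootNumber χ)
  rcases le_total (-1) s.re with h | h
  · refine (H1 k s byl h).trans (Real.exp_le_exp.2 ?_)
    gcongr; linarith
  · have := xiF_fe hχ (1 - s)
    rw [sub_sub_cancel] at this
    rw [this, norm_mul]
    have hn : ‖1 - s‖ ≤ 7 * 4 ^ k := by
      have : ‖1 - s‖ ≤ 1 + ‖s‖ := by simpa using norm_sub_le 1 s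
      linarith
    have a1 := H2 k (1 - s) hn (by simp; linarith)
    have a2 : ‖rootNumber χ‖ ≤ Real.exp (‖rootNumber χ‖ * 8 ^ k) := by
      have := Real.add_one_le_exp (‖rootNumber χ‖ * 8 ^ k); nlinarith
    refine (mul_le_mul a2 a1 (norm_nonneg _) byp).trans ?_
    rw [← Real.exp_add, Real.exp_le_exp]
    nlinarith
end XiSec

section DigSec
open Complex Filter Topology

noncomputable def dgk (n : ℕ) (x : ℝ) : ℝ := Real.exp (-x) - indicator (Ioc 0 (n : ℝ)) (fun x : ℝ => (1 - x / n) ^ n) x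

lemma dgk_nonneg (n : ℕ) {x : ℝ} (hx : 0 < x) : 0 ≤ dgk n x := by
  unfold dgk
  by_cases h : x ≤ n
  · rw [indicator_of_mem (mem_Ioc.mpr ⟨hx, h⟩)]
    linarith [Real.one_sub_div_pow_le_exp_neg h]
  · rw [indicator_of_notMem (by simp; intro _; linarith)]
    linarith [Real.exp_pos (-x)]

lemma dgk_int {s : ℂ} (hs : 0 < s.re) {n : ℕ} (hn : n ≠ 0) :
    IntegrableOn (fun x : ℝ => (dgk n x : ℂ) * (x:ℂ) ^ (s - 1)) (Ioi 0) ∧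
    ∫ x in Ioi (0:ℝ), (dgk n x : ℂ) * (x:ℂ) ^ (s - 1) = Gamma s - GammaSeq s n := by
  have h1 : IntegrableOn (fun x : ℝ => ((Real.exp (-x) : ℝ) : ℂ) * (x:ℂ) ^ (s - 1)) (Ioi 0) := Complex.GammaIntegral_convergent hs
  have h2 : IntegrableOn (indicator (Ioc 0 (n : ℝ)) fun x : ℝ => ((1 - x / n) ^ n : ℝ) * (x : ℂ) ^ (s - 1)) (Ioi 0) := by
    rw [IntegrableOn, integrable_indicator_iff (measurableSet_Ioc : MeasurableSet (Ioc (_ : ℝ) _)), IntegrableOn,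
      Measure.restrict_restrict_of_subset Ioc_subset_Ioi_self, ← IntegrableOn, ←
      intervalIntegrable_iff_integrableOn_Ioc_of_le (by positivity : (0 : ℝ) ≤ n)]
    apply IntervalIntegrable.continuousOn_mul
    · refine intervalIntegral.intervalIntegrable_cpow' ?_
      rwa [sub_re, one_re, ← zero_sub, sub_lt_sub_iff_right]
    · fun_prop
  have e : (fun x : ℝ => (dgk n x : ℂ) * (x:ℂ) ^ (s - 1)) = fun x : ℝ => ((Real.exp (-x) : ℝ) : ℂ) * (x:ℂ) ^ (s - 1) - (indicator (Ioc 0 (n : ℝ)) fun x : ℝ => ((1 - x / n) ^ n : ℝ) * (x : ℂ) ^ (s - 1)) x := by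
    funext x
    unfold dgk
    by_cases h : x ∈ Ioc 0 (n:ℝ)
    · rw [indicator_of_mem h, indicator_of_mem h]; push_cast; ring
    · rw [indicator_of_notMem h, indicator_of_notMem h]; push_cast; ring
  rw [e]
  refine ⟨h1.sub h2, ?_⟩
  rw [integral_sub h1 h2, Gamma_eq_integral hs, GammaSeq_eq_approx_Gamma_integral hs hn,
    MeasureTheory.integral_indicator (measurableSet_Ioc : MeasurableSet (Ioc (_ : ℝ) _)),
      intervalIntegral.integral_of_le (by positivity : 0 ≤ (n : ℝ)),
      Measure.restrict_restrict_of_subset Ioc_subset_Ioi_self]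
  rfl

lemma dgk_bound {a b : ℝ} (ha : 0 < a) {s : ℂ} (h1 : a ≤ s.re) (h2 : s.re ≤ b) {n : ℕ} (hn : n ≠ 0) :
    ‖Gamma s - GammaSeq s n‖ ≤ ‖Gamma (a:ℂ) - GammaSeq a n‖ + ‖Gamma (b:ℂ) - GammaSeq b n‖ := by
  have hs : 0 < s.re := by linarith
  have key : ∀ c : ℝ, 0 < c → IntegrableOn (fun x : ℝ => dgk n x * x ^ (c - 1)) (Ioi 0) ∧
     ∫ x in Ioi (0:ℝ), dgk n x * x ^ (c - 1) = ‖Gamma (c:ℂ) - GammaSeq c n‖ := by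
    intro c hc
    obtain ⟨i1, i2⟩ := dgk_int (s := (c:ℂ)) (by simpa) hn
    have e : EqOn (fun x : ℝ => (dgk n x : ℂ) * (x:ℂ) ^ ((c:ℂ) - 1)) (fun x : ℝ => ((dgk n x * x ^ (c - 1) : ℝ) : ℂ)) (Ioi 0) := by
      intro x hx
      simp only [mem_Ioi] at hx
      simp only
      push_cast
      rw [Complex.ofReal_cpow hx.le]; push_cast; rfl
    have i3 : IntegrableOn (fun x : ℝ => ((dgk n x * x ^ (c - 1) : ℝ) : ℂ)) (Ioi 0) := i1.congr_fun e measurableSet_Ioi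
    have i4 : IntegrableOn (fun x : ℝ => dgk n x * x ^ (c - 1)) (Ioi 0) := by
      have := i3.re
      rw [IntegrableOn]; simpa using this
    refine ⟨i4, ?_⟩
    rw [← i2, setIntegral_congr_fun measurableSet_Ioi e, integral_complex_ofReal, Complex.norm_real, Real.norm_of_nonneg]
    refine setIntegral_nonneg measurableSet_Ioi fun x hx => ?_
    exact mul_nonneg (dgk_nonneg n hx) (Real.rpow_nonneg (le_of_lt hx) _)
  obtain ⟨a1, a2⟩ := key a ha
  obtain ⟨b1, b2⟩ := key b byl
  rw [← a2, ← b2, ← (dgk_int hs hn).2, ← integral_add a1 b1]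
  refine norm_integral_le_of_norm_le (a1.add b1) ?_
  rw [ae_restrict_iff' measurableSet_Ioi]
  refine ae_of_all _ fun x hx => ?_
  simp only [mem_Ioi] at hx
  have hk := dgk_nonneg n hx
  rw [norm_mul, Complex.norm_real, Real.norm_of_nonneg hk, norm_cpow_eq_rpow_re_of_pos hx]
  simp only [Pi.add_apply, sub_re, one_re]
  rw [← mul_add]
  refine mul_le_mul_of_nonneg_left ?_ hk
  have p1 := Real.rpow_nonneg hx.le (a-1)
  have p2 := Real.rpow_nonneg hx.le (b-1)
  rcases le_total x 1 with h | h
  · have := Real.rpow_le_rpow_of_exponent_ge hx h (by linarith : a - 1 ≤ s.re - 1)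
    linarith
  · have := Real.rpow_le_rpow_of_exponent_le h (by linarith : s.re - 1 ≤ b - 1)
    linarith

lemma GammaSeq_unif : TendstoLocallyUniformlyOn (fun (n:ℕ) s => GammaSeq s n) Gamma atTop {s : ℂ | 0 < s.re} := by
  rw [Metric.tendstoLocallyUniformlyOn_iff]
  intro ε hε s hs
  simp only [mem_setOf_eq] at hs
  refine ⟨{z | s.re / 2 < z.re ∧ z.re < s.re + 1}, ?_, ?_⟩
  · refine mem_nhdsWithin_of_mem_nhds (IsOpen.mem_nhds ?_ ?_)
    · exact (isOpen_lt continuous_const Complex.continuous_re).inter (isOpen_lt Complex.continuous_re continuous_const)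
    · simp only [mem_setOf_eq]; constructor <;> linarith
  · have t : ∀ c : ℂ, Tendsto (fun n => ‖Gamma c - GammaSeq c n‖) atTop (𝓝 0) := by
      intro c
      have := (tendsto_const_nhds (x := Gamma c)).sub (GammaSeq_tendsto_Gamma c)
      rw [sub_self] at this
      simpa using this.norm
    have t2 := (t ((s.re/2 : ℝ):ℂ)).add (t ((s.re + 1 : ℝ) : ℂ))
    rw [add_zero] at t2
    filter_upwards [t2.eventually_lt_const hε, eventually_ne_atTop 0] with n h1 h2 z hz
    rw [dist_eq_norm]
    exact (dgk_bound byl hz.1.le hz.2.le h2).trans_lt h1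

lemma GammaSeq_logDeriv {s : ℂ} (hs : 0 < s.re) {n : ℕ} (hn : n ≠ 0) :
    DifferentiableAt ℂ (fun s => GammaSeq s n) s ∧
    logDeriv (fun s => GammaSeq s n) s = Complex.log n - ∑ j ∈ Finset.range (n+1), 1 / (s + j) := by
  have hn' : (n:ℂ) ≠ 0 := Nat.cast_ne_zero.mpr hn
  have hj : ∀ j : ℕ, s + j ≠ 0 := by
    intro j h
    have := congrArg re h
    simp at this
    have : (0:ℝ) ≤ j := by positivity
    linarith
  have d1 : HasDerivAt (fun s : ℂ => (n:ℂ) ^ s) ((n:ℂ)^s * Complex.log n) s := by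
    simpa using (hasDerivAt_id s).const_cpow (Or.inl hn')
  have dp : ∀ s, DifferentiableAt ℂ (fun s : ℂ => ∏ j ∈ Finset.range (n+1), (s + j)) s := by
    intro s; fun_prop
  have np : ∏ j ∈ Finset.range (n+1), (s + j) ≠ 0 := Finset.prod_ne_zero_iff.2 fun j _ => hj j
  have nf : (n:ℂ)^s * (Nat.factorial n : ℂ) ≠ 0 := mul_ne_zero (by simp [Complex.cpow_eq_zero_iff, hn']) (by exact_mod_cast Nat.factorial_ne_zero n)
  have d2 : DifferentiableAt ℂ (fun s : ℂ => (n:ℂ) ^ s * (Nat.factorial n : ℂ)) s := d1.differentiableAt.mul_const _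
  refine ⟨d2.div (dp s) np, ?_⟩
  have e := logDeriv_div s nf np d2 (dp s)
  unfold GammaSeq
  rw [e, logDeriv_mul_const _ _ (by exact_mod_cast Nat.factorial_ne_zero n), logDeriv_apply, d1.deriv,
    logDeriv_prod (fun j _ => hj j) (fun j _ => by fun_prop)]
  congr 1
  · rw [mul_div_cancel_left₀]; simp [Complex.cpow_eq_zero_iff, hn']
  · refine Finset.sum_congr rfl fun j _ => ?_
    rw [logDeriv_apply]; simp

lemma dig_norm_add {s : ℂ} (hs : 0 < s.re) (n : ℕ) : n + s.re ≤ ‖(n:ℂ) + s‖ := by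
  have := Complex.re_le_norm ((n:ℂ) + s); simpa using this

lemma dig_ne {s : ℂ} (hs : 0 < s.re) (n : ℕ) : (n:ℂ) + s ≠ 0 := by
  rw [← norm_pos_iff]
  have := dig_norm_add hs n
  have : (0:ℝ) ≤ n := by positivity
  linarith

lemma dig_term {s : ℂ} (hs : 0 < s.re) (n : ℕ) :
    ‖1 / ((n:ℂ) + 1) - 1 / ((n:ℂ) + s)‖ ≤ ‖s - 1‖ * (1 + 1 / s.re) / ((n:ℝ) + 1) ^ 2 := by
  have hn : (0:ℝ) ≤ n := by positivity
  have h1 : (n:ℂ) + 1 ≠ 0 := by exact_mod_cast Nat.succ_ne_zero n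
  have e : 1 / ((n:ℂ) + 1) - 1 / ((n:ℂ) + s) = (s - 1) / (((n:ℂ) + 1) * ((n:ℂ) + s)) := by
    have := dig_ne hs n
    field_simp; ring
  have n1 : ‖(n:ℂ) + 1‖ = n + 1 := by
    have : ((n:ℂ) + 1) = ((n + 1 : ℝ) : ℂ) := by push_cast; rfl
    rw [this, Complex.norm_real, Real.norm_of_nonneg byp]
  have h2 := dig_norm_add hs n
  have h3 : (n:ℝ) + 1 ≤ (1 + 1 / s.re) * ‖(n:ℂ) + s‖ := by
    have : (1 + 1/s.re) * (n + s.re) ≤ (1 + 1 / s.re) * ‖(n:ℂ) + s‖ := mul_le_mul_of_nonneg_left h2 byp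
    have e2 : (1 + 1/s.re) * (n + s.re) = n + s.re + n / s.re + 1 := by field_simp; ring
    have : 0 ≤ n / s.re := by positivity
    linarith
  have h4 : 0 < ‖(n:ℂ) + s‖ := by linarith
  rw [e, norm_div, norm_mul, n1, div_le_div_iff₀ byp byp]
  have : ‖s - 1‖ * (n+1) * (n + 1) ≤ ‖s - 1‖ * (n+1) * ((1 + 1 / s.re) * ‖(n:ℂ) + s‖) := mul_le_mul_of_nonneg_left h3 byp
  nlinarith

lemma summ_sq : Summable (fun n : ℕ => 1 / ((n:ℝ) + 1) ^ 2) := by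
  have := (summable_nat_add_iff 1).2 (Real.summable_one_div_nat_pow.2 (by norm_num : 1 < 2))
  simpa using this

theorem digamma_hasSum {s : ℂ} (hs : 0 < s.re) :
    HasSum (fun n : ℕ => 1 / ((n:ℂ) + 1) - 1 / ((n:ℂ) + s)) (digamma s + Real.eulerMascheroniConstant) := by
  have hsum : Summable (fun n : ℕ => 1 / ((n:ℂ) + 1) - 1 / ((n:ℂ) + s)) := by
    refine Summable.of_norm_bounded (g := fun n : ℕ => ‖s - 1‖ * (1 + 1 / s.re) * (1 / ((n:ℝ) + 1) ^ 2)) (summ_sq.mul_left _) fun n => ?_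
    refine (dig_term hs n).trans (le_of_eq ?_); ring
  have t1 := hsum.hasSum.tendsto_sum_nat
  have t2 : Tendsto (fun n : ℕ => logDeriv (fun s => GammaSeq s n) s) atTop (𝓝 (logDeriv Gamma s)) := by
    refine logDeriv_tendsto (s := {s : ℂ | 0 < s.re}) (isOpen_lt continuous_const Complex.continuous_re) hs GammaSeq_unif ?_ (Gamma_ne_zero_of_re_pos hs)
    filter_upwards [eventually_ne_atTop 0] with n hn z hz
    exact (GammaSeq_logDeriv hz hn).1.differentiableWithinAt
  have t3 : Tendsto (fun n : ℕ => ((harmonic n : ℝ) - Real.log n : ℝ)) atTop (𝓝 Real.eulerMascheroniConstant) := Real.tendsto_harmonic_sub_log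
  have t4 : Tendsto (fun n : ℕ => (1:ℂ) / (n + 1)) atTop (𝓝 0) := tendsto_one_div_add_atTop_nhds_zero_nat
  have t5 : Tendsto (fun n : ℕ => logDeriv (fun s => GammaSeq s n) s + (((harmonic n : ℝ) - Real.log n : ℝ) : ℂ) + (1:ℂ) / (n + 1)) atTop (𝓝 (digamma s + Real.eulerMascheroniConstant)) := by
    have := (t2.add ((Complex.continuous_ofReal.tendsto _).comp t3)).add t4
    rw [add_zero] at this
    exact this
  have t6 := t1.comp (tendsto_add_atTop_nat 1)
  have : (∑' n : ℕ, (1 / ((n:ℂ) + 1) - 1 / ((n:ℂ) + s))) = digamma s + Real.eulerMascheroniConstant := by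
    refine tendsto_nhds_unique t6 (t5.congr' ?_)
    filter_upwards [eventually_ne_atTop 0] with n hn
    rw [(GammaSeq_logDeriv hs hn).2]
    simp only [Function.comp_apply, Finset.sum_sub_distrib]
    rw [Finset.sum_range_succ (fun n : ℕ => 1 / ((n:ℂ) + 1)), harmonic]
    push_cast
    have e1 : ∑ i ∈ Finset.range n, ((i:ℂ) + 1)⁻¹ = ∑ i ∈ Finset.range n, 1 / ((i:ℂ) + 1) := by simp
    have e2 : ∑ j ∈ Finset.range (n+1), 1 / (s + (j:ℂ)) = ∑ j ∈ Finset.range (n+1), 1 / ((j:ℂ) + s) := by simp only [add_comm]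
    rw [e1, e2]; ring
  rw [← this]; exact hsum.hasSum

end DigSec

section XiSec2
open Complex DirichletCharacter Filter Topology ComplexConjugate
variable {q : ℕ} [NeZero q]

lemma L_conj (χ : DirichletCharacter ℂ q) {s : ℂ} (hs : 1 < s.re) :
    LFunction χ⁻¹ (conj s) = conj (LFunction χ s) := by
  rw [LFunction_eq_LSeries _ (by simpa using hs), LFunction_eq_LSeries _ hs, LSeries, LSeries, Complex.conj_tsum]
  refine tsum_congr fun n => ?_
  rw [LSeries.term_def, LSeries.term_def]
  split_ifs with hn
  · simp
  · rw [map_div₀, ← MulChar.star_apply', Complex.cpow_conj _ _ (by rw [Complex.natCast_arg]; exact Real.pi_pos.ne), Complex.conj_natCast]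
    rfl

lemma Gammaℝ_conj' (s : ℂ) : Gammaℝ (conj s) = conj (Gammaℝ s) := by
  have h0 : conj (2:ℂ) = 2 := Complex.conj_ofNat 2
  rw [Gammaℝ_def, Gammaℝ_def, map_mul]
  have h1 : (Real.pi:ℂ) ^ (-(conj s) / 2) = conj ((Real.pi:ℂ) ^ (-s/2)) := by
    have := Complex.cpow_conj (Real.pi:ℂ) (-s/2) (by rw [Complex.arg_ofReal_of_nonneg Real.pi_pos.le]; exact Real.pi_pos.ne)
    simpa [h0] using this
  have h2 : Gamma (conj s / 2) = conj (Gamma (s/2)) := by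
    have := Complex.Gamma_conj (s/2)
    simpa [h0] using this
  rw [h1, h2]

lemma xiF_conj {χ : DirichletCharacter ℂ q} (hχ : χ.IsPrimitive) (s : ℂ) :
    xiF χ⁻¹ (conj s) = conj (xiF χ s) := by
  have h := fun hq => prim_ne_one hχ hq
  have h' : q ≠ 1 → χ⁻¹ ≠ 1 := fun hq => inv_ne (h hq)
  have d1 : Differentiable ℂ (fun s => conj (xiF χ (conj s))) := fun z => by
    have := (xiF_diff χ h (conj z)).conj_conj
    rw [Complex.conj_conj] at this
    exact this
  have d2 := xiF_diff χ⁻¹ h'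
  have key : xiF χ⁻¹ = fun s => conj (xiF χ (conj s)) := by
    refine AnalyticOnNhd.eq_of_eventuallyEq (z₀ := 2) (fun z _ => d2.analyticAt z) (fun z _ => d1.analyticAt z) ?_
    have : {s : ℂ | 1 < s.re} ∈ 𝓝 (2:ℂ) := (isOpen_lt continuous_const Complex.continuous_re).mem_nhds (by simp)
    filter_upwards [this] with z hz
    replace hz : 1 < z.re := hz
    have hz1 : z ≠ 1 := by rintro rfl; simp at hz
    have hz2 : conj z ≠ 1 := by
      intro hh; have := congrArg re hh; simp at this; linarith
    rw [xiF_eq_L _ hz1 byl, xiF_eq_L _ hz2 (by simp; linarith), map_mul, map_mul, map_mul, kap_inv]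
    have e1 : conj (polF q (conj z)) = polF q z := by unfold polF; split_ifs <;> simp
    have e2 : conj ((q:ℂ) ^ (conj z / 2)) = (q:ℂ) ^ (z/2) := by
      have := Complex.cpow_conj (q:ℂ) (z/2) (by rw [Complex.natCast_arg]; exact Real.pi_pos.ne)
      rw [Complex.conj_natCast] at this
      rw [show conj z / 2 = conj (z/2) by rw [map_div₀, Complex.conj_ofNat], this, Complex.conj_conj]
    have e3 : conj (Gammaℝ (conj z + kap χ)) = Gammaℝ (z + kap χ) := by
      rw [← Gammaℝ_conj']; simp
    have e4 : conj (LFunction χ (conj z)) = LFunction χ⁻¹ z := by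
      rw [← L_conj χ (by simpa using hz), Complex.conj_conj]
    rw [e1, e2, e3, e4]
  rw [key]; simp

lemma xiF_refl {χ : DirichletCharacter ℂ q} (hχ : χ.IsPrimitive) (s : ℂ) :
    xiF χ (1 - conj s) = rootNumber χ * conj (xiF χ s) := by
  rw [xiF_fe hχ, xiF_conj hχ]

lemma xiF_order {χ : DirichletCharacter ℂ q} (hχ : χ.IsPrimitive) (ρ : ℂ) :
    analyticOrderNatAt (xiF χ) (1 - conj ρ) = analyticOrderNatAt (xiF χ) ρ := by
  have h := fun hq => prim_ne_one hχ hq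
  have hd := xiF_diff χ h
  have h0 := xiF_zero_ne hχ (s := 0) (by simp)
  have hnt := hd_order_ne_top hd h0 ρ
  obtain ⟨g, hg, hg0, hfg⟩ := ((hd.analyticAt ρ).analyticOrderAt_ne_top).1 hnt
  set n := analyticOrderNatAt (xiF χ) ρ with hn
  have : analyticOrderAt (xiF χ) (1 - conj ρ) = n := by
    rw [(hd.analyticAt _).analyticOrderAt_eq_natCast]
    refine ⟨fun w => rootNumber χ * (-1) ^ n * conj (g (1 - conj w)), ?_, ?_, ?_⟩
    · have hev : ∀ᶠ z in 𝓝 ρ, DifferentiableAt ℂ g z := by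
        filter_upwards [hg.eventually_analyticAt] with z hz using hz.differentiableAt
      have ht : Tendsto (fun w : ℂ => 1 - conj w) (𝓝 (1 - conj ρ)) (𝓝 ρ) := by
        have : Continuous (fun w : ℂ => 1 - conj w) := by fun_prop
        have := this.tendsto (1 - conj ρ)
        simpa using this
      refine AnalyticAt.mul analyticAt_const ?_
      rw [Complex.analyticAt_iff_eventually_differentiableAt]
      filter_upwards [ht.eventually hev] with w hw
      have h1 : DifferentiableAt ℂ (fun z => g (1 - z)) (conj w) := by
        have : DifferentiableAt ℂ (fun z : ℂ => 1 - z) (conj w) := by fun_prop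
        exact DifferentiableAt.comp (conj w) hw this
      have := h1.conj_conj
      simpa [Function.comp_def] using this
    · simp [root_ne hχ, hg0]
    · have ht : Tendsto (fun w : ℂ => 1 - conj w) (𝓝 (1 - conj ρ)) (𝓝 ρ) := by
        have : Continuous (fun w : ℂ => 1 - conj w) := by fun_prop
        have := this.tendsto (1 - conj ρ)
        simpa using this
      filter_upwards [ht.eventually hfg] with w hw
      have e := xiF_refl hχ (1 - conj w)
      rw [hw] at e
      simp only [map_sub, map_one, Complex.conj_conj, sub_sub_cancel, smul_eq_mul, map_mul, map_pow] at e
      rw [e, smul_eq_mul, show (1 - w - conj ρ) = (-1) * (w - (1 - conj ρ)) by ring, mul_pow]; ring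
  rw [analyticOrderNatAt, this]; rfl

noncomputable def polD (q : ℕ) (s : ℂ) : ℂ := if q = 1 then 1 / s + 1 / (s - 1) else 0

noncomputable def LamS (χ : DirichletCharacter ℂ q) (s : ℂ) : ℂ := LSeries (fun n => χ n * (ArithmeticFunction.vonMangoldt n : ℂ)) s

lemma logDeriv_L (χ : DirichletCharacter ℂ q) {s : ℂ} (hs : 1 < s.re) :
    logDeriv (LFunction χ) s = - LamS χ s := by
  have h := LSeries_twist_vonMangoldt_eq χ hs
  have ev : LFunction χ =ᶠ[𝓝 s] LSeries (fun n => χ n) := by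
    filter_upwards [(isOpen_lt continuous_const Complex.continuous_re).mem_nhds hs] with z hz
    exact LFunction_eq_LSeries χ hz
  have h2 : LamS χ s = -deriv (LSeries (fun n => χ n)) s / LSeries (fun n => χ n) s := h
  rw [h2, logDeriv_apply, ev.deriv_eq, LFunction_eq_LSeries χ hs]; ring

lemma logDeriv_Gammaℝ {s : ℂ} (hs : 0 < s.re) :
    DifferentiableAt ℂ Gammaℝ s ∧ logDeriv Gammaℝ s = - (Real.log Real.pi) / 2 + digamma (s/2) / 2 := by
  have hpi : (Real.pi:ℂ) ≠ 0 := by exact_mod_cast Real.pi_ne_zero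
  have e : Gammaℝ = fun s => (Real.pi:ℂ) ^ (-s/2) * (Gamma ∘ fun s => s / 2) s := by
    funext s; rw [Gammaℝ_def]; rfl
  have hs2 : 0 < (s/2).re := by simp; linarith
  have d1 : HasDerivAt (fun s : ℂ => (Real.pi:ℂ) ^ (-s/2)) ((Real.pi:ℂ) ^ (-s/2) * Complex.log Real.pi * (-1/2)) s := by
    have : HasDerivAt (fun s : ℂ => -s/2) (-1/2) s := (hasDerivAt_id s).neg.div_const 2
    exact this.const_cpow (Or.inl hpi)
  have d2 : DifferentiableAt ℂ Gamma (s/2) := by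
    refine differentiableAt_Gamma _ fun m hm => ?_
    rw [hm] at hs2; simp at hs2
    have : (0:ℝ) ≤ m := by positivity
    linarith
  have d3 : HasDerivAt (fun s : ℂ => s/2) (1/2) s := (hasDerivAt_id s).div_const 2
  have n1 : (Real.pi:ℂ) ^ (-s/2) ≠ 0 := by simp [Complex.cpow_eq_zero_iff, hpi]
  have n5 : (Gamma ∘ fun s => s / 2) s ≠ 0 := Gamma_ne_zero_of_re_pos hs2
  have d4 : DifferentiableAt ℂ (Gamma ∘ fun s => s / 2) s := DifferentiableAt.comp s d2 d3.differentiableAt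
  rw [e]
  refine ⟨d1.differentiableAt.mul d4, ?_⟩
  rw [logDeriv_mul s n1 n5 d1.differentiableAt d4, logDeriv_apply, d1.deriv,
    logDeriv_comp (f := Gamma) (g := fun s : ℂ => s / 2) (x := s) d2 d3.differentiableAt, d3.deriv, digamma_def, ← Complex.ofReal_log Real.pi_pos.le]
  field_simp

lemma xiF_logDeriv {χ : DirichletCharacter ℂ q} (hχ : χ.IsPrimitive) {s : ℂ} (hs : 1 < s.re) :
    logDeriv (xiF χ) s = polD q s + (Real.log (q / Real.pi) / 2 : ℝ) + digamma ((s + kap χ)/2) / 2 - LamS χ s := by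
  have h := fun hq => prim_ne_one hχ hq
  have hq0 : (q:ℂ) ≠ 0 := by exact_mod_cast NeZero.ne q
  have hsr : 0 < (s + kap χ).re := by have := kap_nonneg χ; simp; linarith
  have hs1 : s ≠ 1 := by rintro rfl; simp at hs
  have hs0 : s ≠ 0 := by rintro rfl; simp at hs; linarith
  have ev : xiF χ =ᶠ[𝓝 s] fun s => (polF q s * (q:ℂ) ^ (s / 2)) * ((Gammaℝ ∘ fun s => s + kap χ) s * LFunction χ s) := by
    filter_upwards [(isOpen_lt continuous_const Complex.continuous_re).mem_nhds hs] with z hz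
    rw [xiF_eq_L χ (by rintro rfl; simp at hz) byl]; rfl
  have dp : DifferentiableAt ℂ (polF q) s := by
    unfold polF; split_ifs <;> fun_prop
  have dq : HasDerivAt (fun s : ℂ => (q:ℂ) ^ (s/2)) ((q:ℂ) ^ (s/2) * Complex.log q * (1/2)) s := by
    have : HasDerivAt (fun s : ℂ => s/2) (1/2) s := (hasDerivAt_id s).div_const 2
    exact this.const_cpow (Or.inl hq0)
  obtain ⟨dg, eg⟩ := logDeriv_Gammaℝ hsr
  have da : HasDerivAt (fun s : ℂ => s + kap χ) 1 s := (hasDerivAt_id s).add_const _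
  have dgc : DifferentiableAt ℂ (Gammaℝ ∘ fun s => s + kap χ) s := DifferentiableAt.comp s dg da.differentiableAt
  have dl : DifferentiableAt ℂ (LFunction χ) s := differentiableAt_LFunction χ s (Or.inl hs1)
  have n1 := polF_ne (q := q) hs0 hs1
  have n2 : (q:ℂ) ^ (s/2) ≠ 0 := by simp [Complex.cpow_eq_zero_iff, hq0]
  have n3 : (Gammaℝ ∘ fun s => s + (kap χ : ℂ)) s ≠ 0 := Gammaℝ_ne_zero_of_re_pos hsr
  have n4 : LFunction χ s ≠ 0 := LFunction_ne_zero_of_one_le_re χ (Or.inr hs1) hs.le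
  have hpol : logDeriv (polF q) s = polD q s := by
    unfold polF polD
    split_ifs
    · rw [logDeriv_mul (f := fun s : ℂ => s) (g := fun s : ℂ => s - 1) s hs0 (sub_ne_zero.2 hs1) (by fun_prop) (by fun_prop)]
      congr 1
      · simp
      · rw [logDeriv_apply]; simp
    · simp
  rw [logDeriv_apply, ev.deriv_eq, ev.eq_of_nhds, ← logDeriv_apply (fun s => (polF q s * (q:ℂ) ^ (s / 2)) * ((Gammaℝ ∘ fun s => s + kap χ) s * LFunction χ s)) s, logDeriv_mul (f := fun s => polF q s * (q:ℂ) ^ (s / 2)) (g := fun s => (Gammaℝ ∘ fun s => s + kap χ) s * LFunction χ s) s (mul_ne_zero n1 n2) (mul_ne_zero n3 n4) (dp.mul dq.differentiableAt) (dgc.mul dl),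
    logDeriv_mul s n1 n2 dp dq.differentiableAt, logDeriv_mul s n3 n4 dgc dl, hpol, logDeriv_apply, dq.deriv,
    logDeriv_comp (f := Gammaℝ) (g := fun s : ℂ => s + kap χ) (x := s) dg da.differentiableAt, da.deriv, eg, logDeriv_L χ hs, Real.log_div (by exact_mod_cast NeZero.ne q) Real.pi_ne_zero]
  have : (q:ℂ) ^ (s/2) * Complex.log q * (1/2) / (q:ℂ) ^ (s/2) = Complex.log q / 2 := by field_simp
  rw [this]; push_cast; ring

lemma xiF_logDeriv_fe {χ : DirichletCharacter ℂ q} (hχ : χ.IsPrimitive) (s : ℂ) :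
    logDeriv (xiF χ) (1 - s) = - logDeriv (xiF χ⁻¹) s := by
  have h := fun hq => prim_ne_one hχ hq
  have e : (xiF χ ∘ fun s => 1 - s) = fun s => rootNumber χ * xiF χ⁻¹ s := by
    funext s; exact xiF_fe hχ s
  have d : HasDerivAt (fun s : ℂ => 1 - s) (-1) s := by simpa using (hasDerivAt_id s).const_sub 1
  have h1 := logDeriv_comp (x := s) (xiF_diff χ h (1 - s)) d.differentiableAt
  rw [e, logDeriv_const_mul _ _ (root_ne hχ), d.deriv] at h1
  rw [h1]; ring

lemma xiF_logDeriv_refl {χ : DirichletCharacter ℂ q} (hχ : χ.IsPrimitive) (s : ℂ) :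
    logDeriv (xiF χ) (1 - conj s) = - conj (logDeriv (xiF χ) s) := by
  rw [xiF_logDeriv_fe hχ, logDeriv_apply, logDeriv_apply]
  have : xiF χ⁻¹ = fun s => conj (xiF χ (conj s)) := by
    funext s; rw [← xiF_conj hχ]; simp
  rw [xiF_conj hχ, map_div₀]
  congr 2
  rw [this]
  have h := fun hq => prim_ne_one hχ hq
  have := (xiF_diff χ h s).hasDerivAt
  have h2 : HasDerivAt (fun s => conj (xiF χ (conj s))) (conj (deriv (xiF χ) s)) (conj s) := by
    have := this.conj_conj
    simpa [Function.comp_def] using this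
  exact h2.deriv

end XiSec2

section DensSec
open Complex DirichletCharacter Filter Topology ComplexConjugate

lemma dig_re_term (x y : ℝ) (n : ℕ) : (1 / ((n:ℂ) + 1) - 1 / ((n:ℂ) + (⟨x, y⟩ : ℂ))).re
    = 1 / ((n:ℝ) + 1) - (n + x) / ((n + x) ^ 2 + y ^ 2) := by
  have e1 : 1 / ((n:ℂ) + 1) = ((1 / ((n:ℝ) + 1) : ℝ) : ℂ) := by push_cast; rfl
  rw [sub_re, e1, ofReal_re]
  congr 1
  rw [one_div, inv_re, Complex.normSq_apply]
  simp [sq]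

lemma dig_re_hasSum {x : ℝ} (hx : 0 < x) (y : ℝ) :
    HasSum (fun n : ℕ => 1 / ((n:ℝ) + 1) - (n + x) / ((n + x) ^ 2 + y ^ 2)) ((digamma ⟨x, y⟩).re + Real.eulerMascheroniConstant) := by
  have h := digamma_hasSum (s := ⟨x, y⟩) hx
  have := Complex.hasSum_re h
  simp only [dig_re_term] at this
  simpa using this

lemma dig_re_mono {x : ℝ} (hx : 0 < x) {y y' : ℝ} (h : |y| ≤ |y'|) : (digamma ⟨x, y⟩).re ≤ (digamma ⟨x, y'⟩).re := by
  have := hasSum_le (fun n : ℕ => ?_) (dig_re_hasSum hx y) (dig_re_hasSum hx y')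
  · linarith
  · have hn : (0:ℝ) ≤ n := by positivity
    have : y ^ 2 ≤ y' ^ 2 := sq_le_sq.2 h
    gcongr

lemma dig_re_le {x : ℝ} (hx : 0 < x) {y : ℝ} (h : 1 < y) :
    (digamma ⟨x, y⟩).re ≤ Real.log (x ^ 2 + y ^ 2) / 2 + 1 / (x + y - 1) := by
  have t1 := (dig_re_hasSum hx y).tendsto_sum_nat
  have t3 : Tendsto (fun n : ℕ => ((harmonic n : ℝ) - Real.log n : ℝ)) atTop (𝓝 Real.eulerMascheroniConstant) := Real.tendsto_harmonic_sub_log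
  have t4 := t3.add_const (Real.log (x ^ 2 + y ^ 2) / 2 + 1 / (x + y - 1))
  have key : ∀ N : ℕ, ∑ n ∈ Finset.range N, (1 / ((n:ℝ) + 1) - (n + x) / ((n + x) ^ 2 + y ^ 2)) ≤
      (harmonic N : ℝ) - Real.log ((N + x)^2 + y^2) / 2 + Real.log (x ^ 2 + y ^ 2) / 2 + 1 / (x + y - 1) - 1 / (N + x + y - 1) := by
    intro N
    induction N with
    | zero => simp
    | succ N ih =>
      rw [Finset.sum_range_succ, harmonic_succ]
      have hN : (0:ℝ) ≤ N := by positivity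
      set u : ℝ := N + x with hu
      have hu0 : 0 < u := by positivity
      have p : 0 < u ^ 2 + y ^ 2 := by positivity
      have e1 : Real.log ((u + 1)^2 + y^2) ≤ Real.log (u^2 + y^2) + (2 * u + 1) / (u ^ 2 + y ^ 2) := by
        have : (u + 1)^2 + y^2 = (u^2 + y^2) * (1 + (2 * u + 1) / (u ^ 2 + y ^ 2)) := by field_simp; ring
        rw [this, Real.log_mul byp byp]
        have := Real.log_le_sub_one_of_pos (show 0 < 1 + (2 * u + 1) / (u ^ 2 + y ^ 2) by positivity)
        linarith
      have e2 : 1 / (2 * (u^2 + y^2)) ≤ 1 / (u + y - 1) - 1 / (u + y) := by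
        have : 1 / (u + y - 1) - 1 / (u + y) = 1 / ((u + y - 1) * (u + y)) := by
          have : u + y - 1 ≠ 0 := by linarith
          field_simp; ring
        rw [this]
        refine one_div_le_one_div_of_le (mul_pos byl byl) ?_
        nlinarith [sq_nonneg (u - y)]
      have e3 : (2 * u + 1) / (u ^ 2 + y ^ 2) = 2 * (u / (u^2 + y^2)) + 2 * (1 / (2 * (u^2 + y^2))) := by field_simp
      push_cast
      have e4 : (N:ℝ) + 1 + x = u + 1 := by rw [hu]; ring
      rw [e4, show u + 1 + y - 1 = u + y by ring, inv_eq_one_div]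
      linarith
  have := le_of_tendsto_of_tendsto t1 t4 (by
    filter_upwards [eventually_gt_atTop 0] with N hN
    have hN' : (0:ℝ) < N := by exact_mod_cast hN
    refine (key N).trans ?_
    have h1 : Real.log N ≤ Real.log ((N + x)^2 + y^2) / 2 := by
      rw [le_div_iff₀ byn, mul_comm, ← Nat.cast_ofNat, ← Real.log_pow]
      refine Real.log_le_log byp ?_
      nlinarith [sq_nonneg y]
    have h2 : 0 ≤ 1 / (N + x + y - 1) := by
      apply one_div_nonneg.2; linarith
    linarith)
  linarith

/-- `Σ Λ(n) n^{-σ}` -/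
noncomputable def VS (σ : ℝ) : ℝ := ∑' n : ℕ, ArithmeticFunction.vonMangoldt n * (n:ℝ) ^ (-σ)

lemma VS_summ {σ : ℝ} (hσ : 1 < σ) : Summable (fun n : ℕ => ArithmeticFunction.vonMangoldt n * (n:ℝ) ^ (-σ)) := by
  have := (ArithmeticFunction.LSeriesSummable_vonMangoldt (s := (σ:ℂ)) (by simpa)).norm
  refine this.congr fun n => ?_
  rw [LSeries.norm_term_eq]
  split_ifs with hn
  · subst hn; simp
  · rw [Complex.norm_real, Real.norm_of_nonneg ArithmeticFunction.vonMangoldt_nonneg, ofReal_re, Real.rpow_neg byp]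
    rfl

lemma LS_summ {σ : ℝ} (hσ : 1 < σ) : Summable (fun n : ℕ => Real.log n * (n:ℝ) ^ (-σ)) ∧ 
    VS σ * (∑' n : ℕ, if n = 0 then 0 else (n:ℝ) ^ (-σ)) = ∑' n : ℕ, Real.log n * (n:ℝ) ^ (-σ) := by
  have hs : 1 < (σ:ℂ).re := by simpa
  have s1 := ArithmeticFunction.LSeriesSummable_vonMangoldt hs
  have s2 : LSeriesSummable (fun n => ((ArithmeticFunction.zeta n : ℕ):ℂ)) (σ:ℂ) := ArithmeticFunction.LSeriesSummable_zeta_iff.2 hs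
  have e := LSeries_convolution' s1 s2
  have c := ArithmeticFunction.convolution_vonMangoldt_zeta
  have s3 := LSeriesSummable.convolution s1 s2
  rw [c] at e s3
  have hterm : ∀ (f : ℕ → ℝ) (n : ℕ), LSeries.term (fun n => (f n : ℂ)) (σ:ℂ) n = ((if n = 0 then 0 else f n * (n:ℝ) ^ (-σ) : ℝ) : ℂ) := by
    intro f n
    rw [LSeries.term_def]
    split_ifs with hn
    · simp
    · push_cast
      rw [Complex.ofReal_cpow byp]
      push_cast
      rw [Complex.cpow_neg]; rfl
  have t1 : LSeries.term (fun n => (ArithmeticFunction.vonMangoldt n : ℂ)) (σ:ℂ) = fun n => ((ArithmeticFunction.vonMangoldt n * (n:ℝ) ^ (-σ) : ℝ) : ℂ) := by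
    funext n; rw [hterm]; congr 1; split_ifs with h
    · subst h; simp
    · rfl
  have t3 : LSeries.term (fun n => Complex.log n) (σ:ℂ) = fun n : ℕ => ((Real.log n * (n:ℝ) ^ (-σ) : ℝ) : ℂ) := by
    have : (fun n : ℕ => Complex.log n) = fun n : ℕ => ((Real.log n : ℝ) : ℂ) := by
      funext n; exact (Complex.natCast_log).symm
    funext n
    rw [this, hterm (fun n => Real.log n)]; congr 1; split_ifs with h
    · subst h; simp
    · rfl
  have t2 : LSeries.term (fun n => ((ArithmeticFunction.zeta n : ℕ):ℂ)) (σ:ℂ) = fun n : ℕ => ((if n = 0 then 0 else (n:ℝ) ^ (-σ) : ℝ) : ℂ) := by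
    funext n
    have := hterm (fun n => ((ArithmeticFunction.zeta n : ℕ) : ℝ)) n
    push_cast at this ⊢
    rw [this]
    split_ifs with h
    · simp
    · simp [ArithmeticFunction.zeta_apply, h]
  constructor
  · have := s3
    rw [LSeriesSummable] at this
    rw [show ((fun n : ℕ => Complex.log n)) = _ from rfl] at this
    erw [t3] at this
    exact_mod_cast this
  · rw [LSeries, LSeries, LSeries] at e
    erw [t1, t2, t3] at e
    rw [VS]
    rw [← Complex.ofReal_tsum, ← Complex.ofReal_tsum, ← Complex.ofReal_tsum] at e
    exact_mod_cast e.symm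

lemma logG_step {σ : ℝ} (hσ : 1 < σ) {n : ℕ} (hn : 3 ≤ n) :
    Real.log ((n+1 : ℕ):ℝ) * ((n+1 : ℕ):ℝ) ^ (-σ) ≤
      (Real.log n / (σ - 1) + 1 / (σ - 1)^2) * (n:ℝ) ^ (-(σ-1)) - (Real.log ((n+1:ℕ):ℝ) / (σ - 1) + 1 / (σ - 1)^2) * ((n+1:ℕ):ℝ) ^ (-(σ-1)) := by
  have hn' : (3:ℝ) ≤ n := by exact_mod_cast hn
  set G : ℝ → ℝ := fun t => (Real.log t / (σ - 1) + 1 / (σ - 1)^2) * t ^ (-(σ-1)) with hG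
  have hd : ∀ t : ℝ, 0 < t → HasDerivAt G (- (Real.log t * t ^ (-σ))) t := by
    intro t ht
    have h1 : HasDerivAt (fun t : ℝ => Real.log t / (σ - 1) + 1 / (σ - 1)^2) (t⁻¹ / (σ - 1)) t :=
      ((Real.hasDerivAt_log ht.ne').div_const _).add_const _
    have h2 := Real.hasDerivAt_rpow_const (x := t) (p := -(σ-1)) (Or.inl ht.ne')
    have h3 := h1.mul h2
    refine h3.congr_deriv ?_
    have e1 : t ^ (-(σ-1)) = t ^ (-σ) * t := by
      rw [show -(σ-1) = -σ + 1 by ring, Real.rpow_add ht, Real.rpow_one]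
    have e2 : -(σ-1) - 1 = -σ := by ring
    rw [e2, e1]
    have : σ - 1 ≠ 0 := by linarith
    field_simp; ring
  have hanti := Real.log_div_self_rpow_antitoneOn (a := σ) byl
  have hexp : Real.exp σ⁻¹ ≤ 3 := by
    have : σ⁻¹ ≤ 1 := inv_le_one_of_one_le₀ hσ.le
    have := Real.exp_le_exp.2 this
    linarith [Real.exp_one_lt_d9]
  have := Convex.image_sub_le_mul_sub_of_deriv_le (convex_Icc (n:ℝ) (n+1)) (f := G)
    (fun t ht => (hd t (by linarith [ht.1])).continuousAt.continuousWithinAt)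
    (fun t ht => by
      rw [interior_Icc] at ht
      exact (hd t (by linarith [ht.1])).differentiableAt.differentiableWithinAt)
    (C := - (Real.log (n+1) * ((n:ℝ)+1) ^ (-σ)))
    (fun t ht => by
      rw [interior_Icc] at ht
      rw [(hd t (by linarith [ht.1])).deriv, neg_le_neg_iff]
      have := hanti (a := t) (b := (n:ℝ)+1) (by simp only [mem_Ici]; linarith [ht.1]) (by simp only [mem_Ici]; linarith) ht.2.le
      simp only at this
      rw [Real.rpow_neg byl, Real.rpow_neg (by linarith [ht.1]), ← div_eq_mul_inv, ← div_eq_mul_inv]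
      exact this)
    n (by simp) (n+1) (by simp) byl
  simp only [hG] at this
  push_cast
  linarith

lemma logS_le {σ : ℝ} (hσ : 1 < σ) : ∑' n : ℕ, Real.log n * (n:ℝ) ^ (-σ) ≤
    Real.log 2 * 2 ^ (-σ) + Real.log 3 * 3 ^ (-σ) + (Real.log 3 / (σ - 1) + 1 / (σ - 1)^2) * 3 ^ (-(σ-1)) := by
  have hpos : ∀ n : ℕ, 0 ≤ Real.log n * (n:ℝ) ^ (-σ) := fun n => mul_nonneg (Real.log_natCast_nonneg n) (Real.rpow_nonneg byp _)
  have hσ1 : 0 < σ - 1 := by linarith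
  have key : ∀ k : ℕ, ∑ n ∈ Finset.range (k + 4), Real.log n * (n:ℝ) ^ (-σ) ≤
    Real.log 2 * 2 ^ (-σ) + Real.log 3 * 3 ^ (-σ) + (Real.log 3 / (σ - 1) + 1 / (σ - 1)^2) * 3 ^ (-(σ-1)) - (Real.log ((k+3:ℕ):ℝ) / (σ - 1) + 1 / (σ - 1)^2) * ((k+3:ℕ):ℝ) ^ (-(σ-1)) := by
    intro k
    induction k with
    | zero => simp [Finset.sum_range_succ]
    | succ k ih =>
      rw [show k + 1 + 4 = (k + 4) + 1 by ring, Finset.sum_range_succ]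
      have := logG_step hσ (n := k + 3) (by omega)
      rw [show k + 3 + 1 = k + 4 by ring] at this
      rw [show k + 1 + 3 = k + 4 by ring]
      linarith
  refine Real.tsum_le_of_sum_range_le hpos fun N => ?_
  refine (Finset.sum_le_sum_of_subset_of_nonneg (Finset.range_mono (show N ≤ N + 4 by omega)) fun i _ _ => hpos i).trans ((key N).trans ?_)
  have : 0 ≤ (Real.log ((N+3:ℕ):ℝ) / (σ - 1) + 1 / (σ - 1)^2) * ((N+3:ℕ):ℝ) ^ (-(σ-1)) := by
    have := Real.log_natCast_nonneg (N+3)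
    positivity
  linarith

lemma VS_nonneg (σ : ℝ) : 0 ≤ VS σ := tsum_nonneg fun n => mul_nonneg ArithmeticFunction.vonMangoldt_nonneg (Real.rpow_nonneg byp _)

lemma VS_two : VS 2 ≤ 0.606 := by
  have h := (LS_summ (σ := 2) byn).2
  have h1 := logS_le (σ := 2) byn
  have z : (∑' n : ℕ, if n = 0 then (0:ℝ) else (n:ℝ) ^ (-(2:ℝ))) = Real.pi^2/6 := by
    rw [← hasSum_zeta_two.tsum_eq]
    refine tsum_congr fun n => ?_
    split_ifs with hn
    · subst hn; simp
    · rw [Real.rpow_neg byp, one_div]; norm_cast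
  rw [z] at h
  rw [← h] at h1
  have e2 : (2:ℝ) ^ (-(2:ℝ)) = 1/4 := by rw [Real.rpow_neg byn]; norm_num
  have e3 : (3:ℝ) ^ (-(2:ℝ)) = 1/9 := by rw [Real.rpow_neg byn]; norm_num
  have e4 : (3:ℝ) ^ (-((2:ℝ)-1)) = 1/3 := by rw [Real.rpow_neg byn]; norm_num
  rw [e2, e3, e4] at h1
  have := Real.log_two_lt_d9
  have := Real.log_three_lt_d9
  have := Real.pi_gt_d4
  have hp : 1.6448 ≤ Real.pi^2/6 := by nlinarith
  have := VS_nonneg 2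
  norm_num at h1
  nlinarith

lemma zeta32 : 1.98 ≤ (∑' n : ℕ, if n = 0 then (0:ℝ) else (n:ℝ) ^ (-(3/2:ℝ))) := by
  have hs : Summable (fun n : ℕ => if n = 0 then (0:ℝ) else (n:ℝ) ^ (-(3/2:ℝ))) := by
    refine (Real.summable_nat_rpow.2 (by norm_num : (-(3/2:ℝ)) < -1)).congr fun n => ?_
    split_ifs with hn
    · subst hn; rw [Nat.cast_zero, Real.zero_rpow byn]
    · rfl
  have hpos : ∀ n : ℕ, 0 ≤ (if n = 0 then (0:ℝ) else (n:ℝ) ^ (-(3/2:ℝ))) := fun n => by split_ifs <;> positivity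
  have key : ∀ k : ℕ, 2 - 2 / √((k+1:ℕ):ℝ) ≤ ∑ n ∈ Finset.range (k+1), (if n = 0 then (0:ℝ) else (n:ℝ) ^ (-(3/2:ℝ))) := by
    intro k
    induction k with
    | zero => simp
    | succ k ih =>
      rw [Finset.sum_range_succ]
      simp only [Nat.succ_ne_zero, if_false]
      have e : (((k+1:ℕ)):ℝ) ^ (-(3/2:ℝ)) = 1 / (((k+1:ℕ):ℝ) * √((k+1:ℕ):ℝ)) := by
        rw [Real.rpow_neg byp, show (3/2:ℝ) = 1 + 1/2 by norm_num, Real.rpow_add byp, Real.rpow_one, ← Real.sqrt_eq_rpow, one_div]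
      rw [e]
      set a := √((k+1:ℕ):ℝ) with ha
      set b := √((k+1+1:ℕ):ℝ) with hb
      have ha2 : ((k+1:ℕ):ℝ) = a^2 := (Real.sq_sqrt byp).symm
      have hb2 : ((k+1+1:ℕ):ℝ) = b^2 := (Real.sq_sqrt byp).symm
      have ha0 : 0 < a := Real.sqrt_pos.2 byp
      have hab : b^2 = a^2 + 1 := by rw [← ha2, ← hb2]; push_cast; ring
      have hab2 : a ≤ b := Real.sqrt_le_sqrt (by push_cast; linarith)
      have hb0 : 0 < b := by linarith
      have : 2 / a - 2 / b ≤ 1 / (a^2 * a) := by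
        rw [div_sub_div _ _ ha0.ne' hb0.ne', div_le_div_iff₀ byp byp]
        have : (b - a) * (b + a) = 1 := by nlinarith
        have h3 : (b - a) * (2 * a) ≤ 1 := by nlinarith
        nlinarith [mul_le_mul_of_nonneg_left h3 (show 0 ≤ a * a by positivity)]
      rw [ha2]
      linarith
  have h1 := key 9999
  have h2 := hs.sum_le_tsum (Finset.range 10000) (fun i _ => hpos i)
  have : √((9999+1:ℕ):ℝ) = 100 := by
    rw [show ((9999+1:ℕ):ℝ) = 100^2 by norm_num]; exact Real.sqrt_sq byn
  rw [this] at h1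
  norm_num at h1 h2 ⊢
  linarith

lemma rpow_half_le {x p c : ℝ} (hx : 0 < x) (hc : 0 ≤ c) (h : x ^ (2 * p) ≤ c ^ 2) : x ^ p ≤ c := by
  refine le_of_sq_le_sq ?_ hc
  rwa [← Real.rpow_natCast, ← Real.rpow_mul hx.le, mul_comm p, Nat.cast_ofNat]

lemma VS_32 : VS (3/2) ≤ 2.06 := by
  have h := (LS_summ (σ := 3/2) byn).2
  have h1 := logS_le (σ := 3/2) byn
  have z := zeta32
  rw [← h] at h1
  have e2 : (2:ℝ) ^ (-(3/2:ℝ)) ≤ 0.3536 := by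
    refine rpow_half_le byn byn ?_
    rw [show (2 * (-(3/2:ℝ))) = -(3:ℝ) by norm_num, Real.rpow_neg byn]; norm_num
  have e3 : (3:ℝ) ^ (-(3/2:ℝ)) ≤ 0.1925 := by
    refine rpow_half_le byn byn ?_
    rw [show (2 * (-(3/2:ℝ))) = -(3:ℝ) by norm_num, Real.rpow_neg byn]; norm_num
  have e4 : (3:ℝ) ^ (-((3/2:ℝ)-1)) ≤ 0.5774 := by
    refine rpow_half_le byn byn ?_
    rw [show (2 * (-((3/2:ℝ)-1))) = -(1:ℝ) by norm_num, Real.rpow_neg byn]; norm_num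
  have l2 := Real.log_two_lt_d9
  have l3 := Real.log_three_lt_d9
  have l20 : 0 < Real.log 2 := Real.log_pos byn
  have l30 : 0 < Real.log 3 := Real.log_pos byn
  have := VS_nonneg (3/2)
  have p4 : (0:ℝ) ≤ (3:ℝ) ^ (-((3/2:ℝ)-1)) := by positivity
  have a2 : Real.log 2 * 2 ^ (-(3/2:ℝ)) ≤ 0.6931471808 * 0.3536 := by gcongr
  have a3 : Real.log 3 * 3 ^ (-(3/2:ℝ)) ≤ 1.0986122888 * 0.1925 := by gcongr
  have a4 : (Real.log 3 / (3/2 - 1) + 1 / (3/2 - 1)^2) * (3:ℝ) ^ (-((3/2:ℝ)-1)) ≤ (1.0986122888 / (3/2 - 1) + 1 / (3/2 - 1)^2) * 0.5774 := by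
    gcongr <;> norm_num at *
  norm_num at a2 a3 a4 h1 z ⊢
  nlinarith

variable {q : ℕ} [NeZero q]

noncomputable def mz (χ : DirichletCharacter ℂ q) (ρ : ℂ) : ℕ := analyticOrderNatAt (xiF χ) ρ

noncomputable def Bf (χ : DirichletCharacter ℂ q) (s : ℂ) : ℝ := (logDeriv (xiF χ) s).re

lemma norm_LamS_le (χ : DirichletCharacter ℂ q) {s : ℂ} (hs : 1 < s.re) : ‖LamS χ s‖ ≤ VS s.re := by
  unfold LamS LSeries VS
  refine tsum_of_norm_bounded (VS_summ hs).hasSum fun n => ?_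
  rw [LSeries.norm_term_eq]
  split_ifs with hn
  · subst hn; simp
  · rw [norm_mul, Complex.norm_real, Real.norm_of_nonneg ArithmeticFunction.vonMangoldt_nonneg, Real.rpow_neg byp, div_eq_mul_inv]
    have := DirichletCharacter.norm_le_one χ (n : ZMod q)
    have h2 : 0 ≤ ArithmeticFunction.vonMangoldt n := ArithmeticFunction.vonMangoldt_nonneg
    gcongr
    nlinarith

lemma Bf_le {χ : DirichletCharacter ℂ q} (hχ : χ.IsPrimitive) {σ t : ℝ} (hs : 1 < σ) :
    Bf χ ⟨σ, t⟩ ≤ (polD q ⟨σ, t⟩).re + Real.log (q / Real.pi) / 2 + (digamma ⟨(σ + kap χ)/2, t/2⟩).re / 2 + VS σ := by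
  unfold Bf
  rw [xiF_logDeriv hχ (by simpa using hs)]
  have e : ((⟨σ, t⟩ : ℂ) + kap χ) / 2 = ⟨(σ + kap χ)/2, t/2⟩ := by
    apply Complex.ext <;> simp
  rw [e]
  have h1 := norm_LamS_le χ (s := ⟨σ, t⟩) hs
  have h2 := (abs_le.1 (Complex.abs_re_le_norm (LamS χ ⟨σ, t⟩))).1
  have h3 : ((digamma ⟨(σ + kap χ)/2, t/2⟩) / 2).re = (digamma ⟨(σ + kap χ)/2, t/2⟩).re / 2 := by simp
  rw [sub_re, add_re, add_re, h3, ofReal_re]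
  simp only at h1
  linarith

lemma polD_re (σ t : ℝ) : (polD q ⟨σ, t⟩).re = if q = 1 then σ / (σ^2 + t^2) + (σ - 1) / ((σ-1)^2 + t^2) else 0 := by
  unfold polD
  split_ifs
  · rw [add_re, one_div, one_div, inv_re, inv_re, Complex.normSq_apply, Complex.normSq_apply]
    simp [sq]
  · simp

lemma dig_T {x : ℝ} (hx : 0 < x) (hx2 : x ≤ 3/2) {t T : ℝ} (hT : 98 ≤ T) (ht : |t| ≤ T) :
    (digamma ⟨x, t/2⟩).re ≤ Real.log (T/2) + 0.0214 := by
  have h1 := dig_re_mono hx (y := t/2) (y' := T/2) (by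
    rw [abs_div, abs_div, abs_of_nonneg (by linarith : (0:ℝ) ≤ T)]; gcongr)
  have h2 := dig_re_le hx (y := T/2) byl
  have h3 : 1 / (x + T/2 - 1) ≤ 1/48 := one_div_le_one_div_of_le byn byl
  have h4 : Real.log (x^2 + (T/2)^2) ≤ 2 * Real.log (T/2) + 0.001 := by
    have e : x^2 + (T/2)^2 = (T/2)^2 * (1 + x^2/(T/2)^2) := by field_simp; ring
    rw [e, Real.log_mul byp byp, Real.log_pow]
    have := Real.log_le_sub_one_of_pos (show 0 < 1 + x^2/(T/2)^2 by positivity)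
    have : x^2/(T/2)^2 ≤ 0.001 := by
      rw [div_le_iff₀ byp]; nlinarith
    push_cast; linarith
  norm_num at *
  linarith

lemma Bf_far {χ : DirichletCharacter ℂ q} (hχ : χ.IsPrimitive) {t : ℝ} (ht : 98 ≤ |t|) :
    Bf χ ⟨2, t⟩ ≤ Real.log (q * |t| / (2 * Real.pi)) / 2 + 0.62 := by
  have h := Bf_le hχ (σ := 2) (t := t) byn
  have hk0 := kap_nonneg χ
  have hk1 := kap_le χ
  have hd := dig_T (x := (2 + kap χ)/2) byl byl ht le_rfl
  have hp : (polD q ⟨2, t⟩).re ≤ 0.001 := by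
    rw [polD_re]
    split_ifs
    · have : 9604 ≤ t^2 := by rw [← sq_abs]; nlinarith
      have a1 : (2:ℝ) / (2^2 + t^2) ≤ 2 / 9604 := by gcongr; linarith
      have a2 : ((2:ℝ) - 1) / ((2-1)^2 + t^2) ≤ 1 / 9604 := by
        norm_num; rw [inv_le_comm₀ byp byn]; norm_num; linarith
      norm_num at *; linarith
    · norm_num
  have hv := VS_two
  have q0 : (0:ℝ) < q := by have := one_le_q q; linarith
  have e : Real.log (q * |t| / (2 * Real.pi)) = Real.log (q/Real.pi) + Real.log (|t|/2) := by
    rw [← Real.log_mul byp byp]; congr 1; field_simp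
  rw [e]
  norm_num at *
  linarith

lemma Bf_near {χ : DirichletCharacter ℂ q} (hχ : χ.IsPrimitive) {t T : ℝ} (hT : 100 ≤ T) (ht : |t| ≤ T) :
    Bf χ ⟨3/2, t⟩ ≤ Real.log (q * T / (2 * Real.pi)) / 2 + 3.5 := by
  have h := Bf_le hχ (σ := 3/2) (t := t) byn
  have hk0 := kap_nonneg χ
  have hk1 := kap_le χ
  have hv := VS_32
  have q0 : (0:ℝ) < q := by have := one_le_q q; linarith
  have e : Real.log (q * T / (2 * Real.pi)) = Real.log (q/Real.pi) + Real.log (T/2) := by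
    rw [← Real.log_mul byp byp]; congr 1; field_simp
  rw [e]
  by_cases hc : q = 1 ∧ |t| < 3
  · obtain ⟨hq, ht3⟩ := hc
    have hk : kap χ = 0 := kap_one χ hq
    rw [hk] at h
    have h1 := dig_re_mono (x := (3/2 + 0)/2) byn (y := t/2) (y' := 3/2) (by
      rw [abs_div, abs_div, abs_of_nonneg (by norm_num : (0:ℝ) ≤ 3)]; gcongr)
    have h2 := dig_re_le (x := (3/2 + 0)/2) byn (y := 3/2) byn
    have hp : (polD q ⟨3/2, t⟩).re ≤ 2/3 + 2 := by
      rw [polD_re, if_pos hq]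
      have : 0 ≤ t^2 := sq_nonneg t
      have a1 : (3/2:ℝ) / ((3/2)^2 + t^2) ≤ 2/3 := by
        rw [div_le_iff₀ byp]; linarith
      have a2 : ((3/2:ℝ) - 1) / ((3/2-1)^2 + t^2) ≤ 2 := by
        rw [div_le_iff₀ byp]; linarith
      linarith
    have l2a := Real.log_two_gt_d9
    have l2b := Real.log_two_lt_d9
    have l1 : 3.82 ≤ Real.log (T/2) := by
      have : Real.log (2^5 * 1.5625) ≤ Real.log (T/2) := Real.log_le_log byn byl
      rw [Real.log_mul byn byn, Real.log_pow] at this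
      have h3 := Real.one_sub_inv_le_log_of_pos (show (0:ℝ) < 1.5625 by norm_num)
      norm_num at *; linarith
    have l3 : Real.log (((3/2 + 0)/2)^2 + (3/2)^2) ≤ 1.1 := by
      have : (((3/2 + 0)/2)^2 + (3/2)^2 : ℝ) = 2 * 1.40625 := by norm_num
      rw [this, Real.log_mul byn byn]
      have h3 := Real.log_le_sub_one_of_pos (show (0:ℝ) < 1.40625 by norm_num)
      norm_num at *; linarith
    have l4 : (1:ℝ) / ((3/2 + 0)/2 + 3/2 - 1) = 0.8 := by norm_num
    rw [l4] at h2
    norm_num at *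
    linarith
  · have hp : (polD q ⟨3/2, t⟩).re ≤ 0.2 := by
      rw [polD_re]
      split_ifs with hq
      · have ht3 : 3 ≤ |t| := by by_contra hh; exact hc ⟨hq, by linarith⟩
        have : 9 ≤ t^2 := by rw [← sq_abs]; nlinarith
        have a1 : (3/2:ℝ) / ((3/2)^2 + t^2) ≤ 0.14 := by
          rw [div_le_iff₀ byp]; linarith
        have a2 : ((3/2:ℝ) - 1) / ((3/2-1)^2 + t^2) ≤ 0.06 := by
          rw [div_le_iff₀ byp]; linarith
        linarith
      · norm_num
    have hd := dig_T (x := (3/2 + kap χ)/2) byl byl byl ht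
    norm_num at *
    linarith

lemma dens_hasSum {χ : DirichletCharacter ℂ q} (hχ : χ.IsPrimitive) {σ t : ℝ} (hs : 1 < σ) :
    HasSum (fun ρ : ℂ => (mz χ ρ : ℝ) * ((σ - ρ.re) / ((σ - ρ.re)^2 + (t - ρ.im)^2) + (σ - 1 + ρ.re) / ((σ - 1 + ρ.re)^2 + (t - ρ.im)^2))) (2 * Bf χ ⟨σ, t⟩) := by
  have h := fun hq => prim_ne_one hχ hq
  have hd := xiF_diff χ h
  have h0 := xiF_zero_ne hχ (s := 0) (by simp)
  obtain ⟨C, hC⟩ := xiF_growth hχ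
  have n1 : xiF χ ⟨σ, t⟩ ≠ 0 := xiF_ne_zero_right χ h (by simpa using hs.le)
  have n2 : xiF χ (1 - conj (⟨σ, t⟩ : ℂ)) ≠ 0 := xiF_zero_ne hχ (by simp; linarith)
  have H1 := hadamard hd h0 hC n1
  have H2 := hadamard hd h0 hC n2
  have H := Complex.hasSum_re (H1.sub H2)
  convert! H using 1
  · funext ρ
    have e1 : ((analyticOrderNatAt (xiF χ) ρ : ℂ) * (1 / ((⟨σ, t⟩ : ℂ) - ρ) + 1 / ρ) - (analyticOrderNatAt (xiF χ) ρ : ℂ) * (1 / ((1 - conj (⟨σ, t⟩ : ℂ)) - ρ) + 1 / ρ)) = ((mz χ ρ : ℝ) : ℂ) * (1 / ((⟨σ, t⟩ : ℂ) - ρ) - 1 / ((1 - conj (⟨σ, t⟩ : ℂ)) - ρ)) := by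
      unfold mz; push_cast; ring
    rw [e1, Complex.re_ofReal_mul, sub_re, one_div, one_div, inv_re, inv_re, Complex.normSq_apply, Complex.normSq_apply]
    simp only [sub_re, sub_im, one_re, one_im, conj_re, conj_im]
    congr 1
    have e2 : (1 - σ - ρ.re) / ((1 - σ - ρ.re) * (1 - σ - ρ.re) + (0 - -t - ρ.im) * (0 - -t - ρ.im)) = -((σ - 1 + ρ.re) / ((σ - 1 + ρ.re)^2 + (t - ρ.im)^2)) := by
      rw [← neg_div]; congr 1 <;> ring
    rw [e2]; ring_nf
  · rw [xiF_logDeriv_refl hχ]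
    simp [Bf]; ring

lemma mz_zero {χ : DirichletCharacter ℂ q} (hχ : χ.IsPrimitive) {ρ : ℂ} (h : mz χ ρ ≠ 0) :
    0 < ρ.re ∧ ρ.re < 1 ∧ LFunction χ ρ = 0 := by
  refine xiF_zeros hχ ?_
  by_contra hne
  apply h
  unfold mz
  rw [analyticOrderNatAt, analyticOrderAt_eq_zero.2 (Or.inr hne)]; rfl

end DensSec

section RotSec
open Complex Filter Topology

lemma int_poly {p a c : ℝ} (hp : -1 < p) (hc : 0 < c) :
    IntegrableOn (fun t : ℝ => t ^ p * Real.exp (a * t - c * t ^ 2)) (Ioi 0) := by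
  have h := ((integrableOn_rpow_mul_exp_neg_mul_sq (half_pos hc) hp).const_mul (Real.exp (a^2/(2*c))))
  refine Integrable.mono' h ?_ ?_
  · refine ContinuousOn.aestronglyMeasurable ?_ measurableSet_Ioi
    refine ContinuousOn.mul (fun t ht => ?_) (by fun_prop)
    exact (Real.continuousAt_rpow_const _ _ (Or.inl (ne_of_gt ht))).continuousWithinAt
  · filter_upwards [ae_restrict_mem measurableSet_Ioi] with t ht
    replace ht : 0 < t := ht
    rw [Real.norm_of_nonneg byp, mul_comm, mul_left_comm, mul_comm (t^p), ← Real.exp_add]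
    have key : a * t - c * t^2 ≤ a^2/(2*c) + -(c/2) * t^2 := by
      have : a^2/(2*c) + -(c/2) * t^2 - (a * t - c * t^2) = (a - c*t)^2/(2*c) := by field_simp; ring
      have h2 : 0 ≤ (a - c*t)^2/(2*c) := by positivity
      linarith
    gcongr

noncomputable def phf (δ : ℝ) (z : ℂ) : ℂ := z^2 * exp (2 * Real.pi * I * δ * z - z^2/2)
noncomputable def Ef (b : ℂ) (θ t : ℝ) : ℂ := exp (b * (t * exp (I*θ)) - (t * exp (I*θ))^2/2)

lemma Ef_norm (b : ℂ) (θ t : ℝ) : ‖Ef b θ t‖ = Real.exp ((b * exp (I*θ)).re * t - Real.cos (2*θ) / 2 * t^2) := by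
  rw [Ef, Complex.norm_exp]
  congr 1
  have e1 : exp (I*θ) = ⟨Real.cos θ, Real.sin θ⟩ := by
    rw [mul_comm, Complex.exp_mul_I]; apply Complex.ext <;> simp [← ofReal_cos, ← ofReal_sin]
  rw [e1, Real.cos_two_mul']
  simp [sq]; ring

lemma Ef_norm_le (b : ℂ) {θ θ₁ t : ℝ} (hθ : |θ| ≤ θ₁) (h1 : θ₁ < Real.pi/4) (ht : 0 ≤ t) :
    ‖Ef b θ t‖ ≤ Real.exp (‖b‖ * t - Real.cos (2*θ₁) / 2 * t^2) := by
  rw [Ef_norm]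
  have h2 : (b * exp (I*θ)).re ≤ ‖b‖ := by
    refine (Complex.re_le_norm _).trans ?_
    rw [norm_mul, mul_comm I, Complex.norm_exp_ofReal_mul_I, mul_one]
  have h3 : Real.cos (2*θ₁) ≤ Real.cos (2*θ) := by
    rw [← Real.cos_abs (2*θ), abs_mul, abs_two]
    apply Real.cos_le_cos_of_nonneg_of_le_pi <;> linarith [abs_nonneg θ]
  gcongr

lemma Ef_deriv_t (b : ℂ) (θ t : ℝ) : HasDerivAt (fun t : ℝ => Ef b θ t) (Ef b θ t * (b * exp (I*θ) - t * exp (I*θ)^2)) t := by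
  unfold Ef
  have h : HasDerivAt (fun t:ℝ => (t:ℂ)) 1 t := ofRealCLM.hasDerivAt
  have h1 := h.mul_const (exp (I*θ))
  have h2 := ((h1.const_mul b).sub ((h1.pow 2).div_const 2)).cexp
  convert! h2 using 1
  simp; ring

lemma Ef_deriv_θ (b : ℂ) (θ t : ℝ) : HasDerivAt (fun θ : ℝ => Ef b θ t) (I * t * (Ef b θ t * (b * exp (I*θ) - t * exp (I*θ)^2))) θ := by
  unfold Ef
  have h : HasDerivAt (fun t:ℝ => (t:ℂ)) 1 θ := ofRealCLM.hasDerivAt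
  have h1 := ((h.const_mul I).cexp).const_mul (t:ℂ)
  have h2 := ((h1.const_mul b).sub ((h1.pow 2).div_const 2)).cexp
  convert! h2 using 1
  simp; ring

lemma Ef_cont (b : ℂ) (θ : ℝ) : Continuous (fun t : ℝ => Ef b θ t) := by
  unfold Ef; fun_prop

lemma cpow_contOn (p : ℂ) : ContinuousOn (fun t : ℝ => (t:ℂ)^p) (Ioi 0) := fun t ht =>
  (Complex.continuousAt_ofReal_cpow_const _ _ (Or.inr (ne_of_gt ht))).continuousWithinAt

lemma rot_int (b p : ℂ) (hp : 0 < p.re) {θ : ℝ} (hθ : |θ| < Real.pi/4) :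
    IntegrableOn (fun t : ℝ => (t:ℂ)^(p-1) * (exp (I*θ*p) * Ef b θ t)) (Ioi 0) := by
  have hc : 0 < Real.cos (2*|θ|) := Real.cos_pos_of_mem_Ioo ⟨by linarith [abs_nonneg θ, Real.pi_pos], by linarith⟩
  refine Integrable.mono' ((int_poly (p := p.re-1) (a := ‖b‖) byl (half_pos hc)).const_mul ‖exp (I*θ*p)‖) ?_ ?_
  · exact ((cpow_contOn _).mul ((continuous_const.mul (Ef_cont b θ)).continuousOn)).aestronglyMeasurable measurableSet_Ioi
  · filter_upwards [ae_restrict_mem measurableSet_Ioi] with t ht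
    replace ht : 0 < t := ht
    rw [norm_mul, norm_mul, Complex.norm_cpow_eq_rpow_re_of_pos ht, sub_re, one_re, mul_left_comm]
    have := Ef_norm_le b le_rfl hθ ht.le
    gcongr

lemma rot_const (b p : ℂ) (hp : 0 < p.re) {θ : ℝ} (hθ : |θ| < Real.pi/4) :
    HasDerivAt (fun θ : ℝ => ∫ t in Ioi (0:ℝ), (t:ℂ)^(p-1) * (exp (I*θ*p) * Ef b θ t)) 0 θ := by
  obtain ⟨θ₁, h1, h2⟩ := exists_between hθ
  have hc : 0 < Real.cos (2*θ₁) := Real.cos_pos_of_mem_Ioo ⟨by linarith [abs_nonneg θ, Real.pi_pos], by linarith⟩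
  have hs : {x : ℝ | |x| < θ₁} ∈ 𝓝 θ := (isOpen_lt continuous_abs continuous_const).mem_nhds h1
  set K := Real.exp (θ₁ * ‖p‖) with hK
  have hbd : IntegrableOn (fun t : ℝ => K * (‖p‖ * (t^(p.re-1) * Real.exp (‖b‖ * t - Real.cos (2*θ₁) / 2 * t^2)) + ‖b‖ * (t^(p.re) * Real.exp (‖b‖ * t - Real.cos (2*θ₁) / 2 * t^2)) + t^(p.re+1) * Real.exp (‖b‖ * t - Real.cos (2*θ₁) / 2 * t^2))) (Ioi 0) := by
    refine Integrable.const_mul (Integrable.add (Integrable.add ?_ ?_) ?_) _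
    · exact (int_poly byl (half_pos hc)).const_mul _
    · exact (int_poly byl (half_pos hc)).const_mul _
    · exact int_poly byl (half_pos hc)
  have main := hasDerivAt_integral_of_dominated_loc_of_deriv_le (μ := volume.restrict (Ioi (0:ℝ))) (𝕜 := ℝ)
    (F := fun θ t => (t:ℂ)^(p-1) * (exp (I*θ*p) * Ef b θ t))
    (F' := fun θ t => I * ((t:ℂ)^(p-1) * (exp (I*θ*p) * (p * Ef b θ t + t * (Ef b θ t * (b * exp (I*θ) - t * exp (I*θ)^2)))))) hs
    (bound := fun t : ℝ => K * (‖p‖ * (t^(p.re-1) * Real.exp (‖b‖ * t - Real.cos (2*θ₁) / 2 * t^2)) + ‖b‖ * (t^(p.re) * Real.exp (‖b‖ * t - Real.cos (2*θ₁) / 2 * t^2)) + t^(p.re+1) * Real.exp (‖b‖ * t - Real.cos (2*θ₁) / 2 * t^2)))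
    (Eventually.of_forall fun x => ((cpow_contOn _).mul ((continuous_const.mul (Ef_cont b x)).continuousOn)).aestronglyMeasurable measurableSet_Ioi)
    (rot_int b p hp hθ) ?_ ?_ hbd ?_
  · obtain ⟨hI, hD⟩ := main
    convert! hD using 1
    symm
    rw [integral_const_mul]
    have hd : ∀ t ∈ Ioi (0:ℝ), HasDerivAt (fun t : ℝ => (t:ℂ)^p * (exp (I*θ*p) * Ef b θ t)) ((t:ℂ)^(p-1) * (exp (I*θ*p) * (p * Ef b θ t + t * (Ef b θ t * (b * exp (I*θ) - t * exp (I*θ)^2))))) t := by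
      intro t ht
      replace ht : 0 < t := ht
      have hp0 : p ≠ 0 := by rintro rfl; simp at hp
      have hpow := ((hasDerivAt_id (t:ℂ)).cpow_const (c := p) (Or.inl (by simpa using ht))).comp_ofReal
      have := hpow.mul ((Ef_deriv_t b θ t).const_mul (exp (I*θ*p)))
      convert! this using 1
      have ht0 : (t:ℂ) ≠ 0 := by exact_mod_cast ht.ne'
      have e : (t:ℂ)^p = (t:ℂ)^(p-1) * t := by rw [Complex.cpow_sub _ _ ht0, cpow_one]; field_simp
      simp only [id]; rw [e]; ring
    have hInt : IntegrableOn (fun t : ℝ => (t:ℂ)^(p-1) * (exp (I*θ*p) * (p * Ef b θ t + t * (Ef b θ t * (b * exp (I*θ) - t * exp (I*θ)^2))))) (Ioi 0) := by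
      have := hI.const_mul (-I)
      refine this.congr (Eventually.of_forall fun t => ?_)
      simp only []
      rw [← mul_assoc, neg_mul, I_mul_I]; ring
    have hInt2 : IntegrableOn (fun t : ℝ => (t:ℂ)^p * (exp (I*θ*p) * Ef b θ t)) (Ioi 0) := by
      have := rot_int b (p+1) (by simp; linarith) hθ
      have := this.const_mul (exp (-(I*θ)))
      refine this.congr (Eventually.of_forall fun t => ?_)
      simp only [add_sub_cancel_right]
      have : exp (I*θ*p) = exp (-(I*θ)) * exp (I*θ*(p+1)) := by rw [← exp_add]; ring_nf
      rw [this]; ring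
    have ht := tendsto_zero_of_hasDerivAt_of_integrableOn_Ioi hd hInt hInt2
    have hcw : ContinuousWithinAt (fun t : ℝ => (t:ℂ)^p * (exp (I*θ*p) * Ef b θ t)) (Ici 0) 0 :=
      ((Complex.continuousAt_ofReal_cpow_const _ _ (Or.inl hp)).mul ((continuous_const.mul (Ef_cont b θ)).continuousAt)).continuousWithinAt
    rw [integral_Ioi_of_hasDerivAt_of_tendsto hcw hd hInt ht]
    have hp0 : p ≠ 0 := by rintro rfl; simp at hp
    simp [hp0]
  · refine ContinuousOn.aestronglyMeasurable ?_ measurableSet_Ioi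
    refine continuousOn_const.mul ((cpow_contOn _).mul (Continuous.continuousOn ?_))
    have := Ef_cont b θ
    fun_prop
  · filter_upwards [ae_restrict_mem measurableSet_Ioi] with t ht x hx
    replace ht : 0 < t := ht
    replace hx : |x| < θ₁ := hx
    have hE := Ef_norm_le b hx.le h2 ht.le
    have e1 : ‖exp (I*x*p)‖ ≤ K := by
      rw [Complex.norm_exp, hK]; gcongr
      refine (Complex.re_le_norm _).trans ?_
      rw [norm_mul, norm_mul]; simp; gcongr
    have e2 : ‖exp (I*x)‖ = 1 := by rw [mul_comm I, Complex.norm_exp_ofReal_mul_I]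
    have e3 : ‖b * exp (I*x) - t * exp (I*x)^2‖ ≤ ‖b‖ + t := by
      refine (norm_sub_le _ _).trans ?_
      simp [e2, abs_of_pos ht]
    have r1 : t ^ p.re = t^(p.re-1) * t := by rw [Real.rpow_sub_one ht.ne']; field_simp
    have r2 : t ^ (p.re+1) = t^(p.re-1) * t^2 := by rw [Real.rpow_add_one ht.ne', r1]; ring
    set En := Real.exp (‖b‖ * t - Real.cos (2*θ₁) / 2 * t^2) with hEn
    have e4 : ‖p * Ef b x t + t * (Ef b x t * (b * exp (I*x) - t * exp (I*x)^2))‖ ≤ ‖p‖ * En + t * (En * (‖b‖ + t)) := by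
      refine (norm_add_le _ _).trans ?_
      rw [norm_mul, norm_mul (t:ℂ), norm_mul (Ef b x t), Complex.norm_real, Real.norm_of_nonneg ht.le]
      gcongr
    rw [norm_mul, norm_I, one_mul, norm_mul, norm_mul, Complex.norm_cpow_eq_rpow_re_of_pos ht, sub_re, one_re, r1, r2]
    calc _ ≤ t ^ (p.re - 1) * (K * (‖p‖ * En + t * (En * (‖b‖ + t)))) := by gcongr
      _ = _ := by ring
  · filter_upwards [ae_restrict_mem measurableSet_Ioi] with t ht x hx
    have h : HasDerivAt (fun t:ℝ => (t:ℂ)) 1 x := ofRealCLM.hasDerivAt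
    have h1 := ((h.const_mul I).mul_const p).cexp
    have := (h1.mul (Ef_deriv_θ b x t)).const_mul ((t:ℂ)^(p-1))
    convert! this using 1
    ring

lemma rot_eq (b p : ℂ) (hp : 0 < p.re) {θ : ℝ} (hθ : |θ| < Real.pi/4) :
    ∫ t in Ioi (0:ℝ), (t:ℂ)^(p-1) * Ef b 0 t = ∫ t in Ioi (0:ℝ), (t:ℂ)^(p-1) * (exp (I*θ*p) * Ef b θ t) := by
  have hmem : ∀ x ∈ Ioo (-(Real.pi/4)) (Real.pi/4), |x| < Real.pi/4 := fun x hx => abs_lt.2 hx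
  have := (convex_Ioo (-(Real.pi/4)) (Real.pi/4)).is_const_of_fderivWithin_eq_zero (𝕜 := ℝ)
    (f := fun θ : ℝ => ∫ t in Ioi (0:ℝ), (t:ℂ)^(p-1) * (exp (I*θ*p) * Ef b θ t))
    (fun x hx => (rot_const b p hp (hmem x hx)).differentiableAt.differentiableWithinAt)
    (fun x hx => by
      rw [fderivWithin_of_isOpen isOpen_Ioo hx]
      ext; simp [(rot_const b p hp (hmem x hx)).deriv])
    (x := 0) (y := θ) ⟨by linarith [Real.pi_pos], by linarith [Real.pi_pos]⟩ (abs_lt.1 hθ)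
  simpa using this

noncomputable def Ff (δ : ℝ) (s : ℂ) : ℂ := mellin (fun t : ℝ => phf δ t) s

lemma phf_eq (δ t : ℝ) : phf δ t = (t:ℂ)^2 * Ef (2*Real.pi*I*δ) 0 t := by simp [phf, Ef]

lemma cpow_two_mul {t : ℝ} (ht : 0 < t) (s : ℂ) : (t:ℂ)^(s-1) * (t:ℂ)^2 = (t:ℂ)^(s+2-1) := by
  have ht0 : (t:ℂ) ≠ 0 := by exact_mod_cast ht.ne'
  rw [← Complex.cpow_natCast, ← Complex.cpow_add _ _ ht0]
  congr 1; push_cast; ring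

lemma phf_mellin (δ : ℝ) {s : ℂ} (hs : -2 < s.re) : MellinConvergent (fun t : ℝ => phf δ t) s := by
  have := rot_int (2*Real.pi*I*δ) (s+2) (by simp; linarith) (θ := 0) (by simp [Real.pi_pos])
  refine this.congr ?_
  filter_upwards [ae_restrict_mem measurableSet_Ioi] with t ht
  rw [phf_eq, smul_eq_mul, ← mul_assoc ((t:ℂ)^(s-1)), cpow_two_mul ht]; simp

lemma Ff_eq (δ : ℝ) (s : ℂ) : Ff δ s = ∫ t in Ioi (0:ℝ), (t:ℂ)^(s+2-1) * Ef (2*Real.pi*I*δ) 0 t := by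
  refine setIntegral_congr_fun measurableSet_Ioi fun t ht => ?_
  simp only []
  rw [phf_eq, smul_eq_mul, ← mul_assoc, cpow_two_mul ht]

lemma Ff_bound (δ : ℝ) {s : ℂ} (hs : -2 < s.re) {θ : ℝ} (hθ : |θ| < Real.pi/4) :
    ‖Ff δ s‖ ≤ Real.exp (-(θ * s.im)) * ∫ t in Ioi (0:ℝ), t^(s.re+1) * Real.exp (-(2*Real.pi*δ*Real.sin θ) * t - Real.cos (2*θ)/2 * t^2) := by
  rw [Ff_eq, rot_eq _ _ (by simp; linarith) hθ, ← integral_const_mul]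
  have hc : 0 < Real.cos (2*θ) := Real.cos_pos_of_mem_Ioo ⟨by linarith [(abs_lt.1 hθ).1], by linarith [(abs_lt.1 hθ).2]⟩
  refine norm_integral_le_of_norm_le ((int_poly byl (half_pos hc)).const_mul _) ?_
  filter_upwards [ae_restrict_mem measurableSet_Ioi] with t ht
  replace ht : 0 < t := ht
  rw [norm_mul, norm_mul, Complex.norm_cpow_eq_rpow_re_of_pos ht, Ef_norm, Complex.norm_exp]
  have e1 : exp (I*θ) = ⟨Real.cos θ, Real.sin θ⟩ := by
    rw [mul_comm, Complex.exp_mul_I]; apply Complex.ext <;> simp [← ofReal_cos, ← ofReal_sin]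
  have e2 : (2*Real.pi*I*δ * exp (I*θ)).re = -(2*Real.pi*δ*Real.sin θ) := by rw [e1]; simp
  have e3 : (I*θ*(s+2)).re = -(θ*s.im) := by simp
  have e4 : (s+2-1).re = s.re+1 := by simp; ring
  rw [e2, e3, e4]
  exact le_of_eq (by ring)

end RotSec

section JSec
open Complex Filter Topology

lemma phf_norm (δ t : ℝ) : ‖phf δ t‖ = t^2 * Real.exp (-t^2/2) := by
  rw [phf_eq, norm_mul, Ef_norm]; simp; left; ring

lemma phf_cont (δ : ℝ) : Continuous (fun t : ℝ => phf δ t) := by unfold phf; fun_prop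

lemma Ff_diff (δ : ℝ) {s : ℂ} (hs : -2 < s.re) : DifferentiableAt ℂ (Ff δ) s := by
  refine mellin_differentiableAt_of_isBigO_rpow_exp (a := 1/2) (b := -2) byn ((phf_cont δ).continuousOn.locallyIntegrableOn measurableSet_Ioi) ?_ ?_ (by simpa using hs)
  · have := rpow_mul_exp_neg_mul_sq_isLittleO_exp_neg (b := 1/2) byn 2
    refine (Asymptotics.isBigO_norm_left.1 ?_)
    refine this.isBigO.congr' ?_ (EventuallyEq.refl _ _)
    filter_upwards with t
    rw [phf_norm, Real.rpow_two]; congr 2; ring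
  · refine Asymptotics.IsBigO.of_bound 1 ?_
    filter_upwards [self_mem_nhdsWithin] with t ht
    rw [phf_norm, neg_neg, Real.rpow_two, one_mul, Real.norm_of_nonneg byp]
    exact mul_le_of_le_one_right byp (Real.exp_le_one_iff.2 (by nlinarith [sq_nonneg t]))

lemma Ff_decay (δ : ℝ) {σ : ℝ} (hs : -2 < σ) : ∃ C : ℝ, 0 ≤ C ∧ ∀ t : ℝ, ‖Ff δ (σ + t * I)‖ * (1 + t^2) ≤ C * (1 + t^2)⁻¹ := by
  set A := ∫ t in Ioi (0:ℝ), t^(σ+1) * Real.exp (-(2*Real.pi*δ*Real.sin (1/2)) * t - Real.cos (2*(1/2))/2 * t^2)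
  set B := ∫ t in Ioi (0:ℝ), t^(σ+1) * Real.exp (-(2*Real.pi*δ*Real.sin (-(1/2))) * t - Real.cos (2*(-(1/2)))/2 * t^2)
  have hA : 0 ≤ A := setIntegral_nonneg measurableSet_Ioi fun t ht => by
    replace ht : 0 < t := ht
    positivity
  have hB : 0 ≤ B := setIntegral_nonneg measurableSet_Ioi fun t ht => by
    replace ht : 0 < t := ht
    positivity
  have hpi := Real.pi_gt_three
  refine ⟨770 * (A + B), by positivity, fun t => ?_⟩
  have h1 : ‖Ff δ (σ + t * I)‖ ≤ Real.exp (-(|t|/2)) * (A + B) := by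
    rcases le_total 0 t with h | h
    · have := Ff_bound δ (s := σ + t*I) (by simpa using hs) (θ := 1/2) (by rw [abs_of_pos] <;> linarith)
      simp only [add_re, ofReal_re, re_ofReal_mul, I_re, mul_zero, add_zero, add_im, ofReal_im, im_ofReal_mul, I_im, mul_one, zero_add] at this
      rw [abs_of_nonneg h]
      refine this.trans ?_
      rw [show -(1/2*t) = -(t/2) by ring]
      exact mul_le_mul_of_nonneg_left (le_add_of_nonneg_right hB) (Real.exp_pos _).le
    · have := Ff_bound δ (s := σ + t*I) (by simpa using hs) (θ := -(1/2)) (by rw [abs_of_neg] <;> linarith)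
      simp only [add_re, ofReal_re, re_ofReal_mul, I_re, mul_zero, add_zero, add_im, ofReal_im, im_ofReal_mul, I_im, mul_one, zero_add] at this
      rw [abs_of_nonpos h]
      refine this.trans ?_
      rw [show -(-(1/2)*t) = -(-t/2) by ring]
      exact mul_le_mul_of_nonneg_left (le_add_of_nonneg_left hA) (Real.exp_pos _).le
  rw [← div_eq_mul_inv, le_div_iff₀ byp]
  have h2 : (1+t^2) * (1+t^2) ≤ 770 * Real.exp (|t|/2) := by
    have h3 := Real.pow_div_factorial_le_exp (|t|/2) byp 4
    have h4 := Real.one_le_exp (x := |t|/2) byp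
    have h5 : (|t|/2)^4 = (t^2)^2/16 := by rw [div_pow, ← sq_abs t]; ring
    rw [h5] at h3
    simp [Nat.factorial] at h3
    nlinarith [sq_nonneg (t^2-1)]
  calc _ = ‖Ff δ (σ + t * I)‖ * ((1 + t^2) * (1 + t^2)) := by ring
    _ ≤ (Real.exp (-(|t|/2)) * (A + B)) * (770 * Real.exp (|t|/2)) := by gcongr
    _ = 770 * (A + B) * (Real.exp (-(|t|/2)) * Real.exp (|t|/2)) := by ring
    _ = _ := by rw [← Real.exp_add]; simp

/-- weight -/
noncomputable def Wf (δ X σ : ℝ) (t : ℝ) : ℂ := 1/(2*Real.pi) * (Ff δ (σ + t*I) * (X:ℂ)^((σ:ℂ) + t*I))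

lemma Wf_cont (δ : ℝ) {X σ : ℝ} (hX : 0 < X) (hs : -2 < σ) : Continuous (Wf δ X σ) := by
  unfold Wf
  have h1 : Continuous fun t : ℝ => Ff δ (σ + t*I) := by
    rw [continuous_iff_continuousAt]
    intro t
    exact ContinuousAt.comp (g := Ff δ) (Ff_diff δ (by simpa using hs)).continuousAt (by fun_prop)
  have h2 : Continuous fun t : ℝ => (X:ℂ)^((σ:ℂ) + t*I) := by
    refine Continuous.const_cpow (by fun_prop) (Or.inl (by exact_mod_cast hX.ne'))
  fun_prop

lemma Wf_decay (δ : ℝ) {X σ : ℝ} (hX : 0 < X) (hs : -2 < σ) : ∃ C : ℝ, 0 ≤ C ∧ ∀ t : ℝ, ‖Wf δ X σ t‖ * (1 + t^2) ≤ C * (1 + t^2)⁻¹ := by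
  obtain ⟨C, h0, hC⟩ := Ff_decay δ hs
  refine ⟨‖(1/(2*Real.pi) : ℂ)‖ * X^σ * C, by positivity, fun t => ?_⟩
  unfold Wf
  rw [norm_mul, norm_mul, Complex.norm_cpow_eq_rpow_re_of_pos hX]
  simp only [add_re, ofReal_re, re_ofReal_mul, I_re, mul_zero, add_zero]
  calc _ = ‖(1/(2*Real.pi) : ℂ)‖ * X^σ * (‖Ff δ (σ + t*I)‖ * (1 + t^2)) := by ring
    _ ≤ ‖(1/(2*Real.pi) : ℂ)‖ * X^σ * (C * (1 + t^2)⁻¹) := mul_le_mul_of_nonneg_left (hC t) byp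
    _ = _ := by ring

lemma JI {W g : ℝ → ℂ} (hW : Continuous W) {C : ℝ} (hWb : ∀ t, ‖W t‖ * (1 + t^2) ≤ C * (1 + t^2)⁻¹)
    (hg : Continuous g) {A : ℝ} (hA : ∀ t, ‖g t‖ ≤ A * (1 + t^2)) : Integrable (fun t => W t * g t) ∧ ∫ t, ‖W t * g t‖ ≤ A * ∫ t, C * (1+t^2)⁻¹ := by
  have hb : ∀ t, ‖W t * g t‖ ≤ A * (C * (1+t^2)⁻¹) := fun t => by
    have hA0 : 0 ≤ A := by simpa using (norm_nonneg _).trans (hA 0)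
    rw [norm_mul]
    calc _ ≤ ‖W t‖ * (A * (1+t^2)) := by gcongr; exact hA t
      _ = A * (‖W t‖ * (1+t^2)) := by ring
      _ ≤ _ := mul_le_mul_of_nonneg_left (hWb t) hA0
  have hI : Integrable (fun t : ℝ => A * (C * (1+t^2)⁻¹)) := (integrable_inv_one_add_sq.const_mul _).const_mul _
  have h1 : Integrable (fun t => W t * g t) := hI.mono' (hW.mul hg).aestronglyMeasurable (Eventually.of_forall hb)
  refine ⟨h1, ?_⟩
  rw [← integral_const_mul]
  exact integral_mono h1.norm hI hb

lemma Jsum {W : ℝ → ℂ} (hW : Continuous W) {C : ℝ} (hWb : ∀ t, ‖W t‖ * (1 + t^2) ≤ C * (1 + t^2)⁻¹)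
    {ι : Type} {g : ι → ℝ → ℂ} {G : ℝ → ℂ} (hg : ∀ i, Continuous (g i)) {a : ι → ℝ} (ha : Summable a)
    (hb : ∀ i t, ‖g i t‖ ≤ a i * (1 + t^2)) (hG : ∀ t, HasSum (fun i => g i t) (G t)) :
    HasSum (fun i => ∫ t, W t * g i t) (∫ t, W t * G t) ∧ (∀ t, ‖G t‖ ≤ (∑' i, a i) * (1 + t^2)) := by
  constructor
  · have hc : (Function.support a).Countable := ha.countable_support
    have : Countable (Function.support a) := hc.to_subtype
    have hz : ∀ i ∉ Function.support a, ∀ t, g i t = 0 := fun i hi t => by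
      have := hb i t
      rw [Function.notMem_support.1 hi, zero_mul] at this
      exact norm_le_zero_iff.1 this
    have hs : Summable fun i : Function.support a => ∫ t, ‖W t * g i t‖ := by
      refine Summable.of_nonneg_of_le (fun i => integral_nonneg fun t => norm_nonneg _)
        (fun i => (JI hW hWb (hg i) (hb i)).2) ((ha.subtype _).mul_right _)
    have h := hasSum_integral_of_summable_integral_norm (F := fun (i : Function.support a) t => W t * g i t)
      (fun i => (JI hW hWb (hg i) (hb i)).1) hs
    have e : ∀ t, ∑' i : Function.support a, W t * g i t = W t * G t := fun t => by
      have : HasSum (fun i : Function.support a => g i t) (G t) :=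
        (hasSum_subtype_iff_of_support_subset (f := fun i => g i t) (fun i hi => by
          by_contra h; exact hi (hz i h t))).2 (hG t)
      exact (this.mul_left _).tsum_eq
    simp only [e] at h
    exact (hasSum_subtype_iff_of_support_subset (f := fun i => ∫ t, W t * g i t) (fun i hi => by
      by_contra h; apply hi; simp [hz i h])).1 h
  · intro t
    have h := tsum_of_norm_bounded (ha.mul_right (1+t^2)).hasSum (fun i => hb i t)
    rwa [(hG t).tsum_eq, tsum_mul_right] at h

end JSec

section JkSec
open Complex Filter Topology

lemma cpow_quot {u X : ℝ} (hu : 0 < u) (hX : 0 < X) (s : ℂ) : ((u/X : ℝ):ℂ)^(-s) = (X:ℂ)^s * (u:ℂ)^(-s) := by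
  have h1 : ((u/X:ℝ):ℂ) ≠ 0 := by exact_mod_cast (div_pos hu hX).ne'
  have h2 : (u:ℂ) ≠ 0 := by exact_mod_cast hu.ne'
  have h3 : (X:ℂ) ≠ 0 := by exact_mod_cast hX.ne'
  rw [cpow_def_of_ne_zero h1, cpow_def_of_ne_zero h2, cpow_def_of_ne_zero h3, ← exp_add,
    ← ofReal_log (div_pos hu hX).le, ← ofReal_log hu.le, ← ofReal_log hX.le, Real.log_div hu.ne' hX.ne']
  congr 1; push_cast; ring

lemma cpow_line {u : ℝ} (hu : 0 < u) (σ t : ℝ) : (u:ℂ)^(-((σ:ℂ)+t*I)) = (u:ℂ)^(-(σ:ℂ)) * exp (-(t * Real.log u : ℝ) * I) := by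
  have h2 : (u:ℂ) ≠ 0 := by exact_mod_cast hu.ne'
  rw [cpow_def_of_ne_zero h2, cpow_def_of_ne_zero h2, ← exp_add, ← ofReal_log hu.le]
  congr 1; push_cast; ring

lemma Wf_int (δ : ℝ) {X σ : ℝ} (hX : 0 < X) (hs : -2 < σ) : Integrable (Wf δ X σ) := by
  obtain ⟨C, h0, hC⟩ := Wf_decay δ hX hs
  have := (JI (Wf_cont δ hX hs) hC (g := fun _ => 1) continuous_const (A := 1) (fun t => by simp; positivity)).1
  simpa using this

lemma J_base (δ : ℝ) {X σ u : ℝ} (hX : 0 < X) (hs : -2 < σ) (hu : 0 < u) :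
    ∫ t, Wf δ X σ t * (u:ℂ)^(-((σ:ℂ)+t*I)) = phf δ ((u/X : ℝ):ℂ) := by
  have hv : VerticalIntegrable (mellin (fun t : ℝ => phf δ t)) σ := by
    have := Wf_int δ one_pos hs
    have := this.const_mul (2*Real.pi : ℂ)
    refine this.congr (Eventually.of_forall fun t => ?_)
    have : (Real.pi:ℂ) ≠ 0 := by exact_mod_cast Real.pi_ne_zero
    simp [Wf, Ff]; field_simp
  have h := mellinInv_mellin_eq σ (fun t : ℝ => phf δ t) (div_pos hu hX) (phf_mellin δ (by simpa using hs)) hv (phf_cont δ).continuousAt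
  rw [← h, mellinInv, ← integral_smul]
  congr 1; funext t
  rw [cpow_quot hu hX, Wf, Ff, smul_eq_mul, real_smul]; push_cast; ring

lemma J_ker (δ : ℝ) {X σ : ℝ} (hX : 0 < X) (hs : -2 < σ) {A : Set ℝ} (hA : MeasurableSet A) (hA0 : A ⊆ Ioi 0)
    {k : ℝ → ℂ} (hk : IntegrableOn (fun u : ℝ => k u * (u:ℂ)^(-(σ:ℂ))) A) :
    ∫ t, Wf δ X σ t * (∫ u in A, k u * (u:ℂ)^(-((σ:ℂ)+t*I))) = ∫ u in A, k u * phf δ ((u/X : ℝ):ℂ) := by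
  have hI : Integrable (fun p : ℝ × ℝ => Wf δ X σ p.1 * (k p.2 * (p.2:ℂ)^(-(σ:ℂ))) * exp (-(p.1 * Real.log p.2 : ℝ) * I)) (volume.prod (volume.restrict A)) := by
    refine Integrable.mono ((Wf_int δ hX hs).mul_prod hk) ?_ (Eventually.of_forall fun p => ?_)
    · refine AEStronglyMeasurable.mul ((Wf_int δ hX hs).mul_prod hk).1 (Measurable.aestronglyMeasurable ?_)
      fun_prop
    · rw [norm_mul]
      have : -((p.1 * Real.log p.2 : ℝ):ℂ) * I = ((-(p.1 * Real.log p.2) : ℝ):ℂ) * I := by push_cast; ring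
      rw [this, Complex.norm_exp_ofReal_mul_I, mul_one]
  have e1 : ∀ t, Wf δ X σ t * (∫ u in A, k u * (u:ℂ)^(-((σ:ℂ)+t*I))) = ∫ u in A, Wf δ X σ t * (k u * (u:ℂ)^(-(σ:ℂ))) * exp (-(t * Real.log u : ℝ) * I) := by
    intro t
    rw [← integral_const_mul]
    refine setIntegral_congr_fun hA fun u hu => ?_
    rw [cpow_line (hA0 hu)]; ring
  simp_rw [e1]
  rw [integral_integral_swap hI]
  refine setIntegral_congr_fun hA fun u hu => ?_
  rw [← J_base δ hX hs (hA0 hu), ← integral_const_mul]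
  congr 1; funext t
  rw [cpow_line (hA0 hu)]; ring

lemma cpow_merge {u : ℝ} (hu : 0 < u) (w s : ℂ) : (u:ℂ)^(w-1) * (u:ℂ)^(-s) = (u:ℂ)^(w-1-s) := by
  rw [← Complex.cpow_add _ _ (by exact_mod_cast hu.ne')]; rfl

lemma J_right (δ : ℝ) {X σ : ℝ} (hX : 0 < X) (hs : -2 < σ) {w : ℂ} (hw : w.re < σ) :
    ∫ t, Wf δ X σ t * (1 / (((σ:ℂ)+t*I) - w)) = ∫ u in Ioi (1:ℝ), (u:ℂ)^(w-1) * phf δ ((u/X : ℝ):ℂ) := by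
  have hA0 : Ioi (1:ℝ) ⊆ Ioi 0 := Ioi_subset_Ioi zero_le_one
  rw [← J_ker δ hX hs measurableSet_Ioi hA0]
  · congr 1; funext t; congr 1
    rw [setIntegral_congr_fun (g := fun u : ℝ => (u:ℂ)^(w-1-((σ:ℂ)+t*I))) measurableSet_Ioi (fun u hu => cpow_merge (hA0 hu) _ _),
      integral_Ioi_cpow_of_lt (by simp; linarith) one_pos]
    simp
    rw [show w - 1 - (σ + t*I) + 1 = -((σ + t*I) - w) by ring, neg_div, div_neg, neg_neg, one_div]
  · refine (integrableOn_Ioi_cpow_of_lt (a := w-1-σ) (by simp; linarith) one_pos).congr_fun (fun u hu => (cpow_merge (hA0 hu) _ _).symm) measurableSet_Ioi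

lemma J_left (δ : ℝ) {X σ : ℝ} (hX : 0 < X) (hs : -2 < σ) {w : ℂ} (hw : σ < w.re) :
    ∫ t, Wf δ X σ t * (1 / (w - ((σ:ℂ)+t*I))) = ∫ u in Ioc (0:ℝ) 1, (u:ℂ)^(w-1) * phf δ ((u/X : ℝ):ℂ) := by
  have hA0 : Ioc (0:ℝ) 1 ⊆ Ioi 0 := fun u hu => hu.1
  rw [← J_ker δ hX hs measurableSet_Ioc hA0]
  · congr 1; funext t; congr 1
    rw [setIntegral_congr_fun (g := fun u : ℝ => (u:ℂ)^(w-1-((σ:ℂ)+t*I))) measurableSet_Ioc (fun u hu => cpow_merge (hA0 hu) _ _),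
      ← intervalIntegral.integral_of_le zero_le_one, integral_cpow (Or.inl (by simp; linarith))]
    have : w - 1 - (σ + t*I) + 1 = w - (σ + t*I) := by ring
    rw [this, ofReal_zero, zero_cpow]
    · simp
    · intro h; have := congrArg re h; simp at this; linarith
  · have := (intervalIntegral.intervalIntegrable_cpow' (a := 0) (b := 1) (r := w-1-σ) (by simp; linarith))
    rw [intervalIntegrable_iff_integrableOn_Ioc_of_le zero_le_one] at this
    exact this.congr_fun (fun u hu => (cpow_merge (hA0 hu) _ _).symm) measurableSet_Ioc

lemma ph_scale (δ : ℝ) {X : ℝ} (hX : 0 < X) {w : ℂ} (hw : -2 < w.re) :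
    (∫ u in Ioi (1:ℝ), (u:ℂ)^(w-1) * phf δ ((u/X : ℝ):ℂ)) + (∫ u in Ioc (0:ℝ) 1, (u:ℂ)^(w-1) * phf δ ((u/X : ℝ):ℂ)) = (X:ℂ)^w * Ff δ w := by
  have hi : IntegrableOn (fun u : ℝ => (u:ℂ)^(w-1) * phf δ ((u/X : ℝ):ℂ)) (Ioi 0) := by
    have := (MellinConvergent.comp_mul_left (f := fun t : ℝ => phf δ t) (s := w) (inv_pos.2 hX)).2 (phf_mellin δ hw)
    refine this.congr_fun (fun u hu => ?_) measurableSet_Ioi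
    simp [div_eq_inv_mul]
  have := mellin_comp_mul_left (fun t : ℝ => phf δ t) w (inv_pos.2 hX)
  have e : (((X⁻¹:ℝ):ℂ)^(-w)) = (X:ℂ)^w := by
    rw [ofReal_inv, Complex.inv_cpow, Complex.cpow_neg, inv_inv]
    rw [Complex.arg_ofReal_of_nonneg hX.le]; exact Real.pi_pos.ne
  rw [e, smul_eq_mul] at this
  rw [Ff, ← this, mellin, add_comm, ← setIntegral_union (by rw [Set.disjoint_left]; intro u hu; simp [hu.2]) measurableSet_Ioi (hi.mono_set Ioc_subset_Ioi_self) (hi.mono_set (Ioi_subset_Ioi zero_le_one)), Ioc_union_Ioi_eq_Ioi zero_le_one]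
  refine setIntegral_congr_fun measurableSet_Ioi fun u hu => ?_
  simp [div_eq_inv_mul]

end JkSec

section WeilSec
open Complex DirichletCharacter Filter Topology ComplexConjugate
variable {q : ℕ} [NeZero q]

def GoodF (g : ℝ → ℂ) : Prop := Continuous g ∧ ∃ A : ℝ, ∀ t, ‖g t‖ ≤ A * (1 + t^2)

lemma GoodF.const (c : ℂ) : GoodF (fun _ => c) := ⟨continuous_const, ‖c‖, fun t => by
  nlinarith [norm_nonneg c, sq_nonneg t, mul_nonneg (norm_nonneg c) (sq_nonneg t)]⟩
lemma GoodF.add {g h : ℝ → ℂ} (hg : GoodF g) (hh : GoodF h) : GoodF (fun t => g t + h t) := by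
  obtain ⟨c1, A, hA⟩ := hg
  obtain ⟨c2, B, hB⟩ := hh
  exact ⟨c1.add c2, A + B, fun t => (norm_add_le _ _).trans (by linarith [hA t, hB t])⟩
lemma GoodF.neg {g : ℝ → ℂ} (hg : GoodF g) : GoodF (fun t => - g t) := by
  obtain ⟨c1, A, hA⟩ := hg
  exact ⟨c1.neg, A, fun t => by rw [norm_neg]; exact hA t⟩
lemma line_re (σ t : ℝ) : ((σ:ℂ) + t*I).re = σ := by simp
lemma line_ne {σ t : ℝ} {w : ℂ} (h : w.re ≠ σ) : ((σ:ℂ) + t*I) - w ≠ 0 := by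
  intro h1; apply h
  have := congrArg re h1; simp at this; linarith
lemma GoodF.pole {σ : ℝ} {w : ℂ} (h : w.re ≠ σ) : GoodF (fun t : ℝ => 1 / (((σ:ℂ) + t*I) - w)) := by
  refine ⟨continuous_const.div (by fun_prop) fun t => line_ne h, |σ - w.re|⁻¹, fun t => ?_⟩
  have h1 : |σ - w.re| ≤ ‖((σ:ℂ) + t*I) - w‖ := by
    have := abs_re_le_norm (((σ:ℂ) + t*I) - w); simpa using this
  have h2 : 0 < |σ - w.re| := abs_pos.2 (sub_ne_zero.2 h.symm)
  rw [norm_div, norm_one, one_div]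
  calc _ ≤ |σ - w.re|⁻¹ := by gcongr
    _ ≤ _ := le_mul_of_one_le_right byp (by nlinarith [sq_nonneg t])
lemma GoodF.int {g : ℝ → ℂ} (hg : GoodF g) (δ : ℝ) {X σ : ℝ} (hX : 0 < X) (hs : -2 < σ) :
    Integrable (fun t => Wf δ X σ t * g t) := by
  obtain ⟨c1, A, hA⟩ := hg
  obtain ⟨C, h0, hC⟩ := Wf_decay δ hX hs
  exact (JI (Wf_cont δ hX hs) hC c1 hA).1
lemma Jadd {g h : ℝ → ℂ} (hg : GoodF g) (hh : GoodF h) (δ : ℝ) {X σ : ℝ} (hX : 0 < X) (hs : -2 < σ) :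
    ∫ t, Wf δ X σ t * (g t + h t) = (∫ t, Wf δ X σ t * g t) + ∫ t, Wf δ X σ t * h t := by
  rw [← integral_add (hg.int δ hX hs) (hh.int δ hX hs)]; simp only [mul_add]
lemma Jneg (g : ℝ → ℂ) (δ X σ : ℝ) : ∫ t, Wf δ X σ t * (- g t) = - ∫ t, Wf δ X σ t * g t := by
  rw [← integral_neg]; simp only [mul_neg]
lemma Jconst (c : ℂ) (δ : ℝ) {X σ : ℝ} (hX : 0 < X) (hs : -2 < σ) :
    ∫ t, Wf δ X σ t * c = c * phf δ ((1/X : ℝ) : ℂ) := by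
  rw [← J_base δ hX hs one_pos, integral_mul_const]; simp [mul_comm]
lemma Jsum' (δ : ℝ) {X σ : ℝ} (hX : 0 < X) (hs : -2 < σ) 
    {ι : Type} {g : ι → ℝ → ℂ} {G : ℝ → ℂ} (hg : ∀ i, Continuous (g i)) {a : ι → ℝ} (ha : Summable a)
    (hb : ∀ i t, ‖g i t‖ ≤ a i * (1 + t^2)) (hG : ∀ t, HasSum (fun i => g i t) (G t)) :
    HasSum (fun i => ∫ t, Wf δ X σ t * g i t) (∫ t, Wf δ X σ t * G t) ∧ (Continuous G → GoodF G) := by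
  obtain ⟨C, h0, hC⟩ := Wf_decay δ hX hs
  have := Jsum (Wf_cont δ hX hs) hC hg ha hb hG
  exact ⟨this.1, fun h => ⟨h, _, this.2⟩⟩

lemma dig2 {z : ℂ} (hz : 0 < z.re) : HasSum (fun n : ℕ => 1/(2*(n:ℂ)+2) - 1/(2*(n:ℂ)+z)) (digamma (z/2) / 2 + (Real.eulerMascheroniConstant/2 : ℝ)) := by
  have h := (digamma_hasSum (s := z/2) (by simpa using hz)).div_const 2
  convert! h using 1
  · funext n
    have h1 := dig_ne (s := z/2) (by simpa using hz) n
    have h2 : (n:ℂ) + 1 ≠ 0 := by exact_mod_cast Nat.succ_ne_zero n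
    have h3 : 2*(n:ℂ) + z ≠ 0 := by intro h; apply h1; linear_combination h/2
    rw [show (2*(n:ℂ)+2) = 2*(n+1) by ring, show 2*(n:ℂ)+z = 2*(n+z/2) by ring]
    field_simp
  · push_cast; ring

lemma dig2_cont {f : ℝ → ℂ} (hf : Continuous f) (h0 : ∀ t, 0 < (f t).re) : Continuous fun t => digamma (f t / 2) := by
  rw [continuous_iff_continuousAt]
  intro t
  refine ContinuousAt.comp (g := digamma) (f := fun t => f t/2) ?_ (by fun_prop)
  have hU : IsOpen {z : ℂ | 0 < z.re} := isOpen_lt continuous_const continuous_re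
  have hd : DifferentiableOn ℂ Gamma {z : ℂ | 0 < z.re} := fun z hz => (differentiableAt_Gamma _ (fun m h => by
    replace hz : 0 < z.re := hz
    rw [h] at hz; simp at hz; have : (0:ℝ) ≤ m := by positivity
    linarith)).differentiableWithinAt
  have hm : f t / 2 ∈ {z : ℂ | 0 < z.re} := by have := h0 t; simpa using this
  unfold digamma
  have h1 := ((hd.deriv hU).differentiableAt (hU.mem_nhds hm)).continuousAt
  have h2 := (hd.differentiableAt (hU.mem_nhds hm)).continuousAt
  exact h1.div h2 (Gamma_ne_zero_of_re_pos hm)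

lemma JPsi (δ : ℝ) {X σ : ℝ} (hX : 0 < X) (hs : -2 < σ) {f : ℝ → ℂ} (hf : Continuous f) {c : ℝ} (hc : 1 ≤ c)
    (hre : ∀ t, (f t).re = c) (him : ∀ t, |(f t).im| ≤ |t|) :
    HasSum (fun n : ℕ => ∫ t, Wf δ X σ t * (1/(2*(n:ℂ)+2) - 1/(2*(n:ℂ)+f t))) (∫ t, Wf δ X σ t * (digamma (f t/2) / 2 + (Real.eulerMascheroniConstant/2 : ℝ))) ∧
      GoodF (fun t => (digamma (f t/2) / 2 + (Real.eulerMascheroniConstant/2 : ℝ))) := by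
  have hz : ∀ t, 0 < (f t).re := fun t => by rw [hre]; linarith
  have h3 : ∀ (n : ℕ) t, 2*(n:ℂ) + f t ≠ 0 := fun n t h => by
    have := congrArg re h; simp [hre] at this
    have : (0:ℝ) ≤ n := by positivity
    linarith
  have hb : ∀ (n : ℕ) t, ‖1/(2*(n:ℂ)+2) - 1/(2*(n:ℂ)+f t)‖ ≤ (c+3) * 2 * (1/((n:ℝ)+1)^2) * (1+t^2) := by
    intro n t
    have h4 := dig_term (s := f t/2) (by have := hz t; simpa using this) n
    have e : (1/(2*(n:ℂ)+2) - 1/(2*(n:ℂ)+f t)) = (1/((n:ℂ)+1) - 1/((n:ℂ)+f t/2)) / 2 := by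
      have h2 : (n:ℂ) + 1 ≠ 0 := by exact_mod_cast Nat.succ_ne_zero n
      have h5 : (n:ℂ) + f t/2 ≠ 0 := by intro h; apply h3 n t; linear_combination 2*h
      have h6 := h3 n t
      rw [show (2*(n:ℂ)+2) = 2*(n+1) by ring, show 2*(n:ℂ)+f t = 2*(n+f t/2) by ring]
      field_simp
    have e2 : (f t / 2).re = c/2 := by simp [hre]
    have h6 : ‖f t/2 - 1‖ ≤ (c+3) * (1+t^2) := by
      have h7 : ‖f t‖ ≤ c + |t| := (norm_le_abs_re_add_abs_im _).trans (by rw [hre, abs_of_pos byl]; linarith [him t])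
      have h8 : |t| ≤ 1 + t^2 := by nlinarith [sq_abs t, sq_nonneg (|t| - 1), abs_nonneg t]
      have := norm_sub_le (f t/2) 1
      rw [norm_div, norm_one, Complex.norm_ofNat] at this
      nlinarith [sq_nonneg t]
    have h7 : 1 + 1/(c/2) ≤ 4 := by
      have : 1/(c/2) ≤ 2 := by rw [div_le_iff₀ byl]; linarith
      linarith
    rw [e2] at h4
    have hn : (0:ℝ) < n+1 := by positivity
    simp only [e]
    rw [norm_div, Complex.norm_ofNat]
    calc _ ≤ (‖f t/2 - 1‖ * (1 + 1/(c/2)) / ((n:ℝ)+1)^2)/2 := by gcongr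
      _ ≤ ((c+3)*(1+t^2)) * 4 / ((n:ℝ)+1)^2/2 := by gcongr
      _ = _ := by ring
  obtain ⟨h1, h2⟩ := Jsum' δ hX hs (g := fun (n:ℕ) t => 1/(2*(n:ℂ)+2) - 1/(2*(n:ℂ)+f t)) (a := fun n : ℕ => (c+3) * 2 * (1/((n:ℝ)+1)^2))
    (G := fun t => digamma (f t/2) / 2 + (Real.eulerMascheroniConstant/2 : ℝ))
    (fun n => continuous_const.sub (continuous_const.div (by fun_prop) (h3 n))) (summ_sq.mul_left _) hb (fun t => dig2 (hz t))
  exact ⟨h1, h2 (((dig2_cont hf hz).div_const 2).add continuous_const)⟩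

lemma JLam (χ : DirichletCharacter ℂ q) (δ : ℝ) {X σ : ℝ} (hX : 0 < X) (hs : 1 < σ) :
    HasSum (fun n : ℕ => χ n * (ArithmeticFunction.vonMangoldt n : ℂ) * phf δ ((n/X : ℝ) : ℂ)) (∫ t, Wf δ X σ t * LamS χ (σ + t*I)) := by
  have hcast : ∀ n : ℕ, n ≠ 0 → (0:ℝ) < n := fun n hn => by exact_mod_cast Nat.pos_of_ne_zero hn
  have ht : ∀ (n : ℕ) (t : ℝ), LSeries.term (fun n => χ n * (ArithmeticFunction.vonMangoldt n : ℂ)) (σ+t*I) n = χ n * (ArithmeticFunction.vonMangoldt n : ℂ) * ((n:ℝ):ℂ)^(-((σ:ℂ)+t*I)) := by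
    intro n t
    rw [LSeries.term_def]
    split_ifs with hn
    · subst hn; simp
    · rw [Complex.cpow_neg, div_eq_mul_inv, ofReal_natCast]
  have hsm : ∀ t : ℝ, LSeriesSummable (fun n => χ n * (ArithmeticFunction.vonMangoldt n : ℂ)) (σ+t*I) := fun t =>
    (LSeriesSummable_twist_vonMangoldt χ (s := σ+t*I) (by rw [line_re]; exact hs))
  have hc : ∀ n : ℕ, Continuous (fun t : ℝ => χ n * (ArithmeticFunction.vonMangoldt n : ℂ) * ((n:ℝ):ℂ)^(-((σ:ℂ)+t*I))) := by
    intro n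
    rcases eq_or_ne n 0 with rfl | hn
    · simp; exact continuous_const
    · refine continuous_const.mul (Continuous.const_cpow (by fun_prop) (Or.inl (by exact_mod_cast hn)))
  have hb : ∀ (n : ℕ) (t : ℝ), ‖χ n * (ArithmeticFunction.vonMangoldt n : ℂ) * ((n:ℝ):ℂ)^(-((σ:ℂ)+t*I))‖ ≤ ArithmeticFunction.vonMangoldt n * (n:ℝ)^(-σ) * (1+t^2) := by
    intro n t
    rcases eq_or_ne n 0 with rfl | hn
    · simp
    · rw [norm_mul, norm_mul, Complex.norm_real, Real.norm_of_nonneg ArithmeticFunction.vonMangoldt_nonneg, Complex.norm_cpow_eq_rpow_re_of_pos (hcast n hn), neg_re, line_re]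
      have h1 := DirichletCharacter.norm_le_one χ (n : ZMod q)
      have h2 : 0 ≤ ArithmeticFunction.vonMangoldt n := ArithmeticFunction.vonMangoldt_nonneg
      have h3 : 0 ≤ (n:ℝ)^(-σ) := by positivity
      calc _ ≤ 1 * ArithmeticFunction.vonMangoldt n * (n:ℝ)^(-σ) := by gcongr
        _ ≤ _ := by rw [one_mul]; exact le_mul_of_one_le_right byp (by nlinarith [sq_nonneg t])
  have hG : ∀ t : ℝ, HasSum (fun n : ℕ => χ n * (ArithmeticFunction.vonMangoldt n : ℂ) * ((n:ℝ):ℂ)^(-((σ:ℂ)+t*I))) (LamS χ (σ+t*I)) := by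
    intro t
    have := (hsm t).hasSum
    convert! this using 1
    funext n; exact (ht n t).symm
  obtain ⟨h1, -⟩ := Jsum' δ hX (by linarith : -2 < σ) (g := fun (n:ℕ) t => χ n * (ArithmeticFunction.vonMangoldt n : ℂ) * ((n:ℝ):ℂ)^(-((σ:ℂ)+t*I)))
    (G := fun t => LamS χ (σ+t*I)) (a := fun n : ℕ => ArithmeticFunction.vonMangoldt n * (n:ℝ)^(-σ)) hc (VS_summ hs) hb hG
  convert! h1 using 1
  funext n
  rcases eq_or_ne n 0 with rfl | hn
  · simp
  · rw [← J_base δ hX (by linarith : -2 < σ) (hcast n hn), ← integral_const_mul]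
    congr 1; funext t; ring

lemma JLam' (χ : DirichletCharacter ℂ q) (δ : ℝ) {X σ : ℝ} (hX : 0 < X) (hs2 : -2 < σ) (hs : σ < 0) :
    HasSum (fun n : ℕ => χ n * (ArithmeticFunction.vonMangoldt n : ℂ) * ((n:ℂ)⁻¹ * phf δ (((n:ℝ)⁻¹/X : ℝ) : ℂ))) (∫ t, Wf δ X σ t * LamS χ (1 - (σ + t*I))) := by
  have hcast : ∀ n : ℕ, n ≠ 0 → (0:ℝ) < n := fun n hn => by exact_mod_cast Nat.pos_of_ne_zero hn
  have hre : ∀ t : ℝ, (1 - ((σ:ℂ) + t*I)).re = 1 - σ := fun t => by simp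
  have ht : ∀ (n : ℕ) (t : ℝ), LSeries.term (fun n => χ n * (ArithmeticFunction.vonMangoldt n : ℂ)) (1-(σ+t*I)) n = χ n * (ArithmeticFunction.vonMangoldt n : ℂ) * ((n:ℝ):ℂ)^(-(1-((σ:ℂ)+t*I))) := by
    intro n t
    rw [LSeries.term_def]
    split_ifs with hn
    · subst hn; simp
    · rw [Complex.cpow_neg, div_eq_mul_inv, ofReal_natCast]
  have hsm : ∀ t : ℝ, LSeriesSummable (fun n => χ n * (ArithmeticFunction.vonMangoldt n : ℂ)) (1-(σ+t*I)) := fun t =>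
    (LSeriesSummable_twist_vonMangoldt χ (s := 1-(σ+t*I)) (by rw [hre]; linarith))
  have hc : ∀ n : ℕ, Continuous (fun t : ℝ => χ n * (ArithmeticFunction.vonMangoldt n : ℂ) * ((n:ℝ):ℂ)^(-(1-((σ:ℂ)+t*I)))) := by
    intro n
    rcases eq_or_ne n 0 with rfl | hn
    · simp; exact continuous_const
    · refine continuous_const.mul (Continuous.const_cpow (by fun_prop) (Or.inl (by exact_mod_cast hn)))
  have hb : ∀ (n : ℕ) (t : ℝ), ‖χ n * (ArithmeticFunction.vonMangoldt n : ℂ) * ((n:ℝ):ℂ)^(-(1-((σ:ℂ)+t*I)))‖ ≤ ArithmeticFunction.vonMangoldt n * (n:ℝ)^(-(1-σ)) * (1+t^2) := by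
    intro n t
    rcases eq_or_ne n 0 with rfl | hn
    · simp
    · rw [norm_mul, norm_mul, Complex.norm_real, Real.norm_of_nonneg ArithmeticFunction.vonMangoldt_nonneg, Complex.norm_cpow_eq_rpow_re_of_pos (hcast n hn), neg_re, hre]
      have h1 := DirichletCharacter.norm_le_one χ (n : ZMod q)
      have h2 : 0 ≤ ArithmeticFunction.vonMangoldt n := ArithmeticFunction.vonMangoldt_nonneg
      have h3 : 0 ≤ (n:ℝ)^(-(1-σ)) := by positivity
      calc _ ≤ 1 * ArithmeticFunction.vonMangoldt n * (n:ℝ)^(-(1-σ)) := by gcongr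
        _ ≤ _ := by rw [one_mul]; exact le_mul_of_one_le_right byp (by nlinarith [sq_nonneg t])
  have hG : ∀ t : ℝ, HasSum (fun n : ℕ => χ n * (ArithmeticFunction.vonMangoldt n : ℂ) * ((n:ℝ):ℂ)^(-(1-((σ:ℂ)+t*I)))) (LamS χ (1-(σ+t*I))) := by
    intro t
    have := (hsm t).hasSum
    convert! this using 1
    funext n; exact (ht n t).symm
  obtain ⟨h1, -⟩ := Jsum' δ hX hs2 (g := fun (n:ℕ) t => χ n * (ArithmeticFunction.vonMangoldt n : ℂ) * ((n:ℝ):ℂ)^(-(1-((σ:ℂ)+t*I))))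
    (G := fun t => LamS χ (1-(σ+t*I))) (a := fun n : ℕ => ArithmeticFunction.vonMangoldt n * (n:ℝ)^(-(1-σ))) hc (VS_summ byl) hb hG
  convert! h1 using 1
  funext n
  rcases eq_or_ne n 0 with rfl | hn
  · simp
  · rw [← J_base δ hX hs2 (inv_pos.2 (hcast n hn)), ← integral_const_mul, ← integral_const_mul]
    congr 1; funext t
    have h0 : ((n:ℝ):ℂ) ≠ 0 := by exact_mod_cast hn
    have e : (((n:ℝ)⁻¹:ℝ):ℂ)^(-((σ:ℂ)+t*I)) = ((n:ℝ):ℂ)^((σ:ℂ)+t*I) := by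
      rw [ofReal_inv, Complex.inv_cpow, Complex.cpow_neg, inv_inv]
      rw [Complex.arg_ofReal_of_nonneg (hcast n hn).le]; exact Real.pi_pos.ne
    rw [e, neg_sub, Complex.cpow_sub _ _ h0, cpow_one]
    simp only [ofReal_natCast]; ring

end WeilSec

section WeilSec2
open Complex DirichletCharacter Filter Topology ComplexConjugate
variable {q : ℕ} [NeZero q]

lemma prim_inv {χ : DirichletCharacter ℂ q} (hχ : χ.IsPrimitive) : χ⁻¹.IsPrimitive := by
  unfold IsPrimitive at *; rw [conductor_inv, hχ]

lemma JD {χ : DirichletCharacter ℂ q} (hχ : χ.IsPrimitive) (δ : ℝ) {X σ : ℝ} (hX : 0 < X) (hs : σ = 2 ∨ σ = -(1/2)) :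
    HasSum (fun ρ : ℂ => ∫ t : ℝ, Wf δ X σ t * ((mz χ ρ : ℂ) * (1/(((σ:ℂ)+t*I)-ρ) + 1/ρ)))
      (∫ t : ℝ, Wf δ X σ t * (logDeriv (xiF χ) ((σ:ℂ)+t*I) - logDeriv (xiF χ) 0)) ∧
      GoodF (fun t : ℝ => logDeriv (xiF χ) ((σ:ℂ)+t*I) - logDeriv (xiF χ) 0) := by
  have h := fun hq => prim_ne_one hχ hq
  have hd := xiF_diff χ h
  have h0 := xiF_zero_ne hχ (s := 0) (by simp)
  obtain ⟨C, hC⟩ := xiF_growth hχ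
  have hσ : -2 < σ := by rcases hs with h | h <;> rw [h] <;> norm_num
  have hn : ∀ t : ℝ, xiF χ ((σ:ℂ)+t*I) ≠ 0 := by
    intro t
    rcases hs with hs | hs
    · exact xiF_ne_zero_right χ h (by rw [line_re, hs]; norm_num)
    · exact xiF_zero_ne hχ (by rw [line_re, hs]; norm_num)
  obtain ⟨c0, hc0, hgap⟩ := hd_gap hd h0
  have hsum := hd_summable hd h0 hC
  have hz : ∀ ρ, mz χ ρ ≠ 0 → xiF χ ρ = 0 := by
    intro ρ h; by_contra hne; apply h
    unfold mz
    rw [analyticOrderNatAt, analyticOrderAt_eq_zero.2 (Or.inr hne)]; rfl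
  have hre : ∀ ρ, mz χ ρ ≠ 0 → ρ.re ≠ σ ∧ 1/2 ≤ |σ - ρ.re| := by
    intro ρ hρ
    obtain ⟨h1, h2, -⟩ := mz_zero hχ hρ
    rcases hs with hs | hs
    · rw [hs]; exact ⟨by linarith, by rw [abs_of_pos] <;> linarith⟩
    · rw [hs]; exact ⟨by linarith, by rw [abs_of_neg] <;> linarith⟩
  have hcont : ∀ ρ : ℂ, Continuous (fun t : ℝ => (mz χ ρ : ℂ) * (1/(((σ:ℂ)+t*I)-ρ) + 1/ρ)) := by
    intro ρ
    by_cases hρ : mz χ ρ = 0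
    · simp only [hρ, Nat.cast_zero, zero_mul]; exact continuous_const
    · exact continuous_const.mul ((GoodF.pole (hre ρ hρ).1).1.add continuous_const)
  have hb : ∀ (ρ : ℂ) (t : ℝ), ‖(mz χ ρ : ℂ) * (1/(((σ:ℂ)+t*I)-ρ) + 1/ρ)‖ ≤ (20/c0) * ((mz χ ρ : ℝ)/(1+‖ρ‖)^2) * (1+t^2) := by
    intro ρ t
    by_cases hρ : mz χ ρ = 0
    · simp [hρ]
    set s : ℂ := (σ:ℂ)+t*I with hs'
    have hsn : ‖s‖ ≤ 2 + |t| := by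
      refine (norm_le_abs_re_add_abs_im _).trans ?_
      have e1 : s.re = σ := line_re σ t
      have e2 : s.im = t := by simp [hs']
      rw [e1, e2]
      have : |σ| ≤ 2 := by rcases hs with h | h <;> rw [h] <;> norm_num [abs_le]
      linarith
    have hd1 : 1/2 ≤ ‖s - ρ‖ := by
      refine (hre ρ hρ).2.trans ?_
      have := abs_re_le_norm (s - ρ)
      rwa [sub_re, line_re] at this
    have hg := hgap ρ (hz ρ hρ)
    rw [zero_sub, norm_neg] at hg
    have hρp : 0 < ‖ρ‖ := lt_of_lt_of_le byp hg
    have hρ0 : ρ ≠ 0 := norm_pos_iff.1 hρp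
    have hsρ : s - ρ ≠ 0 := norm_pos_iff.1 byl
    have e : 1/(s-ρ) + 1/ρ = s / ((s-ρ)*ρ) := by field_simp; ring
    have h3 : 1 + ‖ρ‖ ≤ (3 + 2*‖s‖) * ‖s-ρ‖ := by
      have : ‖ρ‖ ≤ ‖s‖ + ‖s-ρ‖ := by
        have := norm_sub_le s (s-ρ); rwa [sub_sub_cancel] at this
      nlinarith [norm_nonneg s]
    have h4 : ‖s‖ * (3+2*‖s‖) ≤ 20 * (1+t^2) := by
      have h5 : ‖s‖ * (3+2*‖s‖) ≤ (2+|t|) * (3+2*(2+|t|)) := by gcongr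
      nlinarith [sq_abs t, sq_nonneg (|t|-1)]
    rw [norm_mul, Complex.norm_natCast, e, norm_div, norm_mul]
    have h6 : ‖s‖/(‖s-ρ‖*‖ρ‖) ≤ 20*(1+t^2)/(c0*(1+‖ρ‖)^2) := by
      rw [div_le_div_iff₀ byp byp]
      calc ‖s‖ * (c0*(1+‖ρ‖)^2) = ‖s‖ * ((1+‖ρ‖) * (c0*(1+‖ρ‖))) := by ring
        _ ≤ ‖s‖ * (((3 + 2*‖s‖) * ‖s-ρ‖) * ‖ρ‖) := by gcongr
        _ = (‖s‖ * (3+2*‖s‖)) * (‖s-ρ‖*‖ρ‖) := by ring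
        _ ≤ _ := by gcongr
    calc _ ≤ (mz χ ρ : ℝ) * (20*(1+t^2)/(c0*(1+‖ρ‖)^2)) := by gcongr
      _ = _ := by field_simp
  have hG : ∀ t : ℝ, HasSum (fun ρ : ℂ => (mz χ ρ : ℂ) * (1/(((σ:ℂ)+t*I)-ρ) + 1/ρ)) (logDeriv (xiF χ) ((σ:ℂ)+t*I) - logDeriv (xiF χ) 0) := fun t => hadamard hd h0 hC (hn t)
  obtain ⟨h1, h2⟩ := Jsum' δ hX hσ (g := fun (ρ:ℂ) (t:ℝ) => (mz χ ρ : ℂ) * (1/(((σ:ℂ)+t*I)-ρ) + 1/ρ)) (a := fun ρ : ℂ => (20/c0) * ((mz χ ρ : ℝ)/(1+‖ρ‖)^2))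
    (G := fun t : ℝ => logDeriv (xiF χ) ((σ:ℂ)+t*I) - logDeriv (xiF χ) 0) hcont (hsum.mul_left _) hb hG
  refine ⟨h1, h2 (Continuous.sub ?_ continuous_const)⟩
  have c1 : Continuous (deriv (xiF χ)) := (hd.contDiff (n := 1)).continuous_deriv le_rfl
  unfold logDeriv
  exact ((c1.comp (by fun_prop : Continuous fun t : ℝ => (σ:ℂ)+t*I)).div (hd.continuous.comp (by fun_prop)) hn)

lemma JD_diff {χ : DirichletCharacter ℂ q} (hχ : χ.IsPrimitive) (δ : ℝ) {X : ℝ} (hX : 0 < X) :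
    HasSum (fun ρ : ℂ => (mz χ ρ : ℂ) * ((X:ℂ)^ρ * Ff δ ρ))
      ((∫ t : ℝ, Wf δ X 2 t * (logDeriv (xiF χ) (((2:ℝ):ℂ)+t*I) - logDeriv (xiF χ) 0)) -
        ∫ t : ℝ, Wf δ X (-(1/2)) t * (logDeriv (xiF χ) (((-(1/2):ℝ):ℂ)+t*I) - logDeriv (xiF χ) 0)) := by
  refine ((JD hχ δ hX (Or.inl rfl)).1.sub (JD hχ δ hX (Or.inr rfl)).1).congr_fun ?_ |> id
  intro ρ
  by_cases hρ : mz χ ρ = 0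
  · simp [hρ]
  obtain ⟨h1, h2, -⟩ := mz_zero hχ hρ
  have key : ∀ σ : ℝ, -2 < σ → ρ.re ≠ σ → ∫ t : ℝ, Wf δ X σ t * ((mz χ ρ : ℂ) * (1/(((σ:ℂ)+t*I)-ρ) + 1/ρ)) = (mz χ ρ : ℂ) * ((∫ t : ℝ, Wf δ X σ t * (1/(((σ:ℂ)+t*I)-ρ))) + 1/ρ * phf δ ((1/X:ℝ):ℂ)) := by
    intro σ h3 h4
    rw [← Jconst (1/ρ) δ hX h3, ← Jadd (GoodF.pole h4) (GoodF.const _) δ hX h3, ← integral_const_mul]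
    congr 1; funext t; ring
  have hL : ∫ t : ℝ, Wf δ X (-(1/2)) t * (1/((((-(1/2):ℝ):ℂ)+t*I)-ρ)) = - ∫ u in Ioc (0:ℝ) 1, (u:ℂ)^(ρ-1) * phf δ ((u/X : ℝ):ℂ) := by
    rw [← J_left δ hX (by norm_num : (-2:ℝ) < -(1/2)) byl, ← Jneg]
    congr 1; funext t; rw [← neg_sub ρ, div_neg]
  rw [key 2 byn byl, key _ byn byl, hL, J_right δ hX byn byl,
    ← ph_scale δ hX byl]
  ring

lemma polD_refl (q : ℕ) (s : ℂ) : polD q (1-s) = -polD q s := by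
  unfold polD; split_ifs
  · rw [show (1 - s - 1) = -s by ring, ← neg_sub s 1, div_neg, div_neg]; ring
  · simp

lemma polD_diff (q : ℕ) (δ : ℝ) {X : ℝ} (hX : 0 < X) :
    (∫ t : ℝ, Wf δ X 2 t * polD q (((2:ℝ):ℂ)+t*I)) - (∫ t : ℝ, Wf δ X (-(1/2)) t * polD q (((-(1/2):ℝ):ℂ)+t*I)) = if q = 1 then Ff δ 0 + X * Ff δ 1 else 0 := by
  unfold polD
  split_ifs with hq
  · have key : ∀ σ : ℝ, -2 < σ → σ ≠ 0 → σ ≠ 1 → ∫ t : ℝ, Wf δ X σ t * (1/((σ:ℂ)+t*I) + 1/((σ:ℂ)+t*I-1)) = (∫ t : ℝ, Wf δ X σ t * (1/(((σ:ℂ)+t*I)-0))) + ∫ t : ℝ, Wf δ X σ t * (1/(((σ:ℂ)+t*I)-1)) := by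
      intro σ h1 h2 h3
      rw [← Jadd (GoodF.pole (by simpa using h2.symm)) (GoodF.pole (by simpa using h3.symm)) δ hX h1]
      simp
    have hL : ∀ ρ : ℂ, 0 ≤ ρ.re → ∫ t : ℝ, Wf δ X (-(1/2)) t * (1/((((-(1/2):ℝ):ℂ)+t*I)-ρ)) = - ∫ u in Ioc (0:ℝ) 1, (u:ℂ)^(ρ-1) * phf δ ((u/X : ℝ):ℂ) := by
      intro ρ h1
      rw [← J_left δ hX (by norm_num : (-2:ℝ) < -(1/2)) byl, ← Jneg]
      congr 1; funext t; rw [← neg_sub ρ, div_neg]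
    have s0 := ph_scale δ hX (w := 0) (by simp)
    have s1 := ph_scale δ hX (w := 1) (by simp; norm_num)
    rw [cpow_zero, one_mul] at s0
    rw [cpow_one] at s1
    rw [key 2 byn byn byn, key _ byn byn byn, hL 0 (by simp), hL 1 (by simp),
      J_right δ hX byn (by simp), J_right δ hX byn (by simp), ← s0, ← s1]
    ring
  · simp

lemma polD_good (q : ℕ) {σ : ℝ} (h0 : σ ≠ 0) (h1 : σ ≠ 1) : GoodF (fun t : ℝ => polD q ((σ:ℂ)+t*I)) := by
  unfold polD
  split_ifs with hq
  · have := (GoodF.pole (σ := σ) (w := 0) (by simpa using h0.symm)).add (GoodF.pole (σ := σ) (w := 1) (by simpa using h1.symm))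
    simpa using this
  · exact GoodF.const 0

theorem weil {χ : DirichletCharacter ℂ q} (hχ : χ.IsPrimitive) (δ : ℝ) {X : ℝ} (hX : 0 < X) :
    ∃ S S' P1 P2 Z : ℂ,
      HasSum (fun n : ℕ => χ n * (ArithmeticFunction.vonMangoldt n : ℂ) * phf δ ((n/X : ℝ) : ℂ)) S ∧
      HasSum (fun n : ℕ => χ⁻¹ n * (ArithmeticFunction.vonMangoldt n : ℂ) * ((n:ℂ)⁻¹ * phf δ (((n:ℝ)⁻¹/X : ℝ) : ℂ))) S' ∧
      HasSum (fun n : ℕ => phf δ ((1/X:ℝ):ℂ)/(2*n+2) - ∫ u in Ioi (1:ℝ), (u:ℂ)^((-(2*n+kap χ) : ℂ)-1) * phf δ ((u/X : ℝ):ℂ)) P1 ∧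
      HasSum (fun n : ℕ => phf δ ((1/X:ℝ):ℂ)/(2*n+2) - ∫ u in Ioc (0:ℝ) 1, (u:ℂ)^((2*n+1+kap χ : ℂ)-1) * phf δ ((u/X : ℝ):ℂ)) P2 ∧
      HasSum (fun ρ : ℂ => (mz χ ρ : ℂ) * ((X:ℂ)^ρ * Ff δ ρ)) Z ∧
      S + S' + Z = ((Real.log (q/Real.pi) - Real.eulerMascheroniConstant : ℝ):ℂ) * phf δ ((1/X:ℝ):ℂ) + P1 + P2 + (if q = 1 then Ff δ 0 + X * Ff δ 1 else 0) := by
  have k0 := kap_nonneg χ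
  have k1 := kap_le χ
  have hσ2 : (-2:ℝ) < 2 := by norm_num
  have hσm : (-2:ℝ) < -(1/2) := by norm_num
  have p1 := JPsi δ hX hσ2 (f := fun t : ℝ => ((2:ℝ):ℂ)+t*I + kap χ) (by fun_prop) (c := 2 + kap χ) byl (fun t => by simp) (fun t => by simp)
  have p2 := JPsi δ hX hσm (f := fun t : ℝ => 1 - (((-(1/2):ℝ):ℂ)+t*I) + kap χ) (by fun_prop) (c := 3/2 + kap χ) byl (fun t => by simp; ring) (fun t => by simp)
  have d1 := (JD hχ δ hX (Or.inl rfl)).2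
  have d2 := (JD hχ δ hX (Or.inr rfl)).2
  have g1 := polD_good q (σ := 2) byn byn
  have g2 := polD_good q (σ := -(1/2)) byn byn
  refine ⟨_, _, ∫ t : ℝ, Wf δ X 2 t * (digamma ((((2:ℝ):ℂ)+t*I + kap χ)/2) / 2 + (Real.eulerMascheroniConstant/2 : ℝ)), ∫ t : ℝ, Wf δ X (-(1/2)) t * (digamma ((1 - (((-(1/2):ℝ):ℂ)+t*I) + kap χ)/2) / 2 + (Real.eulerMascheroniConstant/2 : ℝ)), _, JLam χ δ hX (by norm_num : (1:ℝ) < 2), JLam' χ⁻¹ δ hX hσm byn, ?_, ?_, JD_diff hχ δ hX, ?_⟩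
  · convert! p1.1 using 1
    funext n
    have e : ∀ t : ℝ, 1/(2*(n:ℂ)+2) - 1/(2*(n:ℂ)+(((2:ℝ):ℂ)+t*I + kap χ)) = 1/(2*(n:ℂ)+2) + -(1/((((2:ℝ):ℂ)+t*I) - (-(2*n+kap χ) : ℂ))) := by
      intro t; rw [sub_eq_add_neg]; congr 4; ring
    have hw : (-(2*n+kap χ) : ℂ).re < 2 := by simp; have : (0:ℝ) ≤ n := by positivity
                                              linarith
    simp only [e]
    rw [Jadd (GoodF.const _) (GoodF.pole hw.ne).neg δ hX hσ2, Jconst _ δ hX hσ2, Jneg, J_right δ hX hσ2 hw]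
    ring
  · convert! p2.1 using 1
    funext n
    have e : ∀ t : ℝ, 1/(2*(n:ℂ)+2) - 1/(2*(n:ℂ)+(1 - (((-(1/2):ℝ):ℂ)+t*I) + kap χ)) = 1/(2*(n:ℂ)+2) + (1/((((-(1/2):ℝ):ℂ)+t*I) - (2*n+1+kap χ : ℂ))) := by
      intro t; rw [sub_eq_add_neg]; congr 1; rw [← div_neg]; congr 1; ring
    have hw : -(1/2) < (2*n+1+kap χ : ℂ).re := by simp; have : (0:ℝ) ≤ n := by positivity
                                                  linarith
    have hL : ∫ t : ℝ, Wf δ X (-(1/2)) t * (1/((((-(1/2):ℝ):ℂ)+t*I)-(2*n+1+kap χ : ℂ))) = - ∫ u in Ioc (0:ℝ) 1, (u:ℂ)^((2*n+1+kap χ : ℂ)-1) * phf δ ((u/X : ℝ):ℂ) := by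
      rw [← J_left δ hX hσm hw, ← Jneg]
      congr 1; funext t; rw [← neg_sub (2*n+1+kap χ : ℂ), div_neg]
    simp only [e]
    rw [Jadd (GoodF.const _) (GoodF.pole hw.ne') δ hX hσm, Jconst _ δ hX hσm, hL]
    ring
  · set D0 := logDeriv (xiF χ) 0
    set c : ℂ := ((Real.log (q/Real.pi)/2 : ℝ):ℂ) with hc
    set γ : ℂ := ((Real.eulerMascheroniConstant/2 : ℝ):ℂ) with hγ
    have E1 : ∫ t : ℝ, Wf δ X 2 t * LamS χ (((2:ℝ):ℂ)+t*I) = (∫ t : ℝ, Wf δ X 2 t * polD q (((2:ℝ):ℂ)+t*I)) + ((c - γ - D0) * phf δ ((1/X:ℝ):ℂ) + ((∫ t : ℝ, Wf δ X 2 t * (digamma ((((2:ℝ):ℂ)+t*I + kap χ)/2) / 2 + γ)) + -∫ t : ℝ, Wf δ X 2 t * (logDeriv (xiF χ) (((2:ℝ):ℂ)+t*I) - D0))) := by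
      rw [← Jconst _ δ hX hσ2, ← Jneg, ← Jadd p1.2 d1.neg δ hX hσ2, ← Jadd (GoodF.const _) (p1.2.add d1.neg) δ hX hσ2, ← Jadd g1 ((GoodF.const _).add (p1.2.add d1.neg)) δ hX hσ2]
      congr 1; funext t; congr 1
      have := xiF_logDeriv hχ (s := ((2:ℝ):ℂ)+t*I) (by rw [line_re]; norm_num)
      rw [this]; ring
    have E2 : ∫ t : ℝ, Wf δ X (-(1/2)) t * LamS χ⁻¹ (1 - (((-(1/2):ℝ):ℂ)+t*I)) = -(∫ t : ℝ, Wf δ X (-(1/2)) t * polD q (((-(1/2):ℝ):ℂ)+t*I)) + ((c - γ + D0) * phf δ ((1/X:ℝ):ℂ) + ((∫ t : ℝ, Wf δ X (-(1/2)) t * (digamma ((1 - (((-(1/2):ℝ):ℂ)+t*I) + kap χ)/2) / 2 + γ)) + ∫ t : ℝ, Wf δ X (-(1/2)) t * (logDeriv (xiF χ) (((-(1/2):ℝ):ℂ)+t*I) - D0))) := by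
      rw [← Jconst _ δ hX hσm, ← Jneg, ← Jadd p2.2 d2 δ hX hσm, ← Jadd (GoodF.const _) (p2.2.add d2) δ hX hσm, ← Jadd g2.neg ((GoodF.const _).add (p2.2.add d2)) δ hX hσm]
      congr 1; funext t; congr 1
      have h1 := xiF_logDeriv (prim_inv hχ) (s := 1 - (((-(1/2):ℝ):ℂ)+t*I)) byn
      have h2 := xiF_logDeriv_fe hχ (1 - (((-(1/2):ℝ):ℂ)+t*I))
      rw [sub_sub_cancel, h1, polD_refl, kap_inv] at h2
      rw [h2]; ring
    have E3 := polD_diff q δ hX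
    rw [E1, E2, ← E3]
    have e : ((Real.log (q/Real.pi) - Real.eulerMascheroniConstant : ℝ):ℂ) = 2*c - 2*γ := by rw [hc, hγ]; push_cast; ring
    rw [e]; ring

end WeilSec2

section RemSec
open Complex DirichletCharacter Filter Topology ComplexConjugate
variable {q : ℕ} [NeZero q]

lemma exp_neg_quad {y : ℝ} (hy : 0 ≤ y) : Real.exp (-y) * (1 + y + y^2/2) ≤ 1 := by
  have h1 := Real.quadratic_le_exp_of_nonneg hy
  calc _ ≤ Real.exp (-y) * Real.exp y := by gcongr
    _ = 1 := by rw [← Real.exp_add]; simp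

lemma v3 {v : ℝ} (hv : 0 ≤ v) : v^3 * Real.exp (-v^4/2) ≤ 1 := by
  have h := exp_neg_quad (y := v^4/2) byp
  rw [show -(v^4/2) = -v^4/2 by ring] at h
  have e := Real.exp_pos (-v^4/2)
  have : v^3 ≤ 1 + v^4/2 + (v^4/2)^2/2 := by
    nlinarith [sq_nonneg (v^2 - 3/2*v), sq_nonneg (v^2-1.5*v), sq_nonneg (v-1.5), sq_nonneg (v^4), sq_nonneg (v^2-v-1/2), sq_nonneg (v^2 - v - 1)]
  nlinarith
lemma v5 {v : ℝ} (hv : 0 ≤ v) : v^5 * Real.exp (-v^4/2) ≤ 3/2 := by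
  have h := exp_neg_quad (y := v^4/2) byp
  rw [show -(v^4/2) = -v^4/2 by ring] at h
  have e := Real.exp_pos (-v^4/2)
  have : v^5 ≤ 3/2*(1 + v^4/2 + (v^4/2)^2/2) := by
    have h1 : v^5 ≤ (v^4 + v^6)/2 := by nlinarith [sq_nonneg (v^2*(v-1))]
    nlinarith [sq_nonneg (v^4 - 4/3*v^2), sq_nonneg (v^4 - 3/2*v^2), sq_nonneg (v^2-3/2), sq_nonneg (v^4-v^2-1)]
  nlinarith
lemma v7 {v : ℝ} (hv : 0 ≤ v) : v^7 * Real.exp (-v^4/2) ≤ 4 := by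
  have h := exp_neg_quad (y := v^4/2) byp
  rw [show -(v^4/2) = -v^4/2 by ring] at h
  have e := Real.exp_pos (-v^4/2)
  have : v^7 ≤ 4*(1 + v^4/2 + (v^4/2)^2/2) := by
    have h1 : v^7 ≤ (v^6/(5/8) + (5/8)*v^8)/2 := by nlinarith [sq_nonneg (v^3*(v-8/5))]
    nlinarith [sq_nonneg (v^4 - 2.2*v^2), sq_nonneg (v^2)]
  nlinarith

noncomputable def KK (δ : ℝ) : ℝ := 6 + 9.43 * |δ|
lemma KK_pos (δ : ℝ) : 0 < KK δ := by unfold KK; positivity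

lemma phf_half (δ : ℝ) {u : ℝ} (hu : 0 ≤ u) : ‖phf δ u‖ ≤ Real.sqrt u := by
  rw [phf_norm]
  have h := v3 (Real.sqrt_nonneg u)
  have e : Real.sqrt u ^ 4 = u^2 := by rw [show (4:ℕ) = 2*2 by rfl, pow_mul, Real.sq_sqrt hu]
  have e2 : u^2 = Real.sqrt u * Real.sqrt u^3 := by rw [← e]; ring
  rw [e] at h
  calc _ = Real.sqrt u * (Real.sqrt u^3 * Real.exp (-u^2/2)) := by rw [← mul_assoc, ← e2]
    _ ≤ Real.sqrt u * 1 := by gcongr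
    _ = _ := mul_one _

lemma phf_lip0 (δ a b : ℝ) : ‖phf δ ((b^2:ℝ):ℂ) - phf δ ((a^2:ℝ):ℂ)‖ ≤ 2 * KK δ * ‖b - a‖ := by
  have hd : ∀ r : ℝ, HasDerivAt (fun r : ℝ => phf δ ((r^2:ℝ):ℂ)) ((4*(r:ℂ)^3 + r^4*(2*Real.pi*I*δ*(2*r) - 2*r^3)) * exp (2*Real.pi*I*δ*(r:ℂ)^2 - (r:ℂ)^4/2)) r := by
    intro r
    have h1 : HasDerivAt (fun z : ℂ => z^4 * exp (2*Real.pi*I*δ*z^2 - z^4/2)) ((4*(r:ℂ)^3 + r^4*(2*Real.pi*I*δ*(2*r) - 2*r^3)) * exp (2*Real.pi*I*δ*(r:ℂ)^2 - (r:ℂ)^4/2)) (r:ℂ) := by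
      have a1 := (hasDerivAt_pow 4 (r:ℂ))
      have a2 := (((hasDerivAt_pow 2 (r:ℂ)).const_mul (2*Real.pi*I*δ)).sub (a1.div_const 2)).cexp
      convert! a1.mul a2 using 1
      simp; ring
    convert! h1.comp_ofReal using 1
    funext y; unfold phf; push_cast; ring_nf
  have hb : ∀ r : ℝ, ‖(4*(r:ℂ)^3 + r^4*(2*Real.pi*I*δ*(2*r) - 2*r^3)) * exp (2*Real.pi*I*δ*(r:ℂ)^2 - (r:ℂ)^4/2)‖ ≤ 2 * KK δ := by
    intro r
    have e1 : (2*Real.pi*I*δ*(r:ℂ)^2 - (r:ℂ)^4/2).re = -r^4/2 := by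
      have : (2*Real.pi*I*δ*(r:ℂ)^2 - (r:ℂ)^4/2) = ((-r^4/2:ℝ):ℂ) + ((2*Real.pi*δ*r^2:ℝ):ℂ)*I := by push_cast; ring
      rw [this]; simp [-ofReal_mul, -ofReal_pow, -ofReal_div, -ofReal_neg]
    have e2 : ‖4*(r:ℂ)^3 + r^4*(2*Real.pi*I*δ*(2*r) - 2*r^3)‖ ≤ 4*|r|^3 + 4*Real.pi*|δ| * |r|^5 + 2*|r|^7 := by
      have : 4*(r:ℂ)^3 + r^4*(2*Real.pi*I*δ*(2*r) - 2*r^3) = 4*(r:ℂ)^3 + (4*Real.pi*I*δ*r^5 - 2*r^7) := by ring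
      rw [this]
      refine (norm_add_le _ _).trans ?_
      have h2 := norm_sub_le (4*Real.pi*I*δ*(r:ℂ)^5) (2*(r:ℂ)^7)
      simp only [norm_mul, norm_pow, Complex.norm_real, Complex.norm_I, Complex.norm_ofNat, Real.norm_eq_abs, abs_of_pos Real.pi_pos, mul_one] at h2 ⊢
      linarith
    rw [norm_mul, norm_exp, e1]
    have a3 := v3 (abs_nonneg r)
    have a5 := v5 (abs_nonneg r)
    have a7 := v7 (abs_nonneg r)
    have : |r|^4 = r^4 := by rw [show (4:ℕ)=2*2 by rfl, pow_mul, sq_abs, ← pow_mul]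
    rw [this] at a3 a5 a7
    have hp := Real.pi_lt_d4
    have h9 : Real.pi * |δ| * (|r|^5*Real.exp (-r^4/2)) ≤ 3.1416 * |δ| * (3/2) := by gcongr
    calc _ ≤ (4*|r|^3 + 4*Real.pi*|δ| * |r|^5 + 2*|r|^7) * Real.exp (-r^4/2) := by gcongr
      _ = 4 * (|r|^3*Real.exp (-r^4/2)) + 4 * (Real.pi * |δ| * (|r|^5*Real.exp (-r^4/2))) + 2 * (|r|^7*Real.exp (-r^4/2)) := by ring
      _ ≤ 4 * 1 + 4 * (3.1416 * |δ| * (3/2)) + 2 * 4 := by linarith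
      _ ≤ _ := by unfold KK; nlinarith [abs_nonneg δ]
  exact Convex.norm_image_sub_le_of_norm_hasDerivWithin_le (f := fun r : ℝ => phf δ ((r^2:ℝ):ℂ)) (s := univ) (fun r _ => (hd r).hasDerivWithinAt) (fun r _ => hb r) convex_univ (mem_univ a) (mem_univ b)

lemma phf_lip (δ : ℝ) {X u : ℝ} (hX : 0 < X) (hu : 0 ≤ u) : ‖phf δ ((u/X:ℝ):ℂ) - phf δ ((1/X:ℝ):ℂ)‖ ≤ 2 * (KK δ / Real.sqrt X) * |Real.sqrt u - 1| := by
  have h := phf_lip0 δ (1/Real.sqrt X) (Real.sqrt u / Real.sqrt X)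
  rw [div_pow, div_pow, Real.sq_sqrt hu, Real.sq_sqrt hX.le, one_pow] at h
  refine h.trans (le_of_eq ?_)
  rw [← sub_div, norm_div, Real.norm_eq_abs, Real.norm_eq_abs, abs_of_nonneg (Real.sqrt_nonneg X)]
  ring

lemma cpow_rpow' {u : ℝ} (hu : 0 ≤ u) (m : ℝ) : (u:ℂ)^(m:ℂ) = ((u^m:ℝ):ℂ) := (ofReal_cpow hu m).symm

lemma Rterm (δ : ℝ) {X m : ℝ} (hX : 0 < X) (hm : 1/2 < m) :
    ‖(∫ u in Ioi (1:ℝ), (u:ℂ)^((-(m:ℂ))-1) * phf δ ((u/X : ℝ):ℂ)) - phf δ ((1/X:ℝ):ℂ)/m‖ ≤ (KK δ / Real.sqrt X) / (m*(m-1/2)) := by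
  have i1 : IntegrableOn (fun u : ℝ => u^(-m-1)) (Ioi 1) := integrableOn_Ioi_rpow_of_lt byl one_pos
  have i2 : IntegrableOn (fun u : ℝ => u^(-m-1/2)) (Ioi 1) := integrableOn_Ioi_rpow_of_lt byl one_pos
  have e1 : ∫ u in Ioi (1:ℝ), u^(-m-1) = 1/m := by
    rw [integral_Ioi_rpow_of_lt byl one_pos, Real.one_rpow, show -m-1+1 = -m by ring, div_neg, neg_div, neg_neg]
  have e2 : ∫ u in Ioi (1:ℝ), u^(-m-1/2) = 1/(m-1/2) := by
    rw [integral_Ioi_rpow_of_lt byl one_pos, Real.one_rpow, show -m-1/2+1 = -(m-1/2) by ring, div_neg, neg_div, neg_neg]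
  have e3 : phf δ ((1/X:ℝ):ℂ)/m = ∫ u in Ioi (1:ℝ), ((u^(-m-1):ℝ):ℂ) * phf δ ((1/X : ℝ):ℂ) := by
    rw [integral_mul_const, integral_complex_ofReal, e1]; push_cast; ring
  have e4 : ∫ u in Ioi (1:ℝ), (u:ℂ)^((-(m:ℂ))-1) * phf δ ((u/X : ℝ):ℂ) = ∫ u in Ioi (1:ℝ), ((u^(-m-1):ℝ):ℂ) * phf δ ((u/X : ℝ):ℂ) := by
    refine setIntegral_congr_fun measurableSet_Ioi fun u hu => ?_
    rw [← cpow_rpow' (zero_le_one.trans (le_of_lt hu))]; push_cast; rfl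
  have hc : Continuous (fun u : ℝ => phf δ ((u/X : ℝ):ℂ)) := (phf_cont δ).comp (by fun_prop : Continuous fun u : ℝ => u/X)
  have i3 : IntegrableOn (fun u : ℝ => ((u^(-m-1):ℝ):ℂ) * phf δ ((u/X : ℝ):ℂ)) (Ioi 1) := by
    refine Integrable.mul_bdd (c := 1) i1.ofReal hc.aestronglyMeasurable (Eventually.of_forall fun u => ?_)
    rw [phf_norm]
    have := exp_neg_quad (y := (u/X)^2/2) byp
    rw [show -((u/X)^2/2) = -(u/X)^2/2 by ring] at this
    have := Real.exp_pos (-(u/X)^2/2)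
    nlinarith [sq_nonneg ((u/X)^2/2 - 1), sq_nonneg ((u/X)^2/2)]
  have i4 : IntegrableOn (fun u : ℝ => ((u^(-m-1):ℝ):ℂ) * phf δ ((1/X : ℝ):ℂ)) (Ioi 1) := i1.ofReal.mul_const _
  rw [e3, e4, ← integral_sub i3 i4]
  calc _ ≤ ∫ u in Ioi (1:ℝ), (2*(KK δ / Real.sqrt X)) * (u^(-m-1/2) - u^(-m-1)) := by
        refine norm_integral_le_of_norm_le ((i2.sub i1).const_mul _) ((ae_restrict_iff' measurableSet_Ioi).2 (Eventually.of_forall fun u hu => ?_))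
        replace hu : 1 < u := hu
        rw [← mul_sub, norm_mul, Complex.norm_real, Real.norm_of_nonneg byp]
        have h1 := phf_lip δ hX (by linarith : 0 ≤ u)
        rw [abs_of_nonneg (by rw [sub_nonneg]; exact Real.one_le_sqrt.2 hu.le)] at h1
        have h2 : u^(-m-1/2) = u^(-m-1) * Real.sqrt u := by rw [Real.sqrt_eq_rpow, ← Real.rpow_add byl]; congr 1; ring
        rw [h2]
        calc _ ≤ u^(-m-1) * (2 * (KK δ / Real.sqrt X) * (Real.sqrt u - 1)) := by gcongr
          _ = _ := by ring
    _ = _ := by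
        rw [integral_const_mul, integral_sub i2 i1, e1, e2]
        have : m - 1/2 ≠ 0 := by linarith
        have : m ≠ 0 := by linarith
        have h3 : 1/(m-1/2) - 1/m = (1/2)/(m*(m-1/2)) := by rw [div_sub_div _ _ (by assumption) (by assumption), mul_comm m]; congr 1; ring
        rw [h3]; ring

lemma Lterm (δ : ℝ) {X m : ℝ} (hX : 0 < X) (hm : 0 < m) :
    ‖(∫ u in Ioc (0:ℝ) 1, (u:ℂ)^((m:ℂ)-1) * phf δ ((u/X : ℝ):ℂ)) - phf δ ((1/X:ℝ):ℂ)/m‖ ≤ (KK δ / Real.sqrt X) / (m*(m+1/2)) := by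
  have ii : ∀ p : ℝ, -1 < p → IntegrableOn (fun u : ℝ => u^p) (Ioc 0 1) ∧ ∫ u in Ioc (0:ℝ) 1, u^p = 1/(p+1) := by
    intro p hp
    have := intervalIntegral.intervalIntegrable_rpow' (a := 0) (b := 1) hp
    rw [intervalIntegrable_iff_integrableOn_Ioc_of_le zero_le_one] at this
    refine ⟨this, ?_⟩
    rw [← intervalIntegral.integral_of_le zero_le_one, integral_rpow (Or.inl hp), Real.one_rpow, Real.zero_rpow byl, sub_zero]
  obtain ⟨i1, e1⟩ := ii (m-1) byl
  obtain ⟨i2, e2⟩ := ii (m-1/2) byl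
  rw [sub_add_cancel] at e1
  rw [show m-1/2+1 = m+1/2 by ring] at e2
  have e3 : phf δ ((1/X:ℝ):ℂ)/m = ∫ u in Ioc (0:ℝ) 1, ((u^(m-1):ℝ):ℂ) * phf δ ((1/X : ℝ):ℂ) := by
    rw [integral_mul_const, integral_complex_ofReal, e1]; push_cast; ring
  have e4 : ∫ u in Ioc (0:ℝ) 1, (u:ℂ)^((m:ℂ)-1) * phf δ ((u/X : ℝ):ℂ) = ∫ u in Ioc (0:ℝ) 1, ((u^(m-1):ℝ):ℂ) * phf δ ((u/X : ℝ):ℂ) := by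
    refine setIntegral_congr_fun measurableSet_Ioc fun u hu => ?_
    rw [← cpow_rpow' hu.1.le]; push_cast; rfl
  have hc : Continuous (fun u : ℝ => phf δ ((u/X : ℝ):ℂ)) := (phf_cont δ).comp (by fun_prop : Continuous fun u : ℝ => u/X)
  have i3 : IntegrableOn (fun u : ℝ => ((u^(m-1):ℝ):ℂ) * phf δ ((u/X : ℝ):ℂ)) (Ioc 0 1) := by
    refine Integrable.mul_bdd (c := 1) i1.ofReal hc.aestronglyMeasurable (Eventually.of_forall fun u => ?_)
    rw [phf_norm]
    have := exp_neg_quad (y := (u/X)^2/2) byp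
    rw [show -((u/X)^2/2) = -(u/X)^2/2 by ring] at this
    have := Real.exp_pos (-(u/X)^2/2)
    nlinarith [sq_nonneg ((u/X)^2/2 - 1), sq_nonneg ((u/X)^2/2)]
  have i4 : IntegrableOn (fun u : ℝ => ((u^(m-1):ℝ):ℂ) * phf δ ((1/X : ℝ):ℂ)) (Ioc 0 1) := i1.ofReal.mul_const _
  rw [e3, e4, ← integral_sub i3 i4]
  calc _ ≤ ∫ u in Ioc (0:ℝ) 1, (2*(KK δ / Real.sqrt X)) * (u^(m-1) - u^(m-1/2)) := by
        refine norm_integral_le_of_norm_le ((i1.sub i2).const_mul _) ((ae_restrict_iff' measurableSet_Ioc).2 (Eventually.of_forall fun u hu => ?_))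
        have hu0 : 0 < u := hu.1
        rw [← mul_sub, norm_mul, Complex.norm_real, Real.norm_of_nonneg byp]
        have h1 := phf_lip δ hX hu0.le
        rw [abs_of_nonpos (by rw [sub_nonpos]; exact Real.sqrt_le_one.2 hu.2), neg_sub] at h1
        have h2 : u^(m-1/2) = u^(m-1) * Real.sqrt u := by rw [Real.sqrt_eq_rpow, ← Real.rpow_add hu0]; congr 1; ring
        rw [h2]
        calc _ ≤ u^(m-1) * (2 * (KK δ / Real.sqrt X) * (1 - Real.sqrt u)) := by gcongr
          _ = _ := by ring
    _ = _ := by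
        rw [integral_const_mul, integral_sub i1 i2, e1, e2]
        have h3 : 1/m - 1/(m+1/2) = (1/2)/(m*(m+1/2)) := by field_simp; ring
        rw [h3]; ring

lemma tele_bound {f : ℕ → ℂ} {P : ℂ} (h : HasSum f P) (B : ℕ → ℝ) (hB : ∀ n, 0 ≤ B n) (hf : ∀ n, ‖f n‖ ≤ B n - B (n+1)) : ‖P‖ ≤ B 0 := by
  have h1 : ∀ N, ‖∑ n ∈ Finset.range N, f n‖ ≤ B 0 - B N := by
    intro N
    induction N with
    | zero => simp
    | succ N ih => rw [Finset.sum_range_succ]; exact (norm_add_le _ _).trans (by linarith [hf N])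
  exact le_of_tendsto h.tendsto_sum_nat.norm (Eventually.of_forall fun N => (h1 N).trans (by linarith [hB N]))

lemma F0_bound {b : ℝ} (hb : 0 < b) {f : ℝ → ℂ} {A : Set ℝ} (hA : MeasurableSet A) (hA0 : A ⊆ Ioi 0) (hf : ∀ u ∈ A, ‖f u‖ ≤ 2*b*(u * Real.exp (-b*u^2))) : ‖∫ u in A, f u‖ ≤ 1 := by
  have hi : IntegrableOn (fun u : ℝ => 2*b*(u * Real.exp (-b*u^2))) (Ioi 0) := ((integrable_mul_exp_neg_mul_sq hb).const_mul _).integrableOn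
  have e : ∫ u in Ioi (0:ℝ), 2*b*(u * Real.exp (-b*u^2)) = 1 := by
    have := integral_rpow_mul_exp_neg_mul_rpow (p := 2) (q := 1) two_pos byn hb
    norm_num at this
    rw [integral_const_mul, show (fun u : ℝ => u * Real.exp (-b*u^2)) = fun u : ℝ => u * Real.exp (-(b*u^2)) by funext u; ring_nf, this, Real.rpow_neg_one]
    field_simp
  refine (norm_integral_le_of_norm_le (hi.mono_set hA0) ((ae_restrict_iff' hA).2 (Eventually.of_forall hf))).trans ?_
  rw [← e]
  refine setIntegral_mono_set hi ((ae_restrict_iff' measurableSet_Ioi).2 (Eventually.of_forall fun u hu => ?_)) hA0.eventuallyLE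
  replace hu : 0 < u := hu
  show 0 ≤ _
  positivity

lemma P1_bound (χ : DirichletCharacter ℂ q) (δ : ℝ) {X : ℝ} (hX : 0 < X) {P : ℂ}
    (h : HasSum (fun n : ℕ => phf δ ((1/X:ℝ):ℂ)/(2*n+2) - ∫ u in Ioi (1:ℝ), (u:ℂ)^((-(2*n+kap χ) : ℂ)-1) * phf δ ((u/X : ℝ):ℂ)) P) :
    ‖P‖ ≤ 1 + ‖phf δ ((1/X:ℝ):ℂ)‖ + (2/3) * (KK δ / Real.sqrt X) := by
  set a := ‖phf δ ((1/X:ℝ):ℂ)‖ with ha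
  set K := KK δ / Real.sqrt X with hK
  have hK0 : 0 ≤ K := div_nonneg (KK_pos δ).le (Real.sqrt_nonneg _)
  have ha0 : 0 ≤ a := norm_nonneg _
  have k0 := kap_nonneg χ
  have k1 := kap_le χ
  have := tele_bound h (fun n => if n = 0 then 1 + a + (2/3)*K else a/(2*n) + K/2/(2*n-5/4)) ?_ ?_
  · simpa using this
  · intro n
    split_ifs with hn
    · positivity
    · have : (1:ℝ) ≤ n := by exact_mod_cast Nat.one_le_iff_ne_zero.2 hn
      have h2 : 0 < 2*(n:ℝ) - 5/4 := by linarith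
      positivity
  · intro n
    rcases eq_or_ne n 0 with rfl | hn
    · norm_num
      have h1 : ‖∫ u in Ioi (1:ℝ), (u:ℂ)^((-(kap χ) : ℂ)-1) * phf δ ((u/X : ℝ):ℂ)‖ ≤ 1 := by
        refine F0_bound (b := 1/(2*X^2)) byp measurableSet_Ioi (Ioi_subset_Ioi zero_le_one) fun u hu => ?_
        replace hu : 1 < u := hu
        have hu0 : 0 < u := by linarith
        rw [norm_mul, phf_norm, Complex.norm_cpow_eq_rpow_re_of_pos hu0]
        have e1 : ((-(kap χ) : ℂ)-1).re = -kap χ - 1 := by simp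
        have h2 : u^(-kap χ - 1) ≤ u⁻¹ := by
          rw [← Real.rpow_neg_one]; exact Real.rpow_le_rpow_of_exponent_le hu.le byl
        rw [e1]
        calc _ ≤ u⁻¹ * ((u/X)^2 * Real.exp (-(u/X)^2/2)) := by gcongr
          _ = _ := by
            rw [show -(u/X)^2/2 = -(1/(2*X^2))*u^2 by field_simp]; field_simp
      refine (norm_sub_le _ _).trans ?_
      push_cast at h1
      rw [norm_div, Complex.norm_ofNat]
      norm_num at ha h1 ⊢
      rw [← ha]
      linarith
    · have hn1 : (1:ℝ) ≤ n := by exact_mod_cast Nat.one_le_iff_ne_zero.2 hn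
      simp only [hn, if_false, Nat.succ_ne_zero]
      set m := 2*(n:ℝ) + kap χ with hm
      have h1 := Rterm δ hX (m := m) byl
      have e1 : (-(2*n+kap χ) : ℂ) = -(m:ℂ) := by rw [hm]; push_cast; ring
      rw [e1]
      set J := ∫ u in Ioi (1:ℝ), (u:ℂ)^((-(m:ℂ))-1) * phf δ ((u/X : ℝ):ℂ)
      have e2 : phf δ ((1/X:ℝ):ℂ)/(2*n+2) - J = phf δ ((1/X:ℝ):ℂ) * ((1/(2*n+2) - 1/m : ℝ):ℂ) - (J - phf δ ((1/X:ℝ):ℂ)/m) := by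
        push_cast; ring
      rw [e2]
      have h2 : |1/(2*(n:ℝ)+2) - 1/m| ≤ 1/(2*n) - 1/(2*n+2) := by
        have b1 : 1/m ≤ 1/(2*(n:ℝ)) := by apply one_div_le_one_div_of_le <;> linarith
        have b2 : 1/(2*(n:ℝ)+2) ≤ 1/m := by apply one_div_le_one_div_of_le <;> linarith
        rw [abs_of_nonpos byl]; linarith
      have h3 : 1/(m*(m-1/2)) ≤ 1/2*(1/(2*n-5/4) - 1/(2*n+3/4)) := by
        have : 1/2*(1/(2*(n:ℝ)-5/4) - 1/(2*n+3/4)) = 1/((2*n-5/4)*(2*n+3/4)) := by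
          have b1 : 2*(n:ℝ)-5/4 ≠ 0 := by linarith
          have b2 : 2*(n:ℝ)+3/4 ≠ 0 := by linarith
          rw [div_sub_div _ _ b1 b2, mul_div_assoc']; congr 1; ring
        rw [this]
        apply one_div_le_one_div_of_le
        · exact mul_pos byl byl
        · nlinarith
      refine (norm_sub_le _ _).trans ?_
      rw [norm_mul, ← ha, Complex.norm_real, Real.norm_eq_abs]
      calc _ ≤ a * (1/(2*n) - 1/(2*n+2)) + K * (1/2*(1/(2*n-5/4) - 1/(2*n+3/4))) := by
            refine add_le_add (by gcongr) (h1.trans ?_)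
            rw [← hK, div_eq_mul_one_div]; gcongr
        _ = _ := by push_cast; rw [show 2*((n:ℝ)+1) - 5/4 = 2*n+3/4 by ring, show 2*((n:ℝ)+1) = 2*n+2 by ring]; ring

lemma P2_bound (χ : DirichletCharacter ℂ q) (δ : ℝ) {X : ℝ} (hX : 0 < X) {P : ℂ}
    (h : HasSum (fun n : ℕ => phf δ ((1/X:ℝ):ℂ)/(2*n+2) - ∫ u in Ioc (0:ℝ) 1, (u:ℂ)^((2*n+1+kap χ : ℂ)-1) * phf δ ((u/X : ℝ):ℂ)) P) :
    ‖P‖ ≤ ‖phf δ ((1/X:ℝ):ℂ)‖ + 2 * (KK δ / Real.sqrt X) := by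
  set a := ‖phf δ ((1/X:ℝ):ℂ)‖ with ha
  set K := KK δ / Real.sqrt X with hK
  have hK0 : 0 ≤ K := div_nonneg (KK_pos δ).le (Real.sqrt_nonneg _)
  have ha0 : 0 ≤ a := norm_nonneg _
  have k0 := kap_nonneg χ
  have k1 := kap_le χ
  have := tele_bound h (fun n => a/(2*n+1) + K/2/(2*n+1/4)) (fun n => by positivity) ?_
  · refine this.trans (le_of_eq ?_); norm_num; ring
  · intro n
    have hn1 : (0:ℝ) ≤ n := by positivity
    set m := 2*(n:ℝ) + 1 + kap χ with hm
    have h1 := Lterm δ hX (m := m) byl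
    have e1 : (2*n+1+kap χ : ℂ) = (m:ℂ) := by rw [hm]; push_cast; ring
    rw [e1]
    set J := ∫ u in Ioc (0:ℝ) 1, (u:ℂ)^((m:ℂ)-1) * phf δ ((u/X : ℝ):ℂ)
    have e2 : phf δ ((1/X:ℝ):ℂ)/(2*n+2) - J = phf δ ((1/X:ℝ):ℂ) * ((1/(2*n+2) - 1/m : ℝ):ℂ) - (J - phf δ ((1/X:ℝ):ℂ)/m) := by
      push_cast; ring
    rw [e2]
    have h2 : |1/(2*(n:ℝ)+2) - 1/m| ≤ 1/(2*n+1) - 1/(2*n+3) := by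
      have b1 : 1/m ≤ 1/(2*(n:ℝ)+1) := by apply one_div_le_one_div_of_le <;> linarith
      have b2 : 1/(2*(n:ℝ)+2) ≤ 1/m := by apply one_div_le_one_div_of_le <;> linarith
      have b3 : 1/(2*(n:ℝ)+3) ≤ 1/(2*(n:ℝ)+2) := by apply one_div_le_one_div_of_le <;> linarith
      rw [abs_of_nonpos byl]; linarith
    have h3 : 1/(m*(m+1/2)) ≤ 1/2*(1/(2*n+1/4) - 1/(2*n+9/4)) := by
      have : 1/2*(1/(2*(n:ℝ)+1/4) - 1/(2*n+9/4)) = 1/((2*n+1/4)*(2*n+9/4)) := by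
        have b1 : 2*(n:ℝ)+1/4 ≠ 0 := by linarith
        have b2 : 2*(n:ℝ)+9/4 ≠ 0 := by linarith
        rw [div_sub_div _ _ b1 b2, mul_div_assoc']; congr 1; ring
      rw [this]
      apply one_div_le_one_div_of_le
      · exact mul_pos byl byl
      · nlinarith
    refine (norm_sub_le _ _).trans ?_
    rw [norm_mul, ← ha, Complex.norm_real, Real.norm_eq_abs]
    calc _ ≤ a * (1/(2*n+1) - 1/(2*n+3)) + K * (1/2*(1/(2*n+1/4) - 1/(2*n+9/4))) := by
          refine add_le_add (by gcongr) (h1.trans ?_)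
          rw [← hK, div_eq_mul_one_div]; gcongr
      _ = _ := by push_cast; rw [show 2*((n:ℝ)+1) + 1/4 = 2*n+9/4 by ring, show 2*((n:ℝ)+1)+1 = 2*n+3 by ring]; ring

lemma S'_bound (χ : DirichletCharacter ℂ q) (δ : ℝ) {X : ℝ} (hX : 0 < X) {S' : ℂ}
    (h : HasSum (fun n : ℕ => χ n * (ArithmeticFunction.vonMangoldt n : ℂ) * ((n:ℂ)⁻¹ * phf δ (((n:ℝ)⁻¹/X : ℝ) : ℂ))) S') :
    ‖S'‖ ≤ 2.06 / Real.sqrt X := by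
  have h1 := (VS_summ (σ := 3/2) byn).hasSum.mul_right (1/Real.sqrt X)
  have := tsum_of_norm_bounded h1 (f := fun n : ℕ => χ n * (ArithmeticFunction.vonMangoldt n : ℂ) * ((n:ℂ)⁻¹ * phf δ (((n:ℝ)⁻¹/X : ℝ) : ℂ))) ?_
  · rw [h.tsum_eq] at this
    refine this.trans ?_
    rw [mul_one_div]
    have := VS_32
    unfold VS at this
    gcongr
  · intro n
    rcases eq_or_ne n 0 with rfl | hn
    · simp
    have hn0 : (0:ℝ) < n := by exact_mod_cast Nat.pos_of_ne_zero hn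
    have c1 := DirichletCharacter.norm_le_one χ (n : ZMod q)
    have c2 : 0 ≤ ArithmeticFunction.vonMangoldt n := ArithmeticFunction.vonMangoldt_nonneg
    have c3 := phf_half δ (u := (n:ℝ)⁻¹/X) byp
    have e : (n:ℝ)⁻¹ * Real.sqrt ((n:ℝ)⁻¹/X) = (n:ℝ)^(-(3/2:ℝ)) * (1/Real.sqrt X) := by
      rw [Real.sqrt_div byp, Real.sqrt_inv, Real.sqrt_eq_rpow (n:ℝ), ← Real.rpow_neg hn0.le, mul_div_assoc', ← Real.rpow_neg_one, ← Real.rpow_add hn0, mul_one_div]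
      norm_num
    rw [norm_mul, norm_mul, norm_mul, norm_inv, Complex.norm_natCast, Complex.norm_real, Real.norm_of_nonneg c2]
    calc _ ≤ 1 * ArithmeticFunction.vonMangoldt n * ((n:ℝ)⁻¹ * Real.sqrt ((n:ℝ)⁻¹/X)) := by gcongr
      _ = _ := by rw [e]; ring

theorem weil_bound {χ : DirichletCharacter ℂ q} (hχ : χ.IsPrimitive) (δ : ℝ) {X : ℝ} (hX : 0 < X) :
    ∃ S Z : ℂ,
      HasSum (fun n : ℕ => χ n * (ArithmeticFunction.vonMangoldt n : ℂ) * phf δ ((n/X : ℝ) : ℂ)) S ∧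
      HasSum (fun ρ : ℂ => (mz χ ρ : ℂ) * ((X:ℂ)^ρ * Ff δ ρ)) Z ∧
      ‖S - (if q = 1 then X * Ff δ 1 else 0)‖ ≤ ‖Z‖ + 2 + (Real.log q + 22 + 26 * |δ|) / Real.sqrt X := by
  obtain ⟨S, S', P1, P2, Z, hS, hS', hP1, hP2, hZ, e⟩ := weil hχ δ hX
  refine ⟨S, Z, hS, hZ, ?_⟩
  have b1 := P1_bound χ δ hX hP1
  have b2 := P2_bound χ δ hX hP2
  have b3 := S'_bound χ⁻¹ δ hX hS'
  have b4 := phf_half δ (u := 1/X) byp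
  have hX' : 0 < Real.sqrt X := Real.sqrt_pos.2 hX
  rw [Real.sqrt_div zero_le_one, Real.sqrt_one] at b4
  have b5 : ‖Ff δ 0‖ ≤ 1 := by
    unfold Ff mellin
    refine F0_bound (b := 1/2) byn measurableSet_Ioi subset_rfl fun u hu => ?_
    replace hu : 0 < u := hu
    rw [norm_smul, Complex.norm_cpow_eq_rpow_re_of_pos hu, phf_norm]
    simp [Real.rpow_neg_one]
    rw [show -u^2/2 = -(1/2*u^2) by ring]; norm_num; field_simp; norm_num
  set c : ℝ := Real.log (q/Real.pi) - Real.eulerMascheroniConstant with hc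
  have hq := one_le_q q
  have hlq := Real.log_nonneg hq
  have b6 : |c| ≤ Real.log q + 1.83 := by
    have g1 := Real.one_half_lt_eulerMascheroniConstant
    have g2 := Real.eulerMascheroniConstant_lt_two_thirds
    have g3 : Real.log Real.pi ≤ 1.16 := by
      have h1 := Real.log_le_sub_one_of_pos (x := Real.pi / Real.exp 1) byp
      rw [Real.log_div Real.pi_ne_zero (Real.exp_pos 1).ne', Real.log_exp] at h1
      have : Real.pi / Real.exp 1 ≤ 1.16 := by
        rw [div_le_iff₀ (Real.exp_pos 1)]; linarith [Real.exp_one_gt_d9, Real.pi_lt_d4]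
      linarith
    have g4 : 0 ≤ Real.log Real.pi := Real.log_nonneg (by linarith [Real.pi_gt_three])
    rw [hc, Real.log_div byl Real.pi_ne_zero, abs_le]
    constructor <;> linarith
  have e2 : S - (if q = 1 then X * Ff δ 1 else 0) = -Z - S' + c * phf δ ((1/X:ℝ):ℂ) + P1 + P2 + (if q = 1 then Ff δ 0 else 0) := by
    split_ifs at e ⊢ <;> linear_combination e
  have b7 : ‖(if q = 1 then Ff δ 0 else 0 : ℂ)‖ ≤ 1 := by split_ifs <;> simp [b5]
  have b8 : ‖(c:ℂ) * phf δ ((1/X:ℝ):ℂ)‖ ≤ (Real.log q + 1.83) * (1/Real.sqrt X) := by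
    rw [norm_mul, Complex.norm_real, Real.norm_eq_abs]; gcongr
  rw [e2]
  have t1 := norm_add_le (-Z - S' + c * phf δ ((1/X:ℝ):ℂ) + P1 + P2) (if q = 1 then Ff δ 0 else 0)
  have t2 := norm_add_le (-Z - S' + c * phf δ ((1/X:ℝ):ℂ) + P1) P2
  have t3 := norm_add_le (-Z - S' + c * phf δ ((1/X:ℝ):ℂ)) P1
  have t4 := norm_add_le (-Z - S') (c * phf δ ((1/X:ℝ):ℂ))
  have t5 := norm_sub_le (-Z) S'
  rw [norm_neg] at t5
  have fin : 1/Real.sqrt X + 1/Real.sqrt X + (8/3) * (KK δ / Real.sqrt X) + 2.06/Real.sqrt X + (Real.log q + 1.83)*(1/Real.sqrt X) ≤ (Real.log q + 22 + 26 * |δ|) / Real.sqrt X := by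
    have : 1/Real.sqrt X + 1/Real.sqrt X + (8/3) * (KK δ / Real.sqrt X) + 2.06/Real.sqrt X + (Real.log q + 1.83)*(1/Real.sqrt X) = (2 + 8/3 * KK δ + 2.06 + Real.log q + 1.83)/Real.sqrt X := by ring
    rw [this]
    refine div_le_div_of_nonneg_right ?_ (Real.sqrt_nonneg X)
    unfold KK; nlinarith [abs_nonneg δ]
  linarith

end RemSec

section
open Real

section NearSec

noncomputable def Wt (t : ℝ) : ℝ := if t ≤ 1 then t else 1/t

lemma Wt_pos {t : ℝ} (ht : 0 < t) : 0 < Wt t := by unfold Wt; split_ifs <;> positivity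

lemma Ioi_split : Ioi (0:ℝ) = Ioc 0 1 ∪ Ioi 1 := (Ioc_union_Ioi_eq_Ioi zero_le_one).symm

lemma Wt_int (d : ℝ) : IntegrableOn (fun t : ℝ => (Wt t : ℂ) * (t:ℂ) ^ (-1 + Complex.I * d)) (Ioi 0) ∧
    ∫ t in Ioi (0:ℝ), (Wt t : ℂ) * (t:ℂ) ^ (-1 + Complex.I * d) = ((2/(1+d^2) : ℝ) : ℂ) := by
  have a1 : EqOn (fun t : ℝ => (Wt t : ℂ) * (t:ℂ) ^ (-1 + Complex.I * d)) (fun t : ℝ => (t:ℂ) ^ (Complex.I * d)) (Ioc 0 1) := by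
    intro t ht
    have h0 : (t:ℂ) ≠ 0 := by exact_mod_cast ht.1.ne'
    simp only [Wt, if_pos ht.2]
    rw [Complex.cpow_add _ _ h0, Complex.cpow_neg_one, ← mul_assoc, mul_inv_cancel₀ h0, one_mul]
  have a2 : EqOn (fun t : ℝ => (Wt t : ℂ) * (t:ℂ) ^ (-1 + Complex.I * d)) (fun t : ℝ => (t:ℂ) ^ (-2 + Complex.I * d)) (Ioi 1) := by
    intro t ht
    replace ht : 1 < t := ht
    have h0 : (t:ℂ) ≠ 0 := by exact_mod_cast (by linarith : t ≠ 0)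
    simp only [Wt, if_neg (not_le.2 ht)]
    rw [show (-2 + Complex.I * d : ℂ) = -1 + (-1 + Complex.I * d) by ring, Complex.cpow_add (-1) (-1 + Complex.I * d) h0, Complex.cpow_neg_one]
    push_cast; rw [one_div]
  have i1 : IntegrableOn (fun t : ℝ => (t:ℂ) ^ (Complex.I * d)) (Ioc 0 1) := by
    have := intervalIntegral.intervalIntegrable_cpow' (a := 0) (b := 1) (r := Complex.I * d) (by simp)
    rwa [intervalIntegrable_iff_integrableOn_Ioc_of_le zero_le_one] at this
  have i2 : IntegrableOn (fun t : ℝ => (t:ℂ) ^ (-2 + Complex.I * d)) (Ioi 1) :=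
    integrableOn_Ioi_cpow_of_lt (by simp) one_pos
  have j1 : IntegrableOn (fun t : ℝ => (Wt t : ℂ) * (t:ℂ) ^ (-1 + Complex.I * d)) (Ioc 0 1) :=
    (integrableOn_congr_fun a1 measurableSet_Ioc).2 i1
  have j2 : IntegrableOn (fun t : ℝ => (Wt t : ℂ) * (t:ℂ) ^ (-1 + Complex.I * d)) (Ioi 1) :=
    (integrableOn_congr_fun a2 measurableSet_Ioi).2 i2
  refine ⟨by rw [Ioi_split]; exact j1.union j2, ?_⟩
  rw [Ioi_split, setIntegral_union Ioc_disjoint_Ioi_same measurableSet_Ioi j1 j2,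
    setIntegral_congr_fun measurableSet_Ioc a1, setIntegral_congr_fun measurableSet_Ioi a2,
    integral_Ioi_cpow_of_lt (by simp) one_pos, ← intervalIntegral.integral_of_le zero_le_one,
    integral_cpow (by left; simp)]
  have n1 : (Complex.I * d + 1 : ℂ) ≠ 0 := by
    intro h; simpa using congrArg Complex.re h
  have n2 : (-2 + Complex.I * d + 1 : ℂ) ≠ 0 := by
    intro h; have := congrArg Complex.re h; norm_num at this
  have n3 : (1 + (d:ℂ)^2) ≠ 0 := by
    have : (1 + d^2 : ℝ) ≠ 0 := by positivity
    exact_mod_cast this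
  simp only [Complex.ofReal_one, Complex.one_cpow, Complex.ofReal_zero, Complex.zero_cpow n1]
  push_cast
  field_simp
  linear_combination (-2 * (d:ℂ)^2) * Complex.I_sq

lemma phW_int : IntegrableOn (fun t : ℝ => (t^2 * exp (-t^2/2))^2 / Wt t) (Ioi 0) ∧
    ∫ t in Ioi (0:ℝ), (t^2 * exp (-t^2/2))^2 / Wt t ≤ 1.052 := by
  have ex : ∀ t : ℝ, (exp (-t^2/2))^2 = exp (-t^2) := fun t => by
    rw [← exp_nat_mul]; congr 1; push_cast; ring
  have a1 : EqOn (fun t : ℝ => (t^2 * exp (-t^2/2))^2 / Wt t) (fun t : ℝ => t^3 * exp (-t^2)) (Ioc 0 1) := by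
    intro t ht
    have h0 : t ≠ 0 := ht.1.ne'
    simp only [Wt, if_pos ht.2, mul_pow, ex]
    field_simp
  have a2 : EqOn (fun t : ℝ => (t^2 * exp (-t^2/2))^2 / Wt t) (fun t : ℝ => t^5 * exp (-t^2)) (Ioi 1) := by
    intro t ht
    replace ht : 1 < t := ht
    have h0 : t ≠ 0 := by linarith
    simp only [Wt, if_neg (not_le.2 ht), mul_pow, ex]
    field_simp
  have d1 : ∀ t : ℝ, HasDerivAt (fun t : ℝ => -((t^2+1)/2 * exp (-t^2))) (t^3 * exp (-t^2)) t := by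
    intro t
    have h1 : HasDerivAt (fun t : ℝ => exp (-t^2)) (exp (-t^2) * (-(2*t))) t := by
      have := ((hasDerivAt_pow 2 t).neg).exp
      simpa using this
    have h2 : HasDerivAt (fun t : ℝ => (t^2+1)/2) (2*t/2) t := by
      have := ((hasDerivAt_pow 2 t).add_const 1).div_const 2
      simpa using this
    refine (h2.mul h1).neg.congr_deriv ?_
    ring
  have d2 : ∀ t : ℝ, HasDerivAt (fun t : ℝ => -((t^4+2*t^2+2)/2 * exp (-t^2))) (t^5 * exp (-t^2)) t := by
    intro t
    have h1 : HasDerivAt (fun t : ℝ => exp (-t^2)) (exp (-t^2) * (-(2*t))) t := by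
      have := ((hasDerivAt_pow 2 t).neg).exp
      simpa using this
    have h2 : HasDerivAt (fun t : ℝ => (t^4+2*t^2+2)/2) ((4*t^3+2*(2*t))/2) t := by
      have := (((hasDerivAt_pow 4 t).add ((hasDerivAt_pow 2 t).const_mul 2)).add_const 2).div_const 2
      simpa using this
    refine (h2.mul h1).neg.congr_deriv ?_
    ring
  have i1 : IntegrableOn (fun t : ℝ => t^3 * exp (-t^2)) (Ioc 0 1) :=
    (Continuous.integrableOn_Icc (by fun_prop)).mono_set Ioc_subset_Icc_self
  have i2 : IntegrableOn (fun t : ℝ => t^5 * exp (-t^2)) (Ioi 1) := by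
    have := int_poly (p := 5) (c := 1) (a := 0) byn one_pos
    refine (this.mono_set (Ioi_subset_Ioi zero_le_one)).congr_fun (fun t ht => ?_) measurableSet_Ioi
    simp only [zero_mul, one_mul, zero_sub]
    congr 1
    exact_mod_cast rpow_natCast t 5
  have lim : Filter.Tendsto (fun t : ℝ => -((t^4+2*t^2+2)/2 * exp (-t^2))) Filter.atTop (nhds 0) := by
    have h : Filter.Tendsto (fun y : ℝ => -((1/2) * (y^2 * exp (-y)) + y^1 * exp (-y) + y^0 * exp (-y))) Filter.atTop (nhds (-((1/2)*0+0+0))) :=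
      (((tendsto_pow_mul_exp_neg_atTop_nhds_zero 2).const_mul (1/2)).add (tendsto_pow_mul_exp_neg_atTop_nhds_zero 1)).add (tendsto_pow_mul_exp_neg_atTop_nhds_zero 0) |>.neg
    have h2 := h.comp (Filter.tendsto_pow_atTop (α := ℝ) (n := 2) byn)
    simp only [mul_zero, add_zero, neg_zero] at h2
    refine h2.congr (fun t => ?_)
    simp only [Function.comp]
    ring
  have v1 : ∫ t in Ioc (0:ℝ) 1, t^3 * exp (-t^2) = 1/2 - exp (-1) := by
    rw [← intervalIntegral.integral_of_le zero_le_one,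
      intervalIntegral.integral_eq_sub_of_hasDerivAt (fun t _ => d1 t) ((by fun_prop : Continuous _).intervalIntegrable _ _)]
    norm_num; ring
  have v2 : ∫ t in Ioi (1:ℝ), t^5 * exp (-t^2) = 5/2 * exp (-1) := by
    rw [integral_Ioi_of_hasDerivAt_of_tendsto' (fun t _ => d2 t) i2 lim]
    norm_num
  have j1 := (integrableOn_congr_fun a1 measurableSet_Ioc).2 i1
  have j2 := (integrableOn_congr_fun a2 measurableSet_Ioi).2 i2
  refine ⟨by rw [Ioi_split]; exact j1.union j2, ?_⟩
  rw [Ioi_split, setIntegral_union Ioc_disjoint_Ioi_same measurableSet_Ioi j1 j2,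
    setIntegral_congr_fun measurableSet_Ioc a1, setIntegral_congr_fun measurableSet_Ioi a2, v1, v2]
  have := exp_neg_one_lt_d9
  linarith

lemma sieve (δ : ℝ) (A : Finset ℂ) (hA : ∀ ρ ∈ A, ρ.re = 1/2) (b : ℂ → ℂ) {lam : ℝ} (hl : 0 < lam) :
    ‖∑ ρ ∈ A, b ρ * Ff δ ρ‖ ≤ (lam * 1.052 + (∑ ρ ∈ A, ∑ ρ' ∈ A, ‖b ρ‖ * ‖b ρ'‖ * (2/(1+(ρ.im-ρ'.im)^2)))/lam)/2 := by
  obtain ⟨p1, p2⟩ := phW_int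
  set g : ℝ → ℂ := fun t => ∑ ρ ∈ A, b ρ * (t:ℂ)^(ρ - 1) with hg
  have hF : ∑ ρ ∈ A, b ρ * Ff δ ρ = ∫ t in Ioi (0:ℝ), g t * phf δ t := by
    have : ∀ ρ ∈ A, IntegrableOn (fun t : ℝ => b ρ * ((t:ℂ)^(ρ-1) * phf δ t)) (Ioi 0) := by
      intro ρ hρ
      have := phf_mellin δ (s := ρ) (by rw [hA ρ hρ]; norm_num)
      exact (show IntegrableOn (fun t : ℝ => (t:ℂ)^(ρ-1) * phf δ t) (Ioi 0) volume from this).const_mul (b ρ)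
    calc _ = ∑ ρ ∈ A, ∫ t in Ioi (0:ℝ), b ρ * ((t:ℂ)^(ρ-1) * phf δ t) := by
          refine Finset.sum_congr rfl fun ρ _ => ?_
          rw [integral_const_mul]; rfl
      _ = ∫ t in Ioi (0:ℝ), ∑ ρ ∈ A, b ρ * ((t:ℂ)^(ρ-1) * phf δ t) := (integral_finset_sum _ this).symm
      _ = _ := by
          congr 1; ext t; simp only [hg, Finset.sum_mul, mul_assoc]
  -- the square
  set D : ℝ → ℂ := fun t => ∑ ρ ∈ A, ∑ ρ' ∈ A, b ρ * (starRingEnd ℂ) (b ρ') * ((Wt t : ℂ) * (t:ℂ)^(-1 + Complex.I * ((ρ.im - ρ'.im : ℝ):ℂ))) with hD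
  have hDi : IntegrableOn D (Ioi 0) := by
    refine integrable_finset_sum _ fun ρ _ => integrable_finset_sum _ fun ρ' _ => ?_
    exact ((Wt_int _).1).const_mul _
  have hDv : ∫ t in Ioi (0:ℝ), D t = ∑ ρ ∈ A, ∑ ρ' ∈ A, b ρ * (starRingEnd ℂ) (b ρ') * ((2/(1+(ρ.im-ρ'.im)^2) : ℝ):ℂ) := by
    rw [integral_finset_sum _ fun ρ _ => integrable_finset_sum _ fun ρ' _ => ((Wt_int _).1).const_mul _]
    refine Finset.sum_congr rfl fun ρ _ => ?_
    rw [integral_finset_sum _ fun ρ' _ => ((Wt_int _).1).const_mul _]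
    refine Finset.sum_congr rfl fun ρ' _ => ?_
    rw [integral_const_mul, (Wt_int _).2]
  have hDg : ∀ t ∈ Ioi (0:ℝ), D t = ((Wt t * ‖g t‖^2 : ℝ) : ℂ) := by
    intro t ht
    have h0 : (t:ℂ) ≠ 0 := by exact_mod_cast (ne_of_gt ht)
    have : ((‖g t‖^2 : ℝ) : ℂ) = g t * (starRingEnd ℂ) (g t) := by
      rw [Complex.mul_conj, Complex.normSq_eq_norm_sq]
    push_cast at this ⊢
    rw [this, hg]
    simp only [map_sum, map_mul, hD]
    rw [Finset.sum_mul_sum]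
    simp only [Finset.mul_sum]
    refine Finset.sum_congr rfl fun ρ hρ => Finset.sum_congr rfl fun ρ' hρ' => ?_
    have e1 : (starRingEnd ℂ) ((t:ℂ)^(ρ'-1)) = (t:ℂ)^((starRingEnd ℂ) ρ' - 1) := by
      rw [show (starRingEnd ℂ) ρ' - 1 = (starRingEnd ℂ) (ρ' - 1) by simp, Complex.cpow_conj, Complex.conj_ofReal]
      · rw [Complex.arg_ofReal_of_nonneg (le_of_lt ht)]; exact Real.pi_pos.ne
    have e2 : (-1 + Complex.I * ((ρ.im - ρ'.im : ℝ):ℂ)) = (ρ - 1) + ((starRingEnd ℂ) ρ' - 1) := by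
      apply Complex.ext
      · simp [hA ρ hρ, hA ρ' hρ']; norm_num
      · simp; ring
    rw [e1, e2, Complex.cpow_add _ _ h0]
    ring
  have hWi : IntegrableOn (fun t => Wt t * ‖g t‖^2) (Ioi 0) := by
    have : IntegrableOn (fun t => (D t).re) (Ioi 0) := hDi.re
    refine this.congr_fun (fun t ht => ?_) measurableSet_Ioi
    simp only [hDg t ht, Complex.ofReal_re]
  have hWv : ∫ t in Ioi (0:ℝ), Wt t * ‖g t‖^2 ≤ ∑ ρ ∈ A, ∑ ρ' ∈ A, ‖b ρ‖ * ‖b ρ'‖ * (2/(1+(ρ.im-ρ'.im)^2)) := by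
    have e : ((∫ t in Ioi (0:ℝ), Wt t * ‖g t‖^2 : ℝ) : ℂ) = ∫ t in Ioi (0:ℝ), D t := by
      rw [setIntegral_congr_fun measurableSet_Ioi hDg, integral_complex_ofReal]
    refine (le_abs_self _).trans ?_
    rw [← norm_eq_abs, ← Complex.norm_real, e, hDv]
    refine (norm_sum_le _ _).trans (Finset.sum_le_sum fun ρ _ => (norm_sum_le _ _).trans (Finset.sum_le_sum fun ρ' _ => ?_))
    rw [norm_mul, norm_mul, RCLike.norm_conj, Complex.norm_real, norm_of_nonneg byp]
  rw [hF]
  have hb : ∀ᵐ t ∂(volume.restrict (Ioi (0:ℝ))), ‖g t * phf δ t‖ ≤ (lam/2) * ((t^2 * exp (-t^2/2))^2 / Wt t) + (1/(2*lam)) * (Wt t * ‖g t‖^2) := by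
    filter_upwards [ae_restrict_mem measurableSet_Ioi] with t ht
    have hW := Wt_pos ht
    rw [norm_mul, phf_norm]
    set u := t^2 * exp (-t^2/2)
    have key : 0 ≤ (lam * u - Wt t * ‖g t‖)^2 := sq_nonneg _
    have : (lam/2) * (u^2 / Wt t) + (1/(2*lam)) * (Wt t * ‖g t‖^2) - ‖g t‖ * u = (lam * u - Wt t * ‖g t‖)^2 / (2*lam*Wt t) := by
      field_simp; ring
    have h2 : 0 ≤ (lam * u - Wt t * ‖g t‖)^2 / (2*lam*Wt t) := by positivity
    linarith
  refine (norm_integral_le_of_norm_le ((p1.const_mul _).add (hWi.const_mul _)) hb).trans ?_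
  simp only [Pi.add_apply]
  rw [integral_add (p1.const_mul _) (hWi.const_mul _), integral_const_mul, integral_const_mul]
  have h1 := mul_le_mul_of_nonneg_left p2 (by positivity : 0 ≤ lam/2)
  have h2 := mul_le_mul_of_nonneg_left hWv (by positivity : 0 ≤ 1/(2*lam))
  refine (add_le_add h1 h2).trans (le_of_eq ?_)
  field_simp

variable {q : ℕ} [NeZero q]

lemma dens_nonneg {χ : DirichletCharacter ℂ q} (hχ : χ.IsPrimitive) {σ t : ℝ} (hs : 1 < σ) (ρ : ℂ) :
    0 ≤ (mz χ ρ:ℝ)*((σ-ρ.re)/((σ-ρ.re)^2+(t-ρ.im)^2)+(σ-1+ρ.re)/((σ-1+ρ.re)^2+(t-ρ.im)^2)) := by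
  by_cases h : mz χ ρ = 0
  · simp [h]
  · obtain ⟨h1, h2, _⟩ := mz_zero hχ h
    have : 0 ≤ σ - ρ.re := by linarith
    have : 0 ≤ σ - 1 + ρ.re := by linarith
    positivity

lemma near_dens {χ : DirichletCharacter ℂ q} (hχ : χ.IsPrimitive) {T : ℝ} (hT : 100 ≤ T) (A : Finset ℂ)
    (hA : ∀ ρ ∈ A, ρ.re = 1/2) {t : ℝ} (ht : |t| ≤ T) :
    ∑ ρ ∈ A, (mz χ ρ : ℝ) * (2/(1+(t-ρ.im)^2)) ≤ 2 * (log (q*T/(2*π))/2 + 3.5) := by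
  have h := sum_le_hasSum A (fun ρ _ => dens_nonneg hχ byn ρ) (dens_hasSum hχ (σ := 3/2) (t := t) byn)
  have h2 := Bf_near hχ hT ht
  refine le_trans (le_of_eq (Finset.sum_congr rfl fun ρ hρ => ?_)) (h.trans byl)
  rw [hA ρ hρ]; norm_num; left
  field_simp; norm_num

lemma near_count {χ : DirichletCharacter ℂ q} (hχ : χ.IsPrimitive) {T : ℝ} (hT : 100 ≤ T) (A : Finset ℂ)
    (hA : ∀ ρ ∈ A, ρ.re = 1/2 ∧ |ρ.im| ≤ T) :
    ∑ ρ ∈ A, (mz χ ρ : ℝ) ≤ (T+1) * (2 * (log (q*T/(2*π))/2 + 3.5)) := by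
  set K := ⌈T⌉₊ with hK
  set B := 2 * (log (q*T/(2*π))/2 + 3.5) with hB
  have hK1 : T ≤ K := Nat.le_ceil T
  have hK2 : (K:ℝ) < T + 1 := Nat.ceil_lt_add_one byl
  have hK0 : (0:ℝ) < K := by linarith
  set c : ℕ → ℝ := fun j => -T + (2*j+1)*(T/K) with hc
  have hw : T / K ≤ 1 := (div_le_one hK0).2 hK1
  have hw0 : 0 < T/K := by positivity
  have hTK : T / K * K = T := by field_simp
  have hcT : ∀ j ∈ Finset.range K, |c j| ≤ T := by
    intro j hj
    have hj' : (j:ℝ) + 1 ≤ K := by exact_mod_cast Finset.mem_range.1 hj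
    have hj0 : (0:ℝ) ≤ j := by positivity
    rw [abs_le]; simp only [hc]
    constructor
    · nlinarith
    · nlinarith
  have hB0 : 0 ≤ B := by
    have h := near_dens hχ hT ∅ (by simp) (t := 0) (by simp; linarith)
    rw [Finset.sum_empty] at h
    exact h
  have h1 : ∀ ρ ∈ A, (mz χ ρ : ℝ) ≤ ∑ j ∈ Finset.range K, (mz χ ρ : ℝ) * (2/(1+(c j-ρ.im)^2)) := by
    intro ρ hρ
    obtain ⟨_, h2⟩ := hA ρ hρ
    rw [abs_le] at h2
    have : ∃ j ∈ Finset.range K, |c j - ρ.im| ≤ 1 := by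
      set y := (ρ.im + T)/(2*(T/K)) with hy
      have hyv : y * (2*(T/K)) = ρ.im + T := by rw [hy]; field_simp
      have hy0 : 0 ≤ y := div_nonneg byl byp
      have hyK : y ≤ K := by
        rw [hy, div_le_iff₀ byp]; nlinarith
      by_cases hlt : y < K
      · refine ⟨⌊y⌋₊, Finset.mem_range.2 ((Nat.floor_lt hy0).2 hlt), ?_⟩
        have f1 := Nat.floor_le hy0
        have f2 := Nat.lt_floor_add_one y
        simp only [hc, abs_le]
        constructor <;> nlinarith
      · have : y = K := le_antisymm hyK (not_lt.1 hlt)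
        have hKp : 0 < K := by exact_mod_cast hK0
        refine ⟨K - 1, Finset.mem_range.2 (by omega), ?_⟩
        have hcast : ((K - 1 : ℕ):ℝ) = K - 1 := by rw [Nat.cast_sub hKp]; simp
        simp only [hc, hcast, abs_le]
        rw [this] at hyv
        constructor <;> nlinarith
    obtain ⟨j, hj, hjy⟩ := this
    refine le_trans ?_ (Finset.single_le_sum (f := fun j => (mz χ ρ : ℝ) * (2/(1+(c j-ρ.im)^2))) (fun i _ => by positivity) hj)
    have : (1:ℝ) ≤ 2/(1+(c j-ρ.im)^2) := by
      rw [le_div_iff₀ byp]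
      have := (sq_le_one_iff_abs_le_one _).2 hjy
      linarith
    have m0 : (0:ℝ) ≤ mz χ ρ := by positivity
    nlinarith
  calc _ ≤ ∑ ρ ∈ A, ∑ j ∈ Finset.range K, (mz χ ρ : ℝ) * (2/(1+(c j-ρ.im)^2)) := Finset.sum_le_sum h1
    _ = ∑ j ∈ Finset.range K, ∑ ρ ∈ A, (mz χ ρ : ℝ) * (2/(1+(c j-ρ.im)^2)) := Finset.sum_comm
    _ ≤ ∑ j ∈ Finset.range K, B := Finset.sum_le_sum fun j hj => near_dens hχ hT A (fun ρ hρ => (hA ρ hρ).1) (hcT j hj)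
    _ = K * B := by simp
    _ ≤ _ := by gcongr

theorem near_bound {χ : DirichletCharacter ℂ q} (hχ : χ.IsPrimitive) {T : ℝ} (hT : 100 ≤ T) (A : Finset ℂ)
    (hA : ∀ ρ ∈ A, ρ.re = 1/2 ∧ |ρ.im| ≤ T) (δ : ℝ) {X : ℝ} (hX : 0 < X) :
    ‖∑ ρ ∈ A, (mz χ ρ:ℂ)*((X:ℂ)^ρ * Ff δ ρ)‖ ≤ 2.052 * (log (q*T/(2*π))/2 + 3.5) * sqrt (T+1) * sqrt X := by
  set B := (log (q*T/(2*π))/2 + 3.5) with hB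
  have hB0 : 0 < B := by
    have : 1 ≤ (q:ℝ)*T/(2*π) := by
      rw [le_div_iff₀ byp]
      have := one_le_q q
      nlinarith [Real.pi_lt_d4]
    have := log_nonneg this
    rw [hB]; linarith
  set M := sqrt (T+1) with hM
  have hM2 : M^2 = T+1 := sq_sqrt byl
  have hM0 : 0 < M := sqrt_pos.2 byl
  have hs := sieve δ A (fun ρ hρ => (hA ρ hρ).1) (fun ρ => (mz χ ρ:ℂ) * (X:ℂ)^(ρ - 1/2)) (lam := 2*B*M) byp
  have hn : ∀ ρ ∈ A, ‖(mz χ ρ:ℂ) * (X:ℂ)^(ρ - 1/2)‖ = mz χ ρ := by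
    intro ρ hρ
    rw [norm_mul, Complex.norm_cpow_eq_rpow_re_of_pos hX]
    simp [(hA ρ hρ).1]
  have h2 : (∑ ρ ∈ A, ∑ ρ' ∈ A, ‖(mz χ ρ:ℂ) * (X:ℂ)^(ρ - 1/2)‖ * ‖(mz χ ρ':ℂ) * (X:ℂ)^(ρ' - 1/2)‖ * (2/(1+(ρ.im-ρ'.im)^2))) ≤ (2*B*M)^2 := by
    calc _ = ∑ ρ ∈ A, (mz χ ρ : ℝ) * ∑ ρ' ∈ A, (mz χ ρ' : ℝ) * (2/(1+(ρ.im-ρ'.im)^2)) := by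
          refine Finset.sum_congr rfl fun ρ hρ => ?_
          rw [Finset.mul_sum]
          refine Finset.sum_congr rfl fun ρ' hρ' => ?_
          rw [hn ρ hρ, hn ρ' hρ', mul_assoc]
      _ ≤ ∑ ρ ∈ A, (mz χ ρ : ℝ) * (2*B) := Finset.sum_le_sum fun ρ hρ =>
          mul_le_mul_of_nonneg_left (near_dens hχ hT A (fun ρ hρ => (hA ρ hρ).1) (hA ρ hρ).2) byp
      _ = (∑ ρ ∈ A, (mz χ ρ : ℝ)) * (2*B) := by rw [Finset.sum_mul]
      _ ≤ ((T+1)*(2*B)) * (2*B) := mul_le_mul_of_nonneg_right (near_count hχ hT A hA) byp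
      _ = _ := by rw [← hM2]; ring
  have e : ∑ ρ ∈ A, (mz χ ρ:ℂ)*((X:ℂ)^ρ * Ff δ ρ) = (sqrt X : ℂ) * ∑ ρ ∈ A, ((mz χ ρ:ℂ) * (X:ℂ)^(ρ - 1/2)) * Ff δ ρ := by
    rw [Finset.mul_sum]
    refine Finset.sum_congr rfl fun ρ _ => ?_
    have hX0 : (X:ℂ) ≠ 0 := by exact_mod_cast hX.ne'
    have : (sqrt X : ℂ) = (X:ℂ)^(1/2:ℂ) := by
      rw [sqrt_eq_rpow, Complex.ofReal_cpow hX.le]; simp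
    rw [this, show (X:ℂ)^ρ = (X:ℂ)^(1/2:ℂ) * (X:ℂ)^(ρ-1/2) by rw [← Complex.cpow_add _ _ hX0]; congr 1; ring]
    ring
  rw [e, norm_mul, Complex.norm_real, norm_of_nonneg (sqrt_nonneg _), mul_comm]
  refine mul_le_mul_of_nonneg_right (hs.trans ?_) (sqrt_nonneg _)
  have h3 := div_le_div_of_nonneg_right h2 (by positivity : 0 ≤ 2*B*M)
  have h4 : (2*B*M)^2/(2*B*M) = 2*B*M := by field_simp
  rw [h4] at h3
  have : 0 < B*M := by positivity
  nlinarith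

end NearSec

end

section
open Real

section FarSec

lemma ker_ge {θ z : ℝ} (h0 : 0 < θ) (h1 : θ ≤ 0.28) (hz : 0 ≤ z) (hz1 : z ≤ 3.46) :
    1 ≤ exp (θ*z) * (3/(3+z^2)) + exp (-(θ*(3.46-z))) * (3/(3+(3.46-z)^2)) := by
  have e1 := add_one_le_exp (θ*z)
  have e2 := add_one_le_exp (-(θ*(3.46-z)))
  have A : (0:ℝ) < 3+z^2 := by positivity
  have B : (0:ℝ) < 3+(3.46-z)^2 := by positivity
  have h : 1 ≤ (θ*z+1) * (3/(3+z^2)) + (-(θ*(3.46-z))+1) * (3/(3+(3.46-z)^2)) := by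
    rw [mul_div_assoc', mul_div_assoc', div_add_div _ _ A.ne' B.ne', le_div_iff₀ byp]
    set p := z*(3.46-z) with hp
    have p0 : 0 ≤ p := mul_nonneg hz byl
    have p3 : p ≤ 3 := by rw [hp]; nlinarith [sq_nonneg (z-1.73)]
    have k : 0 ≤ (3-p)*(3+p+3*θ*(2*z-3.46)) := by
      refine mul_nonneg byl ?_
      nlinarith
    have : (θ*z+1)*3*(3+(3.46-z)^2) + (3+z^2)*((-(θ*(3.46-z))+1)*3) - 1*((3+z^2)*(3+(3.46-z)^2)) = (3-p)*(3+p+3*θ*(2*z-3.46)) := by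
      rw [hp]; ring
    linarith
  have c1 := mul_le_mul_of_nonneg_right e1 (by positivity : 0 ≤ 3/(3+z^2))
  have c2 := mul_le_mul_of_nonneg_right e2 (by positivity : 0 ≤ 3/(3+(3.46-z)^2))
  linarith

lemma f_ge {b y : ℝ} (h0 : 0 < b) (h1 : b < 1) :
    3/(3+y^2) ≤ (2-b)/((2-b)^2+y^2) + (2-1+b)/((2-1+b)^2+y^2) := by
  have A : 0 < (2-b)^2+y^2 := by have : 0 < 2-b := by linarith
                                 positivity
  have B : 0 < (2-1+b)^2+y^2 := by have : 0 < 2-1+b := by linarith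
                                   positivity
  rw [div_add_div _ _ A.ne' B.ne', div_le_div_iff₀ byp byp]
  set p := (2-b)*(1+b) with hp
  have hp2 : 2 ≤ p := by rw [hp]; nlinarith
  have hp3 : p ≤ 9/4 := by rw [hp]; nlinarith [sq_nonneg (b-1/2)]
  have e : ((2-b)*((2-1+b)^2+y^2) + ((2-b)^2+y^2)*(2-1+b)) * (3+y^2) - 3*(((2-b)^2+y^2)*((2-1+b)^2+y^2))
     = 3*((p+y^2)*(3+y^2) - ((p+y^2)^2+y^2*(9-4*p))) := by rw [hp]; ring
  have k : 0 ≤ (p+y^2)*(3+y^2) - ((p+y^2)^2+y^2*(9-4*p)) := by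
    have : (p+y^2)*(3+y^2) - ((p+y^2)^2+y^2*(9-4*p)) = p*(3-p) + y^2*(3*p-6) := by ring
    rw [this]
    have := sq_nonneg y
    have a1 : 0 ≤ p*(3-p) := mul_nonneg byl byl
    have a2 : 0 ≤ y^2*(3*p-6) := mul_nonneg this byl
    linarith
  linarith

variable {q : ℕ} [NeZero q]

lemma Lq_ge {T : ℝ} (hT : 100 ≤ T) : 2.76 ≤ log (q*T/(2*π)) := by
  have h1 : (15.9:ℝ) ≤ q*T/(2*π) := by
    rw [le_div_iff₀ byp]
    have := one_le_q q
    nlinarith [Real.pi_lt_d4]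
  rw [le_log_iff_exp_le byl]
  refine le_trans ?_ h1
  have h2 : exp (2.76:ℝ) = exp 1 ^ 3 * exp (-0.24) := by
    rw [← exp_nat_mul, ← exp_add]; norm_num
  have h3 : exp (-0.24:ℝ) ≤ 0.79 := by
    have h4 := quadratic_le_exp_of_nonneg (x := 0.24) byn
    rw [exp_neg, inv_le_comm₀ (exp_pos _) byn]
    refine le_trans ?_ h4; norm_num
  rw [h2]
  have h5 : exp 1 ^ 3 ≤ 2.7182818286^3 := by
    have := exp_one_lt_d9.le
    gcongr
  calc exp 1 ^ 3 * exp (-0.24) ≤ 2.7182818286^3 * 0.79 := by gcongr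
    _ ≤ 15.9 := by norm_num

lemma far_dens {χ : DirichletCharacter ℂ q} (hχ : χ.IsPrimitive) {t : ℝ} (ht : 98 ≤ |t|) (A : Finset ℂ) :
    ∑ ρ ∈ A, (mz χ ρ : ℝ) * (3/(3+(t-ρ.im)^2)) ≤ log (q*|t|/(2*π)) + 1.24 := by
  have h := sum_le_hasSum A (fun ρ _ => dens_nonneg hχ byn ρ) (dens_hasSum hχ (σ := 2) (t := t) byn)
  have h2 := Bf_far hχ ht
  refine le_trans (Finset.sum_le_sum fun ρ hρ => ?_) (h.trans byl)
  by_cases hm : mz χ ρ = 0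
  · simp [hm]
  obtain ⟨b0, b1, _⟩ := mz_zero hχ hm
  exact mul_le_mul_of_nonneg_left (f_ge b0 b1) byp

theorem farS {χ : DirichletCharacter ℂ q} (hχ : χ.IsPrimitive) {T : ℝ} (hT : 100 ≤ T) {θ : ℝ} (h0 : 0 < θ) (h1 : θ ≤ 0.28)
    {s : ℝ} (hs : s = 1 ∨ s = -1) (A : Finset ℂ) (hA : ∀ ρ ∈ A, T < s * ρ.im) :
    ∑ ρ ∈ A, (mz χ ρ : ℝ) * exp (-(θ*(s*ρ.im - T))) ≤
      (log (q*T/(2*π)) + 1.24)/(1-exp (-(3.46*θ))) * (1 + 1/(4*θ*T)) := by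
  set L := log (q*T/(2*π)) with hL
  have hL0 := Lq_ge (q := q) hT
  rw [← hL] at hL0
  set r := exp (-(3.46*θ)) with hr
  have hr0 : 0 < r := exp_pos _
  have hr1 : r < 1 := by rw [hr, exp_lt_one_iff]; linarith
  have hss : s*s = 1 := by rcases hs with h | h <;> rw [h] <;> norm_num
  have hsa : |s| = 1 := by rcases hs with h | h <;> rw [h] <;> norm_num
  set J : ℂ → ℕ := fun ρ => ⌊(s*ρ.im - T)/3.46⌋₊ with hJ
  set N := A.sup J + 2 with hN
  set c : ℕ → ℝ := fun j => s*(T + 3.46*j) with hc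
  have hcabs : ∀ j, |c j| = T + 3.46*j := by
    intro j; simp only [hc]; rw [abs_mul, hsa, one_mul, abs_of_nonneg byp]
  have key : ∀ ρ ∈ A, (mz χ ρ : ℝ) * exp (-(θ*(s*ρ.im - T))) ≤ ∑ j ∈ Finset.range N, r^j * ((mz χ ρ : ℝ) * (3/(3+(c j-ρ.im)^2))) := by
    intro ρ hρ
    set y := s*ρ.im - T with hy
    have hy0 : 0 ≤ y := by have := hA ρ hρ; rw [hy]; linarith
    set j := J ρ with hj
    have hjN : j + 2 ≤ N := by rw [hN]; have := Finset.le_sup (f := J) hρ; omega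
    have f1 : (j:ℝ) ≤ y/3.46 := Nat.floor_le byp
    have f2 : y/3.46 < j + 1 := Nat.lt_floor_add_one _
    rw [le_div_iff₀ byn] at f1
    rw [div_lt_iff₀ byn] at f2
    have hk := ker_ge h0 h1 (z := y - 3.46*j) byl byl
    have d : ∀ i : ℕ, (c i - ρ.im)^2 = (y - 3.46*i)^2 := by
      intro i
      have : c i - ρ.im = -(s*(y - 3.46*i)) := by simp only [hc, hy]; linear_combination (ρ.im) * hss
      rw [this, neg_sq, mul_pow, pow_two s, hss, one_mul]
    have rp : ∀ i : ℕ, r^i = exp (-(θ*(3.46*i))) := by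
      intro i; rw [hr, ← exp_nat_mul]; congr 1; ring
    have two : r^j * ((mz χ ρ : ℝ) * (3/(3+(c j-ρ.im)^2))) + r^(j+1) * ((mz χ ρ : ℝ) * (3/(3+(c (j+1)-ρ.im)^2))) ≤ ∑ j ∈ Finset.range N, r^j * ((mz χ ρ : ℝ) * (3/(3+(c j-ρ.im)^2))) := by
      rw [← Finset.sum_pair (f := fun j => r^j * ((mz χ ρ : ℝ) * (3/(3+(c j-ρ.im)^2)))) (by omega : j ≠ j+1)]
      refine Finset.sum_le_sum_of_subset_of_nonneg ?_ (fun i _ _ => by positivity)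
      intro i hi
      simp only [Finset.mem_insert, Finset.mem_singleton] at hi
      rw [Finset.mem_range]; omega
    refine le_trans ?_ two
    rw [d, d, rp, rp]
    have x1 : exp (-(θ*(3.46*j))) = exp (-(θ*y)) * exp (θ*(y-3.46*j)) := by
      rw [← exp_add]; congr 1; ring
    have x2 : exp (-(θ*(3.46*((j+1:ℕ):ℝ)))) = exp (-(θ*y)) * exp (-(θ*(3.46-(y-3.46*j)))) := by
      rw [← exp_add]; congr 1; push_cast; ring
    have x3 : (y - 3.46*((j+1:ℕ):ℝ))^2 = (3.46-(y-3.46*j))^2 := by push_cast; ring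
    rw [x1, x2, x3]
    have := mul_le_mul_of_nonneg_left hk (by positivity : 0 ≤ (mz χ ρ : ℝ) * exp (-(θ*y)))
    linarith
  have hq := one_le_q q
  have hB : ∀ j : ℕ, ∑ ρ ∈ A, (mz χ ρ : ℝ) * (3/(3+(c j-ρ.im)^2)) ≤ (L + 1.24) + 3.46/T * j := by
    intro j
    refine (far_dens hχ (t := c j) (by rw [hcabs]; have : (0:ℝ) ≤ j := by positivity
                                       linarith) A).trans ?_
    rw [hcabs]
    have : (q:ℝ)*(T+3.46*j)/(2*π) = (q*T/(2*π)) * (1+3.46/T*j) := by field_simp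
    have hp : 0 < 1+3.46/T*(j:ℝ) := by positivity
    rw [this, log_mul byp hp.ne']
    have := log_le_sub_one_of_pos hp
    linarith
  have g1 := hasSum_geometric_of_lt_one hr0.le hr1
  have g2 := hasSum_coe_mul_geometric_of_norm_lt_one (𝕜 := ℝ) (r := r) (by rw [norm_of_nonneg hr0.le]; exact hr1)
  have hg := (g1.mul_left (L+1.24)).add (g2.mul_left (3.46/T))
  have hu : 3.46*θ*r ≤ 1 - r := by
    have := add_one_le_exp (3.46*θ)
    have e : r * exp (3.46*θ) = 1 := by rw [hr, ← exp_add]; simp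
    nlinarith
  calc _ ≤ ∑ ρ ∈ A, ∑ j ∈ Finset.range N, r^j * ((mz χ ρ : ℝ) * (3/(3+(c j-ρ.im)^2))) := Finset.sum_le_sum key
    _ = ∑ j ∈ Finset.range N, r^j * ∑ ρ ∈ A, ((mz χ ρ : ℝ) * (3/(3+(c j-ρ.im)^2))) := by
        rw [Finset.sum_comm]; simp only [Finset.mul_sum]
    _ ≤ ∑ j ∈ Finset.range N, ((L+1.24)*r^j + 3.46/T*(j*r^j)) := Finset.sum_le_sum fun j _ => by
        have := mul_le_mul_of_nonneg_left (hB j) (by positivity : 0 ≤ r^j)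
        linarith
    _ ≤ (L+1.24)*(1-r)⁻¹ + 3.46/T*(r/(1-r)^2) := sum_le_hasSum _ (fun j _ => by positivity) hg
    _ ≤ _ := by
        have h1r : 0 < 1 - r := by linarith
        have : (L + 1.24)/(1-r) * (1 + 1/(4*θ*T)) - ((L+1.24)*(1-r)⁻¹ + 3.46/T*(r/(1-r)^2)) = ((L+1.24)*(1-r) - 4*(3.46*θ*r)) / (4*θ*T*(1-r)^2) := by
          field_simp; ring
        have h2 : 0 ≤ ((L+1.24)*(1-r) - 4*(3.46*θ*r)) / (4*θ*T*(1-r)^2) := by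
          apply div_nonneg _ byp
          nlinarith
        linarith

end FarSec

end

section
open Real

section Far2
open ProbabilityTheory

lemma gauss_mom (m : ℝ) (v : NNReal) : Integrable (fun t : ℝ => 13/12*t^2+3) (gaussianReal m v) ∧
    ∫ t, (13/12*t^2+3) ∂(gaussianReal m v) = 13/12*(v+m^2)+3 := by
  have hm : MemLp (id : ℝ → ℝ) 2 (gaussianReal m v) := memLp_id_gaussianReal 2
  have h1 := variance_eq_sub hm
  rw [variance_id_gaussianReal] at h1
  have h2 : ∫ x, (id x : ℝ) ∂(gaussianReal m v) = m := integral_id_gaussianReal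
  rw [h2] at h1
  have h3 : Integrable (fun t : ℝ => t^2) (gaussianReal m v) := by
    have := hm.integrable_sq
    simpa using this
  have h4 : ∫ t, t^2 ∂(gaussianReal m v) = v + m^2 := by
    have : ∫ x, ((id : ℝ → ℝ)^2) x ∂(gaussianReal m v) = ∫ t, t^2 ∂(gaussianReal m v) := by simp
    rw [← this]; linarith
  refine ⟨(h3.const_mul _).add (integrable_const _), ?_⟩
  rw [integral_add (h3.const_mul _) (integrable_const _), integral_const_mul, h4]
  simp

lemma gauss_bound {c : ℝ} (hc : 0 < c) (μ : ℝ) :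
    IntegrableOn (fun t : ℝ => (13/12*t^2+3) * exp (μ*t - c/2*t^2)) (Ioi 0) ∧
    ∫ t in Ioi (0:ℝ), (13/12*t^2+3) * exp (μ*t - c/2*t^2) ≤
      sqrt (2*π/c) * exp (μ^2/(2*c)) * (13/12*(1/c+μ^2/c^2)+3) := by
  set v : NNReal := ⟨1/c, by positivity⟩ with hv
  have hv0 : v ≠ 0 := by
    intro h
    have h2 : (1/c:ℝ) = 0 := congrArg NNReal.toReal h
    have : 0 < 1/c := by positivity
    linarith
  have hvr : (v:ℝ) = 1/c := rfl
  obtain ⟨i1, i2⟩ := gauss_mom (μ/c) v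
  have key : ∀ t : ℝ, sqrt (2*π/c) * exp (μ^2/(2*c)) * (gaussianPDFReal (μ/c) v t * (13/12*t^2+3)) = (13/12*t^2+3) * exp (μ*t - c/2*t^2) := by
    intro t
    rw [gaussianPDFReal, hvr]
    have e1 : 2*π*(1/c) = 2*π/c := by ring
    rw [e1]
    have h0 : sqrt (2*π/c) ≠ 0 := by positivity
    have e2 : μ*t - c/2*t^2 = μ^2/(2*c) + -(t-μ/c)^2/(2*(1/c)) := by field_simp; ring
    rw [e2, exp_add]
    field_simp
  have i3 : Integrable (fun t : ℝ => gaussianPDFReal (μ/c) v t * (13/12*t^2+3)) := by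
    rw [gaussianReal_of_var_ne_zero _ hv0] at i1
    rw [integrable_withDensity_iff_integrable_smul' (measurable_gaussianPDF _ _) (by simp [gaussianPDF])] at i1
    refine i1.congr (Filter.Eventually.of_forall fun t => ?_)
    simp [gaussianPDF, ENNReal.toReal_ofReal (gaussianPDFReal_nonneg _ _ _)]
  have i4 : Integrable (fun t : ℝ => (13/12*t^2+3) * exp (μ*t - c/2*t^2)) :=
    (i3.const_mul (sqrt (2*π/c) * exp (μ^2/(2*c)))).congr (Filter.Eventually.of_forall key)
  refine ⟨i4.integrableOn, ?_⟩
  calc _ ≤ ∫ t : ℝ, (13/12*t^2+3) * exp (μ*t - c/2*t^2) :=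
        setIntegral_le_integral i4 (Filter.Eventually.of_forall fun t => by positivity)
    _ = sqrt (2*π/c) * exp (μ^2/(2*c)) * ∫ t : ℝ, gaussianPDFReal (μ/c) v t * (13/12*t^2+3) := by
        rw [← integral_const_mul]; exact integral_congr_ae (Filter.Eventually.of_forall fun t => (key t).symm)
    _ = _ := by
        rw [integral_gaussianReal_eq_integral_smul hv0] at i2
        simp only [smul_eq_mul] at i2
        rw [i2, hvr, div_pow]

lemma rpow_pair {y b : ℝ} (hy : 0 < y) (h0 : 0 ≤ b) (h1 : b ≤ 1) : y^b + y^(1-b) ≤ 1 + y := by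
  have e : y^b * y^(1-b) = y := by rw [← rpow_add hy]; simp
  have hb := rpow_pos_of_pos hy b
  have hb' := rpow_pos_of_pos hy (1-b)
  have : 0 ≤ (1 - y^b)*(1-y^(1-b)) := by
    rcases le_total y 1 with h | h
    · exact mul_nonneg (by linarith [rpow_le_one hy.le h h0]) (by linarith [rpow_le_one hy.le h (by linarith : 0 ≤ 1-b)])
    · exact mul_nonneg_of_nonpos_of_nonpos (by linarith [one_le_rpow h h0]) (by linarith [one_le_rpow h (by linarith : 0 ≤ 1-b)])
  nlinarith

lemma far_pt (δ : ℝ) {x w : ℝ} (hx : 1 ≤ x) (hw : 0 < w) (hw1 : w ≤ 1) {ρ : ℂ} (h0 : 0 < ρ.re) (h1 : ρ.re < 1)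
    {θ s μ : ℝ} (hs : s = 1 ∨ s = -1) (hθ : 0 < θ) (hθ1 : θ ≤ 0.28) (hμ : -(2*π*δ*sin (s*θ)) ≤ μ) :
    ‖((x*w:ℝ):ℂ)^ρ * Ff δ ρ‖ + ‖((x*w:ℝ):ℂ)^(1 - starRingEnd ℂ ρ) * Ff δ (1 - starRingEnd ℂ ρ)‖ ≤
      x * exp (-(θ*(s*ρ.im))) * (sqrt (2*π/cos (2*θ)) * exp (μ^2/(2*cos (2*θ))) * (13/12*(1/cos (2*θ)+μ^2/cos (2*θ)^2)+3)) := by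
  have hX : 0 < x*w := by positivity
  have hc : 0 < cos (2*θ) := cos_pos_of_mem_Ioo ⟨by linarith [Real.pi_pos], by linarith [Real.pi_gt_d4]⟩
  have hcs : cos (2*(s*θ)) = cos (2*θ) := by
    rcases hs with rfl | rfl
    · simp
    · rw [← cos_neg]; congr 1; ring
  have hθs : |s*θ| < π/4 := by
    have : |s*θ| = θ := by rcases hs with rfl | rfl <;> simp [abs_of_pos hθ]
    rw [this]; linarith [Real.pi_gt_d4]
  have b1 := Ff_bound δ (s := ρ) byl hθs
  have b2 := Ff_bound δ (s := 1 - starRingEnd ℂ ρ) (by simp; linarith) hθs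
  rw [hcs] at b1 b2
  have ere : (1 - starRingEnd ℂ ρ).re = 1 - ρ.re := by simp
  have eim : (1 - starRingEnd ℂ ρ).im = ρ.im := by simp
  rw [ere, eim] at b2
  obtain ⟨gi, gb⟩ := gauss_bound hc μ
  have int1 := int_poly (p := ρ.re+1) (a := -(2*π*δ*sin (s*θ))) (c := cos (2*θ)/2) byl byp
  have int2 := int_poly (p := 1-ρ.re+1) (a := -(2*π*δ*sin (s*θ))) (c := cos (2*θ)/2) byl byp
  rw [norm_mul, norm_mul, Complex.norm_cpow_eq_rpow_re_of_pos hX, Complex.norm_cpow_eq_rpow_re_of_pos hX, ere]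
  set I1 := ∫ t in Ioi (0:ℝ), t^(ρ.re+1) * exp (-(2*π*δ*sin (s*θ))*t - cos (2*θ)/2*t^2) with hI1
  set I2 := ∫ t in Ioi (0:ℝ), t^(1-ρ.re+1) * exp (-(2*π*δ*sin (s*θ))*t - cos (2*θ)/2*t^2) with hI2
  have key : (x*w)^ρ.re * I1 + (x*w)^(1-ρ.re) * I2 ≤ x * ∫ t in Ioi (0:ℝ), (13/12*t^2+3) * exp (μ*t - cos (2*θ)/2*t^2) := by
    rw [hI1, hI2, ← integral_const_mul, ← integral_const_mul, ← integral_const_mul, ← integral_add (int1.const_mul _) (int2.const_mul _)]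
    refine setIntegral_mono_on ((int1.const_mul _).add (int2.const_mul _)) (gi.const_mul _) measurableSet_Ioi fun t ht => ?_
    replace ht : 0 < t := ht
    have p := rpow_pair (y := x*w*t) byp h0.le h1.le
    rw [mul_rpow hX.le ht.le, mul_rpow hX.le ht.le] at p
    rw [rpow_add ht, rpow_add ht, rpow_one]
    have e1 : exp (-(2*π*δ*sin (s*θ))*t - cos (2*θ)/2*t^2) ≤ exp (μ*t - cos (2*θ)/2*t^2) := by
      apply exp_le_exp.2
      have := mul_le_mul_of_nonneg_right hμ ht.le
      linarith
    set E := exp (-(2*π*δ*sin (s*θ))*t - cos (2*θ)/2*t^2)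
    calc _ = t * ((x*w)^ρ.re * t^ρ.re + (x*w)^(1-ρ.re) * t^(1-ρ.re)) * E := by ring
      _ ≤ (x*(13/12*t^2+3)) * E := by
        refine mul_le_mul_of_nonneg_right ?_ (exp_pos _).le
        have q1 := mul_le_mul_of_nonneg_left p ht.le
        refine q1.trans ?_
        have q2 : x*w*t ≤ x*t := by nlinarith [mul_pos (lt_of_lt_of_le one_pos hx) ht]
        have q3 : t*(1+x*w*t) ≤ t * (x + x*t) := mul_le_mul_of_nonneg_left byl ht.le
        have q4 : t*(x+x*t) = x*(t+t^2) := by ring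
        rw [q4] at q3
        refine q3.trans (mul_le_mul_of_nonneg_left ?_ byl)
        nlinarith [sq_nonneg (t-6)]
      _ ≤ (x*(13/12*t^2+3)) * exp (μ*t - cos (2*θ)/2*t^2) :=
        mul_le_mul_of_nonneg_left e1 byp
      _ = _ := by ring
  have ee : exp (-(s*θ*ρ.im)) = exp (-(θ*(s*ρ.im))) := by congr 1; ring
  rw [ee] at b1 b2
  have u1 := mul_le_mul_of_nonneg_left b1 (rpow_pos_of_pos hX ρ.re).le
  have u2 := mul_le_mul_of_nonneg_left b2 (rpow_pos_of_pos hX (1-ρ.re)).le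
  have u3 := mul_le_mul_of_nonneg_left (key.trans (mul_le_mul_of_nonneg_left gb byl)) (exp_pos (-(θ*(s*ρ.im)))).le
  nlinarith

noncomputable def GK (θ μ : ℝ) : ℝ := sqrt (2*π/cos (2*θ)) * exp (μ^2/(2*cos (2*θ))) * (13/12*(1/cos (2*θ)+μ^2/cos (2*θ)^2)+3)

noncomputable def FK (q : ℕ) (T θ : ℝ) : ℝ := exp (-(θ*T)) * ((log (q*T/(2*π)) + 1.24)/(1-exp (-(3.46*θ))) * (1 + 1/(4*θ*T)))

variable {q : ℕ} [NeZero q]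

lemma far_sum {χ : DirichletCharacter ℂ q} (hχ : χ.IsPrimitive) {T : ℝ} (hT : 100 ≤ T) {θ : ℝ} (h0 : 0 < θ) (h1 : θ ≤ 0.28)
    {s : ℝ} (hs : s = 1 ∨ s = -1) (A : Finset ℂ) (hA : ∀ ρ ∈ A, T < s * ρ.im)
    (δ : ℝ) {x w μ : ℝ} (hx : 1 ≤ x) (hw : 0 < w) (hw1 : w ≤ 1) (hμ : -(2*π*δ*sin (s*θ)) ≤ μ) :
    ‖∑ ρ ∈ A, (mz χ ρ:ℂ)*(((x*w:ℝ):ℂ)^ρ * Ff δ ρ)‖ ≤ x/2 * (FK q T θ * GK θ μ) := by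
  classical
  set inv : ℂ → ℂ := fun ρ => 1 - starRingEnd ℂ ρ with hinv
  have hii : ∀ ρ, inv (inv ρ) = ρ := fun ρ => by simp [hinv]
  set f : ℂ → ℝ := fun ρ => ‖(mz χ ρ:ℂ)*(((x*w:ℝ):ℂ)^ρ * Ff δ ρ)‖ with hf
  set B := A ∪ A.image inv with hB
  have hBi : B.image inv = B := by
    rw [hB, Finset.image_union, Finset.image_image]
    have : inv ∘ inv = id := funext hii
    rw [this, Finset.image_id, Finset.union_comm]
  have hBT : ∀ ρ ∈ B, T < s * ρ.im := by
    intro ρ hρ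
    rcases Finset.mem_union.1 hρ with h | h
    · exact hA ρ h
    · obtain ⟨r, hr, rfl⟩ := Finset.mem_image.1 h
      have : (inv r).im = r.im := by simp [hinv]
      rw [this]; exact hA r hr
  have hsum : ∑ ρ ∈ B, f ρ = ∑ ρ ∈ B, f (inv ρ) := by
    conv_lhs => rw [← hBi]
    rw [Finset.sum_image]
    intro a _ b _ h
    have := congrArg inv h
    rwa [hii, hii] at this
  have hpt : ∀ ρ ∈ B, f ρ + f (inv ρ) ≤ x * (exp (-(θ*T)) * GK θ μ) * ((mz χ ρ : ℝ) * exp (-(θ*(s*ρ.im - T)))) := by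
    intro ρ hρ
    have hm : mz χ (inv ρ) = mz χ ρ := xiF_order hχ ρ
    by_cases hz : mz χ ρ = 0
    · have : f ρ = 0 := by simp [hf, hz]
      have h2 : f (inv ρ) = 0 := by simp only [hf, hm, hz]; simp
      rw [this, h2, hz]; simp
    · obtain ⟨r0, r1, _⟩ := mz_zero hχ hz
      have := far_pt δ hx hw hw1 r0 r1 hs h0 h1 hμ
      have e1 : f ρ = (mz χ ρ : ℝ) * ‖((x*w:ℝ):ℂ)^ρ * Ff δ ρ‖ := by simp only [hf]; rw [norm_mul]; simp
      have e2 : f (inv ρ) = (mz χ ρ : ℝ) * ‖((x*w:ℝ):ℂ)^(inv ρ) * Ff δ (inv ρ)‖ := by simp only [hf]; rw [norm_mul, hm]; simp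
      rw [e1, e2, ← mul_add]
      refine (mul_le_mul_of_nonneg_left this (Nat.cast_nonneg _)).trans (le_of_eq ?_)
      have e3 : exp (-(θ*(s*ρ.im))) = exp (-(θ*T)) * exp (-(θ*(s*ρ.im - T))) := by
        rw [← exp_add]; congr 1; ring
      rw [e3, GK]; ring
  have hfar := farS hχ hT h0 h1 hs B hBT
  have hc : 0 < cos (2*θ) := cos_pos_of_mem_Ioo ⟨by linarith [Real.pi_pos], by linarith [Real.pi_gt_d4]⟩
  have hG : 0 ≤ GK θ μ := by unfold GK; positivity
  have h2 : 2 * ∑ ρ ∈ B, f ρ ≤ x * (exp (-(θ*T)) * GK θ μ) * ((log (q*T/(2*π)) + 1.24)/(1-exp (-(3.46*θ))) * (1 + 1/(4*θ*T))) := by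
    calc 2 * ∑ ρ ∈ B, f ρ = ∑ ρ ∈ B, (f ρ + f (inv ρ)) := by rw [Finset.sum_add_distrib, ← hsum]; ring
      _ ≤ ∑ ρ ∈ B, x * (exp (-(θ*T)) * GK θ μ) * ((mz χ ρ : ℝ) * exp (-(θ*(s*ρ.im - T)))) := Finset.sum_le_sum hpt
      _ ≤ _ := by rw [← Finset.mul_sum]; exact mul_le_mul_of_nonneg_left hfar byp
  have h3 : ∑ ρ ∈ A, f ρ ≤ ∑ ρ ∈ B, f ρ := Finset.sum_le_sum_of_subset_of_nonneg Finset.subset_union_left (fun _ _ _ => norm_nonneg _)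
  refine (norm_sum_le _ _).trans ?_
  change ∑ ρ ∈ A, f ρ ≤ _
  unfold FK
  nlinarith

theorem Z_bound {χ : DirichletCharacter ℂ q} (hχ : χ.IsPrimitive) {T : ℝ} (hT : 100 ≤ T)
    (hGRH : ∀ ρ : ℂ, χ.LFunction ρ = 0 → 0 < ρ.re → ρ.re < 1 → |ρ.im| ≤ T → ρ.re = 1/2)
    (δ : ℝ) {x w : ℝ} (hx : 1 ≤ x) (hw : 0 < w) (hw1 : w ≤ 1) {Z : ℂ}
    (hZ : HasSum (fun ρ : ℂ => (mz χ ρ : ℂ) * (((x*w:ℝ):ℂ)^ρ * Ff δ ρ)) Z) {θ : ℝ} (h0 : 0 < θ) (h1 : θ ≤ 0.28) :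
    ‖Z‖ ≤ 2.052 * (log (q*T/(2*π))/2 + 3.5) * sqrt (T+1) * sqrt (x*w)
      + x/2 * (FK q T θ * GK θ (2*π*|δ| * sin θ)) + x/2 * (FK q T 0.28 * GK 0.28 0) := by
  classical
  have hsin : ∀ t : ℝ, 0 < t → t ≤ 0.28 → 0 ≤ sin t := fun t a b => sin_nonneg_of_nonneg_of_le_pi a.le (by linarith [Real.pi_gt_d4])
  obtain ⟨s, hs, hsδ⟩ : ∃ s : ℝ, (s = 1 ∨ s = -1) ∧ s*δ = -|δ| := by
    rcases le_total 0 δ with h | h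
    · exact ⟨-1, Or.inr rfl, by rw [abs_of_nonneg h]; ring⟩
    · exact ⟨1, Or.inl rfl, by rw [abs_of_nonpos h]; ring⟩
  have hsins : ∀ t : ℝ, sin (s*t) = s * sin t := by
    intro t; rcases hs with rfl | rfl
    · simp
    · simp
  have hs' : -s = 1 ∨ -s = -1 := by rcases hs with rfl | rfl <;> simp
  refine le_of_tendsto hZ.norm (Filter.Eventually.of_forall fun A => ?_)
  set f : ℂ → ℂ := fun ρ => (mz χ ρ : ℂ) * (((x*w:ℝ):ℂ)^ρ * Ff δ ρ) with hf
  set A0 := A.filter (fun ρ => mz χ ρ ≠ 0) with hA0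
  have e0 : ∑ ρ ∈ A, f ρ = ∑ ρ ∈ A0, f ρ := by
    symm
    refine Finset.sum_subset (Finset.filter_subset _ _) fun ρ hρ hn => ?_
    have : mz χ ρ = 0 := by by_contra h; exact hn (Finset.mem_filter.2 ⟨hρ, h⟩)
    simp [hf, this]
  have e1 : ∑ ρ ∈ A0, f ρ = ∑ ρ ∈ A0.filter (fun ρ => |ρ.im| ≤ T), f ρ + (∑ ρ ∈ (A0.filter (fun ρ => ¬ |ρ.im| ≤ T)).filter (fun ρ => T < s*ρ.im), f ρ
     + ∑ ρ ∈ (A0.filter (fun ρ => ¬ |ρ.im| ≤ T)).filter (fun ρ => ¬ T < s*ρ.im), f ρ) := by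
    rw [Finset.sum_filter_add_sum_filter_not, Finset.sum_filter_add_sum_filter_not]
  have b1 := near_bound hχ hT (A0.filter (fun ρ => |ρ.im| ≤ T)) (by
    intro ρ hρ
    obtain ⟨hρ1, hρ2⟩ := Finset.mem_filter.1 hρ
    obtain ⟨r0, r1, r2⟩ := mz_zero hχ (Finset.mem_filter.1 hρ1).2
    exact ⟨hGRH ρ r2 r0 r1 hρ2, hρ2⟩) δ (X := x*w) byp
  have b2 := far_sum hχ hT h0 h1 hs ((A0.filter (fun ρ => ¬ |ρ.im| ≤ T)).filter (fun ρ => T < s*ρ.im)) (by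
    intro ρ hρ; exact (Finset.mem_filter.1 hρ).2) δ hx hw hw1 (μ := 2*π*|δ| * sin θ) (by
      rw [hsins]
      have : -(2*π*δ*(s*sin θ)) = -(2*π*(s*δ)*sin θ) := by ring
      rw [this, hsδ]; apply le_of_eq; ring)
  have b3 := far_sum hχ hT (θ := 0.28) byn le_rfl hs' ((A0.filter (fun ρ => ¬ |ρ.im| ≤ T)).filter (fun ρ => ¬ T < s*ρ.im)) (by
    intro ρ hρ
    obtain ⟨h1, h2⟩ := Finset.mem_filter.1 hρ
    have h3 := (Finset.mem_filter.1 h1).2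
    have h4 := lt_of_not_ge h3
    rcases lt_abs.1 h4 with h | h <;> rcases hs with rfl | rfl <;> linarith) δ hx hw hw1 (μ := 0) (by
      have e : sin (-s*0.28) = -(s*sin 0.28) := by rw [← hsins, ← sin_neg]; congr 1; ring
      rw [e]
      have : -(2*π*δ*(-(s*sin 0.28))) = (2*π*(s*δ)*sin 0.28) := by ring
      rw [this, hsδ]
      have := hsin 0.28 byn le_rfl
      have : 0 ≤ 2*π*|δ| * sin 0.28 := by positivity
      linarith)
  rw [e0, e1]
  refine (norm_add_le _ _).trans ?_
  have := norm_add_le (∑ ρ ∈ (A0.filter (fun ρ => ¬ |ρ.im| ≤ T)).filter (fun ρ => T < s*ρ.im), f ρ) (∑ ρ ∈ (A0.filter (fun ρ => ¬ |ρ.im| ≤ T)).filter (fun ρ => ¬ T < s*ρ.im), f ρ)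
  linarith

end Far2

end

section
open Real

section EtaSec

lemma eta1_div {t w : ℝ} (hw : 0 < w) : eta1 (t/w) = if w ∈ Icc t (2*t) then 2 else 0 := by
  unfold eta1
  have : t/w ∈ Icc (1/2:ℝ) 1 ↔ w ∈ Icc t (2*t) := by
    rw [mem_Icc, mem_Icc, div_le_one hw, div_le_div_iff₀ byn hw]
    constructor <;> rintro ⟨a, b⟩ <;> constructor <;> linarith
  simp only [this]

lemma eta2_zero {t : ℝ} (h : t ≤ 1/4 ∨ 1 ≤ t) : eta2 t = 0 := by
  unfold eta2 mellinConv
  have : ∀ᵐ w ∂(volume.restrict (Ioi (0:ℝ))), eta1 (t/w) * eta1 w / w = 0 := by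
    have h1 : ∀ᵐ w ∂(volume.restrict (Ioi (0:ℝ))), w ≠ 1 := ae_restrict_of_ae (by simp [ae_iff, measure_singleton])
    have h2 : ∀ᵐ w ∂(volume.restrict (Ioi (0:ℝ))), w ≠ 1/2 := ae_restrict_of_ae (by simp [ae_iff, measure_singleton])
    filter_upwards [ae_restrict_mem measurableSet_Ioi, h1, h2] with w hw h1 h2
    replace hw : 0 < w := hw
    rw [eta1_div hw]
    unfold eta1
    by_cases a : w ∈ Icc t (2*t)
    · by_cases b : w ∈ Icc (1/2:ℝ) 1
      · exfalso
        rcases h with h | h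
        · exact h2 (le_antisymm (by linarith [a.2]) b.1)
        · exact h1 (le_antisymm b.2 (by linarith [a.1]))
      · simp only [b, if_false]; simp
    · simp only [a, if_false]; simp
  rw [integral_congr_ae this]; simp

lemma eta2_mid {t a b : ℝ} (hab : a ≤ b) (h : Icc t (2*t) ∩ Icc (1/2:ℝ) 1 = Icc a b) : eta2 t = 4 * (log b - log a) := by
  have ha : 0 < a := by
    have : a ∈ Icc t (2*t) ∩ Icc (1/2:ℝ) 1 := by rw [h]; exact left_mem_Icc.2 hab
    linarith [this.2.1]
  unfold eta2 mellinConv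
  have e : ∀ w ∈ Ioi (0:ℝ), eta1 (t/w) * eta1 w / w = (Icc a b).indicator (fun w => 4 * w⁻¹) w := by
    intro w hw
    rw [eta1_div hw]
    unfold eta1
    rw [← h]
    by_cases p : w ∈ Icc t (2*t) <;> by_cases r : w ∈ Icc (1/2:ℝ) 1
    · rw [indicator_of_mem (show w ∈ Icc t (2*t) ∩ Icc (1/2:ℝ) 1 from ⟨p, r⟩)]; simp only [p, r, if_true]; ring
    · rw [indicator_of_notMem (fun hh => r hh.2)]; simp only [r, if_false]; simp
    · rw [indicator_of_notMem (fun hh => p hh.1)]; simp only [p, if_false]; simp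
    · rw [indicator_of_notMem (fun hh => p hh.1)]; simp only [p, if_false]; simp
  rw [setIntegral_congr_fun measurableSet_Ioi e, setIntegral_indicator measurableSet_Icc]
  have : Ioi (0:ℝ) ∩ Icc a b = Icc a b := inter_eq_right.2 fun w hw => lt_of_lt_of_le ha hw.1
  rw [this, integral_Icc_eq_integral_Ioc, ← intervalIntegral.integral_of_le hab, intervalIntegral.integral_const_mul, integral_inv_of_pos ha byl, log_div byl ha.ne']

lemma eta2_lo {t : ℝ} (h1 : 1/4 ≤ t) (h2 : t ≤ 1/2) : eta2 t = 4 * log (4*t) := by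
  rw [eta2_mid (a := 1/2) (b := 2*t) byl]
  · rw [← log_div byl byn]; congr 2; ring
  · ext w; simp only [mem_inter_iff, mem_Icc]
    constructor
    · rintro ⟨⟨a, b⟩, c, d⟩; exact ⟨c, b⟩
    · rintro ⟨a, b⟩; exact ⟨⟨by linarith, b⟩, a, by linarith⟩

lemma eta2_hi {t : ℝ} (h1 : 1/2 ≤ t) (h2 : t ≤ 1) : eta2 t = -(4 * log t) := by
  rw [eta2_mid (a := t) (b := 1) byl]
  · simp
  · ext w; simp only [mem_inter_iff, mem_Icc]
    constructor
    · rintro ⟨⟨a, b⟩, c, d⟩; exact ⟨a, d⟩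
    · rintro ⟨a, b⟩; exact ⟨⟨a, by linarith⟩, by linarith, b⟩

lemma eta2_nonneg (t : ℝ) : 0 ≤ eta2 t := by
  rcases le_total t (1/4) with h | h
  · rw [eta2_zero (Or.inl h)]
  rcases le_total t (1/2) with h2 | h2
  · rw [eta2_lo h h2]; have := log_nonneg (show 1 ≤ 4*t by linarith); linarith
  rcases le_total t 1 with h3 | h3
  · rw [eta2_hi h2 h3]; have := log_nonpos byl h3; linarith
  · rw [eta2_zero (Or.inr h3)]

lemma eta2_cont : Continuous eta2 := by
  have e : eta2 = fun t => if t ≤ 1/4 then 0 else if t ≤ 1/2 then 4 * log (4*max t (1/4)) else if t ≤ 1 then -(4*log (max t (1/4))) else 0 := by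
    funext t
    split_ifs with h1 h2 h3
    · exact eta2_zero (Or.inl h1)
    · rw [eta2_lo byl h2, max_eq_left byl]
    · rw [eta2_hi byl h3, max_eq_left byl]
    · exact eta2_zero (Or.inr byl)
  have hm : Continuous fun t : ℝ => max t (1/4) := by fun_prop
  have hm0 : ∀ t : ℝ, max t (1/4) ≠ 0 := fun t => by have := le_max_right t (1/4:ℝ); linarith
  have c1 : Continuous fun t : ℝ => 4 * log (4*max t (1/4)) := continuous_const.mul (Continuous.log (by fun_prop) (fun t => mul_ne_zero byn (hm0 t)))
  have c2 : Continuous fun t : ℝ => -(4 * log (max t (1/4))) := (continuous_const.mul (Continuous.log hm hm0)).neg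
  rw [e]
  refine Continuous.if_le continuous_const (Continuous.if_le c1 (Continuous.if_le c2 continuous_const continuous_id continuous_const ?_) continuous_id continuous_const ?_) continuous_id continuous_const ?_
  · intro t ht; rw [ht]; norm_num
  · intro t ht; rw [ht]
    norm_num
    rw [show (1/2:ℝ) = 2⁻¹ by norm_num, log_inv]; ring
  · intro t ht; rw [ht]; norm_num

/-- kernel -/
noncomputable def kk (w : ℝ) : ℝ := eta2 w / w

lemma kk_nonneg {w : ℝ} (hw : w ∈ IQ) : 0 ≤ kk w := div_nonneg (eta2_nonneg w) (by linarith [hw.1])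

lemma kk_contOn : ContinuousOn kk (Icc (1/4:ℝ) 1) := by
  unfold kk
  exact eta2_cont.continuousOn.div continuousOn_id fun w hw => by have := hw.1; show w ≠ 0; linarith

lemma kk_int {E : Type*} [NormedAddCommGroup E] [NormedSpace ℝ E] {f : ℝ → E} (hf : ContinuousOn f (Icc (1/4:ℝ) 1)) : IntegrableOn (fun w => kk w • f w) IQ :=
  ((kk_contOn.smul hf).integrableOn_Icc).mono_set Ioc_subset_Icc_self

lemma kk_ftc {g F1 F2 : ℝ → ℝ} (hg : ContinuousOn g (Icc (1/4:ℝ) 1))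
    (h1 : ∀ w ∈ Icc (1/4:ℝ) (1/2), HasDerivAt F1 (4*log (4*w)/w*g w) w)
    (h2 : ∀ w ∈ Icc (1/2:ℝ) 1, HasDerivAt F2 (-(4*log w)/w*g w) w) :
    ∫ w in IQ, kk w * g w = (F1 (1/2) - F1 (1/4)) + (F2 1 - F2 (1/2)) := by
  have hc : ContinuousOn (fun w => kk w * g w) (Icc (1/4:ℝ) 1) := kk_contOn.mul hg
  rw [← intervalIntegral.integral_of_le byn]
  have i1 : IntervalIntegrable (fun w => kk w * g w) volume (1/4) (1/2) := by
    apply ContinuousOn.intervalIntegrable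
    rw [uIcc_of_le byn]
    exact hc.mono (Icc_subset_Icc le_rfl byn)
  have i2 : IntervalIntegrable (fun w => kk w * g w) volume (1/2) 1 := by
    apply ContinuousOn.intervalIntegrable
    rw [uIcc_of_le byn]
    exact hc.mono (Icc_subset_Icc byn le_rfl)
  rw [← intervalIntegral.integral_add_adjacent_intervals i1 i2]
  congr 1
  · refine intervalIntegral.integral_eq_sub_of_hasDerivAt (fun w hw => ?_) i1
    rw [uIcc_of_le byn] at hw
    rw [kk, eta2_lo hw.1 hw.2]; exact h1 w hw
  · refine intervalIntegral.integral_eq_sub_of_hasDerivAt (fun w hw => ?_) i2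
    rw [uIcc_of_le byn] at hw
    rw [kk, eta2_hi hw.1 hw.2]; exact h2 w hw

lemma log4_deriv {w : ℝ} (hw : 0 < w) : HasDerivAt (fun w => log (4*w)) (1/w) w := by
  have := ((hasDerivAt_id w).const_mul 4).log (by simp; exact hw.ne')
  simp only [id] at this
  convert this using 1
  field_simp

lemma kk_m1 : ∫ w in IQ, kk w ≤ 1.93 := by
  have := kk_ftc (g := fun _ => 1) (F1 := fun w => 2*log (4*w)^2) (F2 := fun w => -(2*log w^2)) continuousOn_const
    (fun w hw => by
      have hw0 : 0 < w := by linarith [hw.1]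
      refine HasDerivAt.congr_deriv (((log4_deriv hw0).pow 2).const_mul 2) ?_
      beta_reduce
      field_simp; ring)
    (fun w hw => by
      have hw0 : 0 < w := by linarith [hw.1]
      refine HasDerivAt.congr_deriv ((((hasDerivAt_log hw0.ne').pow 2).const_mul 2).neg) ?_
      beta_reduce
      field_simp; ring)
  simp only [mul_one] at this
  rw [this]
  norm_num
  rw [show (1/2:ℝ) = 2⁻¹ by norm_num, log_inv]
  nlinarith [log_two_lt_d9, log_two_gt_d9]

lemma kk_mh : ∫ w in IQ, kk w * sqrt w ≤ 1.373 := by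
  have := kk_ftc (g := fun w => sqrt w) (F1 := fun w => 4*(sqrt w * (2*log (4*w)-4))) (F2 := fun w => -(4*(sqrt w * (2*log w-4)))) (by fun_prop)
    (fun w hw => by
      have hw0 : 0 < w := by linarith [hw.1]
      have hs := sq_sqrt hw0.le
      have hs0 := sqrt_pos.2 hw0
      refine HasDerivAt.congr_deriv ((((hasDerivAt_sqrt hw0.ne').mul (((log4_deriv hw0).const_mul 2).sub_const 4)).const_mul 4)) ?_
      beta_reduce
      field_simp; rw [hs]; ring)
    (fun w hw => by
      have hw0 : 0 < w := by linarith [hw.1]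
      have hs := sq_sqrt hw0.le
      have hs0 := sqrt_pos.2 hw0
      refine HasDerivAt.congr_deriv ((((hasDerivAt_sqrt hw0.ne').mul (((hasDerivAt_log hw0.ne').const_mul 2).sub_const 4)).const_mul 4).neg) ?_
      beta_reduce
      field_simp; rw [hs]; ring)
  rw [this]
  have e : sqrt (1/4) = 1/2 := by rw [show (1/4:ℝ) = (1/2)^2 by norm_num]; exact sqrt_sq byn
  have e2 : 0.7071 ≤ sqrt (1/2) := le_sqrt_of_sq_le byn
  rw [e]
  norm_num
  rw [show (1/2:ℝ) = 2⁻¹ by norm_num, log_inv]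
  rw [show (1/2:ℝ) = 2⁻¹ by norm_num] at e2
  norm_num at e2 ⊢
  nlinarith [log_two_lt_d9, log_two_gt_d9]

lemma kk_m3 : ∫ w in IQ, kk w * (1/sqrt w) ≤ 2.75 := by
  have := kk_ftc (g := fun w => 1/sqrt w) (F1 := fun w => 4*((-2*log (4*w)-4)/sqrt w)) (F2 := fun w => -(4*((-2*log w-4)/sqrt w)))
    (continuousOn_const.div (by fun_prop) (fun w hw => by have := sqrt_pos.2 (show 0 < w by linarith [hw.1]); exact this.ne'))
    (fun w hw => by
      have hw0 : 0 < w := by linarith [hw.1]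
      have hs := sq_sqrt hw0.le
      have hs0 := sqrt_pos.2 hw0
      refine HasDerivAt.congr_deriv ((((((log4_deriv hw0).const_mul (-2)).sub_const 4)).div (hasDerivAt_sqrt hw0.ne') hs0.ne').const_mul 4) ?_
      beta_reduce
      field_simp; rw [hs]; ring)
    (fun w hw => by
      have hw0 : 0 < w := by linarith [hw.1]
      have hs := sq_sqrt hw0.le
      have hs0 := sqrt_pos.2 hw0
      refine HasDerivAt.congr_deriv (((((((hasDerivAt_log hw0.ne').const_mul (-2)).sub_const 4)).div (hasDerivAt_sqrt hw0.ne') hs0.ne').const_mul 4).neg) ?_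
      beta_reduce
      field_simp; rw [hs]; ring)
  rw [this]
  have e : sqrt (1/4) = 1/2 := by rw [show (1/4:ℝ) = (1/2)^2 by norm_num]; exact sqrt_sq byn
  have e2 : sqrt (1/2) ≤ 0.70711 := sqrt_le_iff.2 byn
  have e3 : 0 < sqrt (1/2) := by positivity
  have e4 : 1/0.70711 ≤ 1/sqrt (1/2) := one_div_le_one_div_of_le e3 e2
  rw [e]
  have l : log (1/2) = -log 2 := by rw [one_div, log_inv]
  rw [l, show (4*(1/2):ℝ) = 2 by norm_num, show (4*(1/4):ℝ) = 1 by norm_num, log_one, sqrt_one]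
  have e5 : (1.4142:ℝ) ≤ 1/sqrt (1/2) := le_trans byn e4
  have e6 : 4*((-2*log 2-4)/sqrt (1/2)) - 4*((-2*0-4)/(1/2)) + (-(4*((-2*0-4)/1)) - -(4*((-2* -log 2-4)/sqrt (1/2)))) = 48 - 32*(1/sqrt (1/2)) := by ring
  rw [e6]
  norm_num at e5 ⊢
  linarith

lemma eta2_le {w : ℝ} (h1 : 1/4 ≤ w) (h2 : w ≤ 1) : eta2 w ≤ 2*w^2*(1-w^2)*exp (2.8*(1-w^2)) := by
  have hw : 0 < w := by linarith
  rcases le_total w (1/2) with h | h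
  · rw [eta2_lo h1 h]
    have a1 : log (4*w) ≤ 16*w^2*(exp 1)⁻¹/2 := by
      have := log_le_sub_one_of_pos (show 0 < 16*w^2*(exp 1)⁻¹ by positivity)
      rw [log_mul byp byp, log_inv, log_exp, show 16*w^2 = (4*w)^2 by ring, log_pow] at this
      push_cast at this; nlinarith
    have a2 : (8:ℝ) ≤ exp (2.8*(1-w^2)) := by
      have : exp 2.1 ≤ exp (2.8*(1-w^2)) := exp_le_exp.2 (by nlinarith)
      have e : exp 2.1 = exp 1^2 * exp 0.1 := by rw [← exp_nat_mul, ← exp_add]; norm_num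
      have := add_one_le_exp (0.1:ℝ)
      have := exp_one_gt_d9
      nlinarith [exp_pos 1]
    have a3 : (exp 1)⁻¹ ≤ 0.368 := by
      have := exp_neg_one_lt_d9
      rw [exp_neg] at this; linarith
    have a4 : 0.75 * 8 ≤ (1-w^2)*exp (2.8*(1-w^2)) := mul_le_mul (by nlinarith) a2 byn (by nlinarith)
    have a5 := mul_le_mul_of_nonneg_left a3 (sq_nonneg w)
    have a6 := mul_le_mul_of_nonneg_left a4 (sq_nonneg w)
    have e : 2*w^2*(1-w^2)*exp (2.8*(1-w^2)) = 2*(w^2*((1-w^2)*exp (2.8*(1-w^2)))) := by ring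
    rw [e]
    have a7 : 0 ≤ w^2 := sq_nonneg w
    norm_num at a5 a6 ⊢
    linarith
  · rw [eta2_hi h h2]
    have c := strictConcaveOn_log_Ioi.concaveOn.2 (show (1:ℝ) ∈ Ioi 0 by simp) (show (1/4:ℝ) ∈ Ioi 0 by norm_num)
      (show (0:ℝ) ≤ 1 - (1-w^2)/0.75 from (by
        rw [sub_nonneg, div_le_one byn]; nlinarith)) (show 0 ≤ (1-w^2)/0.75 from div_nonneg (by nlinarith) byn) (by ring)
    simp only [smul_eq_mul, log_one, mul_zero, zero_add] at c
    have e : (1 - (1-w^2)/0.75) * 1 + (1-w^2)/0.75 * (1/4) = w^2 := by ring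
    have l : log (1/4) = -(2*log 2) := by rw [one_div, log_inv, show (4:ℝ) = 2^2 by norm_num, log_pow]; norm_num
    rw [e, l, log_pow] at c
    push_cast at c
    have hs : 0 ≤ 1-w^2 := by nlinarith
    have c2 : -3*log w ≤ 2.8*(1-w^2) := by nlinarith [log_two_lt_d9]
    have c3 : 1/w^3 ≤ exp (2.8*(1-w^2)) := by
      calc 1/w^3 = exp (-3*log w) := by
            rw [show -3*log w = -((3:ℕ)*log w) by push_cast; ring, exp_neg, exp_nat_mul, exp_log hw]; simp
        _ ≤ _ := exp_le_exp.2 c2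
    have c4 : -(2*log w) ≤ (1-w^2)/w := by
      have := self_le_sinh_iff.2 (show 0 ≤ -log w by have := log_nonpos hw.le h2; linarith)
      rw [sinh_eq, neg_neg, exp_neg, exp_log hw] at this
      have e : (1-w^2)/w = w⁻¹ - w := by field_simp
      rw [e]; linarith
    calc -(4*log w) ≤ 2*((1-w^2)/w) := by linarith
      _ = 2*w^2*(1-w^2)*(1/w^3) := by field_simp
      _ ≤ _ := mul_le_mul_of_nonneg_left c3 byp

lemma kk_exp_cont (G : ℝ) : IntegrableOn (fun w => kk w * exp (G*w^2)) IQ :=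
  kk_int (f := fun w => exp (G*w^2)) (by fun_prop)

lemma kk_exp {G : ℝ} (hG : 2.8 < G) : ∫ w in IQ, kk w * exp (G*w^2) ≤ exp G / (G-2.8)^2 := by
  set H := G - 2.8 with hH
  have hH0 : 0 < H := by linarith
  have i2 : IntervalIntegrable (fun w : ℝ => exp G * (2*w*(1-w^2)*exp (-(H*(1-w^2))))) volume (1/4) 1 := Continuous.intervalIntegrable (by fun_prop) _ _
  calc _ ≤ ∫ w in IQ, exp G * (2*w*(1-w^2)*exp (-(H*(1-w^2)))) := by
        refine setIntegral_mono_on (kk_exp_cont G) ((intervalIntegrable_iff_integrableOn_Ioc_of_le byn).1 i2) measurableSet_Ioc fun w hw => ?_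
        have hw0 : 0 < w := by linarith [hw.1]
        have := eta2_le hw.1.le hw.2
        rw [kk]
        have e : exp G * (2*w*(1-w^2)*exp (-(H*(1-w^2)))) = (2*w^2*(1-w^2)*exp (2.8*(1-w^2)))/w*exp (G*w^2) := by
          have : exp G * exp (-(H*(1-w^2))) = exp (2.8*(1-w^2)) * exp (G*w^2) := by
            rw [← exp_add, ← exp_add]; congr 1; rw [hH]; ring
          rw [show (2*w^2*(1-w^2)*exp (2.8*(1-w^2)))/w = 2*w*(1-w^2)*exp (2.8*(1-w^2)) by field_simp]
          linear_combination (2*w*(1-w^2))*this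
        rw [e]
        exact mul_le_mul_of_nonneg_right (div_le_div_of_nonneg_right this hw0.le) (exp_pos _).le
    _ = exp G * (1/H^2) - exp G * (((1-(1/4)^2)/H+1/H^2)*exp (-(H*(1-(1/4)^2)))) := by
        rw [← intervalIntegral.integral_of_le byn]
        rw [intervalIntegral.integral_eq_sub_of_hasDerivAt (f := fun w => exp G * (((1-w^2)/H+1/H^2)*exp (-(H*(1-w^2))))) _ i2]
        · simp
        · intro w _
          have d1 : HasDerivAt (fun w : ℝ => 1-w^2) (-(2*w)) w := by
            have := ((hasDerivAt_id w).pow 2).const_sub 1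
            simpa using this
          refine HasDerivAt.congr_deriv ((((d1.div_const H).add_const (1/H^2)).mul ((d1.const_mul H).neg.exp)).const_mul (exp G)) ?_
          simp only [Pi.neg_apply]
          field_simp; ring
    _ ≤ _ := by
        have : 0 ≤ exp G * (((1-(1/4)^2)/H+1/H^2)*exp (-(H*(1-(1/4)^2)))) := by
          have : (0:ℝ) ≤ 1-(1/4)^2 := by norm_num
          positivity
        rw [div_eq_mul_one_div (exp G)]; linarith

end EtaSec

end

section
open Real

section RepSec

lemma etaStar_rep {t : ℝ} (ht : 0 < t) : etaStar t = ∫ u in IQ, kk u * ((t/u)^2 * exp (-(t/u)^2/2)) := by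
  unfold etaStar mellinConv
  have h1 := integral_comp_rpow_Ioi (fun w : ℝ => eta2 (t/w) * (w^2*exp (-w^2/2)) / w) (p := -1) byn
  rw [← h1]
  have h2 := integral_comp_mul_left_Ioi (fun u : ℝ => t * (kk u * ((t/u)^2 * exp (-(t/u)^2/2)))) 0 ht
  rw [mul_zero] at h2
  have e : ∀ x ∈ Ioi (0:ℝ), (|(-1:ℝ)| * x ^ (-1-1:ℝ)) • (eta2 (t/x^(-1:ℝ)) * ((x^(-1:ℝ))^2*exp (-(x^(-1:ℝ))^2/2)) / x^(-1:ℝ))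
      = t * (kk (t*x) * ((t/(t*x))^2 * exp (-(t/(t*x))^2/2))) := by
    intro x hx
    replace hx : 0 < x := hx
    have e2 : x^(-1-1:ℝ) = (x^2)⁻¹ := by
      rw [show (-1-1:ℝ) = -((2:ℕ):ℝ) by norm_num, rpow_neg hx.le, rpow_natCast]
    rw [rpow_neg_one, e2, kk]
    have e3 : t/(t*x) = x⁻¹ := by field_simp
    have e4 : t/x⁻¹ = t*x := by field_simp
    rw [e3, e4]
    simp only [smul_eq_mul, abs_neg, abs_one]
    field_simp
  rw [setIntegral_congr_fun measurableSet_Ioi e, h2, integral_const_mul, smul_eq_mul, ← mul_assoc, inv_mul_cancel₀ ht.ne', one_mul]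
  refine setIntegral_eq_of_subset_of_forall_diff_eq_zero measurableSet_Ioi (fun u hu => by have := hu.1; show 0 < u; linarith) ?_
  rintro u ⟨hu, hn⟩
  have : eta2 u = 0 := by
    apply eta2_zero
    by_contra h
    push Not at h
    exact hn ⟨h.1, h.2.le⟩
  simp [kk, this]

lemma e2pi_star (δ : ℝ) {t : ℝ} (ht : 0 < t) : e2pi (δ*t) * (etaStar t : ℂ) = ∫ u in IQ, (kk u:ℂ) * phf (δ*u) ((t/u:ℝ):ℂ) := by
  rw [etaStar_rep ht, ← integral_complex_ofReal, ← integral_const_mul]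
  refine setIntegral_congr_fun measurableSet_Ioc fun u hu => ?_
  have hu0 : (u:ℂ) ≠ 0 := by have := hu.1; exact_mod_cast (by linarith : u ≠ 0)
  simp only [phf, e2pi]
  have : Complex.exp (2*π*Complex.I*((δ*u:ℝ):ℂ)*((t/u:ℝ):ℂ) - ((t/u:ℝ):ℂ)^2/2) = Complex.exp (2*π*Complex.I*((δ*t:ℝ):ℂ)) * Complex.exp (-((t/u:ℝ):ℂ)^2/2) := by
    rw [← Complex.exp_add]; congr 1; push_cast; field_simp; ring
  rw [this]
  push_cast
  ring

lemma phf_jc (δ x : ℝ) (hx : 0 < x) (n : ℝ) : ContinuousOn (fun u : ℝ => phf (δ*u) ((n/(x*u):ℝ):ℂ)) (Icc (1/4:ℝ) 1) := by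
  have h : ContinuousOn (fun u : ℝ => n/(x*u)) (Icc (1/4:ℝ) 1) := continuousOn_const.div (by fun_prop) fun u hu => by
    have := hu.1
    have : 0 < x*u := mul_pos hx byl
    exact this.ne'
  have h' : ContinuousOn (fun u : ℝ => ((n/(x*u):ℝ):ℂ)) (Icc (1/4:ℝ) 1) := Complex.continuous_ofReal.comp_continuousOn h
  unfold phf
  fun_prop

lemma estar_main (δ : ℝ) : ∫ t in Ioi (0:ℝ), e2pi (δ*t) * (etaStar t : ℂ) = ∫ u in IQ, (kk u:ℂ) * (u * Ff (δ*u) 1) := by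
  have e1 : ∫ t in Ioi (0:ℝ), e2pi (δ*t) * (etaStar t : ℂ) = ∫ t in Ioi (0:ℝ), ∫ u in IQ, (kk u:ℂ) * phf (δ*u) ((t/u:ℝ):ℂ) :=
    setIntegral_congr_fun measurableSet_Ioi fun t ht => e2pi_star δ ht
  rw [e1, integral_integral_swap]
  · refine setIntegral_congr_fun measurableSet_Ioc fun u hu => ?_
    have hu0 : 0 < u := by linarith [hu.1]
    beta_reduce
    rw [integral_const_mul]
    congr 1
    have := integral_comp_mul_left_Ioi (fun t : ℝ => phf (δ*u) (t:ℂ)) 0 (inv_pos.2 hu0)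
    rw [mul_zero, inv_inv] at this
    rw [setIntegral_congr_fun (g := fun t : ℝ => phf (δ*u) ((u⁻¹*t:ℝ):ℂ)) measurableSet_Ioi (fun t _ => by simp only [div_eq_inv_mul])]
    rw [this, Ff, mellin]
    simp
  · have hi : Integrable (fun z : ℝ × ℝ => (16*(z.1^(2:ℝ)*exp (0*z.1-1/2*z.1^2))) * kk z.2) ((volume.restrict (Ioi (0:ℝ))).prod (volume.restrict IQ)) := by
      refine Integrable.mul_prod (f := fun t : ℝ => 16*(t^(2:ℝ)*exp (0*t-1/2*t^2))) (g := kk) ((int_poly byn byn).const_mul 16) ?_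
      exact (kk_contOn.integrableOn_Icc).mono_set Ioc_subset_Icc_self
    refine hi.mono' ?_ ?_
    · rw [Measure.prod_restrict]
      refine ContinuousOn.aestronglyMeasurable ?_ (measurableSet_Ioi.prod measurableSet_Ioc)
      have c1 : ContinuousOn (fun z : ℝ × ℝ => kk z.2) (Ioi (0:ℝ) ×ˢ IQ) :=
        kk_contOn.comp continuousOn_snd fun z hz => ⟨hz.2.1.le, hz.2.2⟩
      have c2 : ContinuousOn (fun z : ℝ × ℝ => z.1/z.2) (Ioi (0:ℝ) ×ˢ IQ) :=
        continuousOn_fst.div continuousOn_snd fun z hz => by have := hz.2.1; linarith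
      have c1' : ContinuousOn (fun z : ℝ × ℝ => (kk z.2 : ℂ)) (Ioi (0:ℝ) ×ˢ IQ) := Complex.continuous_ofReal.comp_continuousOn c1
      have c2' : ContinuousOn (fun z : ℝ × ℝ => ((z.1/z.2 : ℝ) : ℂ)) (Ioi (0:ℝ) ×ˢ IQ) := Complex.continuous_ofReal.comp_continuousOn c2
      unfold Function.uncurry phf
      beta_reduce
      fun_prop
    · rw [Measure.prod_restrict]
      filter_upwards [ae_restrict_mem (measurableSet_Ioi.prod measurableSet_Ioc)] with z hz
      obtain ⟨t, u⟩ := z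
      obtain ⟨ht, hu⟩ := hz
      replace ht : 0 < t := ht
      replace hu : u ∈ IQ := hu
      have hu0 : 0 < u := by linarith [hu.1]
      simp only [Function.uncurry]
      rw [norm_mul, phf_norm, Complex.norm_real, norm_of_nonneg (kk_nonneg hu), mul_comm]
      refine mul_le_mul_of_nonneg_right ?_ (kk_nonneg hu)
      have e2 : t^(2:ℝ) = t^2 := by rw [← rpow_natCast]; norm_num
      rw [e2]
      have h1 : t ≤ t/u := by rw [le_div_iff₀ hu0]; nlinarith [hu.2]
      have h2 : t/u ≤ 4*t := by rw [div_le_iff₀ hu0]; nlinarith [hu.1]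
      have h3 : (t/u)^2 ≤ 16*t^2 := by
        have := pow_le_pow_left₀ byp h2 2
        linarith
      have h4 : exp (-(t/u)^2/2) ≤ exp (0*t-1/2*t^2) := by
        apply exp_le_exp.2
        have := pow_le_pow_left₀ ht.le h1 2
        linarith
      calc _ ≤ (16*t^2) * exp (0*t-1/2*t^2) := mul_le_mul h3 h4 (exp_pos _).le byp
        _ = _ := by ring

variable {q : ℕ} [NeZero q]

lemma vm_le (n : ℕ) : ArithmeticFunction.vonMangoldt n ≤ (n:ℝ)^2/4 := by
  rcases Nat.lt_or_ge n 2 with h | h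
  · interval_cases n <;> simp
  · have h1 : (2:ℝ) ≤ n := by exact_mod_cast h
    have h2 := ArithmeticFunction.vonMangoldt_le_log (n := n)
    have h3 : log n ≤ n/2 := by
      have h4 := log_le_sub_one_of_pos (show 0 < (n:ℝ)/2 by positivity)
      rw [log_div byp byn] at h4
      linarith [log_two_lt_d9]
    nlinarith

lemma term_le (χ : DirichletCharacter ℂ q) (δ : ℝ) {x u : ℝ} (hx : 0 < x) (hu0 : 0 < u) (hu1 : u ≤ 1) (n : ℕ) :
    ‖χ n * (ArithmeticFunction.vonMangoldt n : ℂ) * phf δ ((n/(x*u) : ℝ) : ℂ)‖ ≤ 12*x^4*(1/(n:ℝ)^2) := by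
  rcases Nat.eq_zero_or_pos n with rfl | hn
  · simp
  have hn' : (0:ℝ) < n := by exact_mod_cast hn
  rw [norm_mul, norm_mul, phf_norm, Complex.norm_real, norm_of_nonneg ArithmeticFunction.vonMangoldt_nonneg]
  have h1 := χ.norm_le_one n
  set v := (n:ℝ)/(x*u) with hv
  have hv0 : 0 < v := by positivity
  have h2 : v^2*exp (-v^2/2) ≤ 48/v^4 := by
    have := pow_div_factorial_le_exp (x := v^2/2) byp 3
    simp only [Nat.factorial] at this
    rw [show -v^2/2 = -(v^2/2) by ring, exp_neg, le_div_iff₀ byp]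
    have e : v^2*(exp (v^2/2))⁻¹*v^4 = v^6/exp (v^2/2) := by field_simp
    rw [e, div_le_iff₀ (exp_pos _)]
    norm_num at this
    nlinarith
  have h3 : 48/v^4 ≤ 48*x^4/n^4 := by
    rw [hv, div_pow, div_div_eq_mul_div]
    apply div_le_div_of_nonneg_right _ byp
    apply mul_le_mul_of_nonneg_left _ byn
    exact pow_le_pow_left₀ byp (by nlinarith) 4
  have h4 := vm_le n
  have hΛ := ArithmeticFunction.vonMangoldt_nonneg (n := n)
  calc _ ≤ (1 * ((n:ℝ)^2/4)) * (48*x^4/n^4) := by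
        refine mul_le_mul (mul_le_mul h1 h4 hΛ byn) (h2.trans h3) byp byp
    _ = _ := by field_simp; norm_num

noncomputable def Sf (χ : DirichletCharacter ℂ q) (δ x u : ℝ) : ℂ := ∑' n : ℕ, χ n * (ArithmeticFunction.vonMangoldt n : ℂ) * phf (δ*u) ((n/(x*u) : ℝ) : ℂ)

lemma sum_inv_sq (x : ℝ) : HasSum (fun n : ℕ => 12*x^4*(1/(n:ℝ)^2)) (12*x^4*(π^2/6)) := hasSum_zeta_two.mul_left _

lemma Sf_norm (χ : DirichletCharacter ℂ q) (δ : ℝ) {x u : ℝ} (hx : 0 < x) (hu : u ∈ IQ) : ‖Sf χ δ x u‖ ≤ 12*x^4*(π^2/6) :=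
  tsum_of_norm_bounded (sum_inv_sq x) fun n => term_le χ _ hx (by linarith [hu.1]) hu.2 n

lemma Sf_cont (χ : DirichletCharacter ℂ q) (δ : ℝ) {x : ℝ} (hx : 0 < x) : ContinuousOn (Sf χ δ x) (Icc (1/4:ℝ) 1) := by
  unfold Sf
  refine continuousOn_tsum (fun n => ?_) (sum_inv_sq x).summable (fun n u hu => term_le χ _ hx (by linarith [hu.1]) hu.2 n)
  exact continuousOn_const.mul (phf_jc δ x hx n)

lemma estar_sum (χ : DirichletCharacter ℂ q) (δ : ℝ) {x : ℝ} (hx : 0 < x) :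
    (∑' n : ℕ, (ArithmeticFunction.vonMangoldt n : ℂ) * χ (n : ZMod q) * e2pi (δ * n / x) * (etaStar (n / x) : ℂ)) =
      ∫ u in IQ, (kk u:ℂ) * Sf χ δ x u := by
  set F : ℕ → ℝ → ℂ := fun n u => (kk u:ℂ) * (χ n * (ArithmeticFunction.vonMangoldt n : ℂ) * phf (δ*u) ((n/(x*u) : ℝ) : ℂ)) with hF
  have hkc : ContinuousOn (fun u => (kk u:ℂ)) (Icc (1/4:ℝ) 1) := Complex.continuous_ofReal.comp_continuousOn kk_contOn
  have hFi : ∀ n, IntegrableOn (F n) IQ := fun n =>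
    ((hkc.mul (continuousOn_const.mul (phf_jc δ x hx n))).integrableOn_Icc).mono_set Ioc_subset_Icc_self
  have hkk : IntegrableOn kk IQ := (kk_contOn.integrableOn_Icc).mono_set Ioc_subset_Icc_self
  have hb : ∀ n, ∀ u ∈ IQ, ‖F n u‖ ≤ kk u * (12*x^4*(1/(n:ℝ)^2)) := by
    intro n u hu
    rw [hF]; beta_reduce
    rw [norm_mul, Complex.norm_real, norm_of_nonneg (kk_nonneg hu)]
    exact mul_le_mul_of_nonneg_left (term_le χ _ hx (by linarith [hu.1]) hu.2 n) (kk_nonneg hu)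
  have hs : Summable fun n => ∫ u in IQ, ‖F n u‖ := by
    refine Summable.of_nonneg_of_le (fun n => integral_nonneg fun u => norm_nonneg _) (fun n => ?_) ((sum_inv_sq x).summable.mul_left (∫ u in IQ, kk u))
    rw [← integral_mul_const]
    exact setIntegral_mono_on (hFi n).norm (hkk.mul_const _) measurableSet_Ioc (hb n)
  have := (hasSum_integral_of_summable_integral_norm hFi hs).tsum_eq
  have e1 : ∫ u in IQ, (kk u:ℂ) * Sf χ δ x u = ∫ u in IQ, ∑' n, F n u := by
    refine integral_congr_ae (Filter.Eventually.of_forall fun u => ?_)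
    simp only [hF, Sf, tsum_mul_left]
  rw [e1, ← this]
  refine tsum_congr fun n => ?_
  rcases Nat.eq_zero_or_pos n with rfl | hn
  · simp [hF]
  have hn' : (0:ℝ) < n := by exact_mod_cast hn
  have e2 := e2pi_star δ (t := n/x) byp
  rw [show δ * (n/x) = δ*n/x by ring] at e2
  rw [mul_assoc, e2, ← integral_const_mul]
  refine integral_congr_ae (Filter.Eventually.of_forall fun u => ?_)
  simp only [hF]
  rw [div_div]; ring

theorem estar_rep (χ : DirichletCharacter ℂ q) (δ : ℝ) {x : ℝ} (hx : 0 < x) :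
    (∑' n : ℕ, (ArithmeticFunction.vonMangoldt n : ℂ) * χ (n : ZMod q) * e2pi (δ * n / x) * (etaStar (n / x) : ℂ)) -
      (if q = 1 then (∫ t in Set.Ioi (0:ℝ), e2pi (δ * t) * (etaStar t : ℂ)) * x else 0) =
      ∫ u in IQ, (kk u:ℂ) * (Sf χ δ x u - if q = 1 then ((x*u:ℝ):ℂ) * Ff (δ*u) 1 else 0) := by
  have hkc : ContinuousOn (fun u => (kk u:ℂ)) (Icc (1/4:ℝ) 1) := Complex.continuous_ofReal.comp_continuousOn kk_contOn
  have i1 : IntegrableOn (fun u => (kk u:ℂ) * Sf χ δ x u) IQ :=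
    ((hkc.mul (Sf_cont χ δ hx)).integrableOn_Icc).mono_set Ioc_subset_Icc_self
  rw [estar_sum χ δ hx]
  by_cases hq : q = 1
  · simp only [hq, if_true]
    rw [estar_main, ← integral_mul_const]
    have i2 : IntegrableOn (fun u : ℝ => (kk u:ℂ) * (u * Ff (δ*u) 1) * x) IQ := by
      have : ContinuousOn (fun u : ℝ => Ff (δ*u) 1) (Icc (1/4:ℝ) 1) := by
        have e : (fun u : ℝ => Ff (δ*u) 1) = fun u : ℝ => ∫ t in Ioi (0:ℝ), phf (δ*u) t := by funext u; simp [Ff, mellin]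
        rw [e]
        apply Continuous.continuousOn
        refine continuous_of_dominated (bound := fun t : ℝ => t^(2:ℝ)*exp (0*t-1/2*t^2)) (fun u => (phf_cont _).aestronglyMeasurable) (fun u => ?_) (int_poly byn byn) ?_
        · filter_upwards [ae_restrict_mem measurableSet_Ioi] with t ht
          rw [phf_norm]
          have e2 : t^(2:ℝ) = t^2 := by rw [← rpow_natCast]; norm_num
          rw [e2]; apply le_of_eq; congr 2; ring
        · refine Filter.Eventually.of_forall fun t => ?_
          unfold phf; fun_prop
      exact (((hkc.mul ((Complex.continuous_ofReal.continuousOn).mul this)).mul continuousOn_const).integrableOn_Icc).mono_set Ioc_subset_Icc_self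
    subst hq
    rw [← integral_sub i1 i2]
    refine integral_congr_ae (Filter.Eventually.of_forall fun u => ?_)
    push_cast; ring
  · simp only [hq, if_false, sub_zero]

end RepSec

end

section
open Real

section AsmSec
variable {q : ℕ} [NeZero q]

noncomputable def CK (θ G : ℝ) : ℝ := sqrt (2*π/cos (2*θ)) * (13/12*((1+2*G)/cos (2*θ))+3)

lemma GK_le {θ G d u : ℝ} (h0 : 0 < θ) (h1 : θ ≤ 0.28) (hG : (2*π*|d| * sin θ)^2/(2*cos (2*θ)) ≤ G) (hu0 : 0 < u) (hu1 : u ≤ 1) :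
    GK θ (2*π*|d*u| * sin θ) ≤ CK θ G * exp (G*u^2) := by
  have hc : 0 < cos (2*θ) := cos_pos_of_mem_Ioo ⟨by linarith [Real.pi_pos], by linarith [Real.pi_gt_d4]⟩
  unfold GK CK
  set c := cos (2*θ)
  set m := 2*π*|d| * sin θ with hm
  have e : 2*π*|d*u| * sin θ = m*u := by rw [abs_mul, abs_of_pos hu0, hm]; ring
  rw [e]
  have hG0 : 0 ≤ m^2/(2*c) := by positivity
  have a1 : (m*u)^2/(2*c) ≤ G*u^2 := by
    rw [mul_pow, mul_div_right_comm]
    exact mul_le_mul_of_nonneg_right hG (sq_nonneg u)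
  have a2 : (m*u)^2/c^2 ≤ 2*G/c := by
    have : (m*u)^2/c^2 = 2*((m*u)^2/(2*c))/c := by field_simp
    rw [this]
    apply div_le_div_of_nonneg_right _ hc.le
    have : u^2 ≤ 1 := by nlinarith
    nlinarith
  have a3 : 13/12*(1/c+(m*u)^2/c^2)+3 ≤ 13/12*((1+2*G)/c)+3 := by
    rw [add_div]; linarith
  have a4 := exp_le_exp.2 a1
  calc _ ≤ sqrt (2*π/c) * exp (G*u^2) * (13/12*((1+2*G)/c)+3) := by
        refine mul_le_mul (mul_le_mul_of_nonneg_left a4 (sqrt_nonneg _)) a3 byp byp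
    _ = _ := by ring

noncomputable def farX (q : ℕ) (T θ G W : ℝ) : ℝ := 1/2*(FK q T θ * CK θ G * W) + 1/2*(FK q T 0.28 * GK 0.28 0 * 1.93)

lemma FK_nonneg {T θ : ℝ} (hT : 100 ≤ T) (h0 : 0 < θ) : 0 ≤ FK q T θ := by
  unfold FK
  have := Lq_ge (q := q) hT
  have : exp (-(3.46*θ)) < 1 := by rw [← exp_zero]; exact exp_lt_exp.2 byl
  have : 0 < 1 - exp (-(3.46*θ)) := by linarith
  positivity

lemma near_num {T : ℝ} (hT : 100 ≤ T) : 1.373 * (2.052 * (log (q*T/(2*π))/2 + 3.5) * sqrt (T+1)) ≤ 1.675 * sqrt T * log (q * T) + 6.936 * sqrt T := by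
  have hq := one_le_q q
  have hqT : 0 < (q:ℝ)*T := by positivity
  rw [log_div hqT.ne' byp]
  have l1 : 1.386 ≤ log (2*π) := by
    have : log 4 ≤ log (2*π) := log_le_log byn (by linarith [Real.pi_gt_d4])
    rw [show (4:ℝ) = 2^2 by norm_num, log_pow] at this
    push_cast at this; linarith [log_two_gt_d9]
  have l2 : 4.158 ≤ log (q*T) := by
    have : log 64 ≤ log (q*T) := log_le_log byn (by nlinarith)
    rw [show (64:ℝ) = 2^6 by norm_num, log_pow] at this
    push_cast at this; linarith [log_two_gt_d9]
  have l3 : sqrt (T+1) ≤ 1.005*sqrt T := by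
    rw [sqrt_le_iff]
    refine ⟨by positivity, ?_⟩
    rw [mul_pow, sq_sqrt byl]; nlinarith
  have hs : 0 < sqrt T := sqrt_pos.2 byl
  set ℓ := log (q*T)
  calc _ ≤ 1.373*(2.052*((ℓ-1.386)/2+3.5)*(1.005*sqrt T)) := by
        refine mul_le_mul_of_nonneg_left (mul_le_mul ?_ l3 (sqrt_nonneg _) (by nlinarith)) byn
        linarith
    _ = (1.373*(2.052*((ℓ-1.386)/2+3.5)*1.005))*sqrt T := by ring
    _ ≤ (1.675*ℓ+6.936)*sqrt T := mul_le_mul_of_nonneg_right (by norm_num; linarith) hs.le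
    _ = _ := by ring

lemma asm_big {χ : DirichletCharacter ℂ q} (hχ : χ.IsPrimitive) {T : ℝ} (hT : 100 ≤ T)
    (hGRH : ∀ ρ : ℂ, χ.LFunction ρ = 0 → 0 < ρ.re → ρ.re < 1 → |ρ.im| ≤ T → ρ.re = 1/2)
    (δ : ℝ) {x : ℝ} (hx : 1 ≤ x) {θ G W : ℝ} (h0 : 0 < θ) (h1 : θ ≤ 0.28)
    (hG : (2*π*|δ| * sin θ)^2/(2*cos (2*θ)) ≤ G) (hW : ∫ w in IQ, kk w * exp (G*w^2) ≤ W) :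
    ‖∫ u in IQ, (kk u:ℂ) * (Sf χ δ x u - if q = 1 then ((x*u:ℝ):ℂ) * Ff (δ*u) 1 else 0)‖ ≤
      (2.052 * (log (q*T/(2*π))/2 + 3.5) * sqrt (T+1)) * sqrt x * 1.373 + x * farX q T θ G W + 3.86
        + (log q + 22) / sqrt x * 2.75 + 26*|δ| / sqrt x * 1.373 := by
  set A := 2.052 * (log (q*T/(2*π))/2 + 3.5) * sqrt (T+1) with hA
  have hL := Lq_ge (q := q) hT
  have hA0 : 0 ≤ A := by rw [hA]; positivity
  have hx0 : 0 < x := by linarith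
  have hsx : 0 < sqrt x := sqrt_pos.2 hx0
  have hc : 0 < cos (2*θ) := cos_pos_of_mem_Ioo ⟨by linarith [Real.pi_pos], by linarith [Real.pi_gt_d4]⟩
  have hlq : 0 ≤ log q := log_nonneg (one_le_q q)
  have hF := FK_nonneg (q := q) hT h0
  have hF2 := FK_nonneg (q := q) (θ := 0.28) hT byn
  have hG0 : 0 ≤ G := le_trans byp hG
  have hC : 0 ≤ CK θ G := by unfold CK; positivity
  have hGK : 0 ≤ GK 0.28 0 := by
    have : 0 < cos (2*0.28) := cos_pos_of_mem_Ioo ⟨by linarith [Real.pi_pos], by linarith [Real.pi_gt_d4]⟩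
    unfold GK; positivity
  set B := x/2*(FK q T θ * CK θ G) with hB
  set D := x/2*(FK q T 0.28 * GK 0.28 0) + 2 with hD
  set c3 := (log q + 22)/sqrt x with hc3
  set c4 := 26*|δ| / sqrt x with hc4
  have i1 : IntegrableOn (fun u => kk u * (A*sqrt x * sqrt u)) IQ := kk_int (f := fun u => A*sqrt x * sqrt u) (by fun_prop)
  have i2 : IntegrableOn (fun u => kk u * (B*exp (G*u^2))) IQ := kk_int (f := fun u => B*exp (G*u^2)) (by fun_prop)
  have i3 : IntegrableOn (fun u => kk u * D) IQ := kk_int (f := fun u => D) (by fun_prop)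
  have i4 : IntegrableOn (fun u => kk u * (c3*(1/sqrt u))) IQ := kk_int (f := fun u => c3*(1/sqrt u))
    (continuousOn_const.mul (continuousOn_const.div (by fun_prop) (fun w hw => (sqrt_pos.2 (show 0 < w by linarith [hw.1])).ne')))
  have i5 : IntegrableOn (fun u => kk u * (c4*sqrt u)) IQ := kk_int (f := fun u => c4*sqrt u) (by fun_prop)
  refine (norm_integral_le_of_norm_le ((((i1.add i2).add i3).add i4).add i5) ?_).trans ?_
  · filter_upwards [ae_restrict_mem measurableSet_Ioc] with u hu
    have hu0 : 0 < u := by linarith [hu.1]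
    have hsu : 0 < sqrt u := sqrt_pos.2 hu0
    obtain ⟨S, Z, hS, hZ, hb⟩ := weil_bound hχ (δ*u) (X := x*u) byp
    have hSf : Sf χ δ x u = S := hS.tsum_eq
    have hz := Z_bound hχ hT hGRH (δ*u) hx hu0 hu.2 hZ h0 h1
    have hg := GK_le (d := δ) h0 h1 hG hu0 hu.2
    rw [norm_mul, Complex.norm_real, norm_of_nonneg (kk_nonneg hu), hSf]
    simp only [Pi.add_apply]
    rw [← mul_add, ← mul_add, ← mul_add, ← mul_add]
    refine mul_le_mul_of_nonneg_left (hb.trans ?_) (kk_nonneg hu)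
    rw [← hA, sqrt_mul hx0.le] at hz
    rw [sqrt_mul hx0.le]
    have g1 : x/2*(FK q T θ * GK θ (2*π*|δ*u| * sin θ)) ≤ B*exp (G*u^2) := by
      rw [hB]
      have := mul_le_mul_of_nonneg_left hg hF
      have := mul_le_mul_of_nonneg_left this (show 0 ≤ x/2 by positivity)
      linarith
    have g2 : (log q + 22 + 26*|δ*u|)/(sqrt x * sqrt u) = c3*(1/sqrt u) + c4*sqrt u := by
      rw [hc3, hc4, abs_mul, abs_of_pos hu0]
      have := sq_sqrt hu0.le
      field_simp
      rw [this]
    rw [g2, hD]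
    linarith
  · rw [integral_add' (((i1.add i2).add i3).add i4) i5, integral_add' ((i1.add i2).add i3) i4, integral_add' (i1.add i2) i3, integral_add' i1 i2]
    have e1 : ∫ u in IQ, kk u * (A*sqrt x * sqrt u) = (A*sqrt x) * ∫ u in IQ, kk u * sqrt u := by
      rw [← integral_const_mul]; congr 1; funext u; ring
    have e2 : ∫ u in IQ, kk u * (B*exp (G*u^2)) = B * ∫ u in IQ, kk u * exp (G*u^2) := by
      rw [← integral_const_mul]; congr 1; funext u; ring
    have e3 : ∫ u in IQ, kk u * D = D * ∫ u in IQ, kk u := by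
      rw [← integral_const_mul]; congr 1; funext u; ring
    have e4 : ∫ u in IQ, kk u * (c3*(1/sqrt u)) = c3 * ∫ u in IQ, kk u * (1/sqrt u) := by
      rw [← integral_const_mul]; congr 1; funext u; ring
    have e5 : ∫ u in IQ, kk u * (c4*sqrt u) = c4 * ∫ u in IQ, kk u * sqrt u := by
      rw [← integral_const_mul]; congr 1; funext u; ring
    rw [e1, e2, e3, e4, e5]
    have m1 := mul_le_mul_of_nonneg_left kk_mh (show 0 ≤ A*sqrt x by positivity)
    have m2 := mul_le_mul_of_nonneg_left hW (show 0 ≤ B by positivity)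
    have m3 := mul_le_mul_of_nonneg_left kk_m1 (show 0 ≤ D by positivity)
    have m4 := mul_le_mul_of_nonneg_left kk_m3 (show 0 ≤ c3 by positivity)
    have m5 := mul_le_mul_of_nonneg_left kk_mh (show 0 ≤ c4 by positivity)
    have e6 : B*W + D*1.93 = x*farX q T θ G W + 3.86 := by rw [hB, hD, farX]; ring
    linarith

lemma Ff_one (δ : ℝ) : ‖Ff δ 1‖ ≤ 10.25 := by
  have h := Ff_bound δ (s := 1) byn (θ := 0) (by simp; positivity)
  obtain ⟨gi, gb⟩ := gauss_bound (c := 1) one_pos 0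
  refine h.trans ?_
  simp only [zero_mul, neg_zero, exp_zero, one_mul]
  refine le_trans (setIntegral_mono_on (int_poly (by simp; norm_num) (by simp)) gi measurableSet_Ioi fun t ht => ?_) (gb.trans ?_)
  · have e : t^((1:ℂ).re+1) = t^2 := by rw [← rpow_natCast]; norm_num
    rw [e]
    simp only [sin_zero, mul_zero, cos_zero, neg_zero]
    exact mul_le_mul_of_nonneg_right (by nlinarith [sq_nonneg t]) (exp_pos _).le
  · have : sqrt (2*π/1) ≤ 2.51 := by
      rw [sqrt_le_iff]; norm_num; linarith [Real.pi_lt_d4]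
    norm_num at this ⊢
    linarith

lemma asm_small (χ : DirichletCharacter ℂ q) (δ : ℝ) {x : ℝ} (hx0 : 0 < x) (hx : x < 1) :
    ‖∫ u in IQ, (kk u:ℂ) * (Sf χ δ x u - if q = 1 then ((x*u:ℝ):ℂ) * Ff (δ*u) 1 else 0)‖ ≤ 60*x := by
  have i3 : IntegrableOn (fun u => kk u * (30*x)) IQ := kk_int (f := fun u => 30*x) (by fun_prop)
  refine (norm_integral_le_of_norm_le i3 ?_).trans ?_
  · filter_upwards [ae_restrict_mem measurableSet_Ioc] with u hu
    rw [norm_mul, Complex.norm_real, norm_of_nonneg (kk_nonneg hu)]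
    refine mul_le_mul_of_nonneg_left ?_ (kk_nonneg hu)
    refine (norm_sub_le _ _).trans ?_
    have h1 := Sf_norm χ δ hx0 hu
    have hu0 : 0 < u := by linarith [hu.1]
    have h2 : ‖(if q = 1 then ((x*u:ℝ):ℂ) * Ff (δ*u) 1 else 0)‖ ≤ 10.25*x := by
      split_ifs
      · rw [norm_mul, Complex.norm_real, norm_of_nonneg byp]
        have := Ff_one (δ*u)
        have h3 : x*u ≤ x := by nlinarith [hu.2]
        nlinarith [norm_nonneg (Ff (δ*u) 1)]
      · simp; positivity
    have h3 : π^2/6 ≤ 1.645 := by nlinarith [Real.pi_lt_d4, Real.pi_pos]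
    have h4 : x^4 ≤ x := by
      have := pow_le_pow_of_le_one hx0.le hx.le (show 1 ≤ 4 by norm_num)
      simpa using this
    have h5 : 12*x^4*(π^2/6) ≤ 12*x*1.645 := mul_le_mul byl h3 byp byp
    linarith
  · rw [integral_mul_const]
    have := mul_le_mul_of_nonneg_right kk_m1 (show 0 ≤ 30*x by positivity)
    linarith

theorem asm_final {χ : DirichletCharacter ℂ q} (hχ : χ.IsPrimitive) {T : ℝ} (hT : 100 ≤ T)
    (hGRH : ∀ ρ : ℂ, χ.LFunction ρ = 0 → 0 < ρ.re → ρ.re < 1 → |ρ.im| ≤ T → ρ.re = 1/2)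
    (δ : ℝ) {x : ℝ} (hx : 0 < x) {R : ℝ} (hR0 : 0 ≤ R)
    (hR : ∃ θ G W : ℝ, 0 < θ ∧ θ ≤ 0.28 ∧ (2*π*|δ| * sin θ)^2/(2*cos (2*θ)) ≤ G ∧
      ∫ w in IQ, kk w * exp (G*w^2) ≤ W ∧ farX q T θ G W ≤ R) :
    ∃ E : ℂ,
      (∑' n : ℕ, (ArithmeticFunction.vonMangoldt n : ℂ) * χ (n : ZMod q)
          * e2pi (δ * n / x) * (etaStar (n / x) : ℂ))
        = (if q = 1 then
            (∫ t in Set.Ioi (0:ℝ), e2pi (δ * t) * (etaStar t : ℂ)) * x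
          else 0) + E * x ∧
      ‖E‖ ≤ R
            + (1.675 * sqrt T * log (q * T) + 6.936 * sqrt T
                + 1.954 * log q + 51.047) * x ^ (-(1:ℝ)/2)
            + (6 + 22 * |δ|) * x⁻¹
            + (log q + 6) * (3 + 17 * |δ|) * x ^ (-(3:ℝ)/2) := by
  have hrep := estar_rep χ δ hx
  set I := ∫ u in IQ, (kk u:ℂ) * (Sf χ δ x u - if q = 1 then ((x*u:ℝ):ℂ) * Ff (δ*u) 1 else 0) with hI
  have hxc : (x:ℂ) ≠ 0 := by exact_mod_cast hx.ne'
  refine ⟨I/x, ?_, ?_⟩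
  · rw [div_mul_cancel₀ _ hxc, ← hrep]; ring
  rw [norm_div, Complex.norm_real, norm_of_nonneg hx.le, div_le_iff₀ hx]
  have hlq : 0 ≤ log q := log_nonneg (one_le_q q)
  have hq := one_le_q q
  have hlT : 0 ≤ log (q*T) := log_nonneg (by nlinarith)
  have hsx : 0 < sqrt x := sqrt_pos.2 hx
  have hsq := sq_sqrt hx.le
  set y := 1/sqrt x with hy
  have hy0 : 0 < y := by positivity
  have p1 : x^(-(1:ℝ)/2) = y := by rw [hy, sqrt_eq_rpow, show -(1:ℝ)/2 = -(1/2) by ring, rpow_neg hx.le]; exact (one_div _).symm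
  have p2 : x⁻¹ = y^2 := by rw [hy, div_pow, hsq]; simp
  have p3 : x^(-(3:ℝ)/2) = y^3 := by
    rw [← p1, ← rpow_natCast, ← rpow_mul hx.le]; norm_num
  rw [p1, p2, p3]
  have hδ := abs_nonneg δ
  have hn := near_num (q := q) hT
  have hsT := sqrt_nonneg T
  set N := 1.675 * sqrt T * log (q * T) + 6.936 * sqrt T with hN
  have hN0 : 0 ≤ N := by positivity
  rcases lt_or_ge x 1 with hx1 | hx1
  · refine (asm_small χ δ hx hx1).trans (mul_le_mul_of_nonneg_right ?_ hx.le)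
    have hy1 : 1 ≤ y := by rw [hy, le_div_iff₀ hsx, one_mul]; exact sqrt_le_one.2 hx1.le
    have hy2 : 1 ≤ y^2 := one_le_pow₀ hy1
    have hy3 : 1 ≤ y^3 := one_le_pow₀ hy1
    have a1 : (51.047:ℝ) ≤ (N + 1.954 * log q + 51.047) * y := by nlinarith
    have a2 : (6:ℝ) ≤ (6 + 22 * |δ|) * y^2 := by nlinarith
    have a3 : (18:ℝ) ≤ (log q + 6) * (3 + 17 * |δ|) * y^3 := by
      have : (18:ℝ) ≤ (log q + 6) * (3 + 17 * |δ|) := by nlinarith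
      nlinarith
    linarith
  · obtain ⟨θ, G, W, t0, t1, hG, hW, hf⟩ := hR
    have hb := asm_big hχ hT hGRH δ hx1 t0 t1 hG hW
    rw [← hI] at hb
    refine hb.trans ?_
    set A := 2.052 * (log (q*T/(2*π))/2 + 3.5) * sqrt (T+1)
    have hy1 : y ≤ 1 := by rw [hy, div_le_one hsx]; exact one_le_sqrt.2 hx1
    have s1 : sqrt x = y*x := by rw [hy]; field_simp; exact hsq
    have s2 : (log q + 22)/sqrt x = (log q + 22)*y^3*x := by
      have : y^3*x = y*(y^2*x) := by ring
      rw [mul_assoc, this, ← p2, inv_mul_cancel₀ hx.ne', hy]; ring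
    have s3 : 26*|δ| / sqrt x = 26*|δ| * y^3*x := by
      have : y^3*x = y*(y^2*x) := by ring
      rw [mul_assoc, this, ← p2, inv_mul_cancel₀ hx.ne', hy]; ring
    have s4 : (3.86:ℝ) = 3.86*y^2*x := by rw [mul_assoc, ← p2, inv_mul_cancel₀ hx.ne']; ring
    have key : 1.373*A*y + farX q T θ G W + 3.86*y^2 + (log q+22)*y^3*2.75 + 26*|δ| * y^3*1.373 ≤
       R + (N + 1.954 * log q + 51.047) * y + (6 + 22 * |δ|) * y^2 + (log q + 6) * (3 + 17 * |δ|) * y^3 := by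
      have k1 : 1.373*A*y ≤ N*y := mul_le_mul_of_nonneg_right hn hy0.le
      have y3 : y^3 ≤ y := by
        have := pow_le_pow_of_le_one hy0.le hy1 (show 1 ≤ 3 by norm_num)
        simpa using this
      have y30 : 0 < y^3 := by positivity
      have k2 : 0 ≤ 1.954*log q*y := by positivity
      have k3 : 0 ≤ |δ| * y^2 := by positivity
      have k4 : 0 ≤ log q * y^3 := by positivity
      have k5 : 0 ≤ |δ| * y^3 := by positivity
      have k6 : 0 ≤ log q * |δ| * y^3 := by positivity
      have k7 : 0 < y^2 := by positivity
      have e : (log q + 6) * (3 + 17 * |δ|) * y^3 = 3*(log q * y^3) + 17*(log q * |δ| * y^3) + 18*y^3 + 102*(|δ| * y^3) := by ring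
      rw [e]
      linarith
    have := mul_le_mul_of_nonneg_right key hx.le
    have e : A * sqrt x * 1.373 + x * farX q T θ G W + 3.86 + (log q + 22) / sqrt x * 2.75 + 26*|δ| / sqrt x * 1.373 =
        (1.373*A*y + farX q T θ G W + 3.86*y^2 + (log q+22)*y^3*2.75 + 26*|δ| * y^3*1.373) * x := by
      rw [s2, s3]
      linear_combination (A*1.373)*s1 + s4
    rw [e]
    exact this

end AsmSec

end

section
open Real

section FarSec
variable {q : ℕ} [NeZero q]

lemma cos_lb {θ : ℝ} (h0 : 0 ≤ θ) (h1 : θ ≤ 0.28) : 1 - 2*θ^2 + 0.659*θ^4 - 0.0795*θ^6 ≤ cos (2*θ) := by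
  obtain ⟨y, rfl⟩ : ∃ y, θ = 2*y := ⟨θ/2, by ring⟩
  have y0 : 0 ≤ y := by linarith
  have y1 : y ≤ 0.14 := by linarith
  have b := (abs_le.1 (sin_bound (x := y) (by rw [abs_of_nonneg y0]; linarith))).2
  rw [abs_of_nonneg y0] at b
  have b1 : sin y ≤ y*(1-0.1593*y^2) := by
    have : y^4 ≤ 0.14*y^3 := by nlinarith [pow_nonneg y0 3]
    nlinarith [pow_nonneg y0 3]
  have s0 : 0 ≤ sin y := sin_nonneg_of_nonneg_of_le_pi y0 (by linarith [Real.pi_gt_d4])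
  have b2 : sin y^2 ≤ y^2*(1-0.318*y^2) := by
    have := pow_le_pow_left₀ s0 b1 2
    have z1 : y^2 ≤ 0.0196 := by nlinarith
    nlinarith [pow_nonneg y0 4, mul_nonneg (pow_nonneg y0 4) (sub_nonneg.2 z1)]
  have c1 : 1 - 2*y^2 + 0.636*y^4 ≤ cos (2*y) := by
    rw [cos_two_mul, cos_sq']; nlinarith
  have z0 := sq_nonneg y
  have z1 : y^2 ≤ 0.0196 := by nlinarith
  have c2 : 0 ≤ 1 - 2*y^2 + 0.636*y^4 := by nlinarith [pow_nonneg y0 4]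
  have := pow_le_pow_left₀ c2 c1 2
  rw [cos_two_mul]
  nlinarith [pow_nonneg y0 8]

lemma far_G {T r θ a : ℝ} (h0 : 0 < θ) (h1 : θ ≤ 0.28) (ha : a^2 = r*T) :
    (a * sin θ)^2/(2*cos (2*θ)) = r*T*((1/cos (2*θ) - 1)/4) := by
  have hc : 0 < cos (2*θ) := cos_pos_of_mem_Ioo ⟨by linarith [Real.pi_pos], by linarith [Real.pi_gt_d4]⟩
  have : sin θ^2 = (1 - cos (2*θ))/2 := by rw [cos_two_mul, cos_sq']; ring
  rw [mul_pow, ha, this]; field_simp; ring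

lemma far_h {θ : ℝ} (h0 : 0 < θ) (h1 : θ ≤ 0.28) : 1/cos (2*θ) - 1 ≤ 2*θ^2*(1+1.93*θ^2) := by
  have b := cos_lb h0.le h1
  have z1 : θ^2 ≤ 0.0784 := by nlinarith
  have z0 : 0 < θ^2 := by positivity
  have hc : 0 < 1 - 2*θ^2 + 0.659*θ^4 - 0.0795*θ^6 := by
    have : θ^6 ≤ 0.0784*θ^4 := by nlinarith [pow_pos h0 4]
    nlinarith [pow_pos h0 4]
  have : 1/cos (2*θ) ≤ 1/(1 - 2*θ^2 + 0.659*θ^4 - 0.0795*θ^6) := one_div_le_one_div_of_le hc b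
  have : 1/(1 - 2*θ^2 + 0.659*θ^4 - 0.0795*θ^6) ≤ 1 + 2*θ^2*(1+1.93*θ^2) := by
    rw [div_le_iff₀ hc]
    set z := θ^2
    have e4 : θ^4 = z^2 := by simp only [z]; ring
    have e6 : θ^6 = z^3 := by simp only [z]; ring
    rw [e4, e6]
    have i1 : 0 ≤ 0.519 - 6.4815*z := by linarith
    have : (1 + 2*z*(1+1.93*z))*(1 - 2*z + 0.659*z^2 - 0.0795*z^3) - 1 = z^2*((0.519 - 6.4815*z) + z^2*(2.38474 - 0.30687*z)) := by ring
    have : 0 ≤ z^2*((0.519 - 6.4815*z) + z^2*(2.38474 - 0.30687*z)) := by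
      have : 0 ≤ 2.38474 - 0.30687*z := by linarith
      positivity
    linarith
  linarith

lemma far_k {u : ℝ} (h0 : 0 < u) (h1 : u ≤ 1) : 1/(1-exp (-u)) ≤ 1/u + 1/2 + u/11 := by
  have e := sum_le_exp_of_nonneg h0.le 5
  simp [Finset.sum_range_succ, Nat.factorial] at e
  rw [exp_neg]
  set E := exp u
  have hE : 1 < E := by nlinarith [pow_pos h0 2, pow_pos h0 3, pow_pos h0 4]
  have : 1/(1-E⁻¹) = 1 + 1/(E-1) := by
    have : E - 1 ≠ 0 := by linarith
    field_simp; ring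
  rw [this]
  have hp : 0 < u+u^2/2+u^3/6+u^4/24 := by positivity
  have : 1/(E-1) ≤ 1/(u+u^2/2+u^3/6+u^4/24) := one_div_le_one_div_of_le hp byl
  have : 1/(u+u^2/2+u^3/6+u^4/24) ≤ 1/u - 1/2 + u/11 := by
    rw [div_le_iff₀ hp]
    have : (1/u - 1/2 + u/11)*(u+u^2/2+u^3/6+u^4/24) - 1 = u^2*(1/11-1/12) + u^3*(1/22-1/24)+u^4*(1/66-1/48) + u^5/264 := by field_simp; ring
    have : u^4 ≤ u^2 := pow_le_pow_of_le_one h0.le h1 byn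
    nlinarith [pow_pos h0 2, pow_pos h0 3, pow_pos h0 5]
  linarith

lemma e_hi {y X : ℝ} (m n : ℕ) (hn : n ≠ 0) (h : y * n ≤ m) (hX : 0 ≤ X) (hX' : (2.7182818286:ℝ)^m ≤ X^n) : exp y ≤ X := by
  refine le_of_pow_le_pow_left₀ hn hX ?_
  rw [← exp_nat_mul]
  calc exp (n*y) ≤ exp (m*1) := exp_le_exp.2 byl
    _ = exp 1^m := by rw [exp_nat_mul]
    _ ≤ 2.7182818286^m := pow_le_pow_left₀ (exp_pos _).le exp_one_lt_d9.le m
    _ ≤ _ := hX'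

lemma k28 : 1/(1-exp (-(3.46*0.28))) ≤ 1.6205 := by
  refine (far_k byn byn).trans byn

lemma far_small {T : ℝ} (hT : 100 ≤ T) : 1/2*(FK q T 0.28 * GK 0.28 0 * 1.93) ≤
    T*log (q*T/(2*π))*(0.1*exp (-0.1598*T)) := by
  have hL := Lq_ge (q := q) hT
  unfold FK GK
  set L := log (q*T/(2*π))
  have hcl : (0.847:ℝ) ≤ cos (2*0.28) := le_trans byn (cos_lb (θ := 0.28) byn le_rfl)
  set c := cos (2*0.28)
  have hc : 0 < c := by linarith
  have hs : sqrt (2*π/c) ≤ 2.724 := by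
    rw [sqrt_le_iff]; refine ⟨by norm_num, ?_⟩
    rw [div_le_iff₀ hc]; nlinarith [Real.pi_lt_d4]
  have h1 : 1/c ≤ 1.181 := by rw [div_le_iff₀ hc]; linarith
  have hk := k28
  have hk0 : 0 < 1/(1-exp (-(3.46*0.28))) := by
    refine one_div_pos.2 (sub_pos.2 ?_)
    rw [← exp_zero]; exact exp_lt_exp.2 byn
  have hT0 : 0 < T := by linarith
  have h2 : 1 + 1/(4*0.28*T) ≤ 1.009 := by
    have : 1/(4*0.28*T) ≤ 0.009 := by rw [div_le_iff₀ byp]; linarith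
    linarith
  simp only [ne_eq, OfNat.ofNat_ne_zero, not_false_eq_true, zero_pow, zero_div, exp_zero, mul_one, add_zero]
  have g : sqrt (2*π/c) * (13/12*(1/c)+3) ≤ 2.724*4.3 := mul_le_mul hs byl byp byn
  have f : (L+1.24)/(1-exp (-(3.46*0.28))) * (1+1/(4*0.28*T)) ≤ (L+1.24)*1.6205*1.009 := by
    rw [div_eq_mul_one_div]
    exact mul_le_mul (mul_le_mul_of_nonneg_left hk byl) h2 byp (by nlinarith)
  have ex : exp (-(0.28*T)) ≤ exp (-0.1598*T) := exp_le_exp.2 byl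
  have ex12 : exp (-(0.28*T)) ≤ exp (-0.1598*T)/100 := by
    have : exp (-0.1598*T) = exp (-(0.28*T))*exp (0.1202*T) := by rw [← exp_add]; congr 1; ring
    rw [this]
    have : (100:ℝ) ≤ exp (0.1202*T) := by
      have := sum_le_exp_of_nonneg (show 0 ≤ 0.1202*T by positivity) 4
      simp [Finset.sum_range_succ, Nat.factorial] at this
      nlinarith [pow_pos hT0 3, pow_pos hT0 2, mul_pos hT0 hT0]
    nlinarith [exp_pos (-(0.28*T))]
  set e1 := exp (-(0.28*T))
  set e2 := exp (-0.1598*T)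
  have he1 : 0 < e1 := exp_pos _
  calc _ ≤ 1/2*(e1*((L+1.24)*1.6205*1.009)*(2.724*4.3)*1.93) := by
        have := mul_le_mul (mul_le_mul_of_nonneg_left f he1.le) g byp (mul_nonneg he1.le byl)
        linarith
    _ = (L+1.24)*(1/2*1.6205*1.009*(2.724*4.3)*1.93)*e1 := by ring
    _ ≤ (L+1.24)*(1/2*1.6205*1.009*(2.724*4.3)*1.93)*(e2/100) := mul_le_mul_of_nonneg_left ex12 (by nlinarith)
    _ ≤ (T*L*0.1)*e2 := by
        have : 0 < e2 := exp_pos _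
        have : (L+1.24)*(1/2*1.6205*1.009*(2.724*4.3)*1.93)*(1/100) ≤ T*L*0.1 := by
          have : 100*L ≤ T*L := by nlinarith
          norm_num; linarith
        nlinarith
    _ = _ := by ring

lemma far_M {T θ G c0 s0 k w B : ℝ} (hT : 100 ≤ T) (h0 : 0 < θ) (h1 : θ ≤ 0.28) (hθT : 28 ≤ θ*T)
    (hc0 : 0 < c0) (hc : c0 ≤ cos (2*θ)) (hs0 : 0 < s0) (hs : 6.2832 ≤ c0*s0^2)
    (hk : 1/(1-exp (-(3.46*θ))) ≤ k) (hG : 2.8 < G) (hw : 13/12*((1+2*G)/c0)+3 ≤ w*(G-2.8)^2)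
    (hE : 0.7312*k*s0*w*exp (G-θ*T) ≤ T*(3.4*exp (-0.1598*T) + B)) :
    farX q T θ G (exp G/(G-2.8)^2) ≤ T*log (q*T/(2*π))*(3.5*exp (-0.1598*T) + B) := by
  have hsm := far_small (q := q) hT
  have hL := Lq_ge (q := q) hT
  unfold farX
  suffices h : 1/2*(FK q T θ * CK θ G * (exp G/(G-2.8)^2)) ≤ T*log (q*T/(2*π))*(3.4*exp (-0.1598*T) + B) by linarith
  unfold FK CK
  set L := log (q*T/(2*π))
  set c := cos (2*θ)
  have hcp : 0 < c := by linarith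
  have hk0 : 0 < 1/(1-exp (-(3.46*θ))) := by
    refine one_div_pos.2 (sub_pos.2 ?_)
    rw [← exp_zero]; exact exp_lt_exp.2 byl
  have hs' : sqrt (2*π/c) ≤ s0 := by
    rw [sqrt_le_iff]; refine ⟨hs0.le, ?_⟩
    rw [div_le_iff₀ hcp]; nlinarith [Real.pi_lt_d4, mul_le_mul_of_nonneg_right hc (sq_nonneg s0)]
  have h2 : 1 + 1/(4*θ*T) ≤ 1.00893 := by
    have : 1/(4*θ*T) ≤ 0.00893 := by rw [div_le_iff₀ (by nlinarith)]; nlinarith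
    linarith
  have h20 : 0 ≤ 1 + 1/(4*θ*T) := by positivity
  have hg2 : 0 < (G-2.8)^2 := pow_pos byl 2
  have g : sqrt (2*π/c) * (13/12*((1+2*G)/c)+3) ≤ s0*(w*(G-2.8)^2) := by
    refine mul_le_mul hs' (le_trans ?_ hw) byp hs0.le
    have : (1+2*G)/c ≤ (1+2*G)/c0 := div_le_div_of_nonneg_left byl hc0 hc
    linarith
  have f : (L+1.24)/(1-exp (-(3.46*θ))) * (1+1/(4*θ*T)) ≤ (1.4493*L)*k*1.00893 := by
    rw [div_eq_mul_one_div]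
    refine mul_le_mul (mul_le_mul ?_ hk hk0.le byl) h2 h20 ?_
    · norm_num at hL ⊢; linarith
    · have : 0 ≤ k := by linarith
      positivity
  have f0 : 0 ≤ (L+1.24)/(1-exp (-(3.46*θ))) * (1+1/(4*θ*T)) := by
    rw [div_eq_mul_one_div]; positivity
  have hk' : 0 ≤ k := by linarith
  have hw' : 0 ≤ w*(G-2.8)^2 := le_trans byp hw
  have fg := mul_le_mul f g byp byp
  have hne : G - 2.8 ≠ 0 := by linarith
  have ee : exp (G-θ*T) = exp (-(θ*T))*exp G := by rw [← exp_add]; congr 1; ring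
  calc _ = 1/2*(((L+1.24)/(1-exp (-(3.46*θ))) * (1+1/(4*θ*T)))*(sqrt (2*π/c) * (13/12*((1+2*G)/c)+3)))*(exp (G-θ*T)/(G-2.8)^2) := by rw [ee]; ring
    _ ≤ 1/2*((1.4493*L)*k*1.00893*(s0*(w*(G-2.8)^2)))*(exp (G-θ*T)/(G-2.8)^2) := by
        refine mul_le_mul_of_nonneg_right byl byp
    _ = L*(1/2*1.4493*1.00893)*(k*s0*w*exp (G-θ*T)) := by field_simp
    _ ≤ L*0.7312*(k*s0*w*exp (G-θ*T)) := by
        have hw0 : 0 ≤ w := by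
          by_contra hh; push Not at hh; nlinarith
        refine mul_le_mul_of_nonneg_right (by norm_num; linarith) byp
    _ = L*(0.7312*k*s0*w*exp (G-θ*T)) := by ring
    _ ≤ L*(T*(3.4*exp (-0.1598*T) + B)) := mul_le_mul_of_nonneg_left hE byl
    _ = _ := by ring

end FarSec

end

section
open Real

section FarSec2
variable {q : ℕ} [NeZero q]

lemma far_w {G0 G c0 w : ℝ} (hc0 : 0 < c0) (h0 : 2.8 < G0) (h1 : G0 ≤ G) (h : 13/12*((1+2*G0)/c0)+3 ≤ w*(G0-2.8)^2) :
    13/12*((1+2*G)/c0)+3 ≤ w*(G-2.8)^2 := by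
  have e : ∀ H : ℝ, 13/12*((1+2*H)/c0)+3 = (13/12/c0+3) + (13/6/c0)*H := fun H => by field_simp; ring
  rw [e] at h ⊢
  have hB : 0 < 13/6/c0 := by positivity
  have hA : 0 < 13/12/c0+3 := by positivity
  set A := 13/12/c0+3
  set B := 13/6/c0
  obtain ⟨d, hd, rfl⟩ : ∃ d, 0 ≤ d ∧ G = G0 + d := ⟨G-G0, by linarith, by ring⟩
  obtain ⟨g, hg, rfl⟩ : ∃ g, 0 < g ∧ G0 = g + 2.8 := ⟨G0-2.8, by linarith, by ring⟩
  have h' : A + B*(g+2.8) ≤ w*g^2 := by convert h using 2; ring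
  have hw : 0 < w := by
    by_contra hh; push Not at hh; nlinarith [sq_nonneg g, mul_pos hB hg]
  have : B*g ≤ w*g^2 := by nlinarith
  have : B ≤ w*g := by
    by_contra hh; push Not at hh; nlinarith
  have : (g+2.8+d-2.8) = g+d := by ring
  rw [this]
  have : B*d ≤ w*g*d := mul_le_mul_of_nonneg_right ‹_› hd
  nlinarith [mul_nonneg (mul_nonneg hw.le hg.le) hd, mul_nonneg hw.le (sq_nonneg d)]

def FarOK (q : ℕ) (T δ B : ℝ) : Prop :=
    ∃ θ G W : ℝ, 0 < θ ∧ θ ≤ 0.28 ∧ (2*π*|δ| * sin θ)^2/(2*cos (2*θ)) ≤ G ∧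
      ∫ w in IQ, kk w * exp (G*w^2) ≤ W ∧ farX q T θ G W ≤ T*log (q*T/(2*π))*(3.5*exp (-0.1598*T) + B)

lemma far_pack {T θ G c0 s0 k w B r G0 δ : ℝ} (hT : 100 ≤ T) (ha : (2*π*|δ|)^2 = r*T) (h0 : 0 < θ) (h1 : θ ≤ 0.28) (hθT : 28 ≤ θ*T)
    (hc0 : 0 < c0) (hc : c0 ≤ cos (2*θ)) (hs0 : 0 < s0) (hs : 6.2832 ≤ c0*s0^2)
    (hk : 1/(1-exp (-(3.46*θ))) ≤ k) (hg : r*T*((1/cos (2*θ) - 1)/4) ≤ G) (hG0 : 2.8 < G0) (hG : G0 ≤ G)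
    (hw : 13/12*((1+2*G0)/c0)+3 ≤ w*(G0-2.8)^2)
    (hE : 0.7312*k*s0*w*exp (G-θ*T) ≤ T*(3.4*exp (-0.1598*T) + B)) :
    FarOK q T δ B :=
  ⟨θ, G, _, h0, h1, (far_G h0 h1 ha).trans_le hg, kk_exp byl,
    far_M hT h0 h1 hθT hc0 hc hs0 hs hk byl (far_w hc0 hG0 hG hw) hE⟩

lemma c28 : (0.847212:ℝ) ≤ cos (2*0.28) := le_trans byn (cos_lb (θ := 0.28) byn le_rfl)

lemma far_AB {T r δ B X w G0 G : ℝ} (hT : 100 ≤ T) (ha : (2*π*|δ|)^2 = r*T) (hr : 0 ≤ r)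
    (hg : r*T*0.045088 ≤ G) (hG0 : 2.8 < G0) (hG : G0 ≤ G) (hw : 13/12*((1+2*G0)/0.8472)+3 ≤ w*(G0-2.8)^2)
    (hX : exp (G-0.28*T) ≤ X) (hw0 : 0 ≤ w) (hE : 3.2271*w*X ≤ T*(3.4*exp (-0.1598*T) + B)) :
    FarOK q T δ B := by
  have hc := c28
  refine far_pack (θ := 0.28) (c0 := 0.8472) (s0 := 2.7234) (k := 1.6205) (w := w) hT ha byn le_rfl byl byn
    byl byn byn k28 (le_trans (mul_le_mul_of_nonneg_left ?_ byp) hg) hG0 hG hw (le_trans ?_ hE)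
  · have : 1/cos (2*0.28) ≤ 1/0.847212 := one_div_le_one_div_of_le byn hc
    norm_num at this ⊢; linarith
  · have : 0 ≤ X := (exp_pos _).le.trans hX
    have : w*exp (G-0.28*T) ≤ w*X := mul_le_mul_of_nonneg_left hX hw0
    have : 0 ≤ w*X := by positivity
    linarith

lemma far_C {T P r δ B X w G0 G v c0 s0 : ℝ} (hT : 100 ≤ T) (ha : (2*π*|δ|)^2 = r*T) (hTr : T = r*P) (hr : 3.2155 ≤ r) (hP0 : 39.478 ≤ P)
    (hv0 : 0 < v) (hv : v ≤ 0.311) (hvr : 1 ≤ v*r) (hc0 : 0 < c0)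
    (hc : c0 ≤ 1 - 2*(0.9*v)^2 + 0.659*(0.9*v)^4 - 0.0795*(0.9*v)^6) (hs0 : 0 < s0) (hs : 6.2832 ≤ c0*s0^2)
    (hg : 0.405*P*(1+1.564*(1/r)^2) ≤ G) (hG0 : 2.8 < G0) (hG : G0 ≤ G) (hw : 13/12*((1+2*G0)/c0)+3 ≤ w*(G0-2.8)^2)
    (hw0 : 0 ≤ w) (hX : exp (G-0.9*P) ≤ X)
    (hE : 0.7312*(0.3212+v/2+0.2832*v^2)*s0*w*X ≤ P*(3.4*exp (-0.1598*T) + B)) :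
    FarOK q T δ B := by
  have hr0 : 0 < r := by linarith
  set i := 1/r with hi
  have hi0 : 0 < i := by positivity
  have hir : i*r = 1 := by rw [hi]; field_simp
  have hiv : i ≤ v := by rw [hi, div_le_iff₀ hr0]; exact hvr
  have t0 : 0 < 0.9*i := by positivity
  have t1 : 0.9*i ≤ 0.28 := by linarith
  have hθT : 0.9*i*T = 0.9*P := by rw [hTr]; linear_combination 0.9*P*hir
  refine far_pack (θ := 0.9*i) (c0 := c0) (s0 := s0) (k := 1/(3.46*(0.9*i)) + 1/2 + (3.46*(0.9*i))/11) (w := w) hT ha t0 t1 (by rw [hθT]; linarith) hc0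
    ?_ hs0 hs (far_k byp byl) (le_trans ?_ hg) hG0 hG hw ?_
  · refine hc.trans ((cos_lb byp byl).trans (cos_le_cos_of_nonneg_of_le_pi byp (by linarith [Real.pi_gt_d4]) byl))
  · have := far_h t0 t1
    have h2 : r*T*((1/cos (2*(0.9*i)) - 1)/4) ≤ r*T*(2*(0.9*i)^2*(1+1.93*(0.9*i)^2)/4) := mul_le_mul_of_nonneg_left byl byp
    refine h2.trans ?_
    have e : r*T*(2*(0.9*i)^2*(1+1.93*(0.9*i)^2)/4) = 0.405*P*(1+1.5633*i^2) := by
      rw [hTr]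
      have : r*(r*P)*(2*(0.9*i)^2*(1+1.93*(0.9*i)^2)/4) = (i*r)^2*(0.405*P*(1+1.5633*i^2)) := by ring
      rw [this, hir]; ring
    rw [e]
    exact mul_le_mul_of_nonneg_left (by nlinarith [sq_nonneg i]) byl
  · rw [hθT]
    have hk : 1/(3.46*(0.9*i)) + 1/2 + (3.46*(0.9*i))/11 ≤ r*(0.3212+v/2+0.2832*v^2) := by
      have e1 : 1/(3.46*(0.9*i)) = r/3.114 := by rw [hi]; field_simp; norm_num
      have e2 : r*(v/2) ≥ 1/2 := by linarith
      have e3 : i ≤ r*v^2 := by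
        have : v*1 ≤ v*(v*r) := mul_le_mul_of_nonneg_left hvr hv0.le
        linarith
      rw [e1]
      have e4 : r/3.114 ≤ 0.3212*r := by rw [div_le_iff₀ byn]; linarith
      have e5 : (3.46*(0.9*i))/11 ≤ 0.2832*(r*v^2) := by linarith
      have e6 : r*(0.3212+v/2+0.2832*v^2) = 0.3212*r + r*(v/2) + 0.2832*(r*v^2) := by ring
      rw [e6]; linarith
    have hX0 : 0 ≤ X := (exp_pos _).le.trans hX
    calc _ ≤ 0.7312*(r*(0.3212+v/2+0.2832*v^2))*s0*w*X := by
          refine mul_le_mul ?_ hX (exp_pos _).le byp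
          refine mul_le_mul_of_nonneg_right (mul_le_mul_of_nonneg_right byl hs0.le) hw0
      _ = r*(0.7312*(0.3212+v/2+0.2832*v^2)*s0*w*X) := by ring
      _ ≤ r*(P*(3.4*exp (-0.1598*T) + B)) := mul_le_mul_of_nonneg_left hE hr0.le
      _ = _ := by rw [hTr]; ring

lemma reg_A {T P r δ P0 v c0 s0 w Y : ℝ} (hT : 100 ≤ T) (ha : (2*π*|δ|)^2 = r*T) (hTr : T = r*P) (hr : 3.2155 ≤ r) (hP0 : 39.478 ≤ P0) (hP : P0 ≤ P)
    (hv0 : 0 < v) (hv : v ≤ 0.311) (hvr : 1 ≤ v*r) (hc0 : 0 < c0)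
    (hc : c0 ≤ 1 - 2*(0.9*v)^2 + 0.659*(0.9*v)^4 - 0.0795*(0.9*v)^6) (hs0 : 0 < s0) (hs : 6.2832 ≤ c0*s0^2)
    (hw : 13/12*((1+2*(0.405*P0*(1+1.564*v^2)))/c0)+3 ≤ w*((0.405*P0*(1+1.564*v^2))-2.8)^2) (hw0 : 0 ≤ w)
    (hY : Y ≤ ∑ i ∈ Finset.range 7, ((0.474-0.405*(1+1.564*v^2))*P0)^i/(i.factorial:ℝ))
    (hE : 0.7312*(0.3212+v/2+0.2832*v^2)*s0*w ≤ P0*0.0019*Y) :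
    FarOK q T δ (0.0019*exp (-(0.426*P))) := by
  have hr0 : 0 < r := by linarith
  have hiv : 1/r ≤ v := by rw [div_le_iff₀ hr0]; exact hvr
  have hi2 : (1/r)^2 ≤ v^2 := pow_le_pow_left₀ byp hiv 2
  have hv2 : v^2 ≤ 0.0968 := by nlinarith
  refine far_C (w := w) (G := 0.405*P*(1+1.564*v^2)) (X := exp (0.405*P*(1+1.564*v^2)-0.9*P)) hT ha hTr hr byl hv0 hv hvr hc0 hc hs0 hs
    (mul_le_mul_of_nonneg_left byl byl) ?_ ?_ hw hw0 le_rfl ?_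
  · nlinarith [sq_nonneg v]
  · exact mul_le_mul_of_nonneg_right byl byp
  · set ε := 0.474-0.405*(1+1.564*v^2) with hε
    have hε0 : 0 ≤ ε := by rw [hε]; linarith
    have ex : exp (0.405*P*(1+1.564*v^2)-0.9*P) = exp (-(0.426*P))*exp (-(ε*P)) := by
      rw [← exp_add]; congr 1; rw [hε]; ring
    have hYe : Y ≤ exp (ε*P) := by
      refine hY.trans ((sum_le_exp_of_nonneg (mul_nonneg hε0 byl) 7).trans (exp_le_exp.2 ?_))
      exact mul_le_mul_of_nonneg_left hP hε0
    have h3 : 0.7312*(0.3212+v/2+0.2832*v^2)*s0*w ≤ P*0.0019*exp (ε*P) := hE.trans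
      (le_trans (mul_le_mul_of_nonneg_left hYe byl) (mul_le_mul_of_nonneg_right byl (exp_pos _).le))
    have h4 := mul_le_mul_of_nonneg_right h3 (exp_pos (-(ε*P))).le
    rw [mul_assoc (P*0.0019), ← exp_add, add_neg_cancel, exp_zero] at h4
    have h5 := mul_le_mul_of_nonneg_right h4 (exp_pos (-(0.426*P))).le
    rw [ex]
    have : 0 ≤ P*(3.4*exp (-0.1598*T)) := by
      have : 0 ≤ P := by linarith
      positivity
    linarith

lemma reg_B {T P r δ B P0 P1 v w : ℝ} (hT : 100 ≤ T) (hB : 0 ≤ B) (ha : (2*π*|δ|)^2 = r*T) (hTr : T = r*P) (hr : 3.2155 ≤ r) (hP0 : 39.478 ≤ P0) (hP : P0 ≤ P)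
    (hP1 : P ≤ P1) (hv0 : 0 < v) (hvr : v*r ≤ 1) (hv : 0.25 ≤ v) (hv1 : v ≤ 0.311)
    (hw : 13/12*((1+2*(0.405*P0*(1+1.564*v^2)))/0.8472)+3 ≤ w*((0.405*P0*(1+1.564*v^2))-2.8)^2) (hw0 : 0 ≤ w)
    (hy : P1*(0.1598/v-0.495+0.63342*v^2) ≤ 6.375)
    (hE : 0.7312*0.5041*2.7234*w*588 ≤ P0*3.4) :
    FarOK q T δ B := by
  have hr0 : 0 < r := by linarith
  obtain ⟨i, hi⟩ : ∃ i, i = 1/r := ⟨_, rfl⟩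
  have hi0 : 0 < i := by rw [hi]; positivity
  have hvi : v ≤ i := by rw [hi, le_div_iff₀ hr0]; exact hvr
  have hri : r = 1/i := by rw [hi, one_div_one_div]
  have hi1 : i ≤ 0.311 := by rw [hi, div_le_iff₀ hr0]; nlinarith
  have hi2 : v^2 ≤ i^2 := pow_le_pow_left₀ hv0.le hvi 2
  have hPp : 0 < P := by linarith
  refine far_C (v := 0.311) (c0 := 0.8472) (s0 := 2.7234) (w := w) (G := 0.405*P*(1+1.564*i^2)) (X := 588*exp (-0.1598*T)) hT ha hTr hr byl byn le_rfl
    (by nlinarith) byn byn byn byn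
    (by rw [hi]) ?_ ?_ hw hw0 ?_ ?_
  · nlinarith [sq_nonneg v]
  · exact mul_le_mul byl byl byp byp
  · have h1 : P*(0.1598/i-0.495+0.63342*i^2) ≤ 6.375 := by
      have m : 0.1598/i+0.63342*i^2 ≤ 0.1598/v+0.63342*v^2 := by
        have : 0.1598/v - 0.1598/i = (i-v)*(0.1598/(v*i)) := by field_simp
        have h3 : 0.63342*(i+v) ≤ 0.1598/(v*i) := by
          rw [le_div_iff₀ byp]
          have : v*i ≤ 0.311*0.311 := mul_le_mul byl hi1 hi0.le byn
          nlinarith [mul_pos hv0 hi0]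
        nlinarith [mul_le_mul_of_nonneg_left h3 (sub_nonneg.2 hvi)]
      refine le_trans ?_ hy
      have p0 : 0 ≤ 0.1598/i-0.495+0.63342*i^2 := by
        have : 0.5 ≤ 0.1598/i := by rw [le_div_iff₀ hi0]; linarith
        nlinarith [sq_nonneg i]
      exact mul_le_mul hP1 byl p0 byl
    have h2 : 0.405*P*(1+1.564*i^2)-0.9*P = P*(0.1598/i-0.495+0.63342*i^2) + -0.1598*T := by
      rw [hTr, hri]; field_simp; ring
    rw [h2, exp_add]
    exact mul_le_mul_of_nonneg_right (e_hi 51 8 byn (by push_cast; linarith) byn byn) (exp_pos _).le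
  · have : 0.7312*(0.3212+0.311/2+0.2832*0.311^2)*2.7234*w*588 ≤ P*3.4 := by
      have h6 := mul_le_mul_of_nonneg_right (show (0.3212+0.311/2+0.2832*0.311^2:ℝ) ≤ 0.5041 by norm_num) hw0
      linarith
    have h5 := mul_le_mul_of_nonneg_right this (exp_pos (-0.1598*T)).le
    have : 0 ≤ P*B := by positivity
    linarith

theorem far_num {T δ : ℝ} (hT : 100 ≤ T) (hδ : 4*π^2*|δ| ≤ T) :
    FarOK q T δ (0.0019 * exp (-0.1065 * T^2 / (π * δ)^2)) := by
  have hT0 : 0 < T := by linarith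
  obtain ⟨r, hr⟩ : ∃ r, r = (2*π*|δ|)^2/T := ⟨_, rfl⟩
  have ha : (2*π*|δ|)^2 = r*T := by rw [hr]; field_simp
  have hr0 : 0 ≤ r := by rw [hr]; positivity
  have hB : 0 ≤ 0.0019 * exp (-0.1065 * T^2 / (π * δ)^2) := by positivity
  have eX : 0 < exp (-0.1598*T) := exp_pos _
  have TE := mul_le_mul_of_nonneg_right hT eX.le
  have TB := mul_nonneg hT0.le hB
  by_cases hA : r*0.045088 ≤ 0.1202
  · refine far_AB (w := 0.42) (G := 0.1202*T) (G0 := 12.02) (X := exp (-0.1598*T)) hT ha hr0 (by linarith [mul_le_mul_of_nonneg_right hA hT0.le]) byn byl byn (le_of_eq ?_) byn ?_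
    · congr 1; ring
    · linarith
  push Not at hA
  have hr1 : 2.6 < r := by norm_num at hA ⊢; linarith
  have hPr : 39.478 * r ≤ T := by
    have h1 : (4*π^2*|δ|)^2 ≤ T^2 := pow_le_pow_left₀ byp hδ 2
    have h2 : (4*π^2*|δ|)^2 = 4*π^2*(r*T) := by rw [← ha]; ring
    have h3 : 39.478 ≤ 4*π^2 := by nlinarith [Real.pi_gt_d6]
    have h4 : 39.478*(r*T) ≤ T^2 := by nlinarith [mul_nonneg hr0 hT0.le]
    nlinarith
  obtain ⟨P, hP⟩ : ∃ P, P = T/r := ⟨_, rfl⟩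
  have hTr : T = r*P := by rw [hP]; field_simp
  have hP39 : 39.478 ≤ P := by rw [hP, le_div_iff₀ byl]; exact hPr
  have hPe : -0.1065 * T^2 / (π * δ)^2 = -(0.426*P) := by
    have hd : (π*δ)^2 = r*T/4 := by rw [← ha, mul_pow, mul_pow, mul_pow, sq_abs]; ring
    rw [hd, hP]; field_simp; ring
  rw [hPe] at hB TB ⊢
  have eY : 0 < exp (-(0.426*P)) := exp_pos _
  rcases lt_or_ge r 3.2155 with h2 | h2
  · have ex : r*T*0.045088 - 0.28*T = (r*0.045088-0.1202)*T + -0.1598*T := by ring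
    have gl : 0.1202*T ≤ r*T*0.045088 := by linarith [mul_le_mul_of_nonneg_right hA.le hT0.le]
    have gu : (r*0.045088-0.1202)*T ≤ 0.02479*T := mul_le_mul_of_nonneg_right (by norm_num at h2 ⊢; linarith) hT0.le
    rcases le_or_gt T 180 with t1 | t1
    · refine far_AB (w := 0.42) (G := r*T*0.045088) (G0 := 12.02) (X := 91*exp (-0.1598*T)) hT ha hr0 le_rfl byn byl byn ?_ byn ?_
      · rw [ex, exp_add]
        refine mul_le_mul_of_nonneg_right (e_hi 9 2 byn ?_ byn byn) eX.le
        push_cast; linarith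
      · linarith
    rcases le_or_gt T 240 with t2 | t2
    · refine far_AB (w := 0.17) (G := r*T*0.045088) (G0 := 21.6) (X := 404*exp (-0.1598*T)) hT ha hr0 le_rfl byn byl byn ?_ byn ?_
      · rw [ex, exp_add]
        refine mul_le_mul_of_nonneg_right (e_hi 6 1 byn ?_ byn byn) eX.le
        push_cast; linarith
      · linarith
    · refine far_AB (w := 0.116) (G := r*T*0.045088) (G0 := 28.8) (X := exp (-(0.426*P))) hT ha hr0 le_rfl byn byl byn ?_ byn ?_
      · refine exp_le_exp.2 ?_
        have : 0 ≤ 0.28*r - 0.045088*r^2 - 0.426 := by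
          have := mul_nonneg (sub_nonneg.2 hA.le) (sub_nonneg.2 h2.le)
          norm_num at hA h2 this ⊢; linarith
        rw [hTr]
        linarith [mul_nonneg (show 0 ≤ P by linarith) this]
      · linarith [mul_nonneg hT0.le eX.le, mul_le_mul_of_nonneg_right t2.le eY.le]
  · rcases le_or_gt 53 P with p | p
    · exact reg_A (P0 := 53) (v := 0.311) (c0 := 0.8472) (s0 := 2.7234) (w := 0.1407) (Y := 1.5) hT ha hTr h2 byn p byn le_rfl byl
        byn byn byn byn byn byn (by norm_num [Finset.sum_range_succ, Nat.factorial]) byn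
    rcases le_or_gt 47 P with p' | p'
    · rcases le_or_gt 1 (0.296*r) with hv | hv
      · exact reg_A (P0 := 47) (v := 0.296) (c0 := 0.8612) (s0 := 2.7012) (w := 0.1656) (Y := 1.88) hT ha hTr h2 byn p' byn byn hv
          byn byn byn byn byn byn (by norm_num [Finset.sum_range_succ, Nat.factorial]) byn
      · exact reg_B (P0 := 47) (P1 := 53) (v := 0.296) (w := 0.1685) hT hB ha hTr h2 byn p' p.le byn hv.le byn byn byn byn byn byn
    rcases le_or_gt 43 P with q' | q'
    · rcases le_or_gt 1 (0.28*r) with hv | hv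
      · exact reg_A (P0 := 43) (v := 0.28) (c0 := 0.8755) (s0 := 2.679) (w := 0.1878) (Y := 2.29) hT ha hTr h2 byn q' byn byn hv
          byn byn byn byn byn byn (by norm_num [Finset.sum_range_succ, Nat.factorial]) byn
      · exact reg_B (P0 := 43) (P1 := 47) (v := 0.28) (w := 0.194) hT hB ha hTr h2 byn q' p'.le byn hv.le byn byn byn byn byn byn
    rcases le_or_gt 40.3 P with u | u
    · rcases le_or_gt 1 (0.268*r) with hv | hv
      · exact reg_A (P0 := 40.3) (v := 0.268) (c0 := 0.8857) (s0 := 2.6636) (w := 0.2065) (Y := 2.57) hT ha hTr h2 byn u byn byn hv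
          byn byn byn byn byn byn (by norm_num [Finset.sum_range_succ, Nat.factorial]) byn
      · exact reg_B (P0 := 40.3) (P1 := 43) (v := 0.268) (w := 0.2155) hT hB ha hTr h2 byn u q'.le byn hv.le byn byn byn byn byn byn
    · rcases le_or_gt 1 (0.2635*r) with hv | hv
      · exact reg_A (P0 := 39.478) (v := 0.2635) (c0 := 0.8894) (s0 := 2.658) (w := 0.213) (Y := 2.68) hT ha hTr h2 byn hP39 byn byn hv
          byn byn byn byn byn byn (by norm_num [Finset.sum_range_succ, Nat.factorial]) byn
      · exact reg_B (P0 := 39.478) (P1 := 40.3) (v := 0.2635) (w := 0.223) hT hB ha hTr h2 byn hP39 u.le byn hv.le byn byn byn byn byn byn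

end FarSec2

end

/-- **Corollary 4.9**: major-arc estimate for `η_* = η₂ ∗_M (t² e^{-t²/2})`,
conditional on a partial verification of GRH up to height `T₀`. -/
theorem etaStar_major_arc_conditional
    (x : ℝ) (hx : 0 < x) (δ : ℝ)
    (q : ℕ) [NeZero q] (χ : DirichletCharacter ℂ q) (hχ : χ.IsPrimitive)
    (T₀ : ℝ) (hT₀ : max (4 * Real.pi^2 * |δ|) 100 ≤ T₀)
    (hGRH : ∀ ρ : ℂ, χ.LFunction ρ = 0 → 0 < ρ.re → ρ.re < 1 → |ρ.im| ≤ T₀ →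
      ρ.re = 1/2) :
    ∃ E : ℂ,
      (∑' n : ℕ, (ArithmeticFunction.vonMangoldt n : ℂ) * χ (n : ZMod q)
          * e2pi (δ * n / x) * (etaStar (n / x) : ℂ))
        = (if q = 1 then
            (∫ t in Set.Ioi (0:ℝ), e2pi (δ * t) * (etaStar t : ℂ)) * x
          else 0) + E * x ∧
      ‖E‖ ≤ T₀ * Real.log (q * T₀ / (2 * Real.pi))
              * (3.5 * Real.exp (-0.1598 * T₀)
                + 0.0019 * Real.exp (-0.1065 * T₀^2 / (Real.pi * δ)^2))
            + (1.675 * Real.sqrt T₀ * Real.log (q * T₀) + 6.936 * Real.sqrt T₀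
                + 1.954 * Real.log q + 51.047) * x ^ (-(1:ℝ)/2)
            + (6 + 22 * |δ|) * x⁻¹
            + (Real.log q + 6) * (3 + 17 * |δ|) * x ^ (-(3:ℝ)/2) := by
  have hT : 100 ≤ T₀ := le_trans (le_max_right _ _) hT₀
  have hδ : 4 * Real.pi^2 * |δ| ≤ T₀ := le_trans (le_max_left _ _) hT₀
  have hL := Lq_ge (q := q) hT
  have hL0 : 0 ≤ Real.log (q * T₀ / (2 * Real.pi)) := by linarith
  exact asm_final hχ hT hGRH δ hx (by positivity) (far_num hT hδ)
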